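/- Define f₀(q,t;r) = −(1 + r cos t)·sin q/(r² + 2 + 2r cos t − 2 cos q − 2r cos q cos t)^{3/2} − (1 − r cos t)·sin q/(r² + 2 − 2r cos t − 2 cos q + 2r cos q cos t)^{3/2}. For every r ∈ (0,2), the equilibrium (q,p) = (0,0) of the time-periodic system q̇ = p, ṗ = f₀(q,t;r) is Lyapunov stable: for every η > 0 there exists δ > 0 such that every solution (q(t), p(t)) with q(0)² + p(0)² < δ² is defined for all t ≥ 0 and satisfies q(t)² + p(t)² < η² for all t ≥ 0. -/

import Mathlib

/-- The tangential force on the massless particle in the curved Sitnikov problem with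
circular primaries (`ε = 0`, `R = 1`, primaries at distance `r` from the center). -/
noncomputable def f0 (q t r : ℝ) : ℝ :=
  -((1 + r * Real.cos t) * Real.sin q /
      (r ^ 2 + 2 + 2 * r * Real.cos t - 2 * Real.cos q -
        2 * r * Real.cos q * Real.cos t) ^ ((3 : ℝ) / 2)) -
    (1 - r * Real.cos t) * Real.sin q /
      (r ^ 2 + 2 - 2 * r * Real.cos t - 2 * Real.cos q +
        2 * r * Real.cos q * Real.cos t) ^ ((3 : ℝ) / 2)

namespace Sitnikov

open Set Complex

/-- The open horizontal strip of half-width `σ` around the real axis. -/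
def strip (σ : ℝ) : Set ℂ := {z | |z.im| < σ}

lemma isOpen_strip (σ : ℝ) : IsOpen (strip σ) :=
  isOpen_lt (continuous_im.abs) continuous_const

lemma strip_mono {σ τ : ℝ} (h : σ ≤ τ) : strip σ ⊆ strip τ := fun _ hz => lt_of_lt_of_le hz h

lemma add_real_mem_strip {σ : ℝ} {z : ℂ} (hz : z ∈ strip σ) (x : ℝ) : z + x ∈ strip σ := by
  simpa [strip] using hz

lemma add_one_mem_strip {σ : ℝ} {z : ℂ} (hz : z ∈ strip σ) : z + 1 ∈ strip σ := by
  simpa [strip] using hz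

lemma ofReal_mem_strip {σ : ℝ} (hσ : 0 < σ) (x : ℝ) : (x : ℂ) ∈ strip σ := by
  simpa [strip] using hσ

lemma strip_mem_nhds {σ : ℝ} {z : ℂ} (hz : z ∈ strip σ) : strip σ ∈ nhds z :=
  (isOpen_strip σ).mem_nhds hz

lemma closedBall_subset_strip {σ δ : ℝ} {z : ℂ} (hz : z ∈ strip (σ - δ)) :
    Metric.closedBall z δ ⊆ strip σ := by
  intro w hw
  have h1 : |(w - z).im| ≤ δ := (abs_im_le_norm _).trans (by simpa [dist_eq_norm] using hw)
  have h2 : |z.im| < σ - δ := hz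
  have h3 : |w.im| ≤ |(w - z).im| + |z.im| := by
    have := abs_add_le (w - z).im z.im
    simpa using this
  show |w.im| < σ
  linarith

lemma norm_deriv_le_of_strip {E : Type*} [NormedAddCommGroup E] [NormedSpace ℂ E]
    {f : ℂ → E} {σ δ A : ℝ} (hf : DifferentiableOn ℂ f (strip σ))
    (hA : ∀ z ∈ strip σ, ‖f z‖ ≤ A) (hδ : 0 < δ) {z : ℂ} (hz : z ∈ strip (σ - δ)) :
    ‖deriv f z‖ ≤ A / δ := by
  have hsub := closedBall_subset_strip hz
  refine norm_deriv_le_of_forall_mem_sphere_norm_le hδ ?_ fun w hw =>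
    hA w (hsub (Metric.sphere_subset_closedBall hw))
  refine DifferentiableOn.diffContOnCl ?_
  rw [closure_ball z hδ.ne']
  exact hf.mono hsub

/-- Fourier coefficient of a one-periodic function. -/
noncomputable def coeff (g : ℂ → ℂ) (k : ℤ) : ℂ :=
  ∫ x in (0 : ℝ)..1, g x * exp (-(2 * Real.pi * I * k * x))

lemma coeff_shift {g : ℂ → ℂ} {σ : ℝ} (hg : DifferentiableOn ℂ g (strip σ))
    (hper : ∀ z ∈ strip σ, g (z + 1) = g z) (k : ℤ) {y : ℝ} (hy : |y| < σ) :
    ∫ x in (0 : ℝ)..1, g (x + y * I) * exp (-(2 * Real.pi * I * k * (x + y * I))) = coeff g k := by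
  set f : ℂ → ℂ := fun z => g z * exp (-(2 * Real.pi * I * k * z)) with hf
  have hsub : (Set.uIcc (0 : ℂ).re (1 + y * I : ℂ).re ×ℂ Set.uIcc (0 : ℂ).im (1 + y * I : ℂ).im)
      ⊆ strip σ := by
    rintro z ⟨-, hz⟩
    have hz' : z.im ∈ Set.uIcc 0 y := by simpa using hz
    have : |z.im - 0| ≤ |y - 0| := Set.abs_sub_left_of_mem_uIcc hz'
    simp only [sub_zero] at this
    exact lt_of_le_of_lt this hy
  have hdf : DifferentiableOn ℂ f (strip σ) := by
    refine hg.mul (Differentiable.differentiableOn ?_)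
    fun_prop
  have key := integral_boundary_rect_eq_zero_of_differentiableOn f 0 (1 + y * I) (hdf.mono hsub)
  have hper' : ∀ z ∈ strip σ, f (1 + z) = f z := by
    intro z hz
    simp only [hf]
    rw [add_comm 1 z, hper z hz]
    congr 1
    rw [show -(2 * (Real.pi : ℂ) * I * k * (z + 1)) =
      -(2 * Real.pi * I * k * z) - k * (2 * Real.pi * I) by ring, exp_sub,
      exp_int_mul_two_pi_mul_I, div_one]
  have hside : (∫ t in (0 : ℝ)..y, f (1 + t * I)) = ∫ t in (0 : ℝ)..y, f (t * I) := by
    refine intervalIntegral.integral_congr fun t ht => ?_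
    apply hper'
    have : |t - 0| ≤ |y - 0| := Set.abs_sub_left_of_mem_uIcc ht
    simp only [sub_zero] at this
    simpa [strip] using lt_of_le_of_lt this hy
  simp only [zero_re, zero_im, add_re, one_re, mul_re, ofReal_re, I_re, mul_zero, ofReal_im, I_im,
    mul_one, sub_self, add_zero, add_im, one_im, mul_im, zero_add, ofReal_zero, zero_mul,
    ofReal_one] at key
  rw [hside, add_sub_cancel_right, sub_eq_zero] at key
  rw [coeff]
  exact key.symm

lemma norm_coeff_le {g : ℂ → ℂ} {σ A : ℝ} (hg : DifferentiableOn ℂ g (strip σ))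
    (hper : ∀ z ∈ strip σ, g (z + 1) = g z) (hA : ∀ z ∈ strip σ, ‖g z‖ ≤ A) (k : ℤ)
    {y : ℝ} (hy : |y| < σ) : ‖coeff g k‖ ≤ A * Real.exp (2 * Real.pi * k * y) := by
  rw [← coeff_shift hg hper k hy]
  have := intervalIntegral.norm_integral_le_of_norm_le_const (a := (0 : ℝ)) (b := 1)
    (C := A * Real.exp (2 * Real.pi * k * y))
    (f := fun x : ℝ => g (x + y * I) * exp (-(2 * Real.pi * I * k * (x + y * I)))) ?_
  · simpa using this
  · intro x _
    rw [norm_mul, norm_exp]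
    have h1 : (-(2 * (Real.pi : ℂ) * I * k * (x + y * I))).re = 2 * Real.pi * k * y := by
      simp [mul_re, mul_im]
    rw [h1]
    refine mul_le_mul_of_nonneg_right (hA _ ?_) (Real.exp_pos _).le
    simpa [strip] using hy

lemma norm_coeff_le_exp {g : ℂ → ℂ} {σ τ A : ℝ} (hg : DifferentiableOn ℂ g (strip σ))
    (hper : ∀ z ∈ strip σ, g (z + 1) = g z) (hA : ∀ z ∈ strip σ, ‖g z‖ ≤ A) (k : ℤ)
    (h0 : 0 ≤ τ) (hτ : τ < σ) :
    ‖coeff g k‖ ≤ A * Real.exp (-(2 * Real.pi * τ * |(k : ℝ)|)) := by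
  rcases le_total 0 (k : ℝ) with hk | hk
  · have := norm_coeff_le hg hper hA k (y := -τ) (by rwa [abs_neg, abs_of_nonneg h0])
    rw [abs_of_nonneg hk]
    convert this using 3; ring
  · have := norm_coeff_le hg hper hA k (y := τ) (by rwa [abs_of_nonneg h0])
    rw [abs_of_nonpos hk]
    convert this using 3; ring

lemma abs_mul_exp_le_geometric (k : ℤ) (a : ℝ) :
    |(k : ℝ)| * Real.exp (-(a * |(k : ℝ)|)) =
      (k.natAbs : ℝ) * Real.exp (-a) ^ k.natAbs := by
  rw [← Real.exp_nat_mul, Nat.cast_natAbs, Int.cast_abs]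
  congr 2; ring

lemma summable_abs_mul_exp {a : ℝ} (ha : 0 < a) :
    Summable fun k : ℤ => |(k : ℝ)| * Real.exp (-(a * |(k : ℝ)|)) := by
  have hs : Summable fun n : ℕ => (n : ℝ) * Real.exp (-a) ^ n := by
    have := summable_pow_mul_geometric_of_norm_lt_one 1 (r := Real.exp (-a))
      (by rw [Real.norm_eq_abs, abs_of_pos (Real.exp_pos _)]
          exact Real.exp_lt_one_iff.2 (by linarith))
    simpa using this
  simp_rw [abs_mul_exp_le_geometric]
  refine Summable.of_nat_of_neg ?_ ?_ <;> simpa using hs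

lemma tsum_abs_mul_exp_le {a : ℝ} (ha : 0 < a) (ha1 : a ≤ 1) :
    ∑' k : ℤ, |(k : ℝ)| * Real.exp (-(a * |(k : ℝ)|)) ≤ 8 / a ^ 2 := by
  have hq : ‖Real.exp (-a)‖ < 1 := by
    rw [Real.norm_eq_abs, abs_of_pos (Real.exp_pos _)]; exact Real.exp_lt_one_iff.2 (by linarith)
  have hs : Summable fun n : ℕ => (n : ℝ) * Real.exp (-a) ^ n := by
    have := summable_pow_mul_geometric_of_norm_lt_one 1 hq
    simpa using this
  have ht := tsum_coe_mul_geometric_of_norm_lt_one hq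
  simp_rw [abs_mul_exp_le_geometric]
  rw [tsum_of_nat_of_neg_add_one (f := fun k : ℤ => (k.natAbs : ℝ) * Real.exp (-a) ^ k.natAbs)
    (by simpa using hs)]
  · have h2 : ∑' n : ℕ, (((-((n : ℤ) + 1)).natAbs : ℝ) * Real.exp (-a) ^ (-((n : ℤ) + 1)).natAbs)
        = ∑' n : ℕ, (n : ℝ) * Real.exp (-a) ^ n := by
      rw [hs.tsum_eq_zero_add]
      simp only [CharP.cast_eq_zero, zero_mul, zero_add]
      refine tsum_congr fun n => ?_
      have : (-((n : ℤ) + 1)).natAbs = n + 1 := by omega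
      rw [this]
    rw [h2]
    simp only [Int.natAbs_natCast]
    rw [ht]
    have he : Real.exp (-a) ≤ 1 - a / 2 := by
      have h3 : Real.exp (-a) ≤ 1 / (1 + a) := by
        rw [Real.exp_neg, ← one_div]
        exact one_div_le_one_div_of_le (by linarith) (by linarith [Real.add_one_le_exp a])
      refine h3.trans ?_
      rw [div_le_iff₀ (by linarith)]
      nlinarith
    have h4 : Real.exp (-a) / (1 - Real.exp (-a)) ^ 2 ≤ 1 / (a / 2) ^ 2 := by
      refine div_le_div₀ zero_le_one ?_ (by positivity) ?_
      · linarith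
      · exact pow_le_pow_left₀ (by linarith) (by linarith) 2
    have h5 : 1 / (a / 2) ^ 2 = 4 / a ^ 2 := by field_simp; norm_num
    have h6 : 8 / a ^ 2 = 4 / a ^ 2 + 4 / a ^ 2 := by ring
    linarith
  · have : Summable fun n : ℕ => ((n + 1 : ℕ) : ℝ) * Real.exp (-a) ^ (n + 1) :=
      (summable_nat_add_iff 1).2 hs
    refine this.congr fun n => ?_
    have : (-((n : ℤ) + 1)).natAbs = n + 1 := by omega
    rw [this]

end Sitnikov

namespace Sitnikov

open Set Complex

lemma summable_exp_abs {a : ℝ} (ha : 0 < a) :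
    Summable fun k : ℤ => Real.exp (-(a * |(k : ℝ)|)) := by
  have h : ∀ k : ℤ, Real.exp (-(a * |(k : ℝ)|)) = Real.exp (-a) ^ k.natAbs := by
    intro k
    rw [← Real.exp_nat_mul, Nat.cast_natAbs, Int.cast_abs]
    congr 1; ring
  simp_rw [h]
  have hs : Summable fun n : ℕ => Real.exp (-a) ^ n :=
    summable_geometric_of_lt_one (Real.exp_pos _).le (Real.exp_lt_one_iff.2 (by linarith))
  refine Summable.of_nat_of_neg ?_ ?_ <;> simpa using hs

lemma norm_exp_mul_le (k : ℤ) {z : ℂ} {y : ℝ} (hy : |z.im| ≤ y) :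
    ‖exp (2 * Real.pi * I * k * z)‖ ≤ Real.exp (2 * Real.pi * y * |(k : ℝ)|) := by
  rw [norm_exp]
  apply Real.exp_le_exp.2
  have h1 : (2 * (Real.pi : ℂ) * I * k * z).re = -(2 * Real.pi * (k * z.im)) := by
    simp [mul_re, mul_im]; ring
  rw [h1]
  have h2 : -(k * z.im) ≤ |(k : ℝ)| * y := by
    calc -(k * z.im) ≤ |(k : ℝ) * z.im| := neg_le_abs _
      _ = |(k : ℝ)| * |z.im| := abs_mul _ _
      _ ≤ |(k : ℝ)| * y := by gcongr
  have := mul_le_mul_of_nonneg_left h2 (by positivity : (0 : ℝ) ≤ 2 * Real.pi)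
  linarith

lemma norm_coeff_mul_exp_le {g : ℂ → ℂ} {σ τ y A : ℝ} (hg : DifferentiableOn ℂ g (strip σ))
    (hper : ∀ z ∈ strip σ, g (z + 1) = g z) (hA : ∀ z ∈ strip σ, ‖g z‖ ≤ A) (k : ℤ)
    (h0 : 0 ≤ τ) (hτ : τ < σ) {z : ℂ} (hy : |z.im| ≤ y) :
    ‖coeff g k * exp (2 * Real.pi * I * k * z)‖ ≤
      A * Real.exp (-(2 * Real.pi * (τ - y) * |(k : ℝ)|)) := by
  have hA0 : 0 ≤ A := (norm_nonneg _).trans (hA 0 (by simpa [strip] using h0.trans_lt hτ))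
  rw [norm_mul]
  calc _ ≤ (A * Real.exp (-(2 * Real.pi * τ * |(k : ℝ)|))) *
        Real.exp (2 * Real.pi * y * |(k : ℝ)|) :=
        mul_le_mul (norm_coeff_le_exp hg hper hA k h0 hτ) (norm_exp_mul_le k hy)
          (norm_nonneg _) (by positivity)
    _ = _ := by
      rw [mul_assoc, ← Real.exp_add]
      congr 2; ring

lemma hasSum_coeff {g : ℂ → ℂ} {σ A : ℝ} (hg : DifferentiableOn ℂ g (strip σ))
    (hper : ∀ z ∈ strip σ, g (z + 1) = g z) (hA : ∀ z ∈ strip σ, ‖g z‖ ≤ A)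
    {z : ℂ} (hz : z ∈ strip σ) :
    HasSum (fun k : ℤ => coeff g k * exp (2 * Real.pi * I * k * z)) (g z) := by
  have hz' : |z.im| < σ := hz
  have hmem : ∀ x : ℝ, (x + z.im * I : ℂ) ∈ strip σ := fun x => by simpa [strip] using hz'
  let F : ℝ → ℂ := fun x => g (x + z.im * I)
  have hFper : Function.Periodic F 1 := by
    intro x
    show g ((x + 1 : ℝ) + z.im * I) = g (x + z.im * I)
    rw [← hper _ (hmem x)]
    congr 1; push_cast; ring
  have hFc : Continuous F := by
    refine hg.continuousOn.comp_continuous (by fun_prop) hmem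
  let f : C(AddCircle (1 : ℝ), ℂ) := ⟨hFper.lift, continuous_coinduced_dom.mpr hFc⟩
  have hf : ∀ x : ℝ, f (x : AddCircle (1 : ℝ)) = F x := fun x => hFper.lift_coe x
  have hcoef : ∀ k : ℤ, fourierCoeff f k = coeff g k * exp (2 * Real.pi * I * k * (z.im * I)) := by
    intro k
    rw [fourierCoeff_eq_intervalIntegral _ k 0, ← coeff_shift hg hper k hz',
      ← intervalIntegral.integral_mul_const]
    simp only [div_one, one_smul, zero_add]
    refine intervalIntegral.integral_congr fun x _ => ?_
    simp only [hf, fourier_coe_apply, smul_eq_mul, F]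
    rw [mul_comm, mul_assoc (g _), ← exp_add]
    congr 2
    push_cast
    ring
  obtain ⟨τ, hτ1, hτ2⟩ := exists_between hz'
  have hτ0 : 0 ≤ τ := (abs_nonneg _).trans hτ1.le
  have hsum : Summable (fourierCoeff f) := by
    refine Summable.of_norm_bounded (g := fun k : ℤ =>
      A * Real.exp (-(2 * Real.pi * (τ - |z.im|) * |(k : ℝ)|))) ?_ ?_
    · refine (summable_exp_abs ?_).mul_left A
      have := Real.pi_pos
      have : 0 < τ - |z.im| := by linarith
      positivity
    · intro k
      rw [hcoef]
      exact norm_coeff_mul_exp_le hg hper hA k hτ0 hτ2 (by simp)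
  have key := has_pointwise_sum_fourier_series_of_summable hsum (z.re : AddCircle (1 : ℝ))
  rw [hf] at key
  have hFz : F z.re = g z := by simp only [F, re_add_im]
  rw [hFz] at key
  convert key using 2 with k
  rw [hcoef, fourier_coe_apply, smul_eq_mul, mul_assoc (coeff g k), ← exp_add]
  congr 2
  nth_rewrite 1 [← re_add_im z]
  push_cast
  ring

/-- The Diophantine condition of constant `γ` and smallest exponent. -/
def Diophantine (γ ω : ℝ) : Prop := ∀ k l : ℤ, k ≠ 0 → γ / |(k : ℝ)| ≤ |k * ω - l|

lemma four_mul_abs_le_norm_exp_sub_one {x : ℝ} (hx : |x| ≤ 1 / 2) :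
    4 * |x| ≤ ‖exp (2 * Real.pi * I * x) - 1‖ := by
  have h1 : exp (2 * Real.pi * I * x) = exp (I * (2 * Real.pi * x : ℝ)) := by
    congr 1; push_cast; ring
  rw [h1, norm_exp_I_mul_ofReal_sub_one, norm_mul, Real.norm_eq_abs, Real.norm_eq_abs,
    abs_of_pos (two_pos : (0 : ℝ) < 2)]
  have h2 : 2 * Real.pi * x / 2 = Real.pi * x := by ring
  rw [h2]
  have h3 : |Real.sin (Real.pi * x)| = |Real.sin (Real.pi * |x|)| := by
    rcases abs_choice x with h | h <;> rw [h]
    rw [mul_neg, Real.sin_neg, abs_neg]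
  have hpi := Real.pi_pos
  have h4 := Real.mul_le_sin (x := Real.pi * |x|) (by positivity) (by nlinarith)
  have h5 : 2 / Real.pi * (Real.pi * |x|) = 2 * |x| := by field_simp
  rw [h5] at h4
  rw [h3]
  linarith [le_abs_self (Real.sin (Real.pi * |x|))]

lemma Diophantine.le_norm {γ ω : ℝ} (h : Diophantine γ ω) {k : ℤ} (hk : k ≠ 0) :
    4 * γ / |(k : ℝ)| ≤ ‖exp (2 * Real.pi * I * k * ω) - 1‖ := by
  set x : ℝ := k * ω - round (k * ω) with hx
  have h1 : |x| ≤ 1 / 2 := abs_sub_round _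
  have h2 : exp (2 * Real.pi * I * k * ω) = exp (2 * Real.pi * I * x) := by
    rw [hx]
    push_cast
    rw [show 2 * (Real.pi : ℂ) * I * (k * ω - (round (k * ω) : ℤ)) =
      2 * Real.pi * I * k * ω - (round (k * ω) : ℤ) * (2 * Real.pi * I) by ring, exp_sub,
      exp_int_mul_two_pi_mul_I, div_one]
  rw [h2]
  refine le_trans ?_ (four_mul_abs_le_norm_exp_sub_one h1)
  have := h k (round (k * ω)) hk
  rw [mul_div_assoc]
  linarith

lemma conj_coeff {g : ℂ → ℂ} (hreal : ∀ x : ℝ, (g x).im = 0) (k : ℤ) :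
    (starRingEnd ℂ) (coeff g k) = coeff g (-k) := by
  rw [coeff, coeff, ← intervalIntegral.intervalIntegral_conj]
  refine intervalIntegral.integral_congr fun x _ => ?_
  simp only [map_mul]
  rw [conj_eq_iff_im.2 (hreal x), ← exp_conj]
  congr 2
  simp [Complex.conj_ofNat]

theorem exists_cohomological_solution {g : ℂ → ℂ} {σ δ A γ ω : ℝ} (hω : Diophantine γ ω)
    (hγ : 0 < γ) (hδ : 0 < δ) (hδ1 : δ ≤ 1 / 4) (hδσ : δ < σ)
    (hg : DifferentiableOn ℂ g (strip σ))
    (hper : ∀ z ∈ strip σ, g (z + 1) = g z) (hA : ∀ z ∈ strip σ, ‖g z‖ ≤ A)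
    (h0 : ∫ x in (0 : ℝ)..1, g x = 0) (hreal : ∀ x : ℝ, (g x).im = 0) :
    ∃ η : ℂ → ℂ, DifferentiableOn ℂ η (strip (σ - δ)) ∧
      (∀ z ∈ strip (σ - δ), η (z + 1) = η z) ∧
      (∀ z ∈ strip (σ - δ), η (z + ω) - η z = g z) ∧
      (∀ z ∈ strip (σ - δ), ‖η z‖ ≤ A * (2 / γ) / δ ^ 2) ∧
      ∀ x : ℝ, (η x).im = 0 := by
  have hA0 : 0 ≤ A := (norm_nonneg _).trans (hA 0 (by simpa [strip] using hδ.trans hδσ))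
  have hc0 : coeff g 0 = 0 := by simpa [coeff] using h0
  have hpi := Real.pi_gt_three
  have hpi4 := Real.pi_le_four
  set d : ℤ → ℂ := fun k => coeff g k / (exp (2 * Real.pi * I * k * ω) - 1) with hd
  set u : ℤ → ℝ := fun k => A / (4 * γ) * (|(k : ℝ)| * Real.exp (-(δ * |(k : ℝ)|))) with hu
  have hus : Summable u := (summable_abs_mul_exp hδ).mul_left _
  have hne : ∀ k : ℤ, k ≠ 0 → exp (2 * Real.pi * I * k * ω) - 1 ≠ 0 := by
    intro k hk h
    have h1 := hω.le_norm hk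
    rw [h, norm_zero] at h1
    have hkpos : 0 < |(k : ℝ)| := abs_pos.2 (by exact_mod_cast hk)
    have : 0 < 4 * γ / |(k : ℝ)| := by positivity
    linarith
  have hbound : ∀ k : ℤ, ∀ z ∈ strip (σ - δ), ‖d k * exp (2 * Real.pi * I * k * z)‖ ≤ u k := by
    intro k z hz
    rcases eq_or_ne k 0 with rfl | hk
    · simp [hd, hu, hc0]
    have hz' : |z.im| < σ - δ := hz
    have hkpos : 0 < |(k : ℝ)| := abs_pos.2 (by exact_mod_cast hk)
    have h1 := norm_coeff_mul_exp_le hg hper hA k (τ := σ - δ / 2) (y := σ - δ)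
      (by linarith) (by linarith) hz'.le
    have h2 := hω.le_norm hk
    have h3 : d k * exp (2 * Real.pi * I * k * z) = (coeff g k * exp (2 * Real.pi * I * k * z)) /
        (exp (2 * Real.pi * I * k * ω) - 1) := by
      simp only [hd]; ring
    rw [h3, norm_div]
    have h4 : Real.exp (-(2 * Real.pi * (σ - δ / 2 - (σ - δ)) * |(k : ℝ)|)) ≤
        Real.exp (-(δ * |(k : ℝ)|)) := by
      apply Real.exp_le_exp.2
      have : δ * |(k : ℝ)| ≤ Real.pi * (δ * |(k : ℝ)|) := by
        have : 0 ≤ δ * |(k : ℝ)| := by positivity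
        nlinarith
      nlinarith
    calc _ ≤ (A * Real.exp (-(δ * |(k : ℝ)|))) / (4 * γ / |(k : ℝ)|) := by
          refine div_le_div₀ (by positivity) (h1.trans ?_) (by positivity) h2
          exact mul_le_mul_of_nonneg_left h4 hA0
      _ = u k := by simp only [hu]; field_simp
  have hsummable : ∀ z ∈ strip (σ - δ), Summable fun k : ℤ => d k * exp (2 * Real.pi * I * k * z) :=
    fun z hz => Summable.of_norm_bounded hus fun k => hbound k z hz
  refine ⟨fun z => ∑' k : ℤ, d k * exp (2 * Real.pi * I * k * z), ?_, ?_, ?_, ?_, ?_⟩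
  · refine differentiableOn_tsum_of_summable_norm hus (fun k => ?_) (isOpen_strip _) hbound
    refine Differentiable.differentiableOn ?_
    fun_prop
  · intro z _
    refine tsum_congr fun k => ?_
    congr 1
    rw [show 2 * (Real.pi : ℂ) * I * k * (z + 1) =
      2 * Real.pi * I * k * z + k * (2 * Real.pi * I) by ring, exp_add,
      exp_int_mul_two_pi_mul_I, mul_one]
  · intro z hz
    rw [← (hsummable _ (add_real_mem_strip hz ω)).tsum_sub (hsummable z hz)]
    refine HasSum.tsum_eq ?_
    refine (hasSum_coeff hg hper hA (strip_mono (by linarith) hz)).congr_fun fun k => ?_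
    rcases eq_or_ne k 0 with rfl | hk
    · simp [hd, hc0]
    · simp only [hd]
      rw [show 2 * (Real.pi : ℂ) * I * k * (z + ω) =
        2 * Real.pi * I * k * z + 2 * Real.pi * I * k * ω by ring, exp_add]
      have := hne k hk
      field_simp
  · intro z hz
    refine (tsum_of_norm_bounded hus.hasSum fun k => hbound k z hz).trans ?_
    rw [tsum_mul_left]
    calc _ ≤ A / (4 * γ) * (8 / δ ^ 2) :=
          mul_le_mul_of_nonneg_left (tsum_abs_mul_exp_le hδ (by linarith)) (by positivity)
      _ = _ := by field_simp; ring
  · intro x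
    rw [← conj_eq_iff_im, Complex.conj_tsum, ← (Equiv.neg ℤ).tsum_eq]
    refine tsum_congr fun k => ?_
    simp only [Equiv.neg_apply, hd, map_mul, map_div₀, map_sub, map_one, conj_coeff hreal,
      ← exp_conj, neg_neg]
    congr 3 <;> simp [Complex.conj_ofNat]

end Sitnikov

namespace Sitnikov

open Set Complex

/-- Complex curves parametrised by the unit time interval, with the supremum norm. -/
abbrev TimeCurve := C(unitInterval, ℂ)

namespace TimeCurve

/-- Extension of a time curve to all real times, constant outside the unit interval. -/
noncomputable def ext (f : TimeCurve) : ℝ → ℂ := IccExtend zero_le_one f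

lemma continuous_ext (f : TimeCurve) : Continuous (ext f) := f.continuous.Icc_extend'

lemma ext_coe (f : TimeCurve) (s : unitInterval) : ext f s = f s := IccExtend_val _ _ _

lemma norm_ext_le (f : TimeCurve) (s : ℝ) : ‖ext f s‖ ≤ ‖f‖ := f.norm_coe_le_norm _

lemma norm_le_of {f : TimeCurve} {C : ℝ} (h : ∀ s, ‖f s‖ ≤ C) : ‖f‖ ≤ C :=
  (ContinuousMap.norm_le _ ((norm_nonneg _).trans (h 0))).2 h

/-- The primitive of a time curve that vanishes at time zero. -/
noncomputable def primitive : TimeCurve →L[ℂ] TimeCurve :=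
  LinearMap.mkContinuous
    { toFun := fun f => ⟨fun s => ∫ t in (0 : ℝ)..s, ext f t,
        (intervalIntegral.continuous_primitive
          (fun a b => (continuous_ext f).intervalIntegrable a b) 0).comp continuous_subtype_val⟩
      map_add' := fun f g => by
        ext s
        exact intervalIntegral.integral_add ((continuous_ext f).intervalIntegrable _ _)
          ((continuous_ext g).intervalIntegrable _ _)
      map_smul' := fun c f => by
        ext s
        exact intervalIntegral.integral_smul c (ext f) } 1 fun f => by
    refine norm_le_of fun s => ?_
    have := intervalIntegral.norm_integral_le_of_norm_le_const (a := (0 : ℝ)) (b := s)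
      (f := ext f) (C := ‖f‖) fun x _ => norm_ext_le f x
    rw [sub_zero, abs_of_nonneg s.2.1] at this
    rw [one_mul]
    exact this.trans (mul_le_of_le_one_right (norm_nonneg _) s.2.2)

lemma primitive_apply (f : TimeCurve) (s : unitInterval) :
    primitive f s = ∫ t in (0 : ℝ)..s, ext f t := rfl

@[simp] lemma primitive_zero_time (f : TimeCurve) : primitive f 0 = 0 := by
  rw [primitive_apply]; simp

lemma norm_primitive_le (f : TimeCurve) : ‖primitive f‖ ≤ ‖f‖ := by
  simpa using primitive.le_of_opNorm_le (LinearMap.mkContinuous_norm_le _ zero_le_one _) f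

/-- Integral of a time curve over the unit interval. -/
noncomputable def mean : TimeCurve →L[ℂ] ℂ :=
  (ContinuousMap.evalCLM ℂ (1 : unitInterval)).comp primitive

lemma mean_apply (f : TimeCurve) : mean f = primitive f 1 := rfl

lemma norm_mean_le (f : TimeCurve) : ‖mean f‖ ≤ ‖f‖ :=
  ((primitive f).norm_coe_le_norm 1).trans (norm_primitive_le f)

/-- Constant time curves. -/
noncomputable def const : ℂ →L[ℂ] TimeCurve := algebraMapCLM ℂ TimeCurve

@[simp] lemma const_apply (c : ℂ) (s : unitInterval) : const c s = c := rfl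

lemma norm_const_le (c : ℂ) : ‖const c‖ ≤ ‖c‖ := norm_le_of fun s => by simp

/-- Evaluation at a fixed time. -/
noncomputable def ev (s : unitInterval) : TimeCurve →L[ℂ] ℂ := ContinuousMap.evalCLM ℂ s

@[simp] lemma ev_apply (s : unitInterval) (f : TimeCurve) : ev s f = f s := rfl

/-- `Y` is the time derivative of `F`. -/
def IsPrim (F Y : TimeCurve) : Prop :=
  ∀ s ∈ Icc (0 : ℝ) 1, HasDerivWithinAt (ext F) (ext Y s) (Icc 0 1) s

lemma isPrim_primitive (Y : TimeCurve) : IsPrim (primitive Y) Y := by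
  intro s hs
  have h := ((continuous_ext Y).integral_hasStrictDerivAt 0 s).hasDerivAt.hasDerivWithinAt
    (s := Icc (0 : ℝ) 1)
  exact h.congr (fun t ht => ext_coe (primitive Y) ⟨t, ht⟩) (ext_coe (primitive Y) ⟨s, hs⟩)

lemma isPrim_const (c : ℂ) : IsPrim (const c) 0 := fun s _ => hasDerivWithinAt_const s _ c

lemma IsPrim.add {F Y G Z : TimeCurve} (h : IsPrim F Y) (k : IsPrim G Z) :
    IsPrim (F + G) (Y + Z) := fun s hs => (h s hs).add (k s hs)

lemma IsPrim.sub {F Y G Z : TimeCurve} (h : IsPrim F Y) (k : IsPrim G Z) :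
    IsPrim (F - G) (Y - Z) := fun s hs => (h s hs).sub (k s hs)

lemma IsPrim.mul {F Y G Z : TimeCurve} (h : IsPrim F Y) (k : IsPrim G Z) :
    IsPrim (F * G) (Y * G + F * Z) := fun s hs => (h s hs).mul (k s hs)

lemma IsPrim.eq {F Y : TimeCurve} (h : IsPrim F Y) : F = const (F 0) + primitive Y := by
  have h0 := (isPrim_const (F 0)).add (isPrim_primitive Y)
  rw [zero_add] at h0
  have hd : ∀ s ∈ Icc (0 : ℝ) 1,
      HasDerivWithinAt (ext (F - (const (F 0) + primitive Y))) 0 (Icc 0 1) s := by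
    intro s hs
    have := (h.sub h0) s hs
    rwa [sub_self] at this
  have hc := constant_of_derivWithin_zero (f := ext (F - (const (F 0) + primitive Y)))
    (fun s hs => (hd s hs).differentiableWithinAt) fun s hs =>
      (hd s (Ico_subset_Icc_self hs)).derivWithin
        (uniqueDiffOn_Icc zero_lt_one s (Ico_subset_Icc_self hs))
  ext s
  have h1 := (hc s s.2).trans (ext_coe _ (0 : unitInterval))
  rw [ext_coe] at h1
  simpa [sub_eq_zero] using h1

lemma IsPrim.of_eq {F Y : TimeCurve} {c : ℂ} (h : F = const c + primitive Y) : IsPrim F Y := by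
  rw [h]
  simpa using (isPrim_const c).add (isPrim_primitive Y)

lemma IsPrim.mean_eq {F Y : TimeCurve} (h : IsPrim F Y) : mean Y = F 1 - F 0 := by
  have h1 := congrArg (fun G : TimeCurve => G 1) h.eq
  have h2 : F 1 = F 0 + primitive Y 1 := h1
  rw [mean_apply, h2, add_sub_cancel_left]

lemma IsPrim.inverse {F Y U : TimeCurve} (h : IsPrim F Y) (hU : U * F = 1) :
    IsPrim U (-(U ^ 2 * Y)) := by
  intro s hs
  have hne : ∀ t, ext U t * ext F t = 1 := fun t => congrArg (fun G : TimeCurve => ext G t) hU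
  have hF : ∀ t, ext F t ≠ 0 := fun t h0 => by simpa [h0] using hne t
  have hinv : ext U = fun t => (ext F t)⁻¹ := by
    funext t
    exact eq_inv_of_mul_eq_one_left (hne t)
  have h2 := (h s hs).fun_inv (hF s)
  rw [← hinv] at h2
  refine h2.congr_deriv ?_
  show _ = -(ext U s ^ 2 * ext Y s)
  rw [hinv]
  field_simp

/-- Time derivatives commute with parameter derivatives. -/
lemma IsPrim.deriv {F Y : ℂ → TimeCurve} {z : ℂ} (h : ∀ᶠ w in nhds z, IsPrim (F w) (Y w))
    (hF : DifferentiableAt ℂ F z) (hY : DifferentiableAt ℂ Y z) :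
    IsPrim (deriv F z) (deriv Y z) := by
  have h1 : HasDerivAt (fun w => const (ev 0 (F w)) + primitive (Y w))
      (const (ev 0 (_root_.deriv F z)) + primitive (_root_.deriv Y z)) z :=
    ((const.comp (ev 0)).hasFDerivAt.comp_hasDerivAt z hF.hasDerivAt).add
      (primitive.hasFDerivAt.comp_hasDerivAt z hY.hasDerivAt)
  refine IsPrim.of_eq (hF.hasDerivAt.unique (h1.congr_of_eventuallyEq ?_))
  filter_upwards [h] with w hw using hw.eq

lemma exists_inverse {F : TimeCurve} {m : ℝ} (hm : 0 < m) (h : ∀ s, m ≤ (F s).re) :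
    ∃ U : TimeCurve, U * F = 1 ∧ ‖U‖ ≤ 1 / m := by
  have hne : ∀ s, F s ≠ 0 := fun s h0 => by
    have := h s
    rw [h0, zero_re] at this
    linarith
  refine ⟨⟨fun s => (F s)⁻¹, F.continuous.inv₀ hne⟩, ?_, ?_⟩
  · ext s
    exact inv_mul_cancel₀ (hne s)
  · refine norm_le_of fun s => ?_
    show ‖(F s)⁻¹‖ ≤ _
    rw [norm_inv, ← one_div]
    exact one_div_le_one_div_of_le hm ((h s).trans (re_le_norm _))

lemma inverse_eq_of_mul_eq_one {F U : TimeCurve} (h : U * F = 1) : Ring.inverse F = U := by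
  have hu : IsUnit F := IsUnit.of_mul_eq_one_right U h
  rw [← one_mul (Ring.inverse F), ← h, mul_assoc, Ring.mul_inverse_cancel F hu, mul_one]

lemma star_primitive (f : TimeCurve) : star (primitive f) = primitive (star f) := by
  ext s
  rw [ContinuousMap.star_apply, primitive_apply, primitive_apply, ← starRingEnd_apply,
    ← intervalIntegral.intervalIntegral_conj]
  rfl

lemma star_const (c : ℂ) : star (const c) = const (star c) := rfl

lemma star_mean (f : TimeCurve) : star (mean f) = mean (star f) := by
  rw [mean_apply, mean_apply, ← star_primitive]; rfl

lemma isSelfAdjoint_iff {f : TimeCurve} : IsSelfAdjoint f ↔ ∀ s, (f s).im = 0 := by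
  constructor
  · intro h s
    exact conj_eq_iff_im.1 (congrArg (fun g : TimeCurve => g s) h)
  · intro h
    ext s
    exact conj_eq_iff_im.2 (h s)

lemma isSelfAdjoint_deriv {F : ℂ → TimeCurve} (h : ∀ x : ℝ, IsSelfAdjoint (F x)) {x : ℝ}
    (hF : DifferentiableAt ℂ F x) : IsSelfAdjoint (deriv F x) := by
  have h1 : HasDerivAt (fun y : ℝ => F y) (deriv F x) x := by
    have := hF.hasDerivAt.scomp (h := fun y : ℝ => (y : ℂ)) x ofRealCLM.hasDerivAt
    simpa [Function.comp_def] using this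
  have h2 := h1.star
  refine h2.unique (h1.congr_of_eventuallyEq ?_)
  exact Filter.Eventually.of_forall fun y => h y

lemma isSelfAdjoint_inverse {F U : TimeCurve} (hF : IsSelfAdjoint F) (h : U * F = 1) :
    IsSelfAdjoint U := by
  have h1 : star U * F = 1 := by
    have := congrArg star h
    rwa [star_mul, hF.star_eq, star_one, mul_comm] at this
  exact (inverse_eq_of_mul_eq_one h1).symm.trans (inverse_eq_of_mul_eq_one h)

end TimeCurve

end Sitnikov

namespace Sitnikov

open Set Complex

open TimeCurve

/-- Pairs of time curves with bounded imaginary angle and bounded action. -/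
def Dom (R : ℝ) (a b : TimeCurve) : Prop := (∀ s, |(a s).im| ≤ 1) ∧ ‖b‖ ≤ R

/-- Uniform first order Taylor estimate. -/
def TaylorBound (R C : ℝ) (G A B : TimeCurve → TimeCurve → TimeCurve) : Prop :=
  ∀ a b a' b', Dom R a b → Dom R a' b' →
    ‖G a' b' - G a b - A a b * (a' - a) - B a b * (b' - b)‖ ≤ C * (‖a' - a‖ + ‖b' - b‖) ^ 2

/-- A time dependent Hamiltonian acting on time curves, with its derivatives; the first argument
is an angle and the second one an action. -/
structure Ham (R C : ℝ) where
  H : TimeCurve → TimeCurve → TimeCurve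
  H1 : TimeCurve → TimeCurve → TimeCurve
  H2 : TimeCurve → TimeCurve → TimeCurve
  H11 : TimeCurve → TimeCurve → TimeCurve
  H12 : TimeCurve → TimeCurve → TimeCurve
  H22 : TimeCurve → TimeCurve → TimeCurve
  P : TimeCurve → TimeCurve → TimeCurve
  Q : TimeCurve → TimeCurve → TimeCurve
  taylor_H : TaylorBound R C H H1 H2
  taylor_H1 : TaylorBound R C H1 H11 H12
  taylor_H2 : TaylorBound R C H2 H12 H22
  taylor_H22 : TaylorBound R C H22 P Q
  norm_H22 : ∀ a b, Dom R a b → ‖H22 a b‖ ≤ C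
  norm_P : ∀ a b, Dom R a b → ‖P a b‖ ≤ C
  norm_Q : ∀ a b, Dom R a b → ‖Q a b‖ ≤ C
  per_H : ∀ a b, H (a + const (2 * Real.pi)) b = H a b
  per_H1 : ∀ a b, H1 (a + const (2 * Real.pi)) b = H1 a b
  per_H2 : ∀ a b, H2 (a + const (2 * Real.pi)) b = H2 a b
  per_H22 : ∀ a b, H22 (a + const (2 * Real.pi)) b = H22 a b
  real_H1 : ∀ a b, IsSelfAdjoint a → IsSelfAdjoint b → IsSelfAdjoint (H1 a b)
  real_H2 : ∀ a b, IsSelfAdjoint a → IsSelfAdjoint b → IsSelfAdjoint (H2 a b)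
  real_H22 : ∀ a b, IsSelfAdjoint a → IsSelfAdjoint b → IsSelfAdjoint (H22 a b)

lemma TaylorBound.hasDerivAt {R C : ℝ} {G A B : TimeCurve → TimeCurve → TimeCurve}
    (h : TaylorBound R C G A B) {φ ι : ℂ → TimeCurve} {φ' ι' : TimeCurve} {z : ℂ}
    (hD : ∀ᶠ w in nhds z, Dom R (φ w) (ι w)) (hφ : HasDerivAt φ φ' z) (hι : HasDerivAt ι ι' z) :
    HasDerivAt (fun w => G (φ w) (ι w)) (A (φ z) (ι z) * φ' + B (φ z) (ι z) * ι') z := by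
  have h1 : HasDerivAt (fun w => A (φ z) (ι z) * (φ w - φ z) + B (φ z) (ι z) * (ι w - ι z))
      (A (φ z) (ι z) * φ' + B (φ z) (ι z) * ι') z :=
    ((hφ.sub_const _).const_mul _).add ((hι.sub_const _).const_mul _)
  have h2 : HasDerivAt (fun w => G (φ w) (ι w) -
      (A (φ z) (ι z) * (φ w - φ z) + B (φ z) (ι z) * (ι w - ι z))) 0 z := by
    rw [hasDerivAt_iff_isLittleO]
    have hO : (fun w => φ w - φ z) =O[nhds z] fun w => w - z := hφ.isBigO_sub
    have hO' : (fun w => ι w - ι z) =O[nhds z] fun w => w - z := hι.isBigO_sub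
    have h3 : (fun w => (‖φ w - φ z‖ + ‖ι w - ι z‖) ^ 2) =O[nhds z] fun w => ‖w - z‖ ^ 2 :=
      (hO.norm_norm.add hO'.norm_norm).pow 2
    have h4 : (fun w => ‖w - z‖ ^ 2) =o[nhds z] fun w => w - z := by
      have : (fun w : ℂ => ‖w - z‖ ^ 2) =O[nhds z] fun w => (w - z) ^ 2 :=
        Asymptotics.IsBigO.of_bound 1 (Filter.Eventually.of_forall fun w => by simp)
      refine this.trans_isLittleO ?_
      have h5 : Filter.Tendsto (fun w : ℂ => w - z) (nhds z) (nhds 0) := by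
        have : Continuous fun w : ℂ => w - z := by fun_prop
        simpa using this.tendsto z
      exact (Asymptotics.isLittleO_pow_id one_lt_two).comp_tendsto h5
    refine Asymptotics.IsBigO.trans_isLittleO ?_ (h3.trans_isLittleO h4)
    refine Asymptotics.IsBigO.of_bound C ?_
    filter_upwards [hD] with w hw
    have := h _ _ _ _ hD.self_of_nhds hw
    simp only [sub_self, mul_zero, add_zero, sub_zero, smul_zero]
    rw [Real.norm_of_nonneg (by positivity)]
    refine le_trans (le_of_eq ?_) this
    congr 1
    abel
  have := h2.fun_add h1
  simpa using this

lemma Diophantine.exists_matched_primitive {g : ℂ → TimeCurve} {σ δ B γ ω A : ℝ}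
    (hω : Diophantine γ ω) (hγ : 0 < γ) (hA1 : 1 ≤ A) (hA : 2 / γ ≤ A)
    (hδ : 0 < δ) (hδ1 : δ ≤ 1 / 4) (hδσ : δ < σ)
    (hg : DifferentiableOn ℂ g (strip σ)) (hper : ∀ z ∈ strip σ, g (z + 1) = g z)
    (hB : ∀ z ∈ strip σ, ‖g z‖ ≤ B) (h0 : ∫ x in (0 : ℝ)..1, mean (g x) = 0)
    (hreal : ∀ x : ℝ, IsSelfAdjoint (g x)) :
    ∃ ξ : ℂ → TimeCurve, DifferentiableOn ℂ ξ (strip (σ - δ)) ∧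
      (∀ z ∈ strip (σ - δ), ξ (z + 1) = ξ z) ∧
      (∀ z, IsPrim (ξ z) (g z)) ∧
      (∀ z ∈ strip (σ - δ), ξ z 1 = ξ (z + ω) 0) ∧
      (∀ z ∈ strip (σ - δ), ‖ξ z‖ ≤ 2 * A * B / δ ^ 2) ∧
      ∀ x : ℝ, IsSelfAdjoint (ξ x) := by
  have hsub : strip (σ - δ) ⊆ strip σ := strip_mono (by linarith)
  have hB0 : 0 ≤ B := (norm_nonneg _).trans (hB 0 (by simpa [strip] using hδ.trans hδσ))
  obtain ⟨η, h1, h2, h3, h4, h5⟩ := exists_cohomological_solution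
    (g := fun z => mean (g z)) hω hγ hδ
    hδ1 hδσ (mean.differentiable.comp_differentiableOn hg)
    (fun z hz => by rw [hper z hz]) (fun z hz => (norm_mean_le _).trans (hB z hz)) h0
    (fun x => conj_eq_iff_im.1 ((star_mean _).trans (congrArg mean (hreal x))))
  refine ⟨fun z => const (η z) + primitive (g z), ?_, ?_, ?_, ?_, ?_, ?_⟩
  · exact (const.differentiable.comp_differentiableOn h1).add
      (primitive.differentiable.comp_differentiableOn (hg.mono hsub))
  · intro z hz
    simp only [h2 z hz, hper z (hsub hz)]
  · intro z
    exact IsPrim.of_eq (c := η z) rfl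
  · intro z hz
    have := h3 z hz
    rw [mean_apply] at this
    simp [← this]
  · intro z hz
    refine (norm_add_le _ _).trans ?_
    have e1 := (norm_const_le (η z)).trans (h4 z hz)
    have e2 := (norm_primitive_le (g z)).trans (hB z (hsub hz))
    have e3 : B * (2 / γ) / δ ^ 2 ≤ B * A / δ ^ 2 := by gcongr
    have e4 : B ≤ B * A / δ ^ 2 := by
      rw [le_div_iff₀ (by positivity)]
      have : δ ^ 2 ≤ 1 := by nlinarith
      nlinarith
    have e5 : 2 * A * B / δ ^ 2 = B * A / δ ^ 2 + B * A / δ ^ 2 := by ring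
    linarith
  · intro x
    refine IsSelfAdjoint.add ?_ ?_
    · show star (const _) = _
      rw [star_const]
      exact congrArg _ (conj_eq_iff_im.2 (h5 x))
    · show star (primitive _) = _
      rw [star_primitive, (hreal x).star_eq]

end Sitnikov

namespace Sitnikov

open Set Complex

open TimeCurve

/-- An approximate invariant torus `(φ, ι)` of a Hamiltonian, with time derivatives `(Y, Z)`. -/
structure ApproxTorus {R A : ℝ} (h : Ham R A) (α ω κ δ : ℝ) (φ ι Y Z : ℂ → TimeCurve) : Prop where
  dφ : DifferentiableOn ℂ φ (strip (4 * δ))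
  dι : DifferentiableOn ℂ ι (strip (4 * δ))
  dY : DifferentiableOn ℂ Y (strip (4 * δ))
  dZ : DifferentiableOn ℂ Z (strip (4 * δ))
  perφ : ∀ z ∈ strip (4 * δ), φ (z + 1) = φ z + const (2 * Real.pi)
  perι : ∀ z ∈ strip (4 * δ), ι (z + 1) = ι z
  perY : ∀ z ∈ strip (4 * δ), Y (z + 1) = Y z
  perZ : ∀ z ∈ strip (4 * δ), Z (z + 1) = Z z
  primφ : ∀ z ∈ strip (4 * δ), IsPrim (φ z) (Y z)
  primι : ∀ z ∈ strip (4 * δ), IsPrim (ι z) (Z z)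
  matchφ : ∀ z ∈ strip (4 * δ), φ z 1 + α = φ (z + ω) 0
  matchι : ∀ z ∈ strip (4 * δ), ι z 1 = ι (z + ω) 0
  err1 : ∀ z ∈ strip (4 * δ), ‖Y z - h.H2 (φ z) (ι z)‖ ≤ κ * δ ^ 8
  err2 : ∀ z ∈ strip (4 * δ), ‖Z z + h.H1 (φ z) (ι z)‖ ≤ κ * δ ^ 8
  imφ : ∀ z ∈ strip (4 * δ), ∀ s, |(φ z s).im| ≤ 1 - δ
  normι : ∀ z ∈ strip (4 * δ), ‖ι z‖ ≤ R - δ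
  derivφ : ∀ z ∈ strip (4 * δ), ‖deriv φ z‖ ≤ A - δ
  derivι : ∀ z ∈ strip (4 * δ), ‖deriv ι z‖ ≤ A - δ
  re_deriv : ∀ z ∈ strip (4 * δ), ∀ s, 1 / A + δ ≤ (deriv φ z s).re
  twist : 1 / A + δ ≤
    ‖∫ x in (0 : ℝ)..1, mean (h.H22 (φ x) (ι x) * Ring.inverse (deriv φ x) ^ 2)‖
  realφ : ∀ x : ℝ, IsSelfAdjoint (φ x)
  realι : ∀ x : ℝ, IsSelfAdjoint (ι x)
  realY : ∀ x : ℝ, IsSelfAdjoint (Y x)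
  realZ : ∀ x : ℝ, IsSelfAdjoint (Z x)

lemma deriv_add_one {f : ℂ → TimeCurve} {σ : ℝ} {c : TimeCurve}
    (h : ∀ z ∈ strip σ, f (z + 1) = f z + c) {z : ℂ} (hz : z ∈ strip σ) :
    deriv f (z + 1) = deriv f z := by
  rw [← deriv_comp_add_const]
  have : (fun w => f (w + 1)) =ᶠ[nhds z] fun w => f w + c := by
    filter_upwards [strip_mem_nhds hz] with w hw using h w hw
  rw [this.deriv_eq, deriv_add_const]

lemma deriv_matched {f : ℂ → TimeCurve} {σ ω : ℝ} {c : ℂ} (hf : DifferentiableOn ℂ f (strip σ))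
    (h : ∀ z ∈ strip σ, f z 1 + c = f (z + ω) 0) {z : ℂ} (hz : z ∈ strip σ) :
    deriv f z 1 = deriv f (z + ω) 0 := by
  have h1 : HasDerivAt f (deriv f z) z :=
    (hf.differentiableAt (strip_mem_nhds hz)).hasDerivAt
  have h2 : HasDerivAt f (deriv f (z + ω)) (z + ω) :=
    (hf.differentiableAt (strip_mem_nhds (add_real_mem_strip hz ω))).hasDerivAt
  have h3 : HasDerivAt (fun w => f (w + ω)) (deriv f (z + ω)) z := h2.comp_add_const z ω
  have h4 : HasDerivAt (fun w => f (w + ω) 0) (deriv f (z + ω) 0) z :=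
    (ev 0).hasFDerivAt.comp_hasDerivAt z h3
  have h5 : HasDerivAt (fun w => f w 1 + c) (deriv f z 1) z :=
    ((ev 1).hasFDerivAt.comp_hasDerivAt z h1).add_const c
  refine h5.unique (h4.congr_of_eventuallyEq ?_)
  filter_upwards [strip_mem_nhds hz] with w hw using h w hw

lemma integral_deriv_eq_zero {f : ℂ → ℂ} {σ : ℝ} (hσ : 0 < σ) (hf : DifferentiableOn ℂ f (strip σ))
    (h : ∀ z ∈ strip σ, f (z + 1) = f z) : ∫ x in (0 : ℝ)..1, deriv f x = 0 := by
  have h1 : ∀ x : ℝ, HasDerivAt (fun y : ℝ => f y) (deriv f x) x := fun x =>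
    (hf.differentiableAt (strip_mem_nhds (ofReal_mem_strip hσ x))).hasDerivAt.comp_ofReal
  have hc : Continuous fun x : ℝ => deriv f x :=
    ((hf.deriv (isOpen_strip σ)).continuousOn.comp_continuous continuous_ofReal
      fun x => ofReal_mem_strip hσ x)
  rw [intervalIntegral.integral_eq_sub_of_hasDerivAt (f := fun y : ℝ => f y) (fun x _ => h1 x)
    (hc.intervalIntegrable _ _)]
  have := h 0 (by simpa using ofReal_mem_strip hσ 0)
  simp only [zero_add] at this
  simp [this]

namespace ApproxTorus

variable {R A : ℝ} {h : Ham R A} {α ω κ δ : ℝ} {φ ι Y Z : ℂ → TimeCurve}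

lemma dom (hs : ApproxTorus h α ω κ δ φ ι Y Z) (hδ : 0 < δ) {z : ℂ} (hz : z ∈ strip (4 * δ)) :
    Dom R (φ z) (ι z) :=
  ⟨fun s => (hs.imφ z hz s).trans (by linarith), (hs.normι z hz).trans (by linarith)⟩

lemma hasDerivAt_comp (hs : ApproxTorus h α ω κ δ φ ι Y Z) (hδ : 0 < δ)
    {G G1 G2 : TimeCurve → TimeCurve → TimeCurve} (hG : TaylorBound R A G G1 G2)
    {z : ℂ} (hz : z ∈ strip (4 * δ)) :
    HasDerivAt (fun w => G (φ w) (ι w))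
      (G1 (φ z) (ι z) * deriv φ z + G2 (φ z) (ι z) * deriv ι z) z := by
  have hn := strip_mem_nhds hz
  refine hG.hasDerivAt ?_ (hs.dφ.differentiableAt hn).hasDerivAt
    (hs.dι.differentiableAt hn).hasDerivAt
  filter_upwards [hn] with w hw using hs.dom hδ hw

lemma inverse_mul (hs : ApproxTorus h α ω κ δ φ ι Y Z) (hA : 1 ≤ A) (hδ : 0 < δ) {z : ℂ}
    (hz : z ∈ strip (4 * δ)) :
    Ring.inverse (deriv φ z) * deriv φ z = 1 ∧ ‖Ring.inverse (deriv φ z)‖ ≤ A := by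
  obtain ⟨U, hU, hn⟩ := exists_inverse (F := deriv φ z) (m := 1 / A + δ) (by positivity)
    (hs.re_deriv z hz)
  rw [inverse_eq_of_mul_eq_one hU]
  refine ⟨hU, hn.trans ?_⟩
  rw [div_le_iff₀ (by positivity)]
  have : A * (1 / A) = 1 := by field_simp
  nlinarith

lemma differentiableOn_inverse (hs : ApproxTorus h α ω κ δ φ ι Y Z) (hA : 1 ≤ A) (hδ : 0 < δ) :
    DifferentiableOn ℂ (fun z => Ring.inverse (deriv φ z)) (strip (4 * δ)) := by
  intro z hz
  have h1 := (hs.dφ.deriv (isOpen_strip _)).differentiableAt (strip_mem_nhds hz)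
  refine (DifferentiableAt.inverse h1 ?_).differentiableWithinAt
  exact IsUnit.of_mul_eq_one_right _ (hs.inverse_mul hA hδ hz).1

/-- The defect of the symplectic pairing with the error has zero average. -/
lemma integral_pairing_eq_zero (hs : ApproxTorus h α ω κ δ φ ι Y Z) (hδ : 0 < δ) :
    ∫ x in (0 : ℝ)..1, mean (deriv ι x * (Y x - h.H2 (φ x) (ι x)) -
      deriv φ x * (Z x + h.H1 (φ x) (ι x))) = 0 := by
  have hσ : 0 < 4 * δ := by linarith
  have hdφ := hs.dφ.deriv (isOpen_strip _)
  let K : ℂ → ℂ := fun z => mean (ι z * Y z) - mean (h.H (φ z) (ι z))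
  have hHd : ∀ z ∈ strip (4 * δ), HasDerivAt (fun w => h.H (φ w) (ι w))
      (h.H1 (φ z) (ι z) * deriv φ z + h.H2 (φ z) (ι z) * deriv ι z) z :=
    fun z hz => hs.hasDerivAt_comp hδ h.taylor_H hz
  have hKd : ∀ z ∈ strip (4 * δ), HasDerivAt K (mean (deriv ι z * Y z + ι z * deriv Y z) -
      mean (h.H1 (φ z) (ι z) * deriv φ z + h.H2 (φ z) (ι z) * deriv ι z)) z := by
    intro z hz
    have hn := strip_mem_nhds hz
    exact (mean.hasFDerivAt.comp_hasDerivAt z ((hs.dι.differentiableAt hn).hasDerivAt.fun_mul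
      (hs.dY.differentiableAt hn).hasDerivAt)).sub (mean.hasFDerivAt.comp_hasDerivAt z (hHd z hz))
  let L : ℂ → ℂ := fun z => (ι z * deriv φ z) 0
  have hL : ∀ z ∈ strip (4 * δ), mean (ι z * deriv Y z + Z z * deriv φ z) = L (z + ω) - L z := by
    intro z hz
    have hn := strip_mem_nhds hz
    have h1 : IsPrim (deriv φ z) (deriv Y z) := IsPrim.deriv
      (by filter_upwards [hn] with w hw using hs.primφ w hw) (hs.dφ.differentiableAt hn)
      (hs.dY.differentiableAt hn)
    have h2 := ((hs.primι z hz).mul h1).mean_eq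
    rw [add_comm, h2]
    simp only [ContinuousMap.mul_apply, L, deriv_matched hs.dφ hs.matchφ hz, hs.matchι z hz]
  have hLc : ContinuousOn L (strip (4 * δ)) :=
    ((ev 0).continuous.comp_continuousOn (hs.dι.continuousOn.mul hdφ.continuousOn))
  have hLper : Function.Periodic (fun x : ℝ => L x) 1 := by
    intro x
    have hx := ofReal_mem_strip hσ x
    simp only [L, ofReal_add, ofReal_one]
    rw [hs.perι _ hx, deriv_add_one hs.perφ hx]
  have hLi : ∫ x in (0 : ℝ)..1, (L (x + ω) - L x) = 0 := by
    have hc : Continuous fun x : ℝ => L x :=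
      hLc.comp_continuous continuous_ofReal fun x => ofReal_mem_strip hσ x
    have hc' : Continuous fun x : ℝ => L (x + ω) := by
      have := hc.comp (continuous_add_const ω)
      simpa [Function.comp_def] using this
    rw [intervalIntegral.integral_sub (hc'.intervalIntegrable _ _) (hc.intervalIntegrable _ _)]
    have h1 := intervalIntegral.integral_comp_add_right (a := 0) (b := 1)
      (fun x : ℝ => L x) ω
    have h2 := hLper.intervalIntegral_add_eq ω 0
    simp only [ofReal_add, zero_add] at h1 h2
    rw [h1, add_comm 1 ω, h2, sub_self]
  have hK0 : ∫ x in (0 : ℝ)..1, deriv K x = 0 := by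
    refine integral_deriv_eq_zero hσ
      (fun z hz => (hKd z hz).differentiableAt.differentiableWithinAt) fun z hz => ?_
    simp only [K]
    rw [hs.perι z hz, hs.perY z hz, hs.perφ z hz, h.per_H]
  have hKc : ContinuousOn (deriv K) (strip (4 * δ)) := by
    refine (DifferentiableOn.deriv (fun z hz => ?_) (isOpen_strip _)).continuousOn
    exact (hKd z hz).differentiableAt.differentiableWithinAt
  have key : ∀ x : ℝ, mean (deriv ι x * (Y x - h.H2 (φ x) (ι x)) -
      deriv φ x * (Z x + h.H1 (φ x) (ι x))) = deriv K x - (L (x + ω) - L x) := by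
    intro x
    have hx := ofReal_mem_strip hσ x
    rw [(hKd x hx).deriv, ← hL x hx, ← map_sub, ← map_sub]
    congr 1
    ring
  simp only [key]
  have hc1 : Continuous fun x : ℝ => deriv K x :=
    hKc.comp_continuous continuous_ofReal fun x => ofReal_mem_strip hσ x
  have hc2 : Continuous fun x : ℝ => L (x + ω) - L x := by
    have hc : Continuous fun x : ℝ => L x :=
      hLc.comp_continuous continuous_ofReal fun x => ofReal_mem_strip hσ x
    have := hc.comp (continuous_add_const ω)
    refine Continuous.sub ?_ hc
    simpa [Function.comp_def] using this
  rw [intervalIntegral.integral_sub (hc1.intervalIntegrable _ _) (hc2.intervalIntegrable _ _),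
    hK0, hLi, sub_zero]

end ApproxTorus

end Sitnikov

namespace Sitnikov

open Set Complex

open TimeCurve

namespace ApproxTorus

variable {R A : ℝ} {h : Ham R A} {α ω κ δ : ℝ} {φ ι Y Z : ℂ → TimeCurve}

lemma norm_mul_le_of {a b : TimeCurve} {x y : ℝ} (ha : ‖a‖ ≤ x) (hb : ‖b‖ ≤ y) :
    ‖a * b‖ ≤ x * y :=
  (norm_mul_le a b).trans (mul_le_mul ha hb (norm_nonneg _) ((norm_nonneg _).trans ha))

set_option maxHeartbeats 1000000 in
/-- Solution of the linearised invariance equation, up to a quadratically small error. -/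
theorem exists_correction {γ : ℝ} (hs : ApproxTorus h α ω κ δ φ ι Y Z) (hA : 1 ≤ A)
    (hω : Diophantine γ ω) (hγ : 0 < γ) (hγA : 2 / γ ≤ A) (hδ : 0 < δ) (hδ1 : δ ≤ 1 / 4)
    (hκ : 0 ≤ κ) :
    ∃ v1 v2 w1 w2 : ℂ → TimeCurve,
      (DifferentiableOn ℂ v1 (strip (2 * δ)) ∧ DifferentiableOn ℂ v2 (strip (2 * δ)) ∧
        DifferentiableOn ℂ w1 (strip (2 * δ)) ∧ DifferentiableOn ℂ w2 (strip (2 * δ))) ∧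
      (∀ z ∈ strip (2 * δ), v1 (z + 1) = v1 z ∧ v2 (z + 1) = v2 z ∧ w1 (z + 1) = w1 z ∧
        w2 (z + 1) = w2 z) ∧
      (∀ z ∈ strip (2 * δ), IsPrim (v1 z) (w1 z) ∧ IsPrim (v2 z) (w2 z)) ∧
      (∀ z ∈ strip (2 * δ), v1 z 1 = v1 (z + ω) 0 ∧ v2 z 1 = v2 (z + ω) 0) ∧
      (∀ z ∈ strip (2 * δ), ‖v1 z‖ ≤ 29 * A ^ 11 * κ * δ ^ 4 ∧
        ‖v2 z‖ ≤ 29 * A ^ 11 * κ * δ ^ 4) ∧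
      (∀ z ∈ strip (2 * δ),
        ‖Y z - h.H2 (φ z) (ι z) + w1 z - h.H12 (φ z) (ι z) * v1 z - h.H22 (φ z) (ι z) * v2 z‖ ≤
          29 * A ^ 10 * κ ^ 2 * δ ^ 8 ∧
        ‖Z z + h.H1 (φ z) (ι z) + w2 z + h.H11 (φ z) (ι z) * v1 z + h.H12 (φ z) (ι z) * v2 z‖ ≤
          29 * A ^ 10 * κ ^ 2 * δ ^ 8) ∧
      ∀ x : ℝ, IsSelfAdjoint (v1 x) ∧ IsSelfAdjoint (v2 x) ∧ IsSelfAdjoint (w1 x) ∧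
        IsSelfAdjoint (w2 x) := by
  have hO := isOpen_strip (4 * δ)
  have h32 : strip (2 * δ) ⊆ strip (3 * δ) := strip_mono (by linarith)
  have h43 : strip (3 * δ) ⊆ strip (4 * δ) := strip_mono (by linarith)
  have h42 : strip (2 * δ) ⊆ strip (4 * δ) := h32.trans h43
  have hre : ∀ x : ℝ, (x : ℂ) ∈ strip (4 * δ) := ofReal_mem_strip (by linarith)
  have hre2 : ∀ x : ℝ, (x : ℂ) ∈ strip (2 * δ) := ofReal_mem_strip (by linarith)
  have hA0 : 0 < A := by linarith
  -- the basic functions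
  let u : ℂ → TimeCurve := fun z => Ring.inverse (deriv φ z)
  let E1 : ℂ → TimeCurve := fun z => Y z - h.H2 (φ z) (ι z)
  let E2 : ℂ → TimeCurve := fun z => Z z + h.H1 (φ z) (ι z)
  let k : ℂ → TimeCurve := fun z => h.H22 (φ z) (ι z) * u z ^ 2
  have du : DifferentiableOn ℂ u (strip (4 * δ)) := hs.differentiableOn_inverse hA hδ
  have hu : ∀ z ∈ strip (4 * δ), u z * deriv φ z = 1 := fun z hz => (hs.inverse_mul hA hδ hz).1
  have nu : ∀ z ∈ strip (4 * δ), ‖u z‖ ≤ A := fun z hz => (hs.inverse_mul hA hδ hz).2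
  have dH2 : ∀ z ∈ strip (4 * δ), HasDerivAt (fun w => h.H2 (φ w) (ι w)) _ z :=
    fun z hz => hs.hasDerivAt_comp hδ h.taylor_H2 hz
  have dH1 : ∀ z ∈ strip (4 * δ), HasDerivAt (fun w => h.H1 (φ w) (ι w)) _ z :=
    fun z hz => hs.hasDerivAt_comp hδ h.taylor_H1 hz
  have dH22 : ∀ z ∈ strip (4 * δ), HasDerivAt (fun w => h.H22 (φ w) (ι w)) _ z :=
    fun z hz => hs.hasDerivAt_comp hδ h.taylor_H22 hz
  have dE1 : DifferentiableOn ℂ E1 (strip (4 * δ)) :=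
    hs.dY.sub fun z hz => (dH2 z hz).differentiableAt.differentiableWithinAt
  have dE2 : DifferentiableOn ℂ E2 (strip (4 * δ)) :=
    hs.dZ.add fun z hz => (dH1 z hz).differentiableAt.differentiableWithinAt
  have dk : DifferentiableOn ℂ k (strip (4 * δ)) :=
    DifferentiableOn.mul (fun z hz => (dH22 z hz).differentiableAt.differentiableWithinAt)
      (du.pow 2)
  have dφ' := hs.dφ.deriv hO
  have dι' := hs.dι.deriv hO
  have perφ' : ∀ z ∈ strip (4 * δ), deriv φ (z + 1) = deriv φ z :=
    fun z hz => deriv_add_one hs.perφ hz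
  have perι' : ∀ z ∈ strip (4 * δ), deriv ι (z + 1) = deriv ι z :=
    fun z hz => deriv_add_one (c := 0) (by simpa using hs.perι) hz
  have peru : ∀ z ∈ strip (4 * δ), u (z + 1) = u z := fun z hz => by simp only [u, perφ' z hz]
  have perE1 : ∀ z ∈ strip (4 * δ), E1 (z + 1) = E1 z := fun z hz => by
    simp only [E1, hs.perY z hz, hs.perφ z hz, hs.perι z hz, h.per_H2]
  have perE2 : ∀ z ∈ strip (4 * δ), E2 (z + 1) = E2 z := fun z hz => by
    simp only [E2, hs.perZ z hz, hs.perφ z hz, hs.perι z hz, h.per_H1]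
  have perk : ∀ z ∈ strip (4 * δ), k (z + 1) = k z := fun z hz => by
    simp only [k, hs.perφ z hz, hs.perι z hz, h.per_H22, peru z hz]
  have realφ' : ∀ x : ℝ, IsSelfAdjoint (deriv φ x) := fun x =>
    isSelfAdjoint_deriv hs.realφ (hs.dφ.differentiableAt (strip_mem_nhds (hre x)))
  have realι' : ∀ x : ℝ, IsSelfAdjoint (deriv ι x) := fun x =>
    isSelfAdjoint_deriv hs.realι (hs.dι.differentiableAt (strip_mem_nhds (hre x)))
  have realu : ∀ x : ℝ, IsSelfAdjoint (u x) := fun x =>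
    isSelfAdjoint_inverse (realφ' x) (hu x (hre x))
  have realE1 : ∀ x : ℝ, IsSelfAdjoint (E1 x) := fun x =>
    (hs.realY x).sub (h.real_H2 _ _ (hs.realφ x) (hs.realι x))
  have realE2 : ∀ x : ℝ, IsSelfAdjoint (E2 x) := fun x =>
    (hs.realZ x).add (h.real_H1 _ _ (hs.realφ x) (hs.realι x))
  have realk : ∀ x : ℝ, IsSelfAdjoint (k x) := fun x =>
    (h.real_H22 _ _ (hs.realφ x) (hs.realι x)).mul ((realu x).pow 2)
  have nφ' : ∀ z ∈ strip (4 * δ), ‖deriv φ z‖ ≤ A := fun z hz =>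
    (hs.derivφ z hz).trans (by linarith)
  have nι' : ∀ z ∈ strip (4 * δ), ‖deriv ι z‖ ≤ A := fun z hz =>
    (hs.derivι z hz).trans (by linarith)
  have nk : ∀ z ∈ strip (4 * δ), ‖k z‖ ≤ A ^ 3 := fun z hz => by
    have h1 := norm_mul_le_of (h.norm_H22 _ _ (hs.dom hδ hz))
      (norm_mul_le_of (nu z hz) (nu z hz))
    simp only [k, pow_two]
    exact h1.trans (le_of_eq (by ring))
  -- the second coordinate of the correction
  let e2 : ℂ → TimeCurve := fun z => deriv ι z * E1 z - deriv φ z * E2 z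
  have de2 : DifferentiableOn ℂ e2 (strip (4 * δ)) := (dι'.mul dE1).sub (dφ'.mul dE2)
  have ne2 : ∀ z ∈ strip (4 * δ), ‖e2 z‖ ≤ 2 * A * (κ * δ ^ 8) := fun z hz => by
    refine (norm_sub_le _ _).trans ?_
    have a1 := norm_mul_le_of (nι' z hz) (hs.err1 z hz)
    have a2 := norm_mul_le_of (nφ' z hz) (hs.err2 z hz)
    simp only [E1, E2]
    linarith
  have reale2 : ∀ x : ℝ, IsSelfAdjoint (e2 x) := fun x =>
    ((realι' x).mul (realE1 x)).sub ((realφ' x).mul (realE2 x))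
  obtain ⟨ξ, dξ, perξ, primξ, matchξ, nξ, realξ⟩ := hω.exists_matched_primitive hγ hA hγA hδ hδ1
    (by linarith : δ < 4 * δ) de2
    (fun z hz => by simp only [e2, perι' z hz, perφ' z hz, perE1 z hz, perE2 z hz]) ne2
    (hs.integral_pairing_eq_zero hδ) reale2
  have h3e : 4 * δ - δ = 3 * δ := by ring
  rw [h3e] at dξ perξ matchξ nξ
  have nξ' : ∀ z ∈ strip (3 * δ), ‖ξ z‖ ≤ 4 * A ^ 2 * (κ * δ ^ 6) := fun z hz =>
    (nξ z hz).trans (le_of_eq (by field_simp; ring))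
  -- adjusting the average
  have hδ86 : κ * δ ^ 8 ≤ κ * δ ^ 6 :=
    mul_le_mul_of_nonneg_left (pow_le_pow_of_le_one hδ.le (by linarith) (by norm_num)) hκ
  have hx0 : 0 ≤ κ * δ ^ 6 := by positivity
  set N : ℂ := ∫ x in (0 : ℝ)..1, mean (k x) with hN
  have hNA : 1 / A ≤ ‖N‖ := le_trans (by linarith) hs.twist
  have hN0 : N ≠ 0 := fun h0 => by
    have : 0 < 1 / A := by positivity
    rw [h0, norm_zero] at hNA
    linarith
  set D : ℂ := ∫ x in (0 : ℝ)..1, mean (k x * ξ x - E1 x * u x) with hD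
  set c : ℂ := -(D / N) with hc
  have dq : ∀ {f : ℂ → TimeCurve}, DifferentiableOn ℂ f (strip (3 * δ)) →
      IntervalIntegrable (fun x : ℝ => mean (f x)) MeasureTheory.volume 0 1 := fun hf =>
    (mean.continuous.comp (hf.continuousOn.comp_continuous continuous_ofReal
      (ofReal_mem_strip (by linarith)))).intervalIntegrable _ _
  have hcr : star c = c := by
    have r1 : star N = N := by
      rw [hN, ← starRingEnd_apply, ← intervalIntegral.intervalIntegral_conj]
      refine intervalIntegral.integral_congr fun x _ => ?_
      exact (star_mean _).trans (congrArg mean (realk x))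
    have r2 : star D = D := by
      rw [hD, ← starRingEnd_apply, ← intervalIntegral.intervalIntegral_conj]
      refine intervalIntegral.integral_congr fun x _ => ?_
      exact (star_mean _).trans (congrArg mean
        (((realk x).mul (realξ x)).sub ((realE1 x).mul (realu x))))
    rw [hc, star_neg, star_div₀, r1, r2]
  have nc : ‖c‖ ≤ 5 * A ^ 6 * (κ * δ ^ 6) := by
    have n1 : ‖D‖ ≤ 5 * A ^ 5 * (κ * δ ^ 6) := by
      have := intervalIntegral.norm_integral_le_of_norm_le_const (a := (0 : ℝ)) (b := 1)
        (f := fun x : ℝ => mean (k x * ξ x - E1 x * u x)) (C := 5 * A ^ 5 * (κ * δ ^ 6)) ?_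
      · rwa [sub_zero, abs_one, mul_one] at this
      intro x _
      refine (norm_mean_le _).trans ((norm_sub_le _ _).trans ?_)
      have a1 := norm_mul_le_of (nk x (hre x)) (nξ' x (ofReal_mem_strip (by linarith) x))
      have a2 := norm_mul_le_of ((hs.err1 x (hre x)).trans hδ86) (nu x (hre x))
      have a3 : A ^ 1 ≤ A ^ 5 := pow_le_pow_right₀ hA (by norm_num)
      have a4 := mul_le_mul_of_nonneg_right a3 hx0
      simp only [E1]
      nlinarith
    rw [hc, norm_neg, norm_div, div_le_iff₀ (norm_pos_iff.2 hN0)]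
    refine n1.trans ?_
    have : 5 * A ^ 6 * (κ * δ ^ 6) * (1 / A) ≤ 5 * A ^ 6 * (κ * δ ^ 6) * ‖N‖ :=
      mul_le_mul_of_nonneg_left hNA (by positivity)
    refine le_trans (le_of_eq ?_) this
    field_simp
  let ξ2 : ℂ → TimeCurve := fun z => ξ z + const c
  have dξ2 : DifferentiableOn ℂ ξ2 (strip (3 * δ)) := dξ.add_const _
  have nξ2 : ∀ z ∈ strip (3 * δ), ‖ξ2 z‖ ≤ 9 * A ^ 6 * (κ * δ ^ 6) := fun z hz => by
    refine (norm_add_le _ _).trans ?_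
    have a1 := nξ' z hz
    have a2 := (norm_const_le c).trans nc
    have a3 : A ^ 2 ≤ A ^ 6 := pow_le_pow_right₀ hA (by norm_num)
    have a4 := mul_le_mul_of_nonneg_right a3 hx0
    linarith
  have primξ2 : ∀ z, IsPrim (ξ2 z) (e2 z) := fun z => by
    simpa using (primξ z).add (isPrim_const c)
  have realξ2 : ∀ x : ℝ, IsSelfAdjoint (ξ2 x) := fun x =>
    (realξ x).add ((star_const c).trans (congrArg const hcr))
  -- the first coordinate of the correction
  let e1 : ℂ → TimeCurve := fun z => k z * ξ2 z - E1 z * u z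
  have de1 : DifferentiableOn ℂ e1 (strip (3 * δ)) :=
    ((dk.mono h43).mul dξ2).sub ((dE1.mono h43).mul (du.mono h43))
  have ne1 : ∀ z ∈ strip (3 * δ), ‖e1 z‖ ≤ 10 * A ^ 9 * (κ * δ ^ 6) := fun z hz => by
    refine (norm_sub_le _ _).trans ?_
    have a1 := norm_mul_le_of (nk z (h43 hz)) (nξ2 z hz)
    have a2 := norm_mul_le_of ((hs.err1 z (h43 hz)).trans hδ86) (nu z (h43 hz))
    have a3 : A ^ 1 ≤ A ^ 9 := pow_le_pow_right₀ hA (by norm_num)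
    have a4 := mul_le_mul_of_nonneg_right a3 hx0
    simp only [E1]
    nlinarith
  have reale1 : ∀ x : ℝ, IsSelfAdjoint (e1 x) := fun x =>
    ((realk x).mul (realξ2 x)).sub ((realE1 x).mul (realu x))
  have pere1 : ∀ z ∈ strip (3 * δ), e1 (z + 1) = e1 z := fun z hz => by
    simp only [e1, ξ2, perk z (h43 hz), perE1 z (h43 hz), peru z (h43 hz), perξ z hz]
  have pere2 : ∀ z ∈ strip (4 * δ), e2 (z + 1) = e2 z := fun z hz => by
    simp only [e2, perι' z hz, perφ' z hz, perE1 z hz, perE2 z hz]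
  have he1 : ∫ x in (0 : ℝ)..1, mean (e1 x) = 0 := by
    have a1 : ∀ x : ℝ, mean (e1 x) = mean (k x * ξ x - E1 x * u x) + c * mean (k x) := by
      intro x
      have : e1 x = (k x * ξ x - E1 x * u x) + c • k x := by
        have : const c * k x = c • k x := by ext s; simp
        rw [← this]
        simp only [e1, ξ2]
        ring
      rw [this, map_add, map_smul, smul_eq_mul]
    have a2 : IntervalIntegrable (fun x : ℝ => mean (k x * ξ x - E1 x * u x))
        MeasureTheory.volume 0 1 :=
      dq (((dk.mono h43).mul dξ).sub ((dE1.mono h43).mul (du.mono h43)))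
    simp only [a1]
    rw [intervalIntegral.integral_add a2 ((dq (dk.mono h43)).const_mul c),
      intervalIntegral.integral_const_mul, ← hD, ← hN, hc]
    field_simp
    ring
  obtain ⟨ξ1, dξ1, perξ1, primξ1, matchξ1, nξ1, realξ1⟩ := hω.exists_matched_primitive hγ hA hγA hδ
    hδ1 (by linarith : δ < 3 * δ) de1 pere1 ne1 he1 reale1
  have h2e : 3 * δ - δ = 2 * δ := by ring
  rw [h2e] at dξ1 perξ1 matchξ1 nξ1
  have nξ1' : ∀ z ∈ strip (2 * δ), ‖ξ1 z‖ ≤ 20 * A ^ 10 * (κ * δ ^ 4) := fun z hz =>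
    (nξ1 z hz).trans (le_of_eq (by field_simp; ring))
  have dE1' := dE1.deriv hO
  have dE2' := dE2.deriv hO
  have dY' := hs.dY.deriv hO
  have dZ' := hs.dZ.deriv hO
  have perY' : ∀ z ∈ strip (4 * δ), deriv Y (z + 1) = deriv Y z :=
    fun z hz => deriv_add_one (c := 0) (by simpa using hs.perY) hz
  have perZ' : ∀ z ∈ strip (4 * δ), deriv Z (z + 1) = deriv Z z :=
    fun z hz => deriv_add_one (c := 0) (by simpa using hs.perZ) hz
  have realY' : ∀ x : ℝ, IsSelfAdjoint (deriv Y x) := fun x =>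
    isSelfAdjoint_deriv hs.realY (hs.dY.differentiableAt (strip_mem_nhds (hre x)))
  have realZ' : ∀ x : ℝ, IsSelfAdjoint (deriv Z x) := fun x =>
    isSelfAdjoint_deriv hs.realZ (hs.dZ.differentiableAt (strip_mem_nhds (hre x)))
  have primφ' : ∀ z ∈ strip (4 * δ), IsPrim (deriv φ z) (deriv Y z) := fun z hz =>
    IsPrim.deriv (by filter_upwards [strip_mem_nhds hz] with w hw using hs.primφ w hw)
      (hs.dφ.differentiableAt (strip_mem_nhds hz)) (hs.dY.differentiableAt (strip_mem_nhds hz))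
  have primι' : ∀ z ∈ strip (4 * δ), IsPrim (deriv ι z) (deriv Z z) := fun z hz =>
    IsPrim.deriv (by filter_upwards [strip_mem_nhds hz] with w hw using hs.primι w hw)
      (hs.dι.differentiableAt (strip_mem_nhds hz)) (hs.dZ.differentiableAt (strip_mem_nhds hz))
  have primu : ∀ z ∈ strip (4 * δ), IsPrim (u z) (-(u z ^ 2 * deriv Y z)) := fun z hz =>
    (primφ' z hz).inverse (hu z hz)
  have matchu : ∀ z ∈ strip (4 * δ), u z 1 = u (z + ω) 0 := fun z hz => by
    have a1 : u z 1 * deriv φ z 1 = 1 := congrArg (fun f : TimeCurve => f 1) (hu z hz)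
    have a2 : u (z + ω) 0 * deriv φ (z + ω) 0 = 1 :=
      congrArg (fun f : TimeCurve => f 0) (hu _ (add_real_mem_strip hz ω))
    rw [← deriv_matched hs.dφ hs.matchφ hz] at a2
    exact (eq_inv_of_mul_eq_one_left a1).trans (eq_inv_of_mul_eq_one_left a2).symm
  have matchι' : ∀ z ∈ strip (4 * δ), deriv ι z 1 = deriv ι (z + ω) 0 := fun z hz =>
    deriv_matched (c := 0) hs.dι (by simpa using hs.matchι) hz
  have nE1' : ∀ z ∈ strip (3 * δ), ‖deriv E1 z‖ ≤ κ * δ ^ 7 := fun z hz =>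
    (norm_deriv_le_of_strip dE1 hs.err1 hδ (h3e ▸ hz)).trans (le_of_eq (by field_simp))
  have nE2' : ∀ z ∈ strip (3 * δ), ‖deriv E2 z‖ ≤ κ * δ ^ 7 := fun z hz =>
    (norm_deriv_le_of_strip dE2 hs.err2 hδ (h3e ▸ hz)).trans (le_of_eq (by field_simp))
  have hE1' : ∀ z ∈ strip (4 * δ), deriv E1 z =
      deriv Y z - (h.H12 (φ z) (ι z) * deriv φ z + h.H22 (φ z) (ι z) * deriv ι z) := fun z hz =>
    ((hs.dY.differentiableAt (strip_mem_nhds hz)).hasDerivAt.sub (dH2 z hz)).deriv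
  have hE2' : ∀ z ∈ strip (4 * δ), deriv E2 z =
      deriv Z z + (h.H11 (φ z) (ι z) * deriv φ z + h.H12 (φ z) (ι z) * deriv ι z) := fun z hz =>
    ((hs.dZ.differentiableAt (strip_mem_nhds hz)).hasDerivAt.add (dH1 z hz)).deriv
  have dξ2' := dξ2.mono h32
  have de1' := de1.mono h32
  have hy0 : 0 ≤ κ * δ ^ 4 := by positivity
  have hδ64 : κ * δ ^ 6 ≤ κ * δ ^ 4 :=
    mul_le_mul_of_nonneg_left (pow_le_pow_of_le_one hδ.le (by linarith) (by norm_num)) hκ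
  refine ⟨fun z => deriv φ z * ξ1 z, fun z => deriv ι z * ξ1 z + u z * ξ2 z,
    fun z => deriv Y z * ξ1 z + deriv φ z * e1 z,
    fun z => (deriv Z z * ξ1 z + deriv ι z * e1 z) + (-(u z ^ 2 * deriv Y z) * ξ2 z + u z * e2 z),
    ⟨?_, ?_, ?_, ?_⟩, ?_, ?_, ?_, ?_, ?_, ?_⟩
  · exact (dφ'.mono h42).mul dξ1
  · exact ((dι'.mono h42).mul dξ1).add ((du.mono h42).mul dξ2')
  · exact ((dY'.mono h42).mul dξ1).add ((dφ'.mono h42).mul de1')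
  · exact (((dZ'.mono h42).mul dξ1).add ((dι'.mono h42).mul de1')).add
      (((((du.pow 2).mul dY').neg.mono h42).mul dξ2').add ((du.mul de2).mono h42))
  · intro z hz
    simp only [ξ2, perφ' z (h42 hz), perι' z (h42 hz), perY' z (h42 hz), perZ' z (h42 hz),
      peru z (h42 hz), perξ1 z hz, perξ z (h32 hz), pere1 z (h32 hz), pere2 z (h42 hz),
      and_self]
  · intro z hz
    exact ⟨(primφ' z (h42 hz)).mul (primξ1 z),
      ((primι' z (h42 hz)).mul (primξ1 z)).add ((primu z (h42 hz)).mul (primξ2 z))⟩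
  · intro z hz
    simp only [ξ2, ContinuousMap.mul_apply, ContinuousMap.add_apply, const_apply,
      deriv_matched hs.dφ hs.matchφ (h42 hz), matchι' z (h42 hz), matchu z (h42 hz),
      matchξ1 z hz, matchξ z (h32 hz), and_self]
  · intro z hz
    have a1 := norm_mul_le_of (nφ' z (h42 hz)) (nξ1' z hz)
    have a2 := norm_mul_le_of (nι' z (h42 hz)) (nξ1' z hz)
    have a3 := norm_mul_le_of (nu z (h42 hz)) (nξ2 z (h32 hz))
    have a4 : A ^ 7 ≤ A ^ 11 := pow_le_pow_right₀ hA (by norm_num)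
    have a5 := mul_le_mul a4 hδ64 hx0 (by positivity)
    have a6 : 0 ≤ A ^ 11 * (κ * δ ^ 4) := by positivity
    constructor
    · linarith
    · refine (norm_add_le _ _).trans ?_
      linarith
  · intro z hz
    have b1 := nξ1' z hz
    have b2 := nξ2 z (h32 hz)
    have hk : u z * deriv φ z = 1 := hu z (h42 hz)
    have r1 : Y z - h.H2 (φ z) (ι z) + (deriv Y z * ξ1 z + deriv φ z * e1 z) -
        h.H12 (φ z) (ι z) * (deriv φ z * ξ1 z) -
        h.H22 (φ z) (ι z) * (deriv ι z * ξ1 z + u z * ξ2 z) = deriv E1 z * ξ1 z := by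
      rw [hE1' z (h42 hz)]
      simp only [e1, k, E1]
      linear_combination (h.H22 (φ z) (ι z) * u z * ξ2 z - (Y z - h.H2 (φ z) (ι z))) * hk
    have r2 : Z z + h.H1 (φ z) (ι z) + ((deriv Z z * ξ1 z + deriv ι z * e1 z) +
        (-(u z ^ 2 * deriv Y z) * ξ2 z + u z * e2 z)) +
        h.H11 (φ z) (ι z) * (deriv φ z * ξ1 z) +
        h.H12 (φ z) (ι z) * (deriv ι z * ξ1 z + u z * ξ2 z) =
        deriv E2 z * ξ1 z - u z * u z * deriv E1 z * ξ2 z := by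
      rw [hE2' z (h42 hz), hE1' z (h42 hz)]
      simp only [e1, e2, k, E1, E2]
      linear_combination (-(Z z + h.H1 (φ z) (ι z)) - h.H12 (φ z) (ι z) * u z * ξ2 z) * hk
    have hw0 : 0 ≤ κ * δ ^ 7 := by positivity
    have a1 := norm_mul_le_of (nE1' z (h32 hz)) b1
    have a2 := norm_mul_le_of (nE2' z (h32 hz)) b1
    have a3 := norm_mul_le_of (norm_mul_le_of (norm_mul_le_of (nu z (h42 hz)) (nu z (h42 hz)))
      (nE1' z (h32 hz))) b2
    have a4 : A ^ 8 ≤ A ^ 10 := pow_le_pow_right₀ hA (by norm_num)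
    have a5 : κ ^ 2 * δ ^ 11 ≤ κ ^ 2 * δ ^ 8 :=
      mul_le_mul_of_nonneg_left (pow_le_pow_of_le_one hδ.le (by linarith) (by norm_num))
        (by positivity)
    have a6 : κ ^ 2 * δ ^ 13 ≤ κ ^ 2 * δ ^ 8 :=
      mul_le_mul_of_nonneg_left (pow_le_pow_of_le_one hδ.le (by linarith) (by norm_num))
        (by positivity)
    have c1 : κ * δ ^ 7 * (20 * A ^ 10 * (κ * δ ^ 4)) ≤ 20 * A ^ 10 * (κ ^ 2 * δ ^ 8) := by
      have := mul_le_mul_of_nonneg_left a5 (by positivity : 0 ≤ 20 * A ^ 10)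
      refine le_trans (le_of_eq ?_) this
      ring
    have c2 : A * A * (κ * δ ^ 7) * (9 * A ^ 6 * (κ * δ ^ 6)) ≤ 9 * A ^ 10 * (κ ^ 2 * δ ^ 8) := by
      have := mul_le_mul a4 a6 (by positivity) (by positivity)
      refine le_trans (le_of_eq ?_) (mul_le_mul_of_nonneg_left this (by norm_num : (0 : ℝ) ≤ 9)
        |>.trans (le_of_eq ?_)) <;> ring
    have c3 : 0 ≤ A ^ 10 * (κ ^ 2 * δ ^ 8) := by positivity
    constructor
    · refine (le_of_eq (congrArg norm r1)).trans (a1.trans (c1.trans ?_))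
      linarith
    · refine (le_of_eq (congrArg norm r2)).trans ((norm_sub_le _ _).trans ?_)
      linarith
  · intro x
    have s1 : IsSelfAdjoint (deriv φ x * ξ1 x) := (realφ' x).mul (realξ1 x)
    have s2 : IsSelfAdjoint (deriv ι x * ξ1 x + u x * ξ2 x) :=
      ((realι' x).mul (realξ1 x)).add ((realu x).mul (realξ2 x))
    have s3 : IsSelfAdjoint (deriv Y x * ξ1 x + deriv φ x * e1 x) :=
      ((realY' x).mul (realξ1 x)).add ((realφ' x).mul (reale1 x))
    have s4 : IsSelfAdjoint ((deriv Z x * ξ1 x + deriv ι x * e1 x) +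
        (-(u x ^ 2 * deriv Y x) * ξ2 x + u x * e2 x)) :=
      (((realZ' x).mul (realξ1 x)).add ((realι' x).mul (reale1 x))).add
      (((((realu x).pow 2).mul (realY' x)).neg.mul (realξ2 x)).add ((realu x).mul (reale2 x)))
    exact ⟨s1, s2, s3, s4⟩

end ApproxTorus

end Sitnikov

namespace Sitnikov

open Set Complex

open TimeCurve

namespace ApproxTorus

variable {R A : ℝ} {h : Ham R A} {α ω κ δ : ℝ} {φ ι Y Z : ℂ → TimeCurve}

lemma continuous_twist (hs : ApproxTorus h α ω κ δ φ ι Y Z) (hA : 1 ≤ A) (hδ : 0 < δ) :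
    Continuous fun x : ℝ => mean (h.H22 (φ x) (ι x) * Ring.inverse (deriv φ x) ^ 2) := by
  have h1 : ContinuousOn (fun z => mean (h.H22 (φ z) (ι z) * Ring.inverse (deriv φ z) ^ 2))
      (strip (4 * δ)) :=
    mean.continuous.comp_continuousOn (ContinuousOn.mul
      (fun z hz => (hs.hasDerivAt_comp hδ h.taylor_H22 hz).continuousAt.continuousWithinAt)
      ((hs.differentiableOn_inverse hA hδ).continuousOn.pow 2))
  exact h1.comp_continuous continuous_ofReal fun x => ofReal_mem_strip (by linarith) x

set_option maxHeartbeats 1000000 in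
/-- One step of the Newton iteration. -/
theorem newton_step {γ : ℝ} (hs : ApproxTorus h α ω κ δ φ ι Y Z) (hA : 1 ≤ A)
    (hω : Diophantine γ ω) (hγ : 0 < γ) (hγA : 2 / γ ≤ A) (hδ : 0 < δ) (hδ1 : δ ≤ 1 / 4)
    (hκ : 0 ≤ κ) (hκA : 10 ^ 9 * (A ^ 23 * κ) ≤ 1) :
    ∃ φ' ι' Y' Z' : ℂ → TimeCurve, ApproxTorus h α ω κ (δ / 4) φ' ι' Y' Z' ∧
      ∀ z ∈ strip δ, ‖φ' z - φ z‖ ≤ δ / 4 ∧ ‖ι' z - ι z‖ ≤ δ / 4 := by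
  obtain ⟨v1, v2, w1, w2, ⟨dv1, dv2, dw1, dw2⟩, per, prim, mat, nv, err, real⟩ :=
    hs.exists_correction hA hω hγ hγA hδ hδ1 hκ
  have h21 : strip δ ⊆ strip (2 * δ) := strip_mono (by linarith)
  have h41 : strip δ ⊆ strip (4 * δ) := strip_mono (by linarith)
  have hA0 : 0 < A := by linarith
  have h4 : 4 * (δ / 4) = δ := by ring
  have h2e : 2 * δ - δ = δ := by ring
  set V : ℝ := 29 * A ^ 11 * κ * δ ^ 3 with hV
  have hV0 : 0 ≤ V := by positivity
  have hpow : ∀ n ≤ 23, A ^ n * κ ≤ 1 / 10 ^ 9 := fun n hn => by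
    have := mul_le_mul_of_nonneg_right (pow_le_pow_right₀ hA hn) hκ
    linarith
  have hδ3 : δ ^ 3 ≤ δ / 16 := by nlinarith [sq_nonneg δ, mul_self_le_mul_self hδ.le hδ1]
  have hVA : 6 * A ^ 4 * V ≤ δ / 10 ^ 6 := by
    have h1 : 6 * A ^ 4 * V = 174 * (A ^ 15 * κ) * δ ^ 3 := by rw [hV]; ring
    have h2 := mul_le_mul (hpow 15 (by norm_num)) hδ3 (by positivity) (by positivity)
    rw [h1]
    linarith
  have hVδ : V ≤ δ / 10 ^ 6 := by
    have : 1 ≤ A ^ 4 := one_le_pow₀ hA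
    nlinarith
  have nv1 : ∀ z ∈ strip (2 * δ), ‖v1 z‖ ≤ V * δ := fun z hz =>
    (nv z hz).1.trans (le_of_eq (by rw [hV]; ring))
  have nv2 : ∀ z ∈ strip (2 * δ), ‖v2 z‖ ≤ V * δ := fun z hz =>
    (nv z hz).2.trans (le_of_eq (by rw [hV]; ring))
  have hVδ' : V * δ ≤ V := by nlinarith
  have nv1' : ∀ z ∈ strip δ, ‖deriv v1 z‖ ≤ V := fun z hz =>
    (norm_deriv_le_of_strip dv1 nv1 hδ (h2e.symm ▸ hz)).trans (le_of_eq (by field_simp))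
  have nv2' : ∀ z ∈ strip δ, ‖deriv v2 z‖ ≤ V := fun z hz =>
    (norm_deriv_le_of_strip dv2 nv2 hδ (h2e.symm ▸ hz)).trans (le_of_eq (by field_simp))
  have derφ : ∀ z ∈ strip δ, deriv (fun w => φ w + v1 w) z = deriv φ z + deriv v1 z := fun z hz =>
    deriv_fun_add (hs.dφ.differentiableAt (strip_mem_nhds (h41 hz)))
      (dv1.differentiableAt (strip_mem_nhds (h21 hz)))
  have derι : ∀ z ∈ strip δ, deriv (fun w => ι w + v2 w) z = deriv ι z + deriv v2 z := fun z hz =>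
    deriv_fun_add (hs.dι.differentiableAt (strip_mem_nhds (h41 hz)))
      (dv2.differentiableAt (strip_mem_nhds (h21 hz)))
  have him : ∀ z ∈ strip δ, ∀ s, |((φ z + v1 z) s).im| ≤ 1 - δ / 4 := fun z hz s => by
    have a1 := hs.imφ z (h41 hz) s
    have a2 : |(v1 z s).im| ≤ V * δ :=
      (abs_im_le_norm _).trans (((v1 z).norm_coe_le_norm s).trans (nv1 z (h21 hz)))
    have a3 := abs_add_le (φ z s).im (v1 z s).im
    rw [ContinuousMap.add_apply, add_im]
    linarith
  have hn : ∀ z ∈ strip δ, ‖ι z + v2 z‖ ≤ R - δ / 4 := fun z hz => by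
    have a1 := hs.normι z (h41 hz)
    have a2 := nv2 z (h21 hz)
    have a3 := norm_add_le (ι z) (v2 z)
    linarith
  have hdom : ∀ z ∈ strip δ, Dom R (φ z + v1 z) (ι z + v2 z) := fun z hz =>
    ⟨fun s => (him z hz s).trans (by linarith), (hn z hz).trans (by linarith)⟩
  have hre : ∀ z ∈ strip δ, ∀ s, 1 / A + δ / 4 ≤ (deriv (fun w => φ w + v1 w) z s).re := by
    intro z hz s
    rw [derφ z hz, ContinuousMap.add_apply, add_re]
    have a1 := hs.re_deriv z (h41 hz) s
    have a2 : |(deriv v1 z s).re| ≤ V :=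
      (abs_re_le_norm _).trans (((deriv v1 z).norm_coe_le_norm s).trans (nv1' z hz))
    have := neg_abs_le (deriv v1 z s).re
    linarith
  have htaylor : ∀ {G G1 G2 : TimeCurve → TimeCurve → TimeCurve}, TaylorBound R A G G1 G2 →
      ∀ z ∈ strip δ, ‖G (φ z + v1 z) (ι z + v2 z) - G (φ z) (ι z) - G1 (φ z) (ι z) * v1 z -
        G2 (φ z) (ι z) * v2 z‖ ≤ A * (2 * (V * δ)) ^ 2 := by
    intro G G1 G2 hG z hz
    have a1 := hG _ _ _ _ (hs.dom hδ (h41 hz)) (hdom z hz)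
    simp only [add_sub_cancel_left] at a1
    refine a1.trans ?_
    have a2 : ‖v1 z‖ + ‖v2 z‖ ≤ 2 * (V * δ) := by
      linarith [nv1 z (h21 hz), nv2 z (h21 hz)]
    gcongr
  have herr : 29 * A ^ 10 * κ ^ 2 * δ ^ 8 + A * (2 * (V * δ)) ^ 2 ≤ κ * (δ / 4) ^ 8 := by
    have a1 : 29 * A ^ 10 * κ ^ 2 * δ ^ 8 + A * (2 * (V * δ)) ^ 2 =
        (29 * (A ^ 10 * κ) + 3364 * (A ^ 23 * κ)) * (κ * δ ^ 8) := by rw [hV]; ring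
    have a2 : κ * (δ / 4) ^ 8 = 1 / 65536 * (κ * δ ^ 8) := by ring
    rw [a1, a2]
    refine mul_le_mul_of_nonneg_right ?_ (by positivity)
    linarith [hpow 10 (by norm_num), hpow 23 (by norm_num)]
  have htwist : 1 / A + δ / 4 ≤ ‖∫ x in (0 : ℝ)..1, mean (h.H22 (φ x + v1 x) (ι x + v2 x) *
      Ring.inverse (deriv (fun w => φ w + v1 w) x) ^ 2)‖ := by
    set N := ∫ x in (0 : ℝ)..1, mean (h.H22 (φ x) (ι x) * Ring.inverse (deriv φ x) ^ 2) with hN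
    set f := fun x : ℝ => mean (h.H22 (φ x + v1 x) (ι x + v2 x) *
      Ring.inverse (deriv (fun w => φ w + v1 w) x) ^ 2) with hf
    set g := fun x : ℝ => mean (h.H22 (φ x) (ι x) * Ring.inverse (deriv φ x) ^ 2) with hg
    have hfg : ∀ x : ℝ, ‖f x - g x‖ ≤ 6 * A ^ 4 * V := by
      intro x
      have hx : (x : ℂ) ∈ strip δ := ofReal_mem_strip hδ x
      obtain ⟨hu, nu⟩ := hs.inverse_mul hA hδ (h41 hx)
      obtain ⟨U, hU, nU⟩ := exists_inverse (by positivity) (hre x hx)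
      rw [hf, hg]
      simp only
      rw [inverse_eq_of_mul_eq_one hU, ← map_sub]
      set u := Ring.inverse (deriv φ x)
      have nU' : ‖U‖ ≤ A := by
        refine nU.trans ?_
        rw [div_le_iff₀ (by positivity)]
        have : A * (1 / A) = 1 := by field_simp
        nlinarith
      rw [derφ x hx] at hU
      have b1 : U - u = -(u * U * deriv v1 x) := by
        linear_combination u * hU - U * hu
      have b2 : ‖U - u‖ ≤ A * A * V := by
        rw [b1, norm_neg]
        exact norm_mul_le_of (norm_mul_le_of nu nU') (nv1' x hx)
      have b3 : ‖h.H22 (φ x + v1 x) (ι x + v2 x) - h.H22 (φ x) (ι x)‖ ≤ 4 * A * V := by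
        have c1 := htaylor h.taylor_H22 x hx
        have c2 := norm_mul_le_of (h.norm_P _ _ (hs.dom hδ (h41 hx))) (nv1 x (h21 hx))
        have c3 := norm_mul_le_of (h.norm_Q _ _ (hs.dom hδ (h41 hx))) (nv2 x (h21 hx))
        have c4 : h.H22 (φ x + v1 x) (ι x + v2 x) - h.H22 (φ x) (ι x) =
          (h.H22 (φ x + v1 x) (ι x + v2 x) - h.H22 (φ x) (ι x) - h.P (φ x) (ι x) * v1 x -
            h.Q (φ x) (ι x) * v2 x) + (h.P (φ x) (ι x) * v1 x + h.Q (φ x) (ι x) * v2 x) := by ring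
        rw [c4]
        refine (norm_add_le _ _).trans ?_
        have c5 := norm_add_le (h.P (φ x) (ι x) * v1 x) (h.Q (φ x) (ι x) * v2 x)
        have c6 : A * (V * δ) ≤ A * V := by gcongr
        have c7 : (2 * (V * δ)) ^ 2 ≤ V := by
          have : V * δ ≤ 1 / 4 := by linarith
          have : 0 ≤ V * δ := by positivity
          nlinarith
        have c8 := mul_le_mul_of_nonneg_left c7 hA0.le
        have c9 : 0 ≤ A * V := by positivity
        linarith
      have b4 : h.H22 (φ x + v1 x) (ι x + v2 x) * U ^ 2 - h.H22 (φ x) (ι x) * u ^ 2 =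
          (h.H22 (φ x + v1 x) (ι x + v2 x) - h.H22 (φ x) (ι x)) * (U * U) +
            h.H22 (φ x) (ι x) * ((U - u) * (U + u)) := by ring
      refine (norm_mean_le _).trans ?_
      rw [b4]
      refine (norm_add_le _ _).trans ?_
      have c1 := norm_mul_le_of b3 (norm_mul_le_of nU' nU')
      have c2 : ‖U + u‖ ≤ A + A := (norm_add_le _ _).trans (add_le_add nU' nu)
      have c3 := norm_mul_le_of (h.norm_H22 _ _ (hs.dom hδ (h41 hx))) (norm_mul_le_of b2 c2)
      have c4 : A ^ 3 * V ≤ A ^ 4 * V :=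
        mul_le_mul_of_nonneg_right (pow_le_pow_right₀ hA (by norm_num)) hV0
      refine (add_le_add c1 c3).trans ?_
      linarith
    have hgc : Continuous g := hs.continuous_twist hA hδ
    have hdiff : ContinuousOn (fun z => mean (h.H22 (φ z + v1 z) (ι z + v2 z) *
        Ring.inverse (deriv (fun w => φ w + v1 w) z) ^ 2)) (strip δ) := by
      refine mean.continuous.comp_continuousOn (ContinuousOn.mul (fun z hz => ?_)
        (ContinuousOn.pow (fun z hz => ?_) 2))
      · have hz4 := strip_mem_nhds (h41 hz)
        have hz2 := strip_mem_nhds (h21 hz)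
        refine (h.taylor_H22.hasDerivAt (φ := fun w => φ w + v1 w) (ι := fun w => ι w + v2 w) ?_
          ((hs.dφ.differentiableAt hz4).add (dv1.differentiableAt hz2)).hasDerivAt
          ((hs.dι.differentiableAt hz4).add
            (dv2.differentiableAt hz2)).hasDerivAt).continuousAt.continuousWithinAt
        filter_upwards [strip_mem_nhds hz] with w hw using hdom w hw
      · obtain ⟨U, hU, -⟩ := exists_inverse (by positivity) (hre z hz)
        have hd : DifferentiableOn ℂ (deriv fun w => φ w + v1 w) (strip δ) :=
          ((hs.dφ.mono h41).add (dv1.mono h21)).deriv (isOpen_strip δ)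
        exact (DifferentiableAt.inverse (hd.differentiableAt (strip_mem_nhds hz))
          (IsUnit.of_mul_eq_one_right _ hU)).continuousAt.continuousWithinAt
    have hfc : Continuous f :=
      hdiff.comp_continuous continuous_ofReal fun x => ofReal_mem_strip hδ x
    have hclose : ‖(∫ x in (0 : ℝ)..1, f x) - N‖ ≤ 6 * A ^ 4 * V := by
      rw [hN, ← intervalIntegral.integral_sub (hfc.intervalIntegrable _ _)
        (hgc.intervalIntegrable _ _)]
      have := intervalIntegral.norm_integral_le_of_norm_le_const (a := (0 : ℝ)) (b := 1)
        (f := fun x => f x - g x) (C := 6 * A ^ 4 * V) fun x _ => hfg x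
      rwa [sub_zero, abs_one, mul_one] at this
    have h1 := hs.twist
    have h2 := norm_sub_norm_le N (∫ x in (0 : ℝ)..1, f x)
    rw [norm_sub_rev] at h2
    linarith
  refine ⟨fun z => φ z + v1 z, fun z => ι z + v2 z, fun z => Y z + w1 z, fun z => Z z + w2 z,
    ?_, ?_⟩
  · constructor
    any_goals rw [h4]
    · exact (hs.dφ.mono h41).add (dv1.mono h21)
    · exact (hs.dι.mono h41).add (dv2.mono h21)
    · exact (hs.dY.mono h41).add (dw1.mono h21)
    · exact (hs.dZ.mono h41).add (dw2.mono h21)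
    · intro z hz
      rw [hs.perφ z (h41 hz), (per z (h21 hz)).1]; abel
    · intro z hz
      rw [hs.perι z (h41 hz), (per z (h21 hz)).2.1]
    · intro z hz
      rw [hs.perY z (h41 hz), (per z (h21 hz)).2.2.1]
    · intro z hz
      rw [hs.perZ z (h41 hz), (per z (h21 hz)).2.2.2]
    · exact fun z hz => (hs.primφ z (h41 hz)).add (prim z (h21 hz)).1
    · exact fun z hz => (hs.primι z (h41 hz)).add (prim z (h21 hz)).2
    · intro z hz
      simp only [ContinuousMap.add_apply]
      rw [← hs.matchφ z (h41 hz), ← (mat z (h21 hz)).1]; ring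
    · intro z hz
      simp only [ContinuousMap.add_apply]
      rw [← hs.matchι z (h41 hz), ← (mat z (h21 hz)).2]
    · intro z hz
      have a1 := (err z (h21 hz)).1
      have a2 := htaylor h.taylor_H2 z hz
      refine le_trans (le_trans ?_ (add_le_add a1 a2)) herr
      refine le_trans (le_of_eq ?_) (norm_sub_le _ _)
      congr 1
      ring
    · intro z hz
      have a1 := (err z (h21 hz)).2
      have a2 := htaylor h.taylor_H1 z hz
      refine le_trans (le_trans ?_ (add_le_add a1 a2)) herr
      refine le_trans (le_of_eq ?_) (norm_add_le _ _)
      congr 1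
      ring
    · exact him
    · exact hn
    · intro z hz
      rw [derφ z hz]
      linarith [norm_add_le (deriv φ z) (deriv v1 z), hs.derivφ z (h41 hz), nv1' z hz]
    · intro z hz
      rw [derι z hz]
      linarith [norm_add_le (deriv ι z) (deriv v2 z), hs.derivι z (h41 hz), nv2' z hz]
    · exact hre
    · exact htwist
    · exact fun x => (hs.realφ x).add (real x).1
    · exact fun x => (hs.realι x).add (real x).2.1
    · exact fun x => (hs.realY x).add (real x).2.2.1
    · exact fun x => (hs.realZ x).add (real x).2.2.2
  · intro z hz
    simp only [add_sub_cancel_left]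
    have a1 := nv1 z (h21 hz)
    have a2 := nv2 z (h21 hz)
    constructor <;> linarith

end ApproxTorus

end Sitnikov

namespace Sitnikov

open Set Complex

open TimeCurve

lemma TaylorBound.tendsto {R C : ℝ} {G A B : TimeCurve → TimeCurve → TimeCurve}
    (h : TaylorBound R C G A B) {a b : ℕ → TimeCurve} {a' b' : TimeCurve}
    (hD : ∀ n, Dom R (a n) (b n)) (hD' : Dom R a' b')
    (ha : Filter.Tendsto a Filter.atTop (nhds a')) (hb : Filter.Tendsto b Filter.atTop (nhds b')) :
    Filter.Tendsto (fun n => G (a n) (b n)) Filter.atTop (nhds (G a' b')) := by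
  have ha0 := tendsto_sub_nhds_zero_iff.2 ha
  have hb0 := tendsto_sub_nhds_zero_iff.2 hb
  have h1 : Filter.Tendsto (fun n => G (a n) (b n) - G a' b' - A a' b' * (a n - a') -
      B a' b' * (b n - b')) Filter.atTop (nhds 0) := by
    refine squeeze_zero_norm (fun n => h a' b' (a n) (b n) hD' (hD n)) ?_
    have := ((ha0.norm.add hb0.norm).pow 2).const_mul C
    simpa using this
  have h2 := ((h1.add (ha0.const_mul (A a' b'))).add (hb0.const_mul (B a' b'))).add_const (G a' b')
  simp only [mul_zero, add_zero, zero_add] at h2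
  refine h2.congr fun n => ?_
  ring

lemma TimeCurve.IsPrim.of_tendsto {F Y : ℕ → TimeCurve} {F' Y' : TimeCurve}
    (h : ∀ n, IsPrim (F n) (Y n)) (hF : Filter.Tendsto F Filter.atTop (nhds F'))
    (hY : Filter.Tendsto Y Filter.atTop (nhds Y')) : IsPrim F' Y' := by
  refine IsPrim.of_eq (c := F' 0) (tendsto_nhds_unique hF ?_)
  have h1 : Filter.Tendsto (fun n => const (ev 0 (F n)) + primitive (Y n)) Filter.atTop
      (nhds (const (ev 0 F') + primitive Y')) :=
    ((const.continuous.tendsto _).comp (((ev 0).continuous.tendsto _).comp hF)).add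
      ((primitive.continuous.tendsto _).comp hY)
  exact h1.congr fun n => (h n).eq.symm

/-- A real invariant torus, parametrised by the real line. -/
structure InvTorus {R A : ℝ} (h : Ham R A) (α ω : ℝ) (Φ J : ℝ → TimeCurve) : Prop where
  continuous_fst : Continuous Φ
  continuous_snd : Continuous J
  per_fst : ∀ x, Φ (x + 1) = Φ x + const (2 * Real.pi)
  per_snd : ∀ x, J (x + 1) = J x
  prim_fst : ∀ x, IsPrim (Φ x) (h.H2 (Φ x) (J x))
  prim_snd : ∀ x, IsPrim (J x) (-h.H1 (Φ x) (J x))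
  match_fst : ∀ x, Φ x 1 + α = Φ (x + ω) 0
  match_snd : ∀ x, J x 1 = J (x + ω) 0
  real_fst : ∀ x, IsSelfAdjoint (Φ x)
  real_snd : ∀ x, IsSelfAdjoint (J x)
  mono : ∀ s x y, x ≤ y → 1 / A * (y - x) ≤ (Φ y s).re - (Φ x s).re

namespace ApproxTorus

variable {R A : ℝ} {h : Ham R A} {α ω κ δ : ℝ} {φ ι Y Z : ℂ → TimeCurve}

lemma le_re_sub (hs : ApproxTorus h α ω κ δ φ ι Y Z) (hδ : 0 < δ) (s : unitInterval) {x y : ℝ}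
    (hxy : x ≤ y) : 1 / A * (y - x) ≤ (φ y s).re - (φ x s).re := by
  have hd : ∀ x : ℝ, HasDerivAt (fun y : ℝ => (φ y s).re) (deriv φ x s).re x := fun x => by
    have h1 : HasDerivAt φ (deriv φ x) x :=
      (hs.dφ.differentiableAt (strip_mem_nhds (ofReal_mem_strip (by linarith) x))).hasDerivAt
    have h2 : HasDerivAt (fun z => φ z s) (deriv φ x s) x :=
      (ev s).hasFDerivAt.comp_hasDerivAt (x : ℂ) h1
    exact h2.real_of_complex
  refine mul_sub_le_image_sub_of_le_deriv (f := fun y : ℝ => (φ y s).re)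
    (fun x => (hd x).differentiableAt) (fun x => ?_) hxy
  rw [(hd x).deriv]
  linarith [hs.re_deriv x (ofReal_mem_strip (by linarith) x) s]

/-- Convergence of the Newton iteration to an invariant torus. -/
theorem exists_invTorus {γ : ℝ} (hs : ApproxTorus h α ω κ δ φ ι Y Z) (hA : 1 ≤ A)
    (hω : Diophantine γ ω) (hγ : 0 < γ) (hγA : 2 / γ ≤ A) (hδ : 0 < δ) (hδ1 : δ ≤ 1 / 4)
    (hκ : 0 ≤ κ) (hκA : 10 ^ 9 * (A ^ 23 * κ) ≤ 1) :
    ∃ Φ J : ℝ → TimeCurve, InvTorus h α ω Φ J ∧ ∀ x : ℝ, Dom R (Φ x) (J x) ∧ ‖J x - ι x‖ ≤ δ := by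
  have hδn : ∀ n : ℕ, 0 < δ / 4 ^ n := fun n => by positivity
  have hδn1 : ∀ n : ℕ, δ / 4 ^ n ≤ δ := fun n =>
    div_le_self hδ.le (one_le_pow₀ (by norm_num))
  have step : ∀ n, ∀ x : {x : (ℂ → TimeCurve) × (ℂ → TimeCurve) × (ℂ → TimeCurve) ×
      (ℂ → TimeCurve) // ApproxTorus h α ω κ (δ / 4 ^ n) x.1 x.2.1 x.2.2.1 x.2.2.2},
      ∃ y : {x : (ℂ → TimeCurve) × (ℂ → TimeCurve) × (ℂ → TimeCurve) ×
        (ℂ → TimeCurve) // ApproxTorus h α ω κ (δ / 4 ^ (n + 1)) x.1 x.2.1 x.2.2.1 x.2.2.2},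
      ∀ z ∈ strip (δ / 4 ^ n), ‖y.1.1 z - x.1.1 z‖ ≤ δ / 4 ^ n / 4 ∧
        ‖y.1.2.1 z - x.1.2.1 z‖ ≤ δ / 4 ^ n / 4 := by
    rintro n ⟨x, hx⟩
    obtain ⟨φ', ι', Y', Z', h1, h2⟩ := hx.newton_step hA hω hγ hγA (hδn n)
      ((hδn1 n).trans hδ1) hκ hκA
    have e : δ / 4 ^ n / 4 = δ / 4 ^ (n + 1) := by rw [pow_succ, div_div]
    rw [e] at h1
    exact ⟨⟨(φ', ι', Y', Z'), h1⟩, h2⟩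
  choose nxt hnxt using step
  have hs0 : ApproxTorus h α ω κ (δ / 4 ^ 0) φ ι Y Z := by simpa using hs
  let u := fun n => Nat.rec (motive := fun n => {x : (ℂ → TimeCurve) × (ℂ → TimeCurve) ×
      (ℂ → TimeCurve) × (ℂ → TimeCurve) //
      ApproxTorus h α ω κ (δ / 4 ^ n) x.1 x.2.1 x.2.2.1 x.2.2.2}) ⟨(φ, ι, Y, Z), hs0⟩ nxt n
  set f : ℕ → ℝ → TimeCurve := fun n x => (u n).1.1 x with hf
  set g : ℕ → ℝ → TimeCurve := fun n x => (u n).1.2.1 x with hg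
  have hu : ∀ n, ApproxTorus h α ω κ (δ / 4 ^ n) (u n).1.1 (u n).1.2.1 (u n).1.2.2.1
    (u n).1.2.2.2 := fun n => (u n).2
  have hmem : ∀ (n : ℕ) (x : ℝ), (x : ℂ) ∈ strip (4 * (δ / 4 ^ n)) := fun n x =>
    ofReal_mem_strip (by have := hδn n; linarith) x
  have hdist : ∀ (x : ℝ) n, dist (f n x) (f (n + 1) x) ≤ δ / 4 * (1 / 4) ^ n ∧
      dist (g n x) (g (n + 1) x) ≤ δ / 4 * (1 / 4) ^ n := by
    intro x n
    have e : δ / 4 * (1 / 4) ^ n = δ / 4 ^ n / 4 := by rw [one_div, inv_pow]; ring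
    rw [dist_comm, dist_comm (g n x), dist_eq_norm, dist_eq_norm, e]
    exact hnxt n (u n) x (ofReal_mem_strip (hδn n) x)
  have hlim : ∀ x, ∃ a b, Filter.Tendsto (fun n => f n x) Filter.atTop (nhds a) ∧
      Filter.Tendsto (fun n => g n x) Filter.atTop (nhds b) := fun x =>
    let ⟨a, ha⟩ := cauchySeq_tendsto_of_complete
      (cauchySeq_of_le_geometric _ _ (by norm_num) fun n => (hdist x n).1)
    let ⟨b, hb⟩ := cauchySeq_tendsto_of_complete
      (cauchySeq_of_le_geometric _ _ (by norm_num) fun n => (hdist x n).2)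
    ⟨a, b, ha, hb⟩
  choose Φ J hΦ hJ using hlim
  have hr0 : Filter.Tendsto (fun n : ℕ => δ / 4 * (1 / 4 : ℝ) ^ n / (1 - 1 / 4)) Filter.atTop
      (nhds 0) := by
    have := ((tendsto_pow_atTop_nhds_zero_of_lt_one (r := (1 / 4 : ℝ)) (by norm_num)
      (by norm_num)).const_mul (δ / 4)).div_const (1 - 1 / 4)
    simpa using this
  have hunif : ∀ (k : ℕ → ℝ → TimeCurve) (K : ℝ → TimeCurve),
      (∀ n x, dist (k n x) (K x) ≤ δ / 4 * (1 / 4 : ℝ) ^ n / (1 - 1 / 4)) →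
      (∀ n, Continuous (k n)) → Continuous K := by
    intro k K hk hc
    refine TendstoUniformly.continuous (F := k) (p := Filter.atTop) ?_ (.of_forall hc)
    rw [Metric.tendstoUniformly_iff]
    intro ε hε
    filter_upwards [hr0.eventually_lt_const hε] with n hn x
    rw [dist_comm]
    exact (hk n x).trans_lt hn
  have hdom : ∀ n x, Dom R (f n x) (g n x) := fun n x => (hu n).dom (hδn n) (hmem n x)
  have hdom' : ∀ x, Dom R (Φ x) (J x) := fun x => by
    refine ⟨fun s => ?_, le_of_tendsto (hJ x).norm (.of_forall fun n => (hdom n x).2)⟩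
    have h1 : Filter.Tendsto (fun n => |(ev s (f n x)).im|) Filter.atTop
        (nhds |(ev s (Φ x)).im|) :=
      ((continuous_im.tendsto _).comp (((ev s).continuous.tendsto _).comp (hΦ x))).abs
    exact le_of_tendsto h1 (.of_forall fun n => (hdom n x).1 s)
  have hev : ∀ (s : unitInterval) {k : ℕ → TimeCurve} {K : TimeCurve},
      Filter.Tendsto k Filter.atTop (nhds K) →
      Filter.Tendsto (fun n => k n s) Filter.atTop (nhds (K s)) := fun s k K hk =>
    ((ev s).continuous.tendsto _).comp hk
  have herr : Filter.Tendsto (fun n : ℕ => κ * (δ / 4 ^ n) ^ 8) Filter.atTop (nhds 0) := by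
    have h1 : Filter.Tendsto (fun n : ℕ => δ / 4 ^ n) Filter.atTop (nhds 0) := by
      have := (tendsto_pow_atTop_nhds_zero_of_lt_one (r := (1 / 4 : ℝ)) (by norm_num)
        (by norm_num)).const_mul δ
      rw [mul_zero] at this
      refine this.congr fun n => ?_
      rw [one_div, inv_pow]; rfl
    simpa using (h1.pow 8).const_mul κ
  have hself : ∀ {k : ℕ → TimeCurve} {K : TimeCurve}, (∀ n, IsSelfAdjoint (k n)) →
      Filter.Tendsto k Filter.atTop (nhds K) → IsSelfAdjoint K := fun hk hK =>
    (isClosed_eq continuous_star continuous_id).mem_of_tendsto hK (.of_forall hk)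
  refine ⟨Φ, J, ⟨?_, ?_, ?_, ?_, ?_, ?_, ?_, ?_, ?_, ?_, ?_⟩, fun x => ⟨hdom' x, ?_⟩⟩
  · refine hunif f Φ (fun n x => dist_le_of_le_geometric_of_tendsto _ _ (by norm_num)
      (fun n => (hdist x n).1) (hΦ x) n) fun n =>
      (hu n).dφ.continuousOn.comp_continuous continuous_ofReal (hmem n)
  · refine hunif g J (fun n x => dist_le_of_le_geometric_of_tendsto _ _ (by norm_num)
      (fun n => (hdist x n).2) (hJ x) n) fun n =>
      (hu n).dι.continuousOn.comp_continuous continuous_ofReal (hmem n)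
  · intro x
    refine tendsto_nhds_unique (hΦ (x + 1)) (((hΦ x).add_const _).congr fun n => ?_)
    have := (hu n).perφ x (hmem n x)
    simp only [hf, ofReal_add, ofReal_one, this]
  · intro x
    refine tendsto_nhds_unique (hJ (x + 1)) ((hJ x).congr fun n => ?_)
    have := (hu n).perι x (hmem n x)
    simp only [hg, ofReal_add, ofReal_one, this]
  · intro x
    refine IsPrim.of_tendsto (fun n => (hu n).primφ x (hmem n x)) (hΦ x) ?_
    have h1 := squeeze_zero_norm (fun n => (hu n).err1 x (hmem n x)) herr
    have h2 := h1.add (h.taylor_H2.tendsto (fun n => hdom n x) (hdom' x) (hΦ x) (hJ x))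
    rw [zero_add] at h2
    exact h2.congr fun n => sub_add_cancel _ _
  · intro x
    refine IsPrim.of_tendsto (fun n => (hu n).primι x (hmem n x)) (hJ x) ?_
    have h1 := squeeze_zero_norm (fun n => (hu n).err2 x (hmem n x)) herr
    have h2 := h1.sub (h.taylor_H1.tendsto (fun n => hdom n x) (hdom' x) (hΦ x) (hJ x))
    rw [zero_sub] at h2
    exact h2.congr fun n => add_sub_cancel_right _ _
  · intro x
    refine tendsto_nhds_unique ((hev 1 (hΦ x)).add_const (α : ℂ))
      ((hev 0 (hΦ (x + ω))).congr fun n => ?_)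
    have := (hu n).matchφ x (hmem n x)
    simp only [hf, ofReal_add, this]
  · intro x
    refine tendsto_nhds_unique (hev 1 (hJ x)) ((hev 0 (hJ (x + ω))).congr fun n => ?_)
    have := (hu n).matchι x (hmem n x)
    simp only [hg, ofReal_add, this]
  · exact fun x => hself (fun n => (hu n).realφ x) (hΦ x)
  · exact fun x => hself (fun n => (hu n).realι x) (hJ x)
  · intro s x y hxy
    refine ge_of_tendsto (((continuous_re.tendsto _).comp (hev s (hΦ y))).sub
      ((continuous_re.tendsto _).comp (hev s (hΦ x)))) (.of_forall fun n => ?_)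
    exact (hu n).le_re_sub (hδn n) s hxy
  · have := dist_le_of_le_geometric_of_tendsto₀ _ _ (by norm_num) (fun n => (hdist x n).2) (hJ x)
    rw [dist_comm, dist_eq_norm] at this
    refine this.trans ?_
    norm_num
    linarith

end ApproxTorus

end Sitnikov

namespace Sitnikov

open Set Complex Metric

open TimeCurve

/-- Second order Taylor remainder of a bounded holomorphic function on a disc. -/
lemma norm_taylor_le {f : ℂ → ℂ} {c z : ℂ} {ρ B : ℝ} (hf : DifferentiableOn ℂ f (ball c ρ))
    (hB : ∀ w ∈ ball c ρ, ‖f w‖ ≤ B) (hz : z ∈ ball c ρ) :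
    ‖f z - f c - deriv f c * (z - c)‖ ≤ 4 * B / ρ ^ 2 * ‖z - c‖ ^ 2 := by
  have hρ : 0 < ρ := dist_nonneg.trans_lt hz
  have hc : c ∈ ball c ρ := mem_ball_self hρ
  have m1 : MapsTo f (ball c ρ) (closedBall (f c) (2 * B)) := fun w hw => by
    rw [mem_closedBall, dist_eq_norm]
    linarith [norm_sub_le (f w) (f c), hB w hw, hB c hc]
  have h1 : ∀ w ∈ ball c ρ, ‖dslope f c w‖ ≤ 2 * B / ρ := fun w hw =>
    Complex.norm_dslope_le_div_of_mapsTo_ball hf m1 hw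
  have d1 : DifferentiableOn ℂ (dslope f c) (ball c ρ) :=
    (differentiableOn_dslope (ball_mem_nhds c hρ)).2 hf
  have m2 : MapsTo (dslope f c) (ball c ρ) (closedBall (dslope f c c) (4 * B / ρ)) :=
    fun w hw => by
      rw [mem_closedBall, dist_eq_norm]
      have e : 4 * B / ρ = 2 * B / ρ + 2 * B / ρ := by ring
      linarith [norm_sub_le (dslope f c w) (dslope f c c), h1 w hw, h1 c hc]
  have h2 := Complex.norm_dslope_le_div_of_mapsTo_ball d1 m2 hz
  have e : f z - f c - deriv f c * (z - c) = (z - c) ^ 2 * dslope (dslope f c) c z := by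
    have e1 := sub_smul_dslope f c z
    have e2 := sub_smul_dslope (dslope f c) c z
    rw [dslope_same] at e2
    simp only [smul_eq_mul] at e1 e2
    linear_combination -e1 - (z - c) * e2
  rw [e, norm_mul, norm_pow, mul_comm]
  refine mul_le_mul_of_nonneg_right (h2.trans (le_of_eq ?_)) (by positivity)
  field_simp

/-- Complex neighbourhood of the domain of angles and actions. -/
def dmn (R ρ : ℝ) : Set (ℂ × ℂ) := {z | |z.1.im| < 1 + ρ ∧ ‖z.2‖ < R + ρ}

lemma isOpen_dmn (R ρ : ℝ) : IsOpen (dmn R ρ) :=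
  (isOpen_lt (f := fun z : ℂ × ℂ => |z.1.im|) (by fun_prop) continuous_const).inter
    (isOpen_lt (f := fun z : ℂ × ℂ => ‖z.2‖) (by fun_prop) continuous_const)

lemma add_mem_dmn {R ρ : ℝ} {z v : ℂ × ℂ} (hz : z ∈ dmn R ρ) (hv : ‖v‖ ≤ 1) :
    z + v ∈ dmn R (ρ + 1) := by
  have h1 : |v.1.im| ≤ 1 := (abs_im_le_norm _).trans ((norm_fst_le v).trans hv)
  have h2 : ‖v.2‖ ≤ 1 := (norm_snd_le v).trans hv
  constructor
  · show |z.1.im + v.1.im| < _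
    linarith [abs_add_le z.1.im v.1.im, hz.1]
  · show ‖z.2 + v.2‖ < _
    linarith [norm_add_le z.2 v.2, hz.2]

lemma dmn_mono {R ρ ρ' : ℝ} (h : ρ ≤ ρ') : dmn R ρ ⊆ dmn R ρ' := fun z hz =>
  ⟨by linarith [hz.1], by linarith [hz.2]⟩

/-- Bounded analytic functions depending continuously on time. -/
structure HolBdd (R : ℝ) (G : unitInterval → ℂ × ℂ → ℂ) (ρ B : ℝ) : Prop where
  analytic : ∀ s, AnalyticOnNhd ℂ (G s) (dmn R ρ)
  bound : ∀ s, ∀ z ∈ dmn R ρ, ‖G s z‖ ≤ B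
  cont : ContinuousOn (fun p : unitInterval × (ℂ × ℂ) => G p.1 p.2) {p | p.2 ∈ dmn R ρ}
  real : ∀ s, ∀ z ∈ dmn R ρ, z.1.im = 0 → z.2.im = 0 → (G s z).im = 0
  per : ∀ s z, G s (z + ((2 * (Real.pi : ℂ), 0) : ℂ × ℂ)) = G s z

/-- Directional derivative of a time dependent function. -/
noncomputable def dir (v : ℂ × ℂ) (G : unitInterval → ℂ × ℂ → ℂ) : unitInterval → ℂ × ℂ → ℂ :=
  fun s z => fderiv ℂ (G s) z v

namespace HolBdd

variable {R ρ B : ℝ} {G : unitInterval → ℂ × ℂ → ℂ}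

lemma mono (hG : HolBdd R G ρ B) {ρ' : ℝ} (h : ρ' ≤ ρ) : HolBdd R G ρ' B where
  analytic s := (hG.analytic s).mono (dmn_mono h)
  bound s z hz := hG.bound s z (dmn_mono h hz)
  cont := hG.cont.mono fun _ hp => dmn_mono h hp
  real s z hz := hG.real s z (dmn_mono h hz)
  per := hG.per

lemma hasDerivAt_line (hG : HolBdd R G ρ B) (s : unitInterval) {z v : ℂ × ℂ} {τ : ℂ}
    (hz : z + τ • v ∈ dmn R ρ) :
    HasDerivAt (fun τ : ℂ => G s (z + τ • v)) (dir v G s (z + τ • v)) τ := by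
  have h1 : HasDerivAt (fun τ : ℂ => z + τ • v) v τ := by
    simpa using ((hasDerivAt_id τ).smul_const v).const_add z
  exact ((hG.analytic s _ hz).differentiableAt.hasFDerivAt).comp_hasDerivAt τ h1

lemma norm_dir_le (hG : HolBdd R G (ρ + 1) B) (s : unitInterval) {z v : ℂ × ℂ} (hz : z ∈ dmn R ρ)
    (hv : ‖v‖ ≤ 1) : ‖dir v G s z‖ ≤ B := by
  have hmem : ∀ τ ∈ closedBall (0 : ℂ) 1, z + τ • v ∈ dmn R (ρ + 1) := fun τ hτ =>
    add_mem_dmn hz (by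
      rw [norm_smul]
      exact mul_le_one₀ (by simpa using hτ) (norm_nonneg _) hv)
  have hd : ∀ τ ∈ closedBall (0 : ℂ) 1,
      HasDerivAt (fun τ : ℂ => G s (z + τ • v)) (dir v G s (z + τ • v)) τ := fun τ hτ =>
    hG.hasDerivAt_line s (hmem τ hτ)
  have h0 := (hd 0 (by simp)).deriv
  simp only [zero_smul, add_zero] at h0
  rw [← h0]
  have := Complex.norm_deriv_le_of_forall_mem_sphere_norm_le (f := fun τ : ℂ => G s (z + τ • v))
    (c := 0) (R := 1) (C := B) one_pos ?_ fun τ hτ =>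
      hG.bound s _ (hmem τ (sphere_subset_closedBall hτ))
  · simpa using this
  · refine DifferentiableOn.diffContOnCl fun τ hτ => ?_
    exact (hd τ (closure_ball_subset_closedBall hτ)).differentiableAt.differentiableWithinAt

/-- Second order Taylor estimate in direction `v`. -/
lemma norm_taylor_dir_le (hG : HolBdd R G (ρ + 1) B) (s : unitInterval) {z v : ℂ × ℂ} {τ : ℂ}
    (hz : z ∈ dmn R ρ) (hv : ‖v‖ ≤ 1) (hτ : ‖τ‖ < 1) :
    ‖G s (z + τ • v) - G s z - dir v G s z * τ‖ ≤ 4 * B * ‖τ‖ ^ 2 := by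
  have hmem : ∀ τ ∈ ball (0 : ℂ) 1, z + τ • v ∈ dmn R (ρ + 1) := fun τ hτ =>
    add_mem_dmn hz (by
      rw [norm_smul]
      exact mul_le_one₀ (by simpa using (ball_subset_closedBall hτ)) (norm_nonneg _) hv)
  have hd : ∀ τ ∈ ball (0 : ℂ) 1,
      HasDerivAt (fun τ : ℂ => G s (z + τ • v)) (dir v G s (z + τ • v)) τ := fun τ hτ =>
    hG.hasDerivAt_line s (hmem τ hτ)
  have h0 := (hd 0 (by simp)).deriv
  simp only [zero_smul, add_zero] at h0
  have := norm_taylor_le (f := fun τ : ℂ => G s (z + τ • v)) (c := 0) (ρ := 1) (B := B) (z := τ)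
    (fun τ hτ => (hd τ hτ).differentiableAt.differentiableWithinAt)
    (fun τ hτ => hG.bound s _ (hmem τ hτ)) (by simpa using hτ)
  rw [h0] at this
  simpa using this

lemma dir (hG : HolBdd R G (ρ + 1) B) {v : ℂ × ℂ} (hv : ‖v‖ ≤ 1) (h1 : v.1.im = 0)
    (h2 : v.2.im = 0) : HolBdd R (dir v G) ρ B where
  analytic s := by
    have := ((hG.analytic s).mono (dmn_mono (by linarith : ρ ≤ ρ + 1))).fderiv
    exact fun z hz => (ContinuousLinearMap.analyticAt (ContinuousLinearMap.apply ℂ ℂ v) _).comp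
      (this z hz)
  bound s z hz := hG.norm_dir_le s hz hv
  cont := by
    set τ : ℕ → ℂ := fun n => ((1 / (n + 2) : ℝ) : ℂ) with hτ
    have hτn : ∀ n, ‖τ n‖ = 1 / (n + 2) := fun n => by
      rw [hτ, norm_real, Real.norm_of_nonneg (by positivity)]
    have hτ1 : ∀ n, ‖τ n‖ < 1 := fun n => by
      rw [hτn, div_lt_one (by positivity)]
      have : (0 : ℝ) ≤ n := n.cast_nonneg
      linarith
    have hτ0 : ∀ n, τ n ≠ 0 := fun n => by
      rw [← norm_pos_iff, hτn]; positivity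
    have hlim : Filter.Tendsto (fun n => 4 * B * ‖τ n‖) Filter.atTop (nhds 0) := by
      have h3 : Filter.Tendsto (fun n : ℕ => (1 : ℝ) / (n + 2)) Filter.atTop (nhds 0) := by
        have := (Filter.tendsto_add_atTop_iff_nat (f := fun n : ℕ => (1 : ℝ) / n) 2).2
          tendsto_one_div_atTop_nhds_zero_nat
        simpa using this
      simp only [hτn]
      simpa using h3.const_mul (4 * B)
    refine TendstoUniformlyOn.continuousOn (p := Filter.atTop)
      (F := fun (n : ℕ) (p : unitInterval × (ℂ × ℂ)) =>
        (G p.1 (p.2 + τ n • v) - G p.1 p.2) / τ n) ?_ (Filter.Frequently.of_forall fun n => ?_)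
    · rw [tendstoUniformlyOn_iff]
      intro ε hε
      filter_upwards [hlim.eventually_lt_const hε] with n hn p hp
      rw [dist_comm, dist_eq_norm]
      refine lt_of_le_of_lt ?_ hn
      have := hG.norm_taylor_dir_le p.1 hp hv (hτ1 n)
      have e : (G p.1 (p.2 + τ n • v) - G p.1 p.2) / τ n - Sitnikov.dir v G p.1 p.2 =
        (G p.1 (p.2 + τ n • v) - G p.1 p.2 - Sitnikov.dir v G p.1 p.2 * τ n) / τ n := by
        field_simp [hτ0 n]
      rw [e, norm_div, div_le_iff₀ (norm_pos_iff.2 (hτ0 n))]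
      refine this.trans (le_of_eq (by ring))
    · refine ContinuousOn.div_const (ContinuousOn.sub ?_ (hG.cont.mono fun p hp =>
        dmn_mono (by linarith) hp)) _
      refine hG.cont.comp (f := fun p : unitInterval × (ℂ × ℂ) => (p.1, p.2 + τ n • v))
        (by fun_prop) fun p hp => add_mem_dmn hp ?_
      rw [norm_smul]
      exact mul_le_one₀ (hτ1 n).le (norm_nonneg _) hv
  real s z hz hz1 hz2 := by
    have hz' : z + (0 : ℂ) • v ∈ dmn R (ρ + 1) := by
      simpa using dmn_mono (by linarith) hz
    have hd := hG.hasDerivAt_line s (v := v) (τ := ((0 : ℝ) : ℂ)) (z := z) (by simpa using hz')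
    have hd1 := hd.comp_ofReal
    have hd2 : HasDerivAt (fun t : ℝ => imCLM (G s (z + (t : ℂ) • v)))
        (imCLM (Sitnikov.dir v G s (z + ((0 : ℝ) : ℂ) • v))) 0 :=
      imCLM.hasFDerivAt.comp_hasDerivAt 0 hd1
    simp only [ofReal_zero, zero_smul, add_zero, imCLM_apply] at hd2
    refine hd2.unique ((hasDerivAt_const (0 : ℝ) (0 : ℝ)).congr_of_eventuallyEq ?_)
    have hopen : {t : ℝ | z + (t : ℂ) • v ∈ dmn R (ρ + 1)} ∈ nhds (0 : ℝ) :=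
      ((isOpen_dmn R (ρ + 1)).preimage (f := fun t : ℝ => z + (t : ℂ) • v)
        (by fun_prop)).mem_nhds (by simpa using hz')
    filter_upwards [hopen] with t ht
    refine hG.real s _ ht ?_ ?_
    · simp [hz1, h1]
    · simp [hz2, h2]
  per s z := by
    have : fderiv ℂ (G s) (z + ((2 * (Real.pi : ℂ), 0) : ℂ × ℂ)) = fderiv ℂ (G s) z := by
      rw [← fderiv_comp_add_right]
      congr 1
      funext w
      exact hG.per s w
    show fderiv ℂ (G s) _ v = _
    rw [this]
    rfl

/-- First order Taylor estimate in two variables. -/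
lemma norm_taylor_le (hG : HolBdd R G (ρ + 1) B) (s : unitInterval) {z w : ℂ × ℂ}
    (hz : z ∈ dmn R ρ) (hw : w ∈ dmn R ρ) :
    ‖G s w - G s z - Sitnikov.dir (1, 0) G s z * (w.1 - z.1) -
      Sitnikov.dir (0, 1) G s z * (w.2 - z.2)‖ ≤ 4 * B * ‖w - z‖ ^ 2 := by
  have hB : 0 ≤ B := (norm_nonneg _).trans (hG.bound s z (dmn_mono (by linarith) hz))
  have e1 : ∀ v : ℂ × ℂ, Sitnikov.dir v G s z =
      Sitnikov.dir (1, 0) G s z * v.1 + Sitnikov.dir (0, 1) G s z * v.2 := fun v => by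
    have : v = v.1 • ((1, 0) : ℂ × ℂ) + v.2 • ((0, 1) : ℂ × ℂ) := by ext <;> simp
    conv_lhs => rw [this]
    simp only [Sitnikov.dir, map_add, map_smul, smul_eq_mul]
    ring
  set N := ‖w - z‖ with hN
  rcases eq_or_ne N 0 with h0 | h0
  · have : w = z := by rwa [hN, norm_eq_zero, sub_eq_zero] at h0
    subst this
    simp [h0]
  have hN0 : 0 < N := lt_of_le_of_ne (norm_nonneg _) (Ne.symm h0)
  have hNc : (N : ℂ) ≠ 0 := ofReal_ne_zero.2 h0
  set v : ℂ × ℂ := (N : ℂ)⁻¹ • (w - z) with hv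
  have hv1 : ‖v‖ ≤ 1 := by
    rw [hv, norm_smul, norm_inv, norm_real, Real.norm_of_nonneg hN0.le, inv_mul_cancel₀ h0]
  have hwz : z + (N : ℂ) • v = w := by
    rw [hv, smul_inv_smul₀ hNc]; abel
  have e2 : Sitnikov.dir v G s z * N = Sitnikov.dir (1, 0) G s z * (w.1 - z.1) +
      Sitnikov.dir (0, 1) G s z * (w.2 - z.2) := by
    rw [e1 v, hv]
    simp only [Prod.smul_fst, Prod.smul_snd, Prod.fst_sub, Prod.snd_sub, smul_eq_mul]
    field_simp
  have e3 : G s w - G s z - Sitnikov.dir (1, 0) G s z * (w.1 - z.1) -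
      Sitnikov.dir (0, 1) G s z * (w.2 - z.2) =
      G s w - G s z - Sitnikov.dir v G s z * N := by rw [e2]; ring
  rw [e3]
  rcases lt_or_ge N 1 with h1 | h1
  · have := hG.norm_taylor_dir_le s (τ := N) hz hv1
      (by rwa [norm_real, Real.norm_of_nonneg hN0.le])
    rwa [hwz, norm_real, Real.norm_of_nonneg hN0.le] at this
  · have b1 := hG.bound s w (dmn_mono (by linarith) hw)
    have b2 := hG.bound s z (dmn_mono (by linarith) hz)
    have b3 : ‖Sitnikov.dir v G s z * N‖ ≤ B * N := by
      rw [norm_mul, norm_real, Real.norm_of_nonneg hN0.le]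
      exact mul_le_mul_of_nonneg_right (hG.norm_dir_le s hz hv1) hN0.le
    have b4 := norm_sub_le (G s w - G s z) (Sitnikov.dir v G s z * N)
    have b5 := norm_sub_le (G s w) (G s z)
    have b6 : B * N ≤ B * N ^ 2 := by
      refine mul_le_mul_of_nonneg_left ?_ hB
      nlinarith
    have b7 : B ≤ B * N ^ 2 := le_mul_of_one_le_right hB (one_le_pow₀ h1)
    linarith

end HolBdd

open Classical in
/-- Superposition operator on time curves. -/
noncomputable def op (R : ℝ) (G : unitInterval → ℂ × ℂ → ℂ) (a b : TimeCurve) : TimeCurve :=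
  if h : Dom R a b ∧ Continuous (fun s => G s (a s, b s)) then ⟨_, h.2⟩ else 0

lemma Dom.mem_dmn {R ρ : ℝ} {a b : TimeCurve} (h : Dom R a b) (hρ : 0 < ρ) (s : unitInterval) :
    (a s, b s) ∈ dmn R ρ :=
  ⟨(h.1 s).trans_lt (by linarith), ((b.norm_coe_le_norm s).trans h.2).trans_lt (by linarith)⟩

lemma op_eq_zero {R : ℝ} {G : unitInterval → ℂ × ℂ → ℂ} {a b : TimeCurve} (h : ¬ Dom R a b) :
    op R G a b = 0 := dif_neg fun h' => h h'.1

namespace HolBdd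

variable {R ρ B : ℝ} {G : unitInterval → ℂ × ℂ → ℂ}

lemma op_apply (hG : HolBdd R G ρ B) (hρ : 0 < ρ) {a b : TimeCurve} (h : Dom R a b)
    (s : unitInterval) : op R G a b s = G s (a s, b s) := by
  have hc : Continuous (fun s => G s (a s, b s)) :=
    hG.cont.comp_continuous (f := fun s => (s, (a s, b s))) (by fun_prop)
      fun s => h.mem_dmn hρ s
  rw [op, dif_pos ⟨h, hc⟩]
  rfl

lemma norm_op_le (hG : HolBdd R G ρ B) (hρ : 0 < ρ) {a b : TimeCurve} (h : Dom R a b) :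
    ‖op R G a b‖ ≤ B := norm_le_of fun s => by
  rw [hG.op_apply hρ h]
  exact hG.bound s _ (h.mem_dmn hρ s)

lemma op_per (hG : HolBdd R G ρ B) (hρ : 0 < ρ) (a b : TimeCurve) :
    op R G (a + const (2 * Real.pi)) b = op R G a b := by
  have hd : Dom R (a + const (2 * Real.pi)) b ↔ Dom R a b := by
    simp [Dom]
  by_cases h : Dom R a b
  · ext s
    rw [hG.op_apply hρ h, hG.op_apply hρ (hd.2 h), ← hG.per s (a s, b s)]
    simp
  · rw [op_eq_zero h, op_eq_zero (mt hd.1 h)]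

lemma op_real (hG : HolBdd R G ρ B) (hρ : 0 < ρ) (a b : TimeCurve) (ha : IsSelfAdjoint a)
    (hb : IsSelfAdjoint b) : IsSelfAdjoint (op R G a b) := by
  by_cases h : Dom R a b
  · rw [isSelfAdjoint_iff] at *
    intro s
    rw [hG.op_apply hρ h]
    exact hG.real s _ (h.mem_dmn hρ s) (ha s) (hb s)
  · rw [op_eq_zero h]
    exact IsSelfAdjoint.zero _

lemma taylorBound (hG : HolBdd R G (ρ + 1) B) (hρ : 0 < ρ) {C : ℝ} (hC : 4 * B ≤ C) :
    TaylorBound R C (op R G) (op R (Sitnikov.dir (1, 0) G)) (op R (Sitnikov.dir (0, 1) G)) := by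
  intro a b a' b' h h'
  have hC0 : 0 ≤ C := by
    refine le_trans ?_ hC
    have := (norm_nonneg _).trans (hG.bound 0 _ (h.mem_dmn (by linarith) 0))
    linarith
  refine norm_le_of fun s => ?_
  simp only [ContinuousMap.sub_apply, ContinuousMap.mul_apply]
  rw [hG.op_apply (by linarith) h, hG.op_apply (by linarith) h',
    (hG.dir (v := (1, 0)) (by simp) (by simp) (by simp)).op_apply hρ h,
    (hG.dir (v := (0, 1)) (by simp) (by simp) (by simp)).op_apply hρ h]
  have h1 := hG.norm_taylor_le s (h.mem_dmn hρ s) (h'.mem_dmn hρ s)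
  refine h1.trans ?_
  have h2 : ‖(a' s, b' s) - (a s, b s)‖ ≤ ‖a' - a‖ + ‖b' - b‖ := by
    rw [Prod.norm_def]
    have e1 := (a' - a).norm_coe_le_norm s
    have e2 := (b' - b).norm_coe_le_norm s
    refine max_le (e1.trans ?_) (e2.trans ?_)
    · linarith [norm_nonneg (b' - b)]
    · linarith [norm_nonneg (a' - a)]
  gcongr

lemma dir_comm (hG : HolBdd R G ρ B) (s : unitInterval) {z : ℂ × ℂ} (hz : z ∈ dmn R ρ)
    (v w : ℂ × ℂ) :
    Sitnikov.dir v (Sitnikov.dir w G) s z = Sitnikov.dir w (Sitnikov.dir v G) s z := by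
  have h1 : ∀ v w : ℂ × ℂ, Sitnikov.dir v (Sitnikov.dir w G) s z =
      fderiv ℂ (fderiv ℂ (G s)) z v w := fun v w => by
    have := ((hG.analytic s).fderiv z hz).differentiableAt.hasFDerivAt
    have h2 := ((ContinuousLinearMap.apply ℂ ℂ w).hasFDerivAt.comp z this).fderiv
    show fderiv ℂ (fun z => fderiv ℂ (G s) z w) z v = _
    exact congrArg (fun L : ℂ × ℂ →L[ℂ] ℂ => L v) h2
  rw [h1, h1]
  exact ((hG.analytic s z hz).contDiffAt.isSymmSndFDerivAt_of_omega) v w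

/-- The Hamiltonian operators generated by an analytic function. -/
noncomputable def ham (hG : HolBdd R G 4 B) {C : ℝ} (hC : 4 * B ≤ C) : Ham R C :=
  have h3 : (3 : ℝ) + 1 ≤ 4 := by norm_num
  have h2 : (2 : ℝ) + 1 ≤ 3 := by norm_num
  have h1 : (1 : ℝ) + 1 ≤ 2 := by norm_num
  have g1 : HolBdd R (Sitnikov.dir (1, 0) G) 3 B := (hG.mono h3).dir (by simp) (by simp) (by simp)
  have g2 : HolBdd R (Sitnikov.dir (0, 1) G) 3 B := (hG.mono h3).dir (by simp) (by simp) (by simp)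
  have g22 : HolBdd R (Sitnikov.dir (0, 1) (Sitnikov.dir (0, 1) G)) 2 B :=
    (g2.mono h2).dir (by simp) (by simp) (by simp)
  have gP : HolBdd R (Sitnikov.dir (1, 0) (Sitnikov.dir (0, 1) (Sitnikov.dir (0, 1) G))) 1 B :=
    (g22.mono h1).dir (by simp) (by simp) (by simp)
  have gQ : HolBdd R (Sitnikov.dir (0, 1) (Sitnikov.dir (0, 1) (Sitnikov.dir (0, 1) G))) 1 B :=
    (g22.mono h1).dir (by simp) (by simp) (by simp)
  have hBC : ∀ a b : TimeCurve, Dom R a b → B ≤ C := fun a b h => by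
    have := (norm_nonneg _).trans (hG.bound 0 _ (h.mem_dmn (by norm_num) 0))
    linarith
  { H := op R G
    H1 := op R (Sitnikov.dir (1, 0) G)
    H2 := op R (Sitnikov.dir (0, 1) G)
    H11 := op R (Sitnikov.dir (1, 0) (Sitnikov.dir (1, 0) G))
    H12 := op R (Sitnikov.dir (1, 0) (Sitnikov.dir (0, 1) G))
    H22 := op R (Sitnikov.dir (0, 1) (Sitnikov.dir (0, 1) G))
    P := op R (Sitnikov.dir (1, 0) (Sitnikov.dir (0, 1) (Sitnikov.dir (0, 1) G)))
    Q := op R (Sitnikov.dir (0, 1) (Sitnikov.dir (0, 1) (Sitnikov.dir (0, 1) G)))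
    taylor_H := (hG.mono h3).taylorBound (by norm_num) hC
    taylor_H1 := by
      have := (g1.mono h2).taylorBound (by norm_num) hC
      intro a b a' b' h h'
      have e : op R (Sitnikov.dir (0, 1) (Sitnikov.dir (1, 0) G)) a b =
          op R (Sitnikov.dir (1, 0) (Sitnikov.dir (0, 1) G)) a b := by
        ext s
        rw [((g1.mono h2).dir (v := (0, 1)) (by simp) (by simp) (by simp)).op_apply (by norm_num) h,
          ((g2.mono h2).dir (v := (1, 0)) (by simp) (by simp) (by simp)).op_apply (by norm_num) h,
          hG.dir_comm s (h.mem_dmn (by norm_num) s)]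
      rw [← e]
      exact this a b a' b' h h'
    taylor_H2 := (g2.mono h2).taylorBound (by norm_num) hC
    taylor_H22 := (g22.mono h1).taylorBound (by norm_num) hC
    norm_H22 := fun a b h => (g22.norm_op_le (by norm_num) h).trans (hBC a b h)
    norm_P := fun a b h => (gP.norm_op_le (by norm_num) h).trans (hBC a b h)
    norm_Q := fun a b h => (gQ.norm_op_le (by norm_num) h).trans (hBC a b h)
    per_H := hG.op_per (by norm_num)
    per_H1 := g1.op_per (by norm_num)
    per_H2 := g2.op_per (by norm_num)
    per_H22 := g22.op_per (by norm_num)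
    real_H1 := g1.op_real (by norm_num)
    real_H2 := g2.op_real (by norm_num)
    real_H22 := g22.op_real (by norm_num) }

end HolBdd

end Sitnikov

namespace Sitnikov

open Set Complex

/-- A conformal angle variable in which `(Ψ')² = b (1 + β cos 2Ψ)`. -/
structure Angle (β b σ : ℝ) (Ψ : ℂ → ℂ) : Prop where
  diff : DifferentiableOn ℂ Ψ (strip σ)
  per : ∀ z ∈ strip σ, Ψ (z + 1) = Ψ z + 2 * Real.pi
  real : ∀ x : ℝ, (Ψ x).im = 0
  im_le : ∀ z ∈ strip σ, |(Ψ z).im| ≤ 1 / 2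
  sq : ∀ z ∈ strip σ, deriv Ψ z ^ 2 = b * (1 + β * cos (2 * Ψ z))
  re_deriv : ∀ z ∈ strip σ, 2 ≤ (deriv Ψ z).re
  norm_deriv : ∀ z ∈ strip σ, ‖deriv Ψ z‖ ≤ 13
  lin : β = 0 → ∀ z, Ψ z = 2 * Real.pi * z

theorem norm_cos_le_of_strip {z : ℂ} (hz : z ∈ strip (1 / 10)) : ‖cos (2 * z)‖ ≤ 5 / 4 := by
  have h1 : |z.im| < 1 / 10 := hz
  have hb : ∀ w : ℂ, |w.im| < 2 / 10 → ‖cexp (w * I)‖ ≤ 5 / 4 := by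
    intro w hw
    rw [Complex.norm_exp]
    have : (w * I).re = - w.im := by simp
    rw [this]
    have h2 : Real.exp (-w.im) ≤ Real.exp (1 / 5) :=
      Real.exp_le_exp.2 (by linarith [neg_abs_le w.im])
    have h3 := Real.exp_bound' (x := 1 / 5) (by norm_num) (by norm_num) (n := 3) (by norm_num)
    norm_num [Finset.sum_range_succ, Nat.factorial] at h3
    linarith
  have him : |(2 * z).im| < 2 / 10 := by
    simp [abs_mul]; linarith
  have h2 := hb (2 * z) him
  have h3 := hb (-(2 * z)) (by rwa [neg_im, abs_neg])
  rw [Complex.cos, norm_div]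
  have := norm_add_le (cexp (2 * z * I)) (cexp (-(2 * z) * I))
  simp only [Complex.norm_ofNat]
  linarith

theorem convex_strip (σ : ℝ) : Convex ℝ (strip σ) := by
  have : strip σ = Complex.imLm ⁻¹' Ioo (-σ) σ := by
    ext z; simp [strip, abs_lt]
  rw [this]
  exact (convex_Ioo _ _).linear_preimage _

theorem exists_angle_sqrt {β : ℝ} (hβ : |β| ≤ 27 / 100) : ∃ s : ℂ → ℂ,
    DifferentiableOn ℂ s (strip (1 / 10)) ∧ (∀ z, s (z + 2 * Real.pi) = s z) ∧
    (∀ x : ℝ, (s x).im = 0) ∧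
    (∀ z, s z ^ 2 = 1 + β * cos (2 * z)) ∧ (∀ z ∈ strip (1 / 10), ‖s z - 1‖ ≤ 27 / 80) ∧
    (β = 0 → ∀ z, s z = 1) := by
  have hx : ∀ z ∈ strip (1 / 10), ‖(β : ℂ) * cos (2 * z)‖ ≤ 27 / 80 := by
    intro z hz
    rw [norm_mul, Complex.norm_real, Real.norm_eq_abs]
    have := mul_le_mul hβ (norm_cos_le_of_strip hz) (norm_nonneg _) (by norm_num)
    linarith
  have hre : ∀ z ∈ strip (1 / 10), 0 < (1 + (β : ℂ) * cos (2 * z)).re := by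
    intro z hz
    have := (abs_le.1 ((Complex.abs_re_le_norm _).trans (hx z hz))).1
    simp only [add_re, one_re]; linarith
  refine ⟨fun z => (1 + β * cos (2 * z)) ^ ((1 : ℂ) / 2), ?_, ?_, ?_, ?_, ?_, ?_⟩
  · intro z hz
    refine DifferentiableAt.differentiableWithinAt ?_
    refine DifferentiableAt.cpow (by fun_prop) (by fun_prop) ?_
    exact Or.inl (hre z hz)
  · intro z
    have : cos (2 * (z + 2 * Real.pi)) = cos (2 * z) := by
      rw [show 2 * (z + 2 * Real.pi) = 2 * z + (2 : ℕ) * (2 * Real.pi) by push_cast; ring]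
      exact Complex.cos_add_nat_mul_two_pi _ _
    simp only [this]
  · intro x
    have h0 : (0 : ℝ) ≤ 1 + β * Real.cos (2 * x) := by
      have h1 := abs_le.1 hβ
      have h2 := Real.neg_one_le_cos (2 * x)
      have h3 := Real.cos_le_one (2 * x)
      nlinarith
    have : (1 + (β : ℂ) * cos (2 * x)) ^ ((1 : ℂ) / 2) =
        (((1 + β * Real.cos (2 * x)) ^ ((1 : ℝ) / 2) : ℝ) : ℂ) := by
      rw [Complex.ofReal_cpow h0]; push_cast; rfl
    simp only [this, ofReal_im]
  · intro z
    simp only [one_div]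
    exact Complex.cpow_nat_inv_pow _ two_ne_zero
  · intro z hz
    set s := (1 + (β : ℂ) * cos (2 * z)) ^ ((1 : ℂ) / 2) with hs
    have hsq : s ^ 2 = 1 + β * cos (2 * z) := by
      rw [hs, one_div]; exact Complex.cpow_nat_inv_pow _ two_ne_zero
    have hsre : 0 ≤ s.re := by
      have := Complex.abs_arg_le_pi_div_two_iff.2 (hre z hz).le
      have hne : 1 + (β : ℂ) * cos (2 * z) ≠ 0 := fun h => by
        have := hre z hz; rw [h] at this; simp at this
      rw [hs, Complex.cpow_def_of_ne_zero hne, Complex.exp_re]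
      refine mul_nonneg (Real.exp_pos _).le (Real.cos_nonneg_of_mem_Icc ?_)
      have h4 := abs_le.1 (Complex.abs_arg_le_pi (1 + (β : ℂ) * cos (2 * z)))
      have : (log (1 + (β : ℂ) * cos (2 * z)) * (1 / 2)).im =
          arg (1 + (β : ℂ) * cos (2 * z)) / 2 := by
        rw [show (1 / 2 : ℂ) = ((1 / 2 : ℝ) : ℂ) by norm_num, Complex.im_mul_ofReal, Complex.log_im]
        ring
      rw [this]
      exact ⟨by linarith [h4.1], by linarith [h4.2]⟩
    have h1 : 1 ≤ ‖s + 1‖ := by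
      refine le_trans ?_ (Complex.re_le_norm _)
      simp; exact hsre
    have h2 : ‖s - 1‖ * ‖s + 1‖ ≤ 27 / 80 := by
      rw [← norm_mul, show (s - 1) * (s + 1) = β * cos (2 * z) by linear_combination hsq]
      exact hx z hz
    show ‖s - 1‖ ≤ _
    nlinarith [norm_nonneg (s - 1)]
  · rintro rfl z
    simp

/-- A holomorphic map of a strip close to the identity has a holomorphic inverse. -/
theorem exists_inverse_of_deriv_near_one {E m : ℂ → ℂ} {c ρ : ℝ} (hc : 0 ≤ c) (hc1 : c < 1)
    (hρ : 0 < ρ)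
    (hE : ∀ z ∈ strip ρ, HasDerivAt E (m z) z) (hm : ∀ z ∈ strip ρ, ‖m z - 1‖ ≤ c)
    (hEr : ∀ x : ℝ, (E x).im = 0) :
    ∃ F : ℂ → ℂ, ∀ w ∈ strip ((1 - c) * (ρ / 2)), F w ∈ strip ρ ∧ E (F w) = w ∧
      HasDerivAt F (m (F w))⁻¹ w ∧ (∀ z ∈ strip ρ, E z = w → z = F w) ∧
      (w.im = 0 → (F w).im = 0) := by
  have hU : ∀ z ∈ strip ρ, ∀ w ∈ strip ρ, ‖(E z - z) - (E w - w)‖ ≤ c * ‖z - w‖ := by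
    intro z hz w hw
    refine (convex_strip ρ).norm_image_sub_le_of_norm_hasDerivWithin_le (f := fun z => E z - z)
      (f' := fun z => m z - 1) (fun x hx => ?_) hm hw hz
    exact ((hE x hx).sub (hasDerivAt_id x)).hasDerivWithinAt
  have hUim : ∀ z ∈ strip ρ, |(E z - z).im| ≤ c * |z.im| := by
    intro z hz
    have h1 := hU z hz z.re (ofReal_mem_strip hρ _)
    have h2 : z - (z.re : ℂ) = z.im * I := by
      apply Complex.ext <;> simp
    have h3 := (Complex.abs_im_le_norm _).trans h1
    rw [h2, norm_mul, norm_I, mul_one, norm_real, Real.norm_eq_abs] at h3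
    simpa [hEr] using h3
  have hexp : ∀ z ∈ strip ρ, ∀ w ∈ strip ρ, (1 - c) * ‖z - w‖ ≤ ‖E z - E w‖ := by
    intro z hz w hw
    have h1 := hU z hz w hw
    have h2 : ‖z - w‖ ≤ ‖E z - E w‖ + ‖(E z - z) - (E w - w)‖ := by
      have := norm_sub_le (E z - E w) ((E z - z) - (E w - w))
      rwa [show E z - E w - ((E z - z) - (E w - w)) = z - w by ring] at this
    linarith
  have hex : ∀ w ∈ strip ((1 - c) * (ρ / 2)), ∃ z ∈ strip ρ, E z = w := by
    intro w hw
    have hw' : |w.im| < (1 - c) * (ρ / 2) := hw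
    set K : Set ℂ := {z | |z.im| ≤ ρ / 2}
    have hK : IsClosed K := isClosed_le continuous_im.abs continuous_const
    have hKs : K ⊆ strip ρ := fun z hz => lt_of_le_of_lt (show |z.im| ≤ ρ / 2 from hz) (by linarith)
    have hmap : MapsTo (fun z => w - (E z - z)) K K := by
      intro z hz
      have h1 := hUim z (hKs hz)
      have h2 : |z.im| ≤ ρ / 2 := hz
      show |(w - (E z - z)).im| ≤ ρ / 2
      rw [sub_im]
      refine (abs_sub _ _).trans ?_
      nlinarith
    have hcon : ContractingWith ⟨c, hc⟩ (hmap.restrict (fun z => w - (E z - z)) K K) := by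
      refine ⟨by exact_mod_cast hc1, LipschitzWith.of_dist_le_mul ?_⟩
      rintro ⟨x, hx⟩ ⟨y, hy⟩
      rw [Subtype.dist_eq, Subtype.dist_eq, dist_eq_norm, dist_eq_norm]
      simp only [MapsTo.val_restrict_apply]
      rw [show w - (E x - x) - (w - (E y - y)) = -((E x - x) - (E y - y)) by ring, norm_neg]
      exact hU x (hKs hx) y (hKs hy)
    obtain ⟨z, hz, hfix, -⟩ := hcon.exists_fixedPoint' hK.isComplete hmap (x := 0)
      (by simp [K]; positivity)
      (edist_ne_top _ _)
    refine ⟨z, hKs hz, ?_⟩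
    have : w - (E z - z) = z := hfix
    linear_combination -this
  choose! F hF1 hF2 using hex
  have huniq : ∀ w ∈ strip ((1 - c) * (ρ / 2)), ∀ z ∈ strip ρ, E z = w → z = F w := by
    intro w hw z hz hEz
    have := hexp z hz (F w) (hF1 w hw)
    rw [hEz, hF2 w hw, sub_self, norm_zero] at this
    have h0 : ‖z - F w‖ ≤ 0 := by nlinarith [norm_nonneg (z - F w)]
    exact sub_eq_zero.1 (norm_le_zero_iff.1 h0)
  refine ⟨F, fun w hw => ⟨hF1 w hw, hF2 w hw, ?_, huniq w hw, ?_⟩⟩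
  · refine HasDerivAt.of_local_left_inverse ?_ (hE _ (hF1 w hw)) ?_ ?_
    · have hl : LipschitzOnWith ⟨(1 - c)⁻¹, inv_nonneg.2 (by linarith)⟩ F
          (strip ((1 - c) * (ρ / 2))) := by
        refine LipschitzOnWith.of_dist_le_mul fun x hx y hy => ?_
        have := hexp _ (hF1 x hx) _ (hF1 y hy)
        rw [hF2 x hx, hF2 y hy] at this
        rw [dist_eq_norm, dist_eq_norm]
        show _ ≤ (1 - c)⁻¹ * _
        rw [inv_mul_eq_div, le_div_iff₀ (by linarith)]
        linarith
      exact hl.continuousOn.continuousAt (strip_mem_nhds hw)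
    · intro h0
      have := hm _ (hF1 w hw)
      rw [h0] at this
      simp at this
      linarith
    · filter_upwards [strip_mem_nhds hw] with y hy using hF2 y hy
  · intro him
    have h1 := hUim _ (hF1 w hw)
    rw [hF2 w hw, sub_im, him, zero_sub, abs_neg] at h1
    have : |(F w).im| ≤ 0 := by nlinarith [abs_nonneg (F w).im]
    exact abs_eq_zero.1 (le_antisymm this (abs_nonneg _))

theorem exists_angle {β : ℝ} (hβ : |β| ≤ 27 / 100) :
    ∃ b σ : ℝ, ∃ Ψ : ℂ → ℂ, 0 < b ∧ 0 < σ ∧ Angle β b σ Ψ := by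
  obtain ⟨s, hs, hsper, hsreal, hssq, hs1, hs0⟩ := exists_angle_sqrt hβ
  have hSlow : ∀ z ∈ strip (1 / 10), 53 / 80 ≤ ‖s z‖ := by
    intro z hz
    have := norm_sub_norm_le (1 : ℂ) (s z)
    rw [norm_sub_rev, norm_one] at this
    linarith [hs1 z hz]
  have hs_ne : ∀ z ∈ strip (1 / 10), s z ≠ 0 := by
    intro z hz h
    have := hSlow z hz
    rw [h, norm_zero] at this; norm_num at this
  obtain ⟨E₀, hE₀⟩ := (convex_strip (1 / 10)).exists_forall_hasDerivWithinAt
    (f := fun z => (s z)⁻¹) (hs.inv hs_ne)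
  set E : ℂ → ℂ := fun z => E₀ z - E₀ 0 with hEdef
  have hE : ∀ z ∈ strip (1 / 10), HasDerivAt E (s z)⁻¹ z := fun z hz =>
    ((hE₀ z hz).hasDerivAt (strip_mem_nhds hz)).sub_const _
  have hE0 : E 0 = 0 := by simp [hEdef]
  have hm : ∀ z ∈ strip (1 / 10), ‖(s z)⁻¹ - 1‖ ≤ 27 / 53 := by
    intro z hz
    rw [show (s z)⁻¹ - 1 = -(s z - 1) / s z by field_simp [hs_ne z hz]; ring, norm_div, norm_neg,
      div_le_iff₀ (by linarith [hSlow z hz])]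
    linarith [hs1 z hz, hSlow z hz]
  have hEr : ∀ x : ℝ, (E x).im = 0 := by
    have hd : ∀ x : ℝ, HasDerivAt (fun x : ℝ => (E x).im) 0 x := by
      intro x
      have h1 := (hE x (ofReal_mem_strip (by norm_num) x)).comp_ofReal
      have h2 := Complex.imCLM.hasFDerivAt.comp_hasDerivAt x h1
      refine h2.congr_deriv ?_
      simp [inv_im, hsreal]
    intro x
    have h := is_const_of_deriv_eq_zero (fun x => (hd x).differentiableAt)
      (fun x => (hd x).deriv) x 0
    simpa [hE0] using h
  have hUconst : ∀ z ∈ strip (1 / 10), E (z + 2 * Real.pi) = E z + E (2 * Real.pi) := by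
    intro z hz
    have h2 : ∀ z ∈ strip (1 / 10), z + 2 * Real.pi ∈ strip (1 / 10) := by
      intro z hz
      have := add_real_mem_strip hz (2 * Real.pi)
      simpa using this
    have h1 : ∀ w ∈ strip (1 / 10), HasDerivAt (fun w => E (w + 2 * Real.pi) - E w) 0 w := by
      intro w hw
      have := ((hE _ (h2 w hw)).comp_add_const w (2 * Real.pi)).sub (hE w hw)
      rwa [hsper, sub_self] at this
    have h3 := (convex_strip (1 / 10)).norm_image_sub_le_of_norm_hasDerivWithin_le (C := 0)
      (f := fun w => E (w + 2 * Real.pi) - E w) (f' := fun _ => 0)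
      (fun x hx => (h1 x hx).hasDerivWithinAt) (by simp)
      (show (0 : ℂ) ∈ strip (1 / 10) by simp [strip]) hz
    simp only [zero_mul, norm_le_zero_iff, hE0, sub_zero, zero_add] at h3
    linear_combination h3
  obtain ⟨F, hF⟩ := exists_inverse_of_deriv_near_one (c := 27 / 53) (by norm_num) (by norm_num)
    (by norm_num : (0 : ℝ) < 1 / 10) hE hm hEr
  set e : ℝ := (E (2 * Real.pi)).re with he
  have heE : E (2 * Real.pi) = e := by
    apply Complex.ext
    · simp [he]
    · have := hEr (2 * Real.pi)
      push_cast at this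
      simpa using this
  have hE2 : |e - 2 * Real.pi| ≤ 27 / 53 * (2 * Real.pi) := by
    have h3 := (convex_strip (1 / 10)).norm_image_sub_le_of_norm_hasDerivWithin_le (C := 27 / 53)
      (f := fun w => E w - w) (f' := fun z => (s z)⁻¹ - 1)
      (fun x hx => ((hE x hx).sub (hasDerivAt_id x)).hasDerivWithinAt) hm
      (show (0 : ℂ) ∈ strip (1 / 10) by simp [strip])
      (show (2 * Real.pi : ℂ) ∈ strip (1 / 10) by simp [strip])
    simp only [hE0, sub_zero, heE] at h3
    rw [show (e : ℂ) - 2 * Real.pi = ((e - 2 * Real.pi : ℝ) : ℂ) by push_cast; ring,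
      show (2 * Real.pi : ℂ) = ((2 * Real.pi : ℝ) : ℂ) by push_cast; ring, norm_real, norm_real,
      Real.norm_eq_abs, Real.norm_eq_abs, abs_of_pos Real.two_pi_pos] at h3
    exact h3
  have hpi := Real.pi_gt_d2
  have hpi2 := Real.pi_lt_d2
  have he1 : 3.08 ≤ e := by linarith [(abs_le.1 hE2).1]
  have he2 : e ≤ 9.6 := by linarith [(abs_le.1 hE2).2]
  have hmem : ∀ z ∈ strip (1 / 500), (e : ℂ) * z ∈ strip ((1 - 27 / 53) * (1 / 10 / 2)) := by
    intro z hz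
    have hz' : |z.im| < 1 / 500 := hz
    show |((e : ℂ) * z).im| < _
    rw [Complex.im_ofReal_mul, abs_mul, abs_of_pos (by linarith)]
    nlinarith
  have hderiv : ∀ z ∈ strip (1 / 500), HasDerivAt (fun z => F (e * z)) (e * s (F (e * z))) z := by
    intro z hz
    have h1 := (hF _ (hmem z hz)).2.2.1
    have h2 : HasDerivAt (fun z : ℂ => (e : ℂ) * z) e z := by
      simpa using (hasDerivAt_id z).const_mul (e : ℂ)
    have := h1.comp z h2
    rw [inv_inv, mul_comm] at this
    exact this
  by_cases hb0 : β = 0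
  · refine ⟨(2 * Real.pi) ^ 2, 1 / 500, fun z => 2 * Real.pi * z, by positivity, by norm_num, ?_⟩
    have hd : ∀ z : ℂ, HasDerivAt (fun z : ℂ => 2 * Real.pi * z) (2 * Real.pi : ℂ) z := by
      intro z
      simpa using (hasDerivAt_id z).const_mul (2 * Real.pi : ℂ)
    refine ⟨fun z _ => (hd z).differentiableAt.differentiableWithinAt, fun z _ => by ring,
      fun x => by simp, ?_, ?_, ?_, ?_, fun _ _ => rfl⟩
    · intro z hz
      have hz' : |z.im| < 1 / 500 := hz
      have : (2 * Real.pi * z : ℂ).im = 2 * Real.pi * z.im := by simp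
      rw [this, abs_mul, abs_of_pos Real.two_pi_pos]
      nlinarith [abs_nonneg z.im]
    · intro z _
      rw [(hd z).deriv, hb0]; simp
    · intro z _
      rw [(hd z).deriv]; simp; linarith
    · intro z _
      rw [(hd z).deriv]
      simp [abs_of_pos Real.pi_pos]; linarith
  refine ⟨e ^ 2, 1 / 500, fun z => F (e * z), by positivity, by norm_num, ?_⟩
  refine ⟨fun z hz => (hderiv z hz).differentiableAt.differentiableWithinAt, ?_, ?_, ?_, ?_, ?_,
    ?_, fun h => absurd h hb0⟩
  · intro z hz
    have h1 := hF _ (hmem z hz)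
    refine ((hF _ (hmem _ (add_one_mem_strip hz))).2.2.2.1 _ ?_ ?_).symm
    · have := add_real_mem_strip h1.1 (2 * Real.pi)
      simpa using this
    · rw [hUconst _ h1.1, h1.2.1, heE]; ring
  · intro x
    exact (hF _ (hmem _ (ofReal_mem_strip (by norm_num) x))).2.2.2.2 (by simp)
  · intro z hz
    have : |(F (e * z)).im| < 1 / 10 := (hF _ (hmem z hz)).1
    linarith
  · intro z hz
    rw [(hderiv z hz).deriv, mul_pow, hssq]
    push_cast; ring
  · intro z hz
    rw [(hderiv z hz).deriv, Complex.re_ofReal_mul]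
    have h1 := (abs_le.1 ((Complex.abs_re_le_norm _).trans (hs1 _ (hF _ (hmem z hz)).1))).1
    simp only [sub_re, one_re] at h1
    nlinarith
  · intro z hz
    rw [(hderiv z hz).deriv, norm_mul, norm_real, Real.norm_eq_abs, abs_of_pos (by linarith)]
    have h1 := norm_le_norm_add_norm_sub' (s (F (e * z))) 1
    have h2 := hs1 _ (hF _ (hmem z hz)).1
    rw [norm_one] at h1
    nlinarith [norm_nonneg (s (F (e * z)))]

end Sitnikov

namespace Sitnikov

open Set Complex
open TimeCurve

/-- Functions of time and of a complex angle, jointly continuous and holomorphic in the angle. -/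
structure JointHol (σ : ℝ) (F : ℝ → ℂ → ℂ) : Prop where
  diff : ∀ τ, DifferentiableOn ℂ (F τ) (strip σ)
  cont : ContinuousOn (fun p : ℝ × ℂ => F p.1 p.2) {p | p.2 ∈ strip σ}

/-- Bounded, periodic and real functions of time and of a complex angle. -/
structure LiftData (σ B : ℝ) (F : ℝ → ℂ → ℂ) : Prop extends JointHol σ F where
  bound : ∀ τ, ∀ z ∈ strip σ, ‖F τ z‖ ≤ B
  per : ∀ τ, ∀ z ∈ strip σ, F τ (z + 1) = F τ z
  real : ∀ τ, ∀ x : ℝ, (F τ x).im = 0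

/-- The time curves traced by a function along straight lines. -/
noncomputable def lift (T Ω : ℝ) (F : ℝ → ℂ → ℂ) (z : ℂ) : TimeCurve :=
  open Classical in
  if h : Continuous (fun s : unitInterval => F (T * s) (z + (Ω * s : ℝ))) then ⟨_, h⟩ else 0

namespace JointHol

variable {σ T Ω : ℝ} {F G : ℝ → ℂ → ℂ}

lemma mono (hF : JointHol σ F) {σ' : ℝ} (h : σ' ≤ σ) : JointHol σ' F :=
  ⟨fun τ => (hF.diff τ).mono (strip_mono h), hF.cont.mono fun _ hp => strip_mono h hp⟩

lemma of_hol {v : ℂ → ℂ} (hv : DifferentiableOn ℂ v (strip σ)) : JointHol σ (fun _ => v) :=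
  ⟨fun _ => hv, hv.continuousOn.comp continuousOn_snd fun _ hp => hp⟩

lemma add (hF : JointHol σ F) (hG : JointHol σ G) : JointHol σ (fun τ z => F τ z + G τ z) :=
  ⟨fun τ => (hF.diff τ).add (hG.diff τ), hF.cont.add hG.cont⟩

lemma const_mul (hF : JointHol σ F) (c : ℂ) : JointHol σ (fun τ z => c * F τ z) :=
  ⟨fun τ => (hF.diff τ).const_mul c, continuousOn_const.mul hF.cont⟩

lemma mul (hF : JointHol σ F) (hG : JointHol σ G) : JointHol σ (fun τ z => F τ z * G τ z) :=
  ⟨fun τ => (hF.diff τ).mul (hG.diff τ), hF.cont.mul hG.cont⟩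

lemma lift_apply (hF : JointHol σ F) {z : ℂ} (hz : z ∈ strip σ) (s : unitInterval) :
    lift T Ω F z s = F (T * s) (z + (Ω * s : ℝ)) := by
  have : Continuous (fun s : unitInterval => F (T * s) (z + (Ω * s : ℝ))) :=
    hF.cont.comp_continuous (f := fun s : unitInterval => ((T * s : ℝ), z + (Ω * s : ℝ)))
      (by fun_prop) fun s => add_real_mem_strip hz _
  rw [lift, dif_pos this]; rfl

lemma isPrim_lift (hF : JointHol σ F) (hG : JointHol σ G) {z : ℂ} (hz : z ∈ strip σ)
    (h : ∀ s : ℝ, HasDerivAt (fun s : ℝ => F (T * s) (z + (Ω * s : ℝ)))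
      (G (T * s) (z + (Ω * s : ℝ))) s) : IsPrim (lift T Ω F z) (lift T Ω G z) := by
  have he : ∀ {K : ℝ → ℂ → ℂ}, JointHol σ K → ∀ s ∈ Icc (0 : ℝ) 1,
      ext (lift T Ω K z) s = K (T * s) (z + (Ω * s : ℝ)) := fun {K} hF s hs => by
    have := ext_coe (lift T Ω K z) ⟨s, hs⟩
    rw [hF.lift_apply hz] at this
    exact this
  intro s hs
  rw [he hG s hs]
  exact (h s).hasDerivWithinAt.congr (fun t ht => he hF t ht) (he hF s hs)

lemma continuousOn_deriv (hF : JointHol σ F) {U : Set (ℝ × ℂ)} {B δ : ℝ} (hδ : 0 < δ)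
    (hU : ∀ p ∈ U, Metric.ball p.2 δ ⊆ strip σ)
    (hB : ∀ p ∈ U, ∀ w ∈ Metric.ball p.2 δ, ‖F p.1 w‖ ≤ B) :
    ContinuousOn (fun p : ℝ × ℂ => _root_.deriv (F p.1) p.2) U := by
  set h : ℕ → ℂ := fun n => ((δ / (n + 2) : ℝ) : ℂ) with hh
  have hn : ∀ n, ‖h n‖ = δ / (n + 2) := fun n => by
    rw [hh, norm_real, Real.norm_eq_abs, abs_of_pos (by positivity)]
  have hpos : ∀ n, 0 < ‖h n‖ := fun n => by rw [hn]; positivity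
  have hlt : ∀ n, ‖h n‖ < δ := fun n => by
    rw [hn, div_lt_iff₀ (by positivity)]
    nlinarith [(Nat.cast_nonneg n : (0 : ℝ) ≤ n)]
  have hlim : Filter.Tendsto (fun n => ‖h n‖) Filter.atTop (nhds 0) := by
    simp only [hn]
    refine Filter.Tendsto.div_atTop tendsto_const_nhds ?_
    exact Filter.tendsto_atTop_add_const_right _ _ tendsto_natCast_atTop_atTop
  have hmem : ∀ p ∈ U, p.2 ∈ strip σ := fun p hp => hU p hp (Metric.mem_ball_self hδ)
  have hu : TendstoUniformlyOn (fun n (p : ℝ × ℂ) => (h n)⁻¹ * (F p.1 (p.2 + h n) - F p.1 p.2))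
      (fun p => deriv (F p.1) p.2) Filter.atTop U := by
    rw [Metric.tendstoUniformlyOn_iff]
    intro ε hε
    have h2 : Filter.Tendsto (fun n => 4 * B / δ ^ 2 * ‖h n‖) Filter.atTop (nhds 0) := by
      simpa using hlim.const_mul (4 * B / δ ^ 2)
    filter_upwards [h2.eventually (gt_mem_nhds hε)] with n hnε p hp
    have ht := norm_taylor_le (z := p.2 + h n) ((hF.diff p.1).mono (hU p hp)) (hB p hp)
      (by simpa using hlt n)
    rw [add_sub_cancel_left] at ht
    refine lt_of_le_of_lt ?_ hnε
    rw [dist_eq_norm, norm_sub_rev]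
    have hne : h n ≠ 0 := norm_pos_iff.1 (hpos n)
    have : (h n)⁻¹ * (F p.1 (p.2 + h n) - F p.1 p.2) - deriv (F p.1) p.2 =
        (h n)⁻¹ * (F p.1 (p.2 + h n) - F p.1 p.2 - deriv (F p.1) p.2 * h n) := by
      field_simp
    rw [this, norm_mul, norm_inv, inv_mul_le_iff₀ (hpos n)]
    linarith
  refine hu.continuousOn (Filter.Frequently.of_forall fun n => ?_)
  refine continuousOn_const.mul (ContinuousOn.sub ?_ ?_)
  · refine hF.cont.comp (f := fun p : ℝ × ℂ => (p.1, p.2 + h n)) (by fun_prop) fun p hp => ?_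
    exact hU p hp (by simpa using hlt n)
  · exact hF.cont.mono hmem

lemma deriv (hF : JointHol σ F) : JointHol σ (fun τ => _root_.deriv (F τ)) := by
  refine ⟨fun τ => (hF.diff τ).deriv (isOpen_strip σ), fun p hp => ?_⟩
  obtain ⟨ρ, hρ, hball⟩ := Metric.isOpen_iff.1 (isOpen_strip σ) p.2 hp
  have hb2 : Metric.closedBall p.2 (ρ / 2) ⊆ strip σ :=
    (Metric.closedBall_subset_ball (by linarith)).trans hball
  obtain ⟨B, hB⟩ := ((isCompact_closedBall p.1 1).prod
    (isCompact_closedBall p.2 (ρ / 2))).exists_bound_of_continuousOn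
    (hF.cont.mono fun q hq => hb2 hq.2)
  have hsub : ∀ q ∈ Metric.ball p.1 1 ×ˢ Metric.ball p.2 (ρ / 4),
      Metric.ball q.2 (ρ / 4) ⊆ Metric.closedBall p.2 (ρ / 2) := by
    intro q hq w hw
    have h1 := Metric.mem_ball.1 hq.2
    have h2 := Metric.mem_ball.1 hw
    rw [Metric.mem_closedBall]
    linarith [dist_triangle w q.2 p.2]
  have hc := hF.continuousOn_deriv (U := Metric.ball p.1 1 ×ˢ Metric.ball p.2 (ρ / 4))
    (B := B) (by linarith : 0 < ρ / 4) (fun q hq => (hsub q hq).trans hb2)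
    (fun q hq w hw => hB (q.1, w) ⟨Metric.ball_subset_closedBall hq.1, hsub q hq hw⟩)
  refine (hc.continuousAt ?_).continuousWithinAt
  exact (Metric.isOpen_ball.prod Metric.isOpen_ball).mem_nhds
    ⟨Metric.mem_ball_self one_pos, Metric.mem_ball_self (by linarith)⟩

/-- The lift is holomorphic in the initial angle, with the expected derivative. -/
lemma hasDerivAt_lift (hF : JointHol σ F) {z : ℂ} (hz : z ∈ strip σ) :
    HasDerivAt (lift T Ω F) (lift T Ω (fun τ => _root_.deriv (F τ)) z) z := by
  have hF' := hF.deriv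
  obtain ⟨ρ, hρ, hball⟩ := Metric.isOpen_iff.1 (isOpen_strip σ) z hz
  have hb2 : Metric.closedBall z (ρ / 2) ⊆ strip σ :=
    (Metric.closedBall_subset_ball (by linarith)).trans hball
  obtain ⟨B, hB⟩ := ((isCompact_Icc (a := (0 : ℝ)) (b := 1)).prod
    (isCompact_closedBall z (ρ / 2))).exists_bound_of_continuousOn
    (f := fun p : ℝ × ℂ => F (T * p.1) (p.2 + (Ω * p.1 : ℝ)))
    (hF.cont.comp (f := fun p : ℝ × ℂ => ((T * p.1 : ℝ), p.2 + (Ω * p.1 : ℝ))) (by fun_prop)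
      fun p hp => add_real_mem_strip (hb2 hp.2) _)
  have hest : ∀ w ∈ Metric.ball z (ρ / 2),
      ‖lift T Ω F w - lift T Ω F z -
      (w - z) • lift T Ω (fun τ => _root_.deriv (F τ)) z‖ ≤
        4 * B / (ρ / 2) ^ 2 * ‖w - z‖ ^ 2 := by
    intro w hw
    refine norm_le_of fun s => ?_
    have hwS : w ∈ strip σ := hb2 (Metric.ball_subset_closedBall hw)
    simp only [ContinuousMap.sub_apply, ContinuousMap.smul_apply, hF.lift_apply hwS,
      hF.lift_apply hz, hF'.lift_apply hz, smul_eq_mul]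
    have hsub : ∀ u ∈ Metric.ball (z + (Ω * s : ℝ)) (ρ / 2), u - (Ω * s : ℝ) ∈
        Metric.ball z (ρ / 2) := fun u hu => by
      rw [mem_ball_iff_norm] at hu ⊢
      rwa [show u - (Ω * s : ℝ) - z = u - (z + (Ω * s : ℝ)) by ring]
    have ht := norm_taylor_le (f := F (T * s)) (c := z + (Ω * s : ℝ)) (z := w + (Ω * s : ℝ))
      (ρ := ρ / 2) (B := B)
      ((hF.diff _).mono fun u hu => by
        have := add_real_mem_strip (hb2 (Metric.ball_subset_closedBall (hsub u hu))) (Ω * s)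
        rwa [sub_add_cancel] at this)
      (fun u hu => by
        have := hB (s, u - (Ω * s : ℝ)) ⟨s.2, Metric.ball_subset_closedBall (hsub u hu)⟩
        simpa using this)
      (by rw [mem_ball_iff_norm] at hw ⊢; simpa using hw)
    rw [add_sub_add_right_eq_sub, mul_comm (_root_.deriv _ _)] at ht
    exact ht
  rw [hasDerivAt_iff_isLittleO]
  have hO : (fun w => lift T Ω F w - lift T Ω F z -
      (w - z) • lift T Ω (fun τ => _root_.deriv (F τ)) z)
      =O[nhds z] fun w => ‖w - z‖ ^ 2 := by
    refine Asymptotics.IsBigO.of_bound (4 * B / (ρ / 2) ^ 2) ?_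
    filter_upwards [Metric.ball_mem_nhds z (by linarith : 0 < ρ / 2)] with w hw
    rw [norm_pow, norm_norm]
    exact hest w hw
  refine hO.trans_isLittleO ?_
  have := Asymptotics.isLittleO_pow_sub_sub z (m := 2) (by norm_num)
  exact this

end JointHol

namespace LiftData

variable {σ B B' : ℝ} {F G : ℝ → ℂ → ℂ}

lemma mono (hF : LiftData σ B F) {σ' : ℝ} (h : σ' ≤ σ) (hB : B ≤ B') : LiftData σ' B' F :=
  { hF.toJointHol.mono h with
    bound := fun τ z hz => (hF.bound τ z (strip_mono h hz)).trans hB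
    per := fun τ z hz => hF.per τ z (strip_mono h hz)
    real := hF.real }

lemma add (hF : LiftData σ B F) (hG : LiftData σ B' G) :
    LiftData σ (B + B') (fun τ z => F τ z + G τ z) :=
  { hF.toJointHol.add hG.toJointHol with
    bound := fun τ z hz => (norm_add_le _ _).trans (add_le_add (hF.bound τ z hz) (hG.bound τ z hz))
    per := fun τ z hz => by rw [hF.per τ z hz, hG.per τ z hz]
    real := fun τ x => by rw [add_im, hF.real, hG.real, add_zero] }

lemma const_mul (hF : LiftData σ B F) (c : ℝ) :
    LiftData σ (|c| * B) (fun τ z => c * F τ z) :=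
  { hF.toJointHol.const_mul c with
    bound := fun τ z hz => by
      rw [norm_mul, norm_real]
      exact mul_le_mul_of_nonneg_left (hF.bound τ z hz) (abs_nonneg c)
    per := fun τ z hz => by rw [hF.per τ z hz]
    real := fun τ x => by rw [im_ofReal_mul, hF.real, mul_zero] }

lemma mul (hF : LiftData σ B F) (hG : LiftData σ B' G) (hB : 0 ≤ B) :
    LiftData σ (B * B') (fun τ z => F τ z * G τ z) :=
  { hF.toJointHol.mul hG.toJointHol with
    bound := fun τ z hz => by
      rw [norm_mul]
      exact mul_le_mul (hF.bound τ z hz) (hG.bound τ z hz) (norm_nonneg _) hB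
    per := fun τ z hz => by rw [hF.per τ z hz, hG.per τ z hz]
    real := fun τ x => by rw [mul_im, hF.real, hG.real, mul_zero, zero_mul, add_zero] }

lemma deriv (hF : LiftData σ B F) {δ : ℝ} (hδ : 0 < δ) (hδσ : δ < σ) :
    LiftData (σ - δ) (B / δ) (fun τ => _root_.deriv (F τ)) where
  diff τ := ((hF.diff τ).deriv (isOpen_strip σ)).mono (strip_mono (by linarith))
  cont := (hF.toJointHol.deriv.mono (by linarith)).cont
  bound τ z hz := norm_deriv_le_of_strip (hF.diff τ) (hF.bound τ) hδ hz
  per τ z hz := by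
    rw [← deriv_comp_add_const]
    refine Filter.EventuallyEq.deriv_eq ?_
    filter_upwards [strip_mem_nhds (strip_mono (by linarith : σ - δ ≤ σ) hz)] with w hw
    exact hF.per τ w hw
  real τ x := by
    have hx := ofReal_mem_strip (hδ.trans hδσ) x
    have h1 := ((hF.diff τ).differentiableAt (strip_mem_nhds hx)).hasDerivAt.comp_ofReal
    have h2 := Complex.imCLM.hasFDerivAt.comp_hasDerivAt x h1
    have h3 : HasDerivAt (fun y : ℝ => (F τ y).im) 0 x := by
      simp only [hF.real]
      exact hasDerivAt_const x 0
    exact h2.unique h3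

end LiftData

end Sitnikov

namespace Sitnikov

open Set Complex
open TimeCurve

/-- `D` is the partial time derivative of `C`; the shift by whole numbers of time periods amounts
to a rotation of the angle. -/
structure Osc (ω₀ σ : ℝ) (C D : ℝ → ℂ → ℂ) : Prop where
  fst : ∃ B, LiftData σ B C
  snd : ∃ B, LiftData σ B D
  chain : ∀ T Ω : ℝ, ∀ z ∈ strip σ, ∀ s : ℝ, HasDerivAt (fun s : ℝ => C (T * s) (z + (Ω * s : ℝ)))
    (Ω * deriv (C (T * s)) (z + (Ω * s : ℝ)) + T * D (T * s) (z + (Ω * s : ℝ))) s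
  shift : ∀ n : ℕ, ∀ z ∈ strip σ, C (2 * Real.pi * n) z = C 0 (z + (n * ω₀ : ℝ))

namespace Osc

variable {ω₀ σ : ℝ} {C D C' D' : ℝ → ℂ → ℂ}

lemma congr (h : Osc ω₀ σ C D) (hD : ∀ τ z, D' τ z = D τ z) : Osc ω₀ σ C D' := by
  have : D' = D := funext fun τ => funext fun z => hD τ z
  rwa [this]

lemma add (h : Osc ω₀ σ C D) (h' : Osc ω₀ σ C' D') :
    Osc ω₀ σ (fun τ z => C τ z + C' τ z) (fun τ z => D τ z + D' τ z) := by
  obtain ⟨B, hB⟩ := h.fst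
  obtain ⟨B', hB'⟩ := h'.fst
  obtain ⟨E, hE⟩ := h.snd
  obtain ⟨E', hE'⟩ := h'.snd
  refine ⟨⟨_, hB.add hB'⟩, ⟨_, hE.add hE'⟩, fun T Ω z hz s => ?_, fun n z hz => ?_⟩
  · have hm := strip_mem_nhds (add_real_mem_strip hz (Ω * s))
    refine ((h.chain T Ω z hz s).add (h'.chain T Ω z hz s)).congr_deriv ?_
    rw [deriv_fun_add ((hB.diff _).differentiableAt hm) ((hB'.diff _).differentiableAt hm)]
    ring
  · rw [h.shift n z hz, h'.shift n z hz]

lemma const_mul (h : Osc ω₀ σ C D) (c : ℝ) :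
    Osc ω₀ σ (fun τ z => c * C τ z) (fun τ z => c * D τ z) := by
  obtain ⟨B, hB⟩ := h.fst
  obtain ⟨E, hE⟩ := h.snd
  refine ⟨⟨_, hB.const_mul c⟩, ⟨_, hE.const_mul c⟩, fun T Ω z hz s => ?_, fun n z hz => ?_⟩
  · have hm := strip_mem_nhds (add_real_mem_strip hz (Ω * s))
    refine ((h.chain T Ω z hz s).const_mul (c : ℂ)).congr_deriv ?_
    rw [deriv_const_mul _ ((hB.diff _).differentiableAt hm)]
    ring
  · rw [h.shift n z hz]

lemma hol_mul (h : Osc ω₀ σ C D) {v : ℂ → ℂ} {B : ℝ} (hB0 : 0 ≤ B)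
    (hv : LiftData σ B (fun _ => v))
    (hshift : ∀ n : ℕ, ∀ z ∈ strip σ, v (z + (n * ω₀ : ℝ)) = v z) :
    Osc ω₀ σ (fun τ z => v z * C τ z) (fun τ z => v z * D τ z) := by
  obtain ⟨B, hB⟩ := h.fst
  obtain ⟨E, hE⟩ := h.snd
  refine ⟨⟨_, hv.mul hB hB0⟩, ⟨_, hv.mul hE hB0⟩, fun T Ω z hz s => ?_, fun n z hz => ?_⟩
  · have hm := strip_mem_nhds (add_real_mem_strip hz (Ω * s))
    have hvd := (hv.diff 0).differentiableAt hm
    have h1 : HasDerivAt (fun s : ℝ => z + ((Ω * s : ℝ) : ℂ)) (Ω : ℂ) s := by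
      have : HasDerivAt (fun s : ℝ => Ω * s) Ω s := by simpa using (hasDerivAt_id s).const_mul Ω
      simpa using this.ofReal_comp.const_add z
    refine ((hvd.hasDerivAt.comp s h1).mul (h.chain T Ω z hz s)).congr_deriv ?_
    rw [deriv_fun_mul hvd ((hB.diff _).differentiableAt hm)]
    simp only [Function.comp_apply]
    ring
  · rw [h.shift n z hz, hshift n z hz]

end Osc

lemma norm_sin_le_exp (w : ℂ) : ‖sin w‖ ≤ Real.exp |w.im| := by
  have h1 : ‖cexp (-w * I)‖ ≤ Real.exp |w.im| := by
    rw [Complex.norm_exp]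
    exact Real.exp_le_exp.2 (by simpa using le_abs_self w.im)
  have h2 : ‖cexp (w * I)‖ ≤ Real.exp |w.im| := by
    rw [Complex.norm_exp]
    exact Real.exp_le_exp.2 (by simpa using neg_le_abs w.im)
  rw [Complex.sin, norm_div, norm_mul, norm_I, mul_one, Complex.norm_ofNat]
  linarith [norm_sub_le (cexp (-w * I)) (cexp (w * I))]

lemma Angle.add_nat {β b σ : ℝ} {Ψ : ℂ → ℂ} (hΨ : Angle β b σ Ψ) (n : ℕ) {z : ℂ}
    (hz : z ∈ strip σ) : Ψ (z + n) = Ψ z + n * (2 * Real.pi) := by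
  induction n with
  | zero => simp
  | succ n ih =>
    have : z + n ∈ strip σ := by simpa using add_real_mem_strip hz n
    push_cast
    rw [← add_assoc, hΨ.per _ this, ih]
    ring

/-- Compatibility of the angle with the frequency. -/
lemma Angle.add_rotation {β b σ ω₀ : ℝ} {Ψ : ℂ → ℂ} (hΨ : Angle β b σ Ψ) (h : ω₀ = 1 ∨ β = 0)
    (n : ℕ) {z : ℂ} (hz : z ∈ strip σ) :
    Ψ (z + (n * ω₀ : ℝ)) = Ψ z + n * ω₀ * (2 * Real.pi) := by
  rcases h with rfl | h
  · have := hΨ.add_nat n hz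
    simpa using this
  · rw [hΨ.lin h, hΨ.lin h]
    push_cast
    ring

/-- The elementary oscillating functions. -/
lemma Angle.osc_sin {β b σ ω₀ : ℝ} {Ψ : ℂ → ℂ} (hΨ : Angle β b σ Ψ) (h : ω₀ = 1 ∨ β = 0)
    (k : ℕ) (l : ℤ) (θ ν e : ℝ) (hν : ν = k * ω₀ + l) :
    Osc ω₀ σ (fun τ z => (e / ν : ℝ) * sin (k * Ψ z + (ν * τ + θ : ℝ)))
      (fun τ z => (if ν = 0 then 0 else e : ℝ) * cos (k * Ψ z + (ν * τ + θ : ℝ))) := by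
  have hc : ContinuousOn (fun p : ℝ × ℂ => k * Ψ p.2 + ((ν * p.1 + θ : ℝ) : ℂ))
      {p | p.2 ∈ strip σ} := by
    refine ContinuousOn.add (continuousOn_const.mul ?_) (by fun_prop)
    exact hΨ.diff.continuousOn.comp continuousOn_snd fun p hp => hp
  have hbase : ∀ θ : ℝ, LiftData σ (Real.exp (k / 2))
      (fun τ z => sin (k * Ψ z + (ν * τ + θ : ℝ))) := by
    intro θ
    have hc : ContinuousOn (fun p : ℝ × ℂ => k * Ψ p.2 + ((ν * p.1 + θ : ℝ) : ℂ))
        {p | p.2 ∈ strip σ} := by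
      refine ContinuousOn.add (continuousOn_const.mul ?_) (by fun_prop)
      exact hΨ.diff.continuousOn.comp continuousOn_snd fun p hp => hp
    refine ⟨⟨fun τ => ((hΨ.diff.const_mul _).add_const _).csin,
      Complex.continuous_sin.comp_continuousOn hc⟩,
      fun τ z hz => ?_, fun τ z hz => ?_, fun τ x => ?_⟩
    · refine (norm_sin_le_exp _).trans (Real.exp_le_exp.2 ?_)
      rw [add_im, ofReal_im, add_zero, ← ofReal_natCast, im_ofReal_mul, abs_mul, Nat.abs_cast]
      have := hΨ.im_le z hz
      have hk : (0 : ℝ) ≤ k := Nat.cast_nonneg k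
      nlinarith
    · rw [hΨ.per z hz]
      rw [show k * (Ψ z + 2 * Real.pi) + ((ν * τ + θ : ℝ) : ℂ) =
        k * Ψ z + ((ν * τ + θ : ℝ) : ℂ) + k * (2 * Real.pi) by ring]
      exact Complex.sin_add_nat_mul_two_pi _ _
    · have : (k : ℂ) * Ψ x + (ν * τ + θ : ℝ) = ((k * (Ψ x).re + (ν * τ + θ) : ℝ) : ℂ) := by
        apply Complex.ext
        · simp
        · simp [hΨ.real]
      rw [this, ← ofReal_sin, ofReal_im]
  have hcos : ∀ τ z, cos (k * Ψ z + (ν * τ + θ : ℝ)) =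
      sin (k * Ψ z + (ν * τ + (θ + Real.pi / 2) : ℝ)) := by
    intro τ z
    rw [← Complex.sin_add_pi_div_two]
    congr 1
    push_cast
    ring
  refine ⟨⟨_, (hbase θ).const_mul (e / ν)⟩, ?_, fun T Ω z hz s => ?_, fun n z hz => ?_⟩
  · simp only [hcos]
    exact ⟨_, (hbase _).const_mul _⟩
  · have hm := add_real_mem_strip hz (Ω * s)
    have hd : HasDerivAt Ψ (deriv Ψ (z + (Ω * s : ℝ))) (z + (Ω * s : ℝ)) :=
      (hΨ.diff.differentiableAt (strip_mem_nhds hm)).hasDerivAt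
    have h1 : HasDerivAt (fun s : ℝ => z + ((Ω * s : ℝ) : ℂ)) (Ω : ℂ) s := by
      have : HasDerivAt (fun s : ℝ => Ω * s) Ω s := by simpa using (hasDerivAt_id s).const_mul Ω
      simpa using this.ofReal_comp.const_add z
    have h2 : HasDerivAt (fun s : ℝ => ((ν * (T * s) + θ : ℝ) : ℂ)) (ν * T : ℂ) s := by
      have : HasDerivAt (fun s : ℝ => ν * (T * s) + θ) (ν * T) s := by
        have := (((hasDerivAt_id s).const_mul T).const_mul ν).add_const θ
        simpa using this
      simpa using this.ofReal_comp
    have h3 := ((Complex.hasDerivAt_sin _).comp s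
      (((hd.comp s h1).const_mul (k : ℂ)).add h2)).const_mul ((e / ν : ℝ) : ℂ)
    have h4 : deriv (fun w => ((e / ν : ℝ) : ℂ) * sin (k * Ψ w + (ν * (T * s) + θ : ℝ)))
        (z + (Ω * s : ℝ)) = (e / ν : ℝ) * (cos (k * Ψ (z + (Ω * s : ℝ)) + (ν * (T * s) + θ : ℝ)) *
          (k * deriv Ψ (z + (Ω * s : ℝ)))) :=
      ((((hd.const_mul (k : ℂ)).add_const _).csin).const_mul _).deriv
    refine h3.congr_deriv ?_
    rw [h4]
    simp only [Function.comp_apply, Pi.add_apply]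
    by_cases hν0 : ν = 0
    · simp [hν0]
    · have hν' : (ν : ℂ) ≠ 0 := by exact_mod_cast hν0
      simp only [hν0, if_false]
      push_cast
      field_simp
  · congr 1
    rw [hΨ.add_rotation h n hz]
    rw [show (k * (Ψ z + n * ω₀ * (2 * Real.pi)) + ((ν * 0 + θ : ℝ) : ℂ)) =
      k * Ψ z + ((ν * (2 * Real.pi * n) + θ : ℝ) : ℂ) + ((-l * n : ℤ) : ℂ) * (2 * Real.pi) by
        rw [hν]; push_cast; ring]
    exact (Complex.sin_add_int_mul_two_pi _ _).symm

lemma trig_identity (c₀ c₂ u t : ℂ) :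
    3 * c₂ / 8 * cos (2 * t) + c₀ / 2 * cos (2 * u) + c₂ / 4 * cos (2 * u + 2 * t) +
      c₂ / 4 * cos (2 * u - 2 * t) + c₀ / 8 * cos (4 * u) + c₂ / 16 * cos (4 * u + 2 * t) +
      c₂ / 16 * cos (4 * u - 2 * t) = (c₀ + c₂ * cos (2 * t)) * cos u ^ 4 - 3 * c₀ / 8 := by
  have h4 : cos (4 * u) = 8 * cos u ^ 4 - 8 * cos u ^ 2 + 1 := by
    rw [show 4 * u = 2 * (2 * u) by ring, Complex.cos_two_mul, Complex.cos_two_mul]; ring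
  rw [Complex.cos_add, Complex.cos_sub, Complex.cos_add, Complex.cos_sub, h4,
    Complex.cos_two_mul u]
  ring

lemma trig_identity' (c₀ c₂ u t : ℂ) :
    c₀ * sin (2 * u) + c₂ / 2 * sin (2 * u + 2 * t) + c₂ / 2 * sin (2 * u - 2 * t) +
      c₀ / 2 * sin (4 * u) + c₂ / 4 * sin (4 * u + 2 * t) + c₂ / 4 * sin (4 * u - 2 * t) =
      4 * (c₀ + c₂ * cos (2 * t)) * (cos u ^ 3 * sin u) := by
  have h4 : sin (4 * u) = 8 * sin u * cos u ^ 3 - 4 * sin u * cos u := by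
    rw [show 4 * u = 2 * (2 * u) by ring, Complex.sin_two_mul, Complex.sin_two_mul,
      Complex.cos_two_mul]; ring
  rw [Complex.sin_add, Complex.sin_sub, Complex.sin_add, Complex.sin_sub, h4,
    Complex.sin_two_mul u]
  ring

/-- The coefficients of the averaged equation are compatible with the angle. -/
def Compatible (ω₀ c₀ c₂ β : ℝ) : Prop :=
  (ω₀ = 1 ∧ 3 * c₀ / 8 * β = c₂ / 4) ∨ (ω₀ ≠ 1 ∧ β = 0)

lemma Compatible.rotation {ω₀ c₀ c₂ β : ℝ} (h : Compatible ω₀ c₀ c₂ β) : ω₀ = 1 ∨ β = 0 :=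
  h.imp (fun h => h.1) fun h => h.2

/-- The oscillating part of the leading term of the Hamiltonian has a bounded primitive. -/
theorem Angle.exists_osc {β b σ ω₀ c₀ c₂ : ℝ} {Ψ : ℂ → ℂ} (hΨ : Angle β b σ Ψ)
    (hω : 1 / 2 < ω₀) (h : Compatible ω₀ c₀ c₂ β) : ∃ p : ℝ → ℂ → ℂ,
    Osc ω₀ σ p fun τ z => (c₀ + c₂ * cos (2 * τ)) * cos (Ψ z + ω₀ * τ) ^ 4 -
      3 * c₀ / 8 * (1 + β * cos (2 * Ψ z)) := by
  have key := fun (k : ℕ) (l : ℤ) (e : ℝ) => hΨ.osc_sin h.rotation k l 0 (k * ω₀ + l) e rfl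
  have hs := ((((((key 0 2 (3 * c₂ / 8)).add (key 2 0 (c₀ / 2))).add (key 2 2 (c₂ / 4))).add
    (key 2 (-2) (c₂ / 4))).add (key 4 0 (c₀ / 8))).add (key 4 2 (c₂ / 16))).add
    (key 4 (-2) (c₂ / 16))
  refine ⟨_, hs.congr fun τ z => ?_⟩
  have n1 : (2 : ℝ) * ω₀ + 2 ≠ 0 := by linarith
  have n2 : (4 : ℝ) * ω₀ + 2 ≠ 0 := by linarith
  have n3 : (4 : ℝ) * ω₀ + -2 ≠ 0 := by linarith
  have n4 : ω₀ ≠ 0 := by linarith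
  have ht := trig_identity c₀ c₂ (Ψ z + ω₀ * τ) τ
  push_cast
  simp only [n1, n2, n3, n4, zero_mul, zero_add, add_zero, mul_eq_zero, OfNat.ofNat_ne_zero,
    or_self, if_false]
  rw [show (2 : ℂ) * Ψ z + 2 * ω₀ * τ = 2 * (Ψ z + ω₀ * τ) by ring,
    show (2 : ℂ) * Ψ z + (2 * ω₀ + 2) * τ = 2 * (Ψ z + ω₀ * τ) + 2 * τ by ring,
    show (2 : ℂ) * Ψ z + (2 * ω₀ + -2) * τ = 2 * (Ψ z + ω₀ * τ) - 2 * τ by ring,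
    show (4 : ℂ) * Ψ z + 4 * ω₀ * τ = 4 * (Ψ z + ω₀ * τ) by ring,
    show (4 : ℂ) * Ψ z + (4 * ω₀ + 2) * τ = 4 * (Ψ z + ω₀ * τ) + 2 * τ by ring,
    show (4 : ℂ) * Ψ z + (4 * ω₀ + -2) * τ = 4 * (Ψ z + ω₀ * τ) - 2 * τ by ring]
  rcases h with ⟨h1, h2⟩ | ⟨h1, h2⟩
  · have h2' : (3 * c₀ / 8 * β : ℂ) = c₂ / 4 := by exact_mod_cast h2
    have h3 : 2 * (Ψ z + ω₀ * τ) - 2 * τ = 2 * Ψ z := by rw [h1]; push_cast; ring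
    rw [h3] at ht ⊢
    have h4 : (2 : ℝ) * ω₀ + -2 = 0 := by rw [h1]; ring
    simp only [h4, if_true, ofReal_zero]
    push_cast
    linear_combination -ht - cos (2 * Ψ z) * h2'
  · have h4 : (2 : ℝ) * ω₀ + -2 ≠ 0 := fun h => h1 (by linarith)
    simp only [h4, if_false, h2]
    push_cast
    linear_combination -ht

/-- The angular derivative of the oscillating part has a bounded primitive. -/
theorem Angle.exists_osc_deriv {β b σ ω₀ c₀ c₂ : ℝ} {Ψ : ℂ → ℂ} (hΨ : Angle β b σ Ψ)
    (hω : 1 / 2 < ω₀) (h : Compatible ω₀ c₀ c₂ β) : ∃ p : ℝ → ℂ → ℂ,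
    Osc ω₀ σ p fun τ z => -4 * (c₀ + c₂ * cos (2 * τ)) *
      (cos (Ψ z + ω₀ * τ) ^ 3 * sin (Ψ z + ω₀ * τ)) +
      3 * c₀ / 4 * β * sin (2 * Ψ z) := by
  have key := fun (k : ℕ) (l : ℤ) (e : ℝ) =>
    hΨ.osc_sin h.rotation k l (Real.pi / 2) (k * ω₀ + l) e rfl
  have hs := (((((key 2 0 c₀).add (key 2 2 (c₂ / 2))).add
    (key 2 (-2) (c₂ / 2))).add (key 4 0 (c₀ / 2))).add (key 4 2 (c₂ / 4))).add
    (key 4 (-2) (c₂ / 4))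
  refine ⟨_, hs.congr fun τ z => ?_⟩
  have n1 : (2 : ℝ) * ω₀ + 2 ≠ 0 := by linarith
  have n2 : (4 : ℝ) * ω₀ + 2 ≠ 0 := by linarith
  have n3 : (4 : ℝ) * ω₀ + -2 ≠ 0 := by linarith
  have n4 : ω₀ ≠ 0 := by linarith
  have ht := trig_identity' c₀ c₂ (Ψ z + ω₀ * τ) τ
  push_cast
  simp only [n1, n2, n3, n4, add_zero, mul_eq_zero, OfNat.ofNat_ne_zero,
    or_self, if_false, ← add_assoc, Complex.cos_add_pi_div_two]
  rw [show (2 : ℂ) * Ψ z + 2 * ω₀ * τ = 2 * (Ψ z + ω₀ * τ) by ring,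
    show (2 : ℂ) * Ψ z + (2 * ω₀ + 2) * τ = 2 * (Ψ z + ω₀ * τ) + 2 * τ by ring,
    show (2 : ℂ) * Ψ z + (2 * ω₀ + -2) * τ = 2 * (Ψ z + ω₀ * τ) - 2 * τ by ring,
    show (4 : ℂ) * Ψ z + 4 * ω₀ * τ = 4 * (Ψ z + ω₀ * τ) by ring,
    show (4 : ℂ) * Ψ z + (4 * ω₀ + 2) * τ = 4 * (Ψ z + ω₀ * τ) + 2 * τ by ring,
    show (4 : ℂ) * Ψ z + (4 * ω₀ + -2) * τ = 4 * (Ψ z + ω₀ * τ) - 2 * τ by ring]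
  rcases h with ⟨h1, h2⟩ | ⟨h1, h2⟩
  · have h2' : (3 * c₀ / 8 * β : ℂ) = c₂ / 4 := by exact_mod_cast h2
    have h3 : 2 * (Ψ z + ω₀ * τ) - 2 * τ = 2 * Ψ z := by rw [h1]; push_cast; ring
    rw [h3] at ht ⊢
    have h4 : (2 : ℝ) * ω₀ + -2 = 0 := by rw [h1]; ring
    simp only [h4, if_true, ofReal_zero]
    push_cast
    linear_combination ht + 2 * sin (2 * Ψ z) * h2'
  · have h4 : (2 : ℝ) * ω₀ + -2 ≠ 0 := fun h => h1 (by linarith)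
    simp only [h4, if_false, h2]
    push_cast
    linear_combination ht

end Sitnikov

namespace Sitnikov

open Set Complex

open Metric

lemma convex_dmn (R ρ : ℝ) : Convex ℝ (dmn R ρ) := by
  have h1 : Convex ℝ {z : ℂ × ℂ | |z.1.im| < 1 + ρ} := by
    have : {z : ℂ × ℂ | |z.1.im| < 1 + ρ} =
        (imLm.comp (LinearMap.fst ℝ ℂ ℂ)) ⁻¹' ball 0 (1 + ρ) := by
      ext z; simp
    rw [this]
    exact (convex_ball _ _).linear_preimage _
  have h2 : Convex ℝ {z : ℂ × ℂ | ‖z.2‖ < R + ρ} := by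
    have : {z : ℂ × ℂ | ‖z.2‖ < R + ρ} = (LinearMap.snd ℝ ℂ ℂ) ⁻¹' ball 0 (R + ρ) := by
      ext z; simp
    rw [this]
    exact (convex_ball _ _).linear_preimage _
  exact h1.inter h2

namespace HolBdd

variable {R ρ B : ℝ} {G : unitInterval → ℂ × ℂ → ℂ}

lemma norm_sub_le (hG : HolBdd R G (ρ + 1) B) (s : unitInterval) {z w : ℂ × ℂ}
    (hz : z ∈ dmn R ρ) (hw : w ∈ dmn R ρ) : ‖G s z - G s w‖ ≤ B * ‖z - w‖ := by
  have hB : 0 ≤ B := (norm_nonneg _).trans (hG.bound s z (dmn_mono (by linarith) hz))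
  refine (convex_dmn R ρ).norm_image_sub_le_of_norm_fderiv_le (𝕜 := ℂ) (fun x hx =>
    (hG.analytic s x (dmn_mono (by linarith) hx)).differentiableAt) (fun x hx => ?_) hw hz
  refine ContinuousLinearMap.opNorm_le_of_unit_norm hB fun v hv => ?_
  exact hG.norm_dir_le s hx hv.le

lemma sub {G' : unitInterval → ℂ × ℂ → ℂ} {B' ε : ℝ} (hG : HolBdd R G ρ B)
    (hG' : HolBdd R G' ρ B') (h : ∀ s, ∀ z ∈ dmn R ρ, ‖G s z - G' s z‖ ≤ ε) :
    HolBdd R (fun s z => G s z - G' s z) ρ ε where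
  analytic s := (hG.analytic s).sub (hG'.analytic s)
  bound := h
  cont := hG.cont.sub hG'.cont
  real s z hz h1 h2 := by rw [sub_im, hG.real s z hz h1 h2, hG'.real s z hz h1 h2, sub_zero]
  per s z := by rw [hG.per, hG'.per]

lemma dir_sub {G' : unitInterval → ℂ × ℂ → ℂ} {B' : ℝ} (hG : HolBdd R G ρ B)
    (hG' : HolBdd R G' ρ B') (s : unitInterval) {z v : ℂ × ℂ} (hz : z ∈ dmn R ρ) :
    Sitnikov.dir v (fun s z => G s z - G' s z) s z =
      Sitnikov.dir v G s z - Sitnikov.dir v G' s z := by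
  unfold Sitnikov.dir
  rw [fderiv_fun_sub (hG.analytic s z hz).differentiableAt (hG'.analytic s z hz).differentiableAt]
  rfl

lemma norm_dir_sub_dir_le {L : unitInterval → ℂ × ℂ → ℂ} {B' ε : ℝ} (hG : HolBdd R G (ρ + 2) B)
    (hL : HolBdd R L (ρ + 2) B') (h : ∀ s, ∀ z ∈ dmn R (ρ + 2), ‖G s z - L s z‖ ≤ ε)
    (s : unitInterval) {v z w : ℂ × ℂ} (hv : ‖v‖ ≤ 1) (h1 : v.1.im = 0) (h2 : v.2.im = 0)
    (hz : z ∈ dmn R ρ) (hw : w ∈ dmn R ρ) :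
    ‖Sitnikov.dir v G s z - Sitnikov.dir v L s w‖ ≤ ε + B' * ‖z - w‖ := by
  rw [show ρ + 2 = (ρ + 1) + 1 by ring] at hG hL h
  have hz' : z ∈ dmn R (ρ + 1) := dmn_mono (by linarith) hz
  have e1 := (hG.sub hL h).norm_dir_le s hz' hv
  rw [(hG.mono (by linarith)).dir_sub (hL.mono (by linarith)) s hz'] at e1
  have e2 := (hL.dir hv h1 h2).norm_sub_le s hz hw
  calc _ ≤ ‖Sitnikov.dir v G s z - Sitnikov.dir v L s z‖ +
      ‖Sitnikov.dir v L s z - Sitnikov.dir v L s w‖ := norm_sub_le_norm_sub_add_norm_sub ..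
    _ ≤ _ := add_le_add e1 e2

lemma norm_dir_dir_sub_le {L : unitInterval → ℂ × ℂ → ℂ} {B' ε : ℝ} (hG : HolBdd R G (ρ + 3) B)
    (hL : HolBdd R L (ρ + 3) B') (h : ∀ s, ∀ z ∈ dmn R (ρ + 3), ‖G s z - L s z‖ ≤ ε)
    (s : unitInterval) {v z w : ℂ × ℂ} (hv : ‖v‖ ≤ 1) (h1 : v.1.im = 0) (h2 : v.2.im = 0)
    (hz : z ∈ dmn R ρ) (hw : w ∈ dmn R ρ) :
    ‖Sitnikov.dir v (Sitnikov.dir v G) s z - Sitnikov.dir v (Sitnikov.dir v L) s w‖ ≤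
      ε + B' * ‖z - w‖ := by
  rw [show ρ + 3 = (ρ + 2) + 1 by ring] at hG hL h
  refine (hG.dir hv h1 h2).norm_dir_sub_dir_le (hL.dir hv h1 h2) (fun s z hz => ?_) s hv h1 h2 hz hw
  rw [← (hG.mono (by linarith)).dir_sub (hL.mono (by linarith)) s hz]
  exact (hG.sub hL h).norm_dir_le s hz hv

end HolBdd

/-- The leading part of the rescaled Hamiltonian. -/
noncomputable def lead (a c₀ c₂ ω₀ T : ℝ) : unitInterval → ℂ × ℂ → ℂ := fun s z =>
  -a * (c₀ + c₂ * cos (2 * ((T * s : ℝ) : ℂ))) * z.2 ^ 2 *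
    cos (z.1 + ω₀ * ((T * s : ℝ) : ℂ)) ^ 4

lemma norm_cos_ofReal_le (x : ℝ) : ‖cos (x : ℂ)‖ ≤ 1 := by
  rw [← ofReal_cos, norm_real]; exact Real.abs_cos_le_one x

lemma norm_cos_le_exp_abs (z : ℂ) : ‖cos z‖ ≤ Real.exp |z.im| := by
  rw [Complex.cos]
  have h1 : ‖exp (z * I)‖ ≤ Real.exp |z.im| := by
    rw [norm_exp]; simp [neg_le_abs]
  have h2 : ‖exp (-z * I)‖ ≤ Real.exp |z.im| := by
    rw [norm_exp]; simp [le_abs_self]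
  rw [norm_div, norm_ofNat, div_le_iff₀ (by norm_num)]
  linarith [norm_add_le (exp (z * I)) (exp (-z * I))]

lemma holBdd_lead (a c₀ c₂ ω₀ : ℝ) : ∃ B, 0 < B ∧ ∀ T : ℝ,
    HolBdd 2 (lead a c₀ c₂ ω₀ T) 4 B := by
  refine ⟨|a| * (|c₀| + |c₂|) * 6 ^ 2 * Real.exp 5 ^ 4 + 1, by positivity, fun T => ?_⟩
  constructor
  · intro s z _
    unfold lead
    refine AnalyticAt.mul (AnalyticAt.mul analyticAt_const (analyticAt_snd.pow 2)) ?_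
    have h : AnalyticAt ℂ (fun z : ℂ × ℂ => z.1 + ω₀ * ((T * s : ℝ) : ℂ)) z :=
      analyticAt_fst.add analyticAt_const
    exact (AnalyticAt.fun_comp (g := cos) analyticAt_cos h).pow 4
  · rintro s z ⟨h1, h2⟩
    unfold lead
    rw [norm_mul, norm_mul, norm_mul, norm_pow, norm_pow, norm_neg, norm_real, Real.norm_eq_abs]
    have e1 : ‖(c₀ : ℂ) + c₂ * cos (2 * ((T * s : ℝ) : ℂ))‖ ≤ |c₀| + |c₂| := by
      refine (norm_add_le _ _).trans ?_
      rw [norm_mul, norm_real, norm_real, Real.norm_eq_abs, Real.norm_eq_abs]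
      have := norm_cos_ofReal_le (2 * (T * s))
      rw [ofReal_mul, ofReal_ofNat] at this
      exact add_le_add le_rfl (mul_le_of_le_one_right (abs_nonneg _) this)
    have e2 : ‖cos (z.1 + ω₀ * ((T * s : ℝ) : ℂ))‖ ≤ Real.exp 5 := by
      refine (norm_cos_le_exp_abs _).trans (Real.exp_le_exp.2 ?_)
      have : (z.1 + ω₀ * ((T * s : ℝ) : ℂ)).im = z.1.im := by
        rw [← ofReal_mul, add_im, ofReal_im, add_zero]
      rw [this]; linarith
    have e3 : ‖z.2‖ ≤ 6 := by linarith
    refine le_trans (b := |a| * (|c₀| + |c₂|) * 6 ^ 2 * Real.exp 5 ^ 4) ?_ (by linarith)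
    gcongr
  · unfold lead
    exact Continuous.continuousOn (by fun_prop)
  · intro s z _ h1 h2
    have e1 : z.1 = (z.1.re : ℂ) := by apply Complex.ext <;> simp [h1]
    have e2 : z.2 = (z.2.re : ℂ) := by apply Complex.ext <;> simp [h2]
    unfold lead
    rw [e1, e2]
    norm_cast
  · intro s z
    unfold lead
    congr 2
    · simp
    · simp only [Prod.fst_add]
      rw [add_right_comm, cos_add_two_pi]

lemma hasDerivAt_comp_add_smul {F : ℂ × ℂ → ℂ} {z : ℂ × ℂ} (hF : DifferentiableAt ℂ F z)
    (v : ℂ × ℂ) : HasDerivAt (fun τ : ℂ => F (z + τ • v)) (fderiv ℂ F z v) 0 := by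
  have h1 : HasDerivAt (fun τ : ℂ => z + τ • v) v 0 := by
    simpa using ((hasDerivAt_id (0 : ℂ)).smul_const v).const_add z
  refine HasFDerivAt.comp_hasDerivAt (l := F) (0 : ℂ) ?_ h1
  simpa using hF.hasFDerivAt

lemma dir_fst_lead (a c₀ c₂ ω₀ T : ℝ) (s : unitInterval) (z : ℂ × ℂ) :
    dir (1, 0) (lead a c₀ c₂ ω₀ T) s z = a * z.2 ^ 2 *
      (4 * (c₀ + c₂ * cos (2 * ((T * s : ℝ) : ℂ))) * (cos (z.1 + ω₀ * ((T * s : ℝ) : ℂ)) ^ 3 *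
        sin (z.1 + ω₀ * ((T * s : ℝ) : ℂ)))) := by
  have hd : HasDerivAt (fun τ : ℂ => lead a c₀ c₂ ω₀ T s (z + τ • ((1, 0) : ℂ × ℂ)))
      (dir (1, 0) (lead a c₀ c₂ ω₀ T) s z) 0 := by
    have hA : DifferentiableAt ℂ (lead a c₀ c₂ ω₀ T s) z := by
      unfold lead; fun_prop
    exact hasDerivAt_comp_add_smul hA _
  refine hd.unique ?_
  unfold lead
  have h2 : HasDerivAt (fun τ : ℂ => z.1 + τ + ω₀ * ((T * s : ℝ) : ℂ)) 1 0 :=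
    ((hasDerivAt_id (0 : ℂ)).const_add z.1).add_const _
  have h3 := (h2.ccos.pow 4).const_mul
    (-a * (c₀ + c₂ * cos (2 * ((T * s : ℝ) : ℂ))) * z.2 ^ 2)
  refine (h3.congr_deriv ?_).congr_of_eventuallyEq (Filter.Eventually.of_forall fun τ => ?_)
  · simp only [add_zero]; push_cast; ring
  · simp

lemma dir_snd_lead (a c₀ c₂ ω₀ T : ℝ) (s : unitInterval) (z : ℂ × ℂ) :
    dir (0, 1) (lead a c₀ c₂ ω₀ T) s z = -2 * a * z.2 *
      ((c₀ + c₂ * cos (2 * ((T * s : ℝ) : ℂ))) * cos (z.1 + ω₀ * ((T * s : ℝ) : ℂ)) ^ 4) := by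
  have hd : HasDerivAt (fun τ : ℂ => lead a c₀ c₂ ω₀ T s (z + τ • ((0, 1) : ℂ × ℂ)))
      (dir (0, 1) (lead a c₀ c₂ ω₀ T) s z) 0 := by
    have hA : DifferentiableAt ℂ (lead a c₀ c₂ ω₀ T s) z := by
      unfold lead; fun_prop
    exact hasDerivAt_comp_add_smul hA _
  refine hd.unique ?_
  unfold lead
  have h2 : HasDerivAt (fun τ : ℂ => z.2 + τ) 1 0 := (hasDerivAt_id (0 : ℂ)).const_add z.2
  have h3 := ((h2.pow 2).const_mul
    (-a * (c₀ + c₂ * cos (2 * ((T * s : ℝ) : ℂ))))).mul_const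
      (cos (z.1 + ω₀ * ((T * s : ℝ) : ℂ)) ^ 4)
  refine (h3.congr_deriv ?_).congr_of_eventuallyEq (Filter.Eventually.of_forall fun τ => ?_)
  · simp only [add_zero]; push_cast; ring
  · simp

lemma dir_snd_dir_snd_lead (a c₀ c₂ ω₀ T : ℝ) (s : unitInterval) (z : ℂ × ℂ) :
    dir (0, 1) (dir (0, 1) (lead a c₀ c₂ ω₀ T)) s z = -2 * a *
      ((c₀ + c₂ * cos (2 * ((T * s : ℝ) : ℂ))) * cos (z.1 + ω₀ * ((T * s : ℝ) : ℂ)) ^ 4) := by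
  have e : dir (0, 1) (lead a c₀ c₂ ω₀ T) s = fun z => -2 * a * z.2 *
      ((c₀ + c₂ * cos (2 * ((T * s : ℝ) : ℂ))) * cos (z.1 + ω₀ * ((T * s : ℝ) : ℂ)) ^ 4) :=
    funext fun z => dir_snd_lead ..
  have hd : HasDerivAt (fun τ : ℂ => dir (0, 1) (lead a c₀ c₂ ω₀ T) s (z + τ • ((0, 1) : ℂ × ℂ)))
      (dir (0, 1) (dir (0, 1) (lead a c₀ c₂ ω₀ T)) s z) 0 := by
    have hA : DifferentiableAt ℂ (dir (0, 1) (lead a c₀ c₂ ω₀ T) s) z := by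
      rw [e]; fun_prop
    exact hasDerivAt_comp_add_smul hA _
  refine hd.unique ?_
  rw [e]
  have h2 : HasDerivAt (fun τ : ℂ => z.2 + τ) 1 0 := (hasDerivAt_id (0 : ℂ)).const_add z.2
  have h3 := (h2.const_mul (-2 * (a : ℂ))).mul_const
    ((c₀ + c₂ * cos (2 * ((T * s : ℝ) : ℂ))) * cos (z.1 + ω₀ * ((T * s : ℝ) : ℂ)) ^ 4)
  refine (h3.congr_deriv ?_).congr_of_eventuallyEq (Filter.Eventually.of_forall fun τ => ?_)
  · ring
  · simp

end Sitnikov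

namespace Sitnikov

open Set Complex

open TimeCurve

/-- A function of a complex angle plus an oscillating perturbation. -/
noncomputable def pert (f : ℂ → ℂ) (c : ℝ) (C : ℝ → ℂ → ℂ) : ℝ → ℂ → ℂ :=
  fun τ z => f z + c * C τ z

/-- The velocity of a perturbed function along straight lines. -/
noncomputable def pertVel (f : ℂ → ℂ) (c T Ω : ℝ) (C D : ℝ → ℂ → ℂ) : ℝ → ℂ → ℂ :=
  fun τ z => Ω * deriv f z + c * (Ω * deriv (C τ) z + T * D τ z)

section

variable {ω₀ σ c T Ω : ℝ} {f : ℂ → ℂ} {C D : ℝ → ℂ → ℂ}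

lemma jointHol_pert (hf : DifferentiableOn ℂ f (strip σ)) (h : Osc ω₀ σ C D) :
    JointHol σ (pert f c C) := by
  obtain ⟨B, hB⟩ := h.fst
  exact (JointHol.of_hol hf).add (hB.toJointHol.const_mul c)

lemma jointHol_pertVel (hf : DifferentiableOn ℂ f (strip σ)) (h : Osc ω₀ σ C D) :
    JointHol σ (pertVel f c T Ω C D) := by
  obtain ⟨B, hB⟩ := h.fst
  obtain ⟨E, hE⟩ := h.snd
  exact ((JointHol.of_hol (hf.deriv (isOpen_strip σ))).const_mul Ω).add
    (((hB.toJointHol.deriv.const_mul Ω).add (hE.toJointHol.const_mul T)).const_mul c)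

lemma isPrim_pert (hf : DifferentiableOn ℂ f (strip σ)) (h : Osc ω₀ σ C D) {z : ℂ}
    (hz : z ∈ strip σ) :
    IsPrim (lift T Ω (pert f c C) z) (lift T Ω (pertVel f c T Ω C D) z) := by
  refine (jointHol_pert hf h).isPrim_lift (jointHol_pertVel hf h) hz fun s => ?_
  have h1 : HasDerivAt (fun s : ℝ => z + ((Ω * s : ℝ) : ℂ)) (Ω : ℂ) s := by
    have := ((hasDerivAt_id s).const_mul Ω).ofReal_comp.const_add z
    simpa using this
  have h2 : HasDerivAt (fun s : ℝ => f (z + ((Ω * s : ℝ) : ℂ)))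
      (deriv f (z + ((Ω * s : ℝ) : ℂ)) * Ω) s :=
    ((hf.differentiableAt (strip_mem_nhds (add_real_mem_strip hz _))).hasDerivAt).comp s h1
  refine (h2.add ((h.chain T Ω z hz s).const_mul (c : ℂ))).congr_deriv ?_
  unfold pertVel
  ring

lemma deriv_pert (hf : DifferentiableOn ℂ f (strip σ)) (h : Osc ω₀ σ C D) {z : ℂ}
    (hz : z ∈ strip σ) (τ : ℝ) : deriv (pert f c C τ) z = deriv f z + c * deriv (C τ) z := by
  obtain ⟨B, hB⟩ := h.fst
  have h2 := ((hB.diff τ).differentiableAt (strip_mem_nhds hz)).hasDerivAt.const_mul (c : ℂ)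
  exact ((hf.differentiableAt (strip_mem_nhds hz)).hasDerivAt.add h2).deriv

lemma lift_pert_apply (hf : DifferentiableOn ℂ f (strip σ)) (h : Osc ω₀ σ C D) {z : ℂ}
    (hz : z ∈ strip σ) (s : unitInterval) : lift T Ω (pert f c C) z s =
      f (z + (Ω * s : ℝ)) + c * C (T * s) (z + (Ω * s : ℝ)) :=
  (jointHol_pert hf h).lift_apply hz s

lemma differentiableOn_lift_pert (hf : DifferentiableOn ℂ f (strip σ)) (h : Osc ω₀ σ C D) :
    DifferentiableOn ℂ (lift T Ω (pert f c C)) (strip σ) := fun _ hz =>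
  ((jointHol_pert hf h).hasDerivAt_lift hz).differentiableAt.differentiableWithinAt

lemma differentiableOn_lift_pertVel (hf : DifferentiableOn ℂ f (strip σ)) (h : Osc ω₀ σ C D) :
    DifferentiableOn ℂ (lift T Ω (pertVel f c T Ω C D)) (strip σ) := fun _ hz =>
  ((jointHol_pertVel hf h).hasDerivAt_lift hz).differentiableAt.differentiableWithinAt

lemma deriv_lift_pert_apply (hf : DifferentiableOn ℂ f (strip σ)) (h : Osc ω₀ σ C D) {z : ℂ}
    (hz : z ∈ strip σ) (s : unitInterval) : deriv (lift T Ω (pert f c C)) z s =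
      deriv f (z + (Ω * s : ℝ)) + c * deriv (C (T * s)) (z + (Ω * s : ℝ)) := by
  rw [((jointHol_pert hf h).hasDerivAt_lift hz).deriv, (jointHol_pert hf h).deriv.lift_apply hz,
    deriv_pert hf h (add_real_mem_strip hz _)]

lemma lift_pertVel_apply (hf : DifferentiableOn ℂ f (strip σ)) (h : Osc ω₀ σ C D) {z : ℂ}
    (hz : z ∈ strip σ) (s : unitInterval) : lift T Ω (pertVel f c T Ω C D) z s =
      Ω * deriv f (z + (Ω * s : ℝ)) + c * (Ω * deriv (C (T * s)) (z + (Ω * s : ℝ)) +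
        T * D (T * s) (z + (Ω * s : ℝ))) :=
  (jointHol_pertVel hf h).lift_apply hz s

lemma lift_pert_add_one (hf : DifferentiableOn ℂ f (strip σ)) (h : Osc ω₀ σ C D) {e : ℂ}
    (he : ∀ z ∈ strip σ, f (z + 1) = f z + e) {z : ℂ} (hz : z ∈ strip σ) :
    lift T Ω (pert f c C) (z + 1) = lift T Ω (pert f c C) z + const e := by
  obtain ⟨B, hB⟩ := h.fst
  ext s
  have h1 : z + 1 + ((Ω * s : ℝ) : ℂ) = z + ((Ω * s : ℝ) : ℂ) + 1 := by ring
  have h2 := add_real_mem_strip hz (Ω * s)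
  have h3 : const e s = e := rfl
  rw [ContinuousMap.add_apply, lift_pert_apply hf h hz, lift_pert_apply hf h
    (add_one_mem_strip hz), h1, he _ h2, hB.per _ _ h2, h3]
  ring

lemma lift_pertVel_add_one (hf : DifferentiableOn ℂ f (strip σ)) (h : Osc ω₀ σ C D) {e : ℂ}
    (he : ∀ z ∈ strip σ, f (z + 1) = f z + e) {z : ℂ} (hz : z ∈ strip σ) :
    lift T Ω (pertVel f c T Ω C D) (z + 1) = lift T Ω (pertVel f c T Ω C D) z := by
  obtain ⟨B, hB⟩ := h.fst
  obtain ⟨E, hE⟩ := h.snd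
  ext s
  have h1 : z + 1 + ((Ω * s : ℝ) : ℂ) = z + ((Ω * s : ℝ) : ℂ) + 1 := by ring
  have h2 := add_real_mem_strip hz (Ω * s)
  have h4 : ∀ {g : ℂ → ℂ} {e : ℂ}, (∀ z ∈ strip σ, g (z + 1) = g z + e) →
      deriv g (z + ((Ω * s : ℝ) : ℂ) + 1) = deriv g (z + ((Ω * s : ℝ) : ℂ)) := fun {g e} hg => by
    rw [← deriv_comp_add_const]
    have : (fun w => g (w + 1)) =ᶠ[nhds (z + ((Ω * s : ℝ) : ℂ))] fun w => g w + e := by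
      filter_upwards [strip_mem_nhds h2] with w hw using hg w hw
    rw [this.deriv_eq, deriv_add_const]
  rw [lift_pertVel_apply hf h hz, lift_pertVel_apply hf h (add_one_mem_strip hz), h1,
    hE.per _ _ h2, h4 he, h4 (g := C (T * s)) (e := 0) fun z hz => by rw [hB.per _ _ hz, add_zero]]

lemma lift_pert_match (hf : DifferentiableOn ℂ f (strip σ)) (h : Osc ω₀ σ C D) {e : ℂ} {n : ℕ}
    (he : ∀ z ∈ strip σ, f (z + (n * ω₀ : ℝ)) = f z + e) {z : ℂ} (hz : z ∈ strip σ)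
    (hT : T = 2 * Real.pi * n) :
    lift T Ω (pert f c C) z 1 + e = lift T Ω (pert f c C) (z + ((Ω + n * ω₀ : ℝ) : ℂ)) 0 := by
  have h2 := add_real_mem_strip hz Ω
  have h3 : z + ((Ω + n * ω₀ : ℝ) : ℂ) + ((0 : ℝ) : ℂ) = z + (Ω : ℂ) + ((n * ω₀ : ℝ) : ℂ) := by
    push_cast; ring
  rw [lift_pert_apply hf h hz, lift_pert_apply hf h (add_real_mem_strip hz _)]
  simp only [Icc.coe_one, Icc.coe_zero, mul_one, mul_zero]
  rw [h3, he _ h2, hT, h.shift n _ h2]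
  ring

lemma deriv_im_eq_zero {g : ℂ → ℂ} (hg : ∀ x : ℝ, (g x).im = 0) {x : ℝ}
    (hd : DifferentiableAt ℂ g x) : (deriv g x).im = 0 := by
  have h2 : HasDerivAt (fun t : ℝ => imCLM (g t)) (imCLM (deriv g x)) x :=
    imCLM.hasFDerivAt.comp_hasDerivAt x hd.hasDerivAt.comp_ofReal
  simp only [imCLM_apply, hg] at h2
  exact h2.unique (hasDerivAt_const x 0)

lemma isSelfAdjoint_lift_pert (hσ : 0 < σ) (hf : DifferentiableOn ℂ f (strip σ))
    (h : Osc ω₀ σ C D) (hr : ∀ x : ℝ, (f x).im = 0) (x : ℝ) :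
    IsSelfAdjoint (lift T Ω (pert f c C) x) := by
  obtain ⟨B, hB⟩ := h.fst
  rw [isSelfAdjoint_iff]
  intro s
  rw [lift_pert_apply hf h (ofReal_mem_strip hσ x), ← ofReal_add, add_im, hr, im_ofReal_mul,
    hB.real, mul_zero, add_zero]

lemma isSelfAdjoint_lift_pertVel (hσ : 0 < σ) (hf : DifferentiableOn ℂ f (strip σ))
    (h : Osc ω₀ σ C D) (hr : ∀ x : ℝ, (f x).im = 0) (x : ℝ) :
    IsSelfAdjoint (lift T Ω (pertVel f c T Ω C D) x) := by
  obtain ⟨B, hB⟩ := h.fst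
  obtain ⟨E, hE⟩ := h.snd
  rw [isSelfAdjoint_iff]
  intro s
  have hm := strip_mem_nhds (ofReal_mem_strip hσ (x + Ω * s))
  rw [lift_pertVel_apply hf h (ofReal_mem_strip hσ x), ← ofReal_add, add_im, im_ofReal_mul,
    im_ofReal_mul, add_im, im_ofReal_mul, im_ofReal_mul, hE.real,
    deriv_im_eq_zero hr (hf.differentiableAt hm),
    deriv_im_eq_zero (hB.real _) ((hB.diff _).differentiableAt hm)]
  simp

end

end Sitnikov

namespace Sitnikov

open Set Complex

open TimeCurve

lemma TimeCurve.mean_const (c : ℂ) : mean (const c) = c := by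
  have h : ∀ t, ext (const c) t = c := fun t => rfl
  simp [mean_apply, primitive_apply, h]

namespace Angle

variable {β b σ ω₀ : ℝ} {Ψ : ℂ → ℂ}

lemma deriv_ne_zero (hΨ : Angle β b σ Ψ) {z : ℂ} (hz : z ∈ strip σ) : deriv Ψ z ≠ 0 := fun h => by
  have := hΨ.re_deriv z hz
  rw [h, zero_re] at this
  linarith

lemma norm_inv_deriv_le (hΨ : Angle β b σ Ψ) {z : ℂ} (hz : z ∈ strip σ) :
    ‖(deriv Ψ z)⁻¹‖ ≤ 1 / 2 := by
  rw [norm_inv, ← one_div]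
  exact one_div_le_one_div_of_le two_pos ((hΨ.re_deriv z hz).trans (re_le_norm _))

lemma deriv_two (hΨ : Angle β b σ Ψ) {z : ℂ} (hz : z ∈ strip σ) :
    HasDerivAt (deriv Ψ) (-(b * β * sin (2 * Ψ z))) z := by
  have hm := strip_mem_nhds hz
  have h1 : HasDerivAt (deriv Ψ) (deriv (deriv Ψ) z) z :=
    ((hΨ.diff.deriv (isOpen_strip σ)).differentiableAt hm).hasDerivAt
  have h0 : HasDerivAt Ψ (deriv Ψ z) z := (hΨ.diff.differentiableAt hm).hasDerivAt
  have h2 := h1.pow 2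
  have h3 := (((h0.const_mul 2).ccos.const_mul (β : ℂ)).const_add 1).const_mul (b : ℂ)
  have h4 : (fun w => deriv Ψ w ^ 2) =ᶠ[nhds z] fun w => b * (1 + β * cos (2 * Ψ w)) := by
    filter_upwards [hm] with w hw using hΨ.sq w hw
  have h5 := h2.unique (h3.congr_of_eventuallyEq h4)
  have h6 : deriv (deriv Ψ) z = -(b * β * sin (2 * Ψ z)) := by
    apply mul_left_cancel₀ (mul_ne_zero two_ne_zero (hΨ.deriv_ne_zero hz))
    norm_num at h5
    linear_combination h5
  rwa [h6] at h1

lemma hasDerivAt_inv_deriv (hΨ : Angle β b σ Ψ) {z : ℂ} (hz : z ∈ strip σ) :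
    HasDerivAt (fun w => (deriv Ψ w)⁻¹) ((deriv Ψ z)⁻¹ ^ 2 * (b * β * sin (2 * Ψ z))) z := by
  refine ((hΨ.deriv_two hz).inv (hΨ.deriv_ne_zero hz)).congr_deriv ?_
  rw [neg_neg, inv_pow, div_eq_inv_mul]

lemma inv_sq_mul (hΨ : Angle β b σ Ψ) {z : ℂ} (hz : z ∈ strip σ) :
    (deriv Ψ z)⁻¹ ^ 2 * (b * (1 + β * cos (2 * Ψ z))) = 1 := by
  rw [← hΨ.sq z hz, ← mul_pow, inv_mul_cancel₀ (hΨ.deriv_ne_zero hz), one_pow]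

lemma deriv_add {x : ℝ} {e : ℂ}
    (h : ∀ z ∈ strip σ, Ψ (z + x) = Ψ z + e) {z : ℂ} (hz : z ∈ strip σ) :
    deriv Ψ (z + x) = deriv Ψ z := by
  rw [← deriv_comp_add_const]
  have : (fun w => Ψ (w + x)) =ᶠ[nhds z] fun w => Ψ w + e := by
    filter_upwards [strip_mem_nhds hz] with w hw using h w hw
  rw [this.deriv_eq, deriv_add_const]

lemma liftData_inv_deriv (hσ : 0 < σ) (hΨ : Angle β b σ Ψ) :
    LiftData σ (1 / 2) (fun _ z => (deriv Ψ z)⁻¹) where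
  toJointHol := JointHol.of_hol fun _ hz =>
    (hΨ.hasDerivAt_inv_deriv hz).differentiableAt.differentiableWithinAt
  bound _ _ hz := hΨ.norm_inv_deriv_le hz
  per _ z hz := by
    have h : ∀ z ∈ strip σ, Ψ (z + (1 : ℝ)) = Ψ z + 2 * Real.pi := by simpa using hΨ.per
    have := deriv_add h hz
    rw [ofReal_one] at this
    rw [this]
  real _ x := by
    have := deriv_im_eq_zero hΨ.real
      (hΨ.diff.differentiableAt (strip_mem_nhds (ofReal_mem_strip hσ x)))
    rw [inv_im, this, neg_zero, zero_div]

lemma inv_deriv_add (hΨ : Angle β b σ Ψ) (h : ω₀ = 1 ∨ β = 0) (n : ℕ) {z : ℂ}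
    (hz : z ∈ strip σ) : (deriv Ψ (z + (n * ω₀ : ℝ)))⁻¹ = (deriv Ψ z)⁻¹ := by
  rw [deriv_add (fun z hz => hΨ.add_rotation h n hz) hz]

end Angle

lemma Osc.exists_bound {σ ω₀ : ℝ} {C D : ℝ → ℂ → ℂ} (hσ : 0 < σ) (h : Osc ω₀ σ C D) :
    ∃ P, 0 < P ∧ ∀ τ, ∀ z ∈ strip (σ / 2), ‖C τ z‖ ≤ P ∧ ‖deriv (C τ) z‖ ≤ P := by
  obtain ⟨B, hB⟩ := h.fst
  have h0 : 0 ≤ B := (norm_nonneg _).trans (hB.bound 0 _ (ofReal_mem_strip hσ 0))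
  have hd := hB.deriv (half_pos hσ) (half_lt_self hσ)
  rw [sub_half] at hd
  have h1 : 0 ≤ B / (σ / 2) := by positivity
  refine ⟨B + B / (σ / 2) + 1, by positivity, fun τ z hz => ⟨?_, ?_⟩⟩
  · have := hB.bound τ z (strip_mono (by linarith) hz)
    linarith
  · have := hd.bound τ z hz
    linarith

lemma Osc.mono {σ σ' ω₀ : ℝ} {C D : ℝ → ℂ → ℂ} (h : Osc ω₀ σ C D) (hσ : σ' ≤ σ) :
    Osc ω₀ σ' C D where
  fst := h.fst.imp fun _ hB => hB.mono hσ le_rfl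
  snd := h.snd.imp fun _ hB => hB.mono hσ le_rfl
  chain T Ω z hz := h.chain T Ω z (strip_mono hσ hz)
  shift n z hz := h.shift n z (strip_mono hσ hz)

lemma Angle.mono {β b σ σ' : ℝ} {Ψ : ℂ → ℂ} (h : Angle β b σ Ψ) (hσ : σ' ≤ σ) :
    Angle β b σ' Ψ where
  diff := h.diff.mono (strip_mono hσ)
  per z hz := h.per z (strip_mono hσ hz)
  real := h.real
  im_le z hz := h.im_le z (strip_mono hσ hz)
  sq z hz := h.sq z (strip_mono hσ hz)
  re_deriv z hz := h.re_deriv z (strip_mono hσ hz)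
  norm_deriv z hz := h.norm_deriv z (strip_mono hσ hz)
  lin := h.lin

end Sitnikov

namespace Sitnikov

open Set Complex

open TimeCurve

/-- The oscillating part of the leading term of the Hamiltonian. -/
noncomputable def oscTerm (ω₀ c₀ c₂ β : ℝ) (Ψ : ℂ → ℂ) : ℝ → ℂ → ℂ := fun τ z =>
  (c₀ + c₂ * cos (2 * τ)) * cos (Ψ z + ω₀ * τ) ^ 4 - 3 * c₀ / 8 * (1 + β * cos (2 * Ψ z))

/-- The angular derivative of the oscillating part of the leading term. -/
noncomputable def oscTermDeriv (ω₀ c₀ c₂ β : ℝ) (Ψ : ℂ → ℂ) : ℝ → ℂ → ℂ := fun τ z =>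
  -4 * (c₀ + c₂ * cos (2 * τ)) * (cos (Ψ z + ω₀ * τ) ^ 3 * sin (Ψ z + ω₀ * τ)) +
    3 * c₀ / 4 * β * sin (2 * Ψ z)

/-- Angle variable of the averaged system together with the primitives of the oscillations. -/
structure Seed (a ω₀ c₀ c₂ b β σ P : ℝ) (Ψ : ℂ → ℂ) (C₁ C₂ C₃ : ℝ → ℂ → ℂ) : Prop where
  angle : Angle β b σ Ψ
  osc₁ : Osc ω₀ σ C₁ fun τ z => (deriv Ψ z)⁻¹ * oscTerm ω₀ c₀ c₂ β Ψ τ z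
  osc₂ : Osc ω₀ σ C₂ fun τ z => (deriv Ψ z)⁻¹ * ((deriv Ψ z)⁻¹ * oscTermDeriv ω₀ c₀ c₂ β Ψ τ z)
  osc₃ : Osc ω₀ σ C₃ fun τ z => (deriv Ψ z)⁻¹ * ((deriv Ψ z)⁻¹ * oscTerm ω₀ c₀ c₂ β Ψ τ z)
  bound₁ : ∀ τ, ∀ z ∈ strip σ, ‖C₁ τ z‖ ≤ P ∧ ‖deriv (C₁ τ) z‖ ≤ P
  bound₂ : ∀ τ, ∀ z ∈ strip σ, ‖C₂ τ z‖ ≤ P ∧ ‖deriv (C₂ τ) z‖ ≤ P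
  bound₃ : ∀ τ, ∀ z ∈ strip σ, ‖C₃ τ z‖ ≤ P ∧ ‖deriv (C₃ τ) z‖ ≤ P
  boundv : ∀ z ∈ strip σ, ‖deriv (fun w => (deriv Ψ w)⁻¹) z‖ ≤ P
  rot : ω₀ = 1 ∨ β = 0
  hσ : 0 < σ
  hP : 0 < P
  ha : 0 < a
  hb : 0 < b
  hc₀ : 0 < c₀

theorem exists_seed {a ω₀ c₀ c₂ β : ℝ} (ha : 0 < a) (hc₀ : 0 < c₀) (hω : 1 / 2 < ω₀)
    (hβ : |β| ≤ 27 / 100) (h : Compatible ω₀ c₀ c₂ β) :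
    ∃ b σ P Ψ C₁ C₂ C₃, Seed a ω₀ c₀ c₂ b β σ P Ψ C₁ C₂ C₃ := by
  obtain ⟨b, σ, Ψ, hb, hσ, hΨ⟩ := exists_angle hβ
  obtain ⟨p, hp⟩ := hΨ.exists_osc hω h
  obtain ⟨p', hp'⟩ := hΨ.exists_osc_deriv hω h
  have hv := hΨ.liftData_inv_deriv hσ
  have hs : ∀ n : ℕ, ∀ z ∈ strip σ, (deriv Ψ (z + (n * ω₀ : ℝ)))⁻¹ = (deriv Ψ z)⁻¹ :=
    fun n z hz => hΨ.inv_deriv_add h.rotation n hz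
  have o1 := hp.hol_mul (by norm_num) hv hs
  have o2 := (hp'.hol_mul (by norm_num) hv hs).hol_mul (by norm_num) hv hs
  have o3 := o1.hol_mul (by norm_num) hv hs
  obtain ⟨P1, hP1, b1⟩ := o1.exists_bound hσ
  obtain ⟨P2, hP2, b2⟩ := o2.exists_bound hσ
  obtain ⟨P3, hP3, b3⟩ := o3.exists_bound hσ
  have hvd := hv.deriv (half_pos hσ) (half_lt_self hσ)
  rw [sub_half] at hvd
  have hs2 : σ / 2 ≤ σ := by linarith
  have h0 : 0 < 1 / 2 / (σ / 2) := by positivity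
  refine ⟨b, σ / 2, P1 + P2 + P3 + 1 / 2 / (σ / 2), Ψ, _, _, _, hΨ.mono hs2, o1.mono hs2,
    o2.mono hs2, o3.mono hs2, fun τ z hz => ?_, fun τ z hz => ?_, fun τ z hz => ?_,
    fun z hz => ?_, h.rotation, half_pos hσ, by positivity, ha, hb, hc₀⟩
  · exact ⟨(b1 τ z hz).1.trans (by linarith), (b1 τ z hz).2.trans (by linarith)⟩
  · exact ⟨(b2 τ z hz).1.trans (by linarith), (b2 τ z hz).2.trans (by linarith)⟩
  · exact ⟨(b3 τ z hz).1.trans (by linarith), (b3 τ z hz).2.trans (by linarith)⟩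
  · exact (hvd.bound 0 z hz).trans (by linarith)

namespace Seed

variable {a ω₀ c₀ c₂ b β σ P J T Ω : ℝ} {Ψ : ℂ → ℂ} {C₁ C₂ C₃ : ℝ → ℂ → ℂ}

lemma diff_inv (h : Seed a ω₀ c₀ c₂ b β σ P Ψ C₁ C₂ C₃) (J : ℝ) :
    DifferentiableOn ℂ (fun z => (J : ℂ) * (deriv Ψ z)⁻¹) (strip σ) := fun _ hz =>
  ((h.angle.hasDerivAt_inv_deriv hz).const_mul _).differentiableAt.differentiableWithinAt

lemma norm_pert_le {c : ℝ} {X : ℂ} (hc : |c| ≤ 4 * a) (hT : 0 < T) (hX : ‖X‖ ≤ P)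
    (ha : 0 < a) : ‖((c / T : ℝ) : ℂ) * X‖ ≤ 4 * a * P / T := by
  rw [norm_mul, norm_real, Real.norm_eq_abs, abs_div, abs_of_pos hT, div_mul_eq_mul_div]
  gcongr

lemma abs_fst (h : Seed a ω₀ c₀ c₂ b β σ P Ψ C₁ C₂ C₃) (hJ : J ∈ Icc (1 : ℝ) 2) :
    |-2 * a * J| ≤ 4 * a := by
  have ha := h.ha
  rw [abs_mul, abs_mul, abs_neg, abs_two, abs_of_pos ha, abs_of_pos (by linarith [hJ.1])]
  nlinarith [hJ.2]

lemma abs_snd (h : Seed a ω₀ c₀ c₂ b β σ P Ψ C₁ C₂ C₃) (hJ : J ∈ Icc (1 : ℝ) 2) :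
    |a * J ^ 2| ≤ 4 * a := by
  have ha := h.ha
  rw [abs_of_pos (by have := hJ.1; positivity)]
  have : J ^ 2 ≤ 2 ^ 2 := pow_le_pow_left₀ (by linarith [hJ.1]) hJ.2 2
  nlinarith

lemma close (h : Seed a ω₀ c₀ c₂ b β σ P Ψ C₁ C₂ C₃) (hJ : J ∈ Icc (1 : ℝ) 2) (hT : 0 < T)
    {z : ℂ} (hz : z ∈ strip σ) (s : unitInterval) :
    ‖lift T Ω (pert Ψ (-2 * a * J / T) C₁) z s - Ψ (z + (Ω * s : ℝ))‖ ≤ 4 * a * P / T ∧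
    ‖lift T Ω (pert (fun z => (J : ℂ) * (deriv Ψ z)⁻¹) (a * J ^ 2 / T) C₂) z s -
      J * (deriv Ψ (z + (Ω * s : ℝ)))⁻¹‖ ≤ 4 * a * P / T ∧
    ‖deriv (lift T Ω (pert Ψ (-2 * a * J / T) C₁)) z s - deriv Ψ (z + (Ω * s : ℝ))‖ ≤
      4 * a * P / T ∧
    ‖deriv (lift T Ω (pert (fun z => (J : ℂ) * (deriv Ψ z)⁻¹) (a * J ^ 2 / T) C₂)) z s‖ ≤
      2 * P + 4 * a * P / T := by
  have hw := add_real_mem_strip hz (Ω * s)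
  have hJ0 : |J| ≤ 2 := by rw [abs_of_pos (by linarith [hJ.1])]; exact hJ.2
  rw [lift_pert_apply h.angle.diff h.osc₁ hz, lift_pert_apply (h.diff_inv J) h.osc₂ hz,
    deriv_lift_pert_apply h.angle.diff h.osc₁ hz, deriv_lift_pert_apply (h.diff_inv J) h.osc₂ hz,
    add_sub_cancel_left, add_sub_cancel_left, add_sub_cancel_left]
  refine ⟨norm_pert_le (h.abs_fst hJ) hT (h.bound₁ _ _ hw).1 h.ha,
    norm_pert_le (h.abs_snd hJ) hT (h.bound₂ _ _ hw).1 h.ha,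
    norm_pert_le (h.abs_fst hJ) hT (h.bound₁ _ _ hw).2 h.ha, (norm_add_le _ _).trans
    (add_le_add ?_ (norm_pert_le (h.abs_snd hJ) hT (h.bound₂ _ _ hw).2 h.ha))⟩
  rw [deriv_const_mul _ (h.angle.hasDerivAt_inv_deriv hw).differentiableAt, norm_mul, norm_real,
    Real.norm_eq_abs]
  exact mul_le_mul hJ0 (h.boundv _ hw) (norm_nonneg _) zero_le_two

/-- The velocity of the approximate torus is close to the leading part of the vector field. -/
lemma vel_close (h : Seed a ω₀ c₀ c₂ b β σ P Ψ C₁ C₂ C₃) (hJ : J ∈ Icc (1 : ℝ) 2) (hT : 0 < T)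
    (hΩ : Ω = -2 * a * J * (3 * c₀ / 8) / b) {z : ℂ} (hz : z ∈ strip σ) (s : unitInterval) :
    ‖lift T Ω (pertVel Ψ (-2 * a * J / T) T Ω C₁
        fun τ z => (deriv Ψ z)⁻¹ * oscTerm ω₀ c₀ c₂ β Ψ τ z) z s -
      dir (0, 1) (lead a c₀ c₂ ω₀ T) s
        (Ψ (z + (Ω * s : ℝ)), J * (deriv Ψ (z + (Ω * s : ℝ)))⁻¹)‖ ≤ |Ω| * (4 * a * P / T) ∧
    ‖lift T Ω (pertVel (fun z => (J : ℂ) * (deriv Ψ z)⁻¹) (a * J ^ 2 / T) T Ω C₂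
        fun τ z => (deriv Ψ z)⁻¹ * ((deriv Ψ z)⁻¹ * oscTermDeriv ω₀ c₀ c₂ β Ψ τ z)) z s +
      dir (1, 0) (lead a c₀ c₂ ω₀ T) s
        (Ψ (z + (Ω * s : ℝ)), J * (deriv Ψ (z + (Ω * s : ℝ)))⁻¹)‖ ≤ |Ω| * (4 * a * P / T) := by
  have hw := add_real_mem_strip hz (Ω * s)
  have hTc : (T : ℂ) ≠ 0 := ofReal_ne_zero.2 hT.ne'
  have hbc : (b : ℂ) ≠ 0 := ofReal_ne_zero.2 h.hb.ne'
  have hu := h.angle.deriv_ne_zero hw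
  have hsq := h.angle.inv_sq_mul hw
  have hΩc : (Ω : ℂ) * b = -2 * a * J * (3 * c₀ / 8) := by
    rw [hΩ]; push_cast; field_simp
  rw [lift_pertVel_apply h.angle.diff h.osc₁ hz, lift_pertVel_apply (h.diff_inv J) h.osc₂ hz,
    dir_snd_lead, dir_fst_lead,
    deriv_const_mul _ (h.angle.hasDerivAt_inv_deriv hw).differentiableAt,
    (h.angle.hasDerivAt_inv_deriv hw).deriv]
  generalize z + ((Ω * s : ℝ) : ℂ) = w at *
  have hvu : (deriv Ψ w)⁻¹ * deriv Ψ w = 1 := inv_mul_cancel₀ hu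
  have key : ∀ {c : ℝ} {X : ℂ}, |c| ≤ 4 * a → ‖X‖ ≤ P →
      ‖(Ω : ℂ) * (((c / T : ℝ) : ℂ) * X)‖ ≤ |Ω| * (4 * a * P / T) := fun hc hX => by
    rw [norm_mul, norm_real, Real.norm_eq_abs]
    exact mul_le_mul_of_nonneg_left (norm_pert_le hc hT hX h.ha) (abs_nonneg _)
  refine ⟨le_trans (le_of_eq (congrArg _ ?_)) (key (h.abs_fst hJ) (h.bound₁ (T * s) w hw).2),
    le_trans (le_of_eq (congrArg _ ?_)) (key (h.abs_snd hJ) (h.bound₂ (T * s) w hw).2)⟩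
  · simp only [oscTerm]
    rw [← sub_eq_zero]
    generalize (deriv Ψ w)⁻¹ = v at *
    have e1 : (((-2 * a * J / T : ℝ) : ℂ)) * T = -2 * a * J := by push_cast; field_simp
    have e2 : (Ω : ℂ) * deriv Ψ w + 2 * a * J * v * (3 * c₀ / 8) * (1 + β * cos (2 * Ψ w)) = 0 := by
      have hv0 : v ≠ 0 := fun h0 => by rw [h0, zero_mul] at hvu; exact zero_ne_one hvu
      apply mul_left_cancel₀ hv0
      apply mul_left_cancel₀ hbc
      linear_combination (b : ℂ) * Ω * hvu + 2 * a * J * (3 * c₀ / 8) * hsq + hΩc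
    linear_combination e2 + v * ((c₀ + c₂ * cos (2 * ((T * s : ℝ) : ℂ))) *
      cos (Ψ w + ω₀ * ((T * s : ℝ) : ℂ)) ^ 4 - 3 * c₀ / 8 * (1 + β * cos (2 * Ψ w))) * e1
  · simp only [oscTermDeriv]
    rw [← sub_eq_zero]
    generalize (deriv Ψ w)⁻¹ = v at *
    have e1 : (((a * J ^ 2 / T : ℝ) : ℂ)) * T = a * J ^ 2 := by push_cast; field_simp
    linear_combination v ^ 2 * J * β * sin (2 * Ψ w) * hΩc + v ^ 2 *
      (-4 * (c₀ + c₂ * cos (2 * ((T * s : ℝ) : ℂ))) * (cos (Ψ w + ω₀ * ((T * s : ℝ) : ℂ)) ^ 3 *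
        sin (Ψ w + ω₀ * ((T * s : ℝ) : ℂ))) + 3 * c₀ / 4 * β * sin (2 * Ψ w)) * e1

end Seed

end Sitnikov

namespace Sitnikov

open Set Complex

open TimeCurve

lemma TimeCurve.inverse_apply {F : TimeCurve} {m : ℝ} (hm : 0 < m) (h : ∀ s, m ≤ (F s).re)
    (s : unitInterval) : Ring.inverse F s = (F s)⁻¹ := by
  obtain ⟨U, hU, -⟩ := exists_inverse hm h
  rw [inverse_eq_of_mul_eq_one hU]
  exact eq_inv_of_mul_eq_one_left (congrArg (fun G : TimeCurve => G s) hU)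

lemma norm_inv_sq_sub_le {u w : ℂ} {q : ℝ} (hw : 2 ≤ ‖w‖) (hw' : ‖w‖ ≤ 13) (hu : 1 ≤ ‖u‖)
    (hq : ‖u - w‖ ≤ q) (hq1 : q ≤ 1) : ‖u⁻¹ ^ 2 - w⁻¹ ^ 2‖ ≤ 7 * q := by
  have hu0 : u ≠ 0 := norm_pos_iff.1 (by linarith)
  have hw0 : w ≠ 0 := norm_pos_iff.1 (by linarith)
  have e : u⁻¹ ^ 2 - w⁻¹ ^ 2 = -((u - w) * (u - w + 2 * w)) / (u ^ 2 * w ^ 2) := by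
    field_simp; ring
  have hq0 : 0 ≤ q := (norm_nonneg _).trans hq
  have h1 : ‖u - w + 2 * w‖ ≤ 28 := by
    refine (norm_add_le _ _).trans ?_
    rw [norm_mul, Complex.norm_ofNat]
    linarith
  have h2 : 4 ≤ ‖u‖ ^ 2 * ‖w‖ ^ 2 := by
    have a1 : 1 ≤ ‖u‖ ^ 2 := one_le_pow₀ hu
    have a2 : 2 ^ 2 ≤ ‖w‖ ^ 2 := pow_le_pow_left₀ (by norm_num) hw 2
    nlinarith
  rw [e, norm_div, norm_neg, norm_mul, norm_mul, norm_pow, norm_pow, div_le_iff₀ (by linarith)]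
  have h3 := mul_le_mul hq h1 (norm_nonneg _) hq0
  nlinarith

namespace Seed

variable {a ω₀ c₀ c₂ b β σ P J T Ω : ℝ} {Ψ : ℂ → ℂ} {C₁ C₂ C₃ : ℝ → ℂ → ℂ}

section

variable {R : ℝ} {B B' M : ℝ} {G : unitInterval → ℂ × ℂ → ℂ}

lemma mem_dmn (h : Seed a ω₀ c₀ c₂ b β σ P Ψ C₁ C₂ C₃) (hJ : J ∈ Icc (1 : ℝ) 2) {w φ ι : ℂ}
    (hw : w ∈ strip σ) {q : ℝ} (h1 : ‖φ - Ψ w‖ ≤ q) (h2 : ‖ι - J * (deriv Ψ w)⁻¹‖ ≤ q)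
    (hq : q ≤ 1 / 100) : |φ.im| ≤ 1 / 2 + 1 / 100 ∧ ‖ι‖ ≤ 1 + 1 / 100 ∧ (φ, ι) ∈ dmn 2 1 ∧
      (Ψ w, J * (deriv Ψ w)⁻¹) ∈ dmn 2 1 := by
  have e1 : |φ.im| ≤ 1 / 2 + 1 / 100 := by
    have := (abs_im_le_norm (φ - Ψ w)).trans h1
    rw [sub_im] at this
    have := abs_sub_abs_le_abs_sub φ.im (Ψ w).im
    linarith [h.angle.im_le w hw]
  have e2 : ‖(J : ℂ) * (deriv Ψ w)⁻¹‖ ≤ 1 := by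
    rw [norm_mul, norm_real, Real.norm_eq_abs, abs_of_pos (by linarith [hJ.1])]
    have := mul_le_mul hJ.2 (h.angle.norm_inv_deriv_le hw) (norm_nonneg _) zero_le_two
    linarith
  have e3 : ‖ι‖ ≤ 1 + 1 / 100 := by
    have := norm_sub_norm_le ι (J * (deriv Ψ w)⁻¹)
    linarith
  refine ⟨e1, e3, ⟨?_, ?_⟩, ⟨?_, ?_⟩⟩
  · show |φ.im| < 1 + 1
    linarith
  · show ‖ι‖ < 2 + 1
    linarith
  · show |(Ψ w).im| < 1 + 1
    linarith [h.angle.im_le w hw]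
  · show ‖(J : ℂ) * (deriv Ψ w)⁻¹‖ < 2 + 1
    linarith

lemma twist_close (h : Seed a ω₀ c₀ c₂ b β σ P Ψ C₁ C₂ C₃) (hJ : J ∈ Icc (1 : ℝ) 2) (hT : 0 < T)
    (hG : HolBdd 2 G 4 B) (hL : HolBdd 2 (lead a c₀ c₂ ω₀ T) 4 B')
    (hGL : ∀ s, ∀ z ∈ dmn 2 4, ‖G s z - lead a c₀ c₂ ω₀ T s z‖ ≤ M / T) {φ ι D : TimeCurve}
    {z : ℂ} (hz : z ∈ strip σ) {q : ℝ} (hq : q ≤ 1 / 100) (hqP : 4 * a * P / T ≤ q)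
    (h1 : ∀ s : unitInterval, ‖φ s - Ψ (z + (Ω * s : ℝ))‖ ≤ q)
    (h2 : ∀ s : unitInterval, ‖ι s - J * (deriv Ψ (z + (Ω * s : ℝ)))⁻¹‖ ≤ q)
    (h3 : ∀ s : unitInterval, ‖D s - deriv Ψ (z + (Ω * s : ℝ))‖ ≤ q) :
    ‖mean (op 2 (dir (0, 1) (dir (0, 1) G)) φ ι * Ring.inverse D ^ 2) +
      (2 * a * (3 * c₀ / 8) / b : ℝ)‖ ≤ M / T + 8 * B' * q + (|Ω| + 1) * q := by
  have hB'0 : 0 ≤ B' := by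
    have := hL.bound 0 ((0, 0) : ℂ × ℂ) ⟨by norm_num, by norm_num⟩
    exact (norm_nonneg _).trans this
  have hw : ∀ s : unitInterval, z + ((Ω * s : ℝ) : ℂ) ∈ strip σ := fun s =>
    add_real_mem_strip hz (Ω * s)
  have hm := fun s => h.mem_dmn hJ (hw s) (h1 s) (h2 s) hq
  have hdom : Dom 2 φ ι := ⟨fun s => (hm s).1.trans (by norm_num),
    norm_le_of fun s => (hm s).2.1.trans (by norm_num)⟩
  have hDre : ∀ s, 1 ≤ (D s).re := fun s => by
    have e1 := h.angle.re_deriv _ (hw s)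
    have e2 := (abs_re_le_norm (D s - deriv Ψ (z + (Ω * s : ℝ)))).trans (h3 s)
    rw [sub_re, abs_le] at e2
    linarith
  set X : TimeCurve := lift T Ω (pertVel (fun _ => 0) (1 / T) T Ω C₃
    fun τ z => (deriv Ψ z)⁻¹ * ((deriv Ψ z)⁻¹ * oscTerm ω₀ c₀ c₂ β Ψ τ z)) z with hX
  have hf0 : DifferentiableOn ℂ (fun _ : ℂ => (0 : ℂ)) (strip σ) := differentiableOn_const 0
  have hq4 : 4 * (a * (P / T)) ≤ q := le_trans (le_of_eq (by ring)) hqP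
  have hmean : ‖mean X‖ ≤ 2 * (P / T) := by
    rw [(isPrim_pert hf0 h.osc₃ hz).mean_eq, lift_pert_apply hf0 h.osc₃ hz,
      lift_pert_apply hf0 h.osc₃ hz]
    have key : ∀ {Y : ℂ}, ‖Y‖ ≤ P → ‖0 + ((1 / T : ℝ) : ℂ) * Y‖ ≤ P / T := fun hY => by
      rw [zero_add, norm_mul, norm_real, Real.norm_of_nonneg (by positivity), one_div_mul_eq_div]
      gcongr
    refine (norm_sub_le _ _).trans ?_
    linarith [key (h.bound₃ (T * (1 : unitInterval)) _ (hw 1)).1,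
      key (h.bound₃ (T * (0 : unitInterval)) _ (hw 0)).1]
  have hg : HolBdd 2 (dir (0, 1) (dir (0, 1) G)) 2 B :=
    ((hG.mono (by norm_num : (3 : ℝ) + 1 ≤ 4)).dir (by simp) (by simp) (by simp)
      |>.mono (by norm_num : (2 : ℝ) + 1 ≤ 3)).dir (by simp) (by simp) (by simp)
  have hl : HolBdd 2 (dir (0, 1) (dir (0, 1) (lead a c₀ c₂ ω₀ T))) 2 B' :=
    ((hL.mono (by norm_num : (3 : ℝ) + 1 ≤ 4)).dir (by simp) (by simp) (by simp)
      |>.mono (by norm_num : (2 : ℝ) + 1 ≤ 3)).dir (by simp) (by simp) (by simp)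
  set E : TimeCurve := op 2 (dir (0, 1) (dir (0, 1) G)) φ ι * Ring.inverse D ^ 2 -
    (((-2 * a : ℝ) : ℂ) • X - const ((2 * a * (3 * c₀ / 8) / b : ℝ) : ℂ)) with hE
  have hEn : ‖E‖ ≤ M / T + 8 * B' * q + |Ω| * (2 * (a * (P / T))) := by
    refine norm_le_of fun s => ?_
    have e0 : E s = dir (0, 1) (dir (0, 1) G) s (φ s, ι s) * (D s)⁻¹ ^ 2 -
        (((-2 * a : ℝ) : ℂ) * X s - ((2 * a * (3 * c₀ / 8) / b : ℝ) : ℂ)) := by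
      have := inverse_apply one_pos hDre s
      have h2' := hg.op_apply (by norm_num) hdom s
      simp only [hE, ContinuousMap.sub_apply, ContinuousMap.mul_apply, ContinuousMap.pow_apply,
        ContinuousMap.smul_apply, smul_eq_mul, this, h2']
      rfl
    have e1 := (hG.mono (by norm_num : (1 : ℝ) + 3 ≤ 4)).norm_dir_dir_sub_le (v := (0, 1))
      (hL.mono (by norm_num)) (fun s z hz => hGL s z (dmn_mono (by norm_num) hz)) s (by simp)
      (by simp) (by simp) (hm s).2.2.1 (hm s).2.2.2
    have e2 : ‖(φ s, ι s) - (Ψ (z + (Ω * s : ℝ)), J * (deriv Ψ (z + (Ω * s : ℝ)))⁻¹)‖ ≤ q :=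
      max_le (h1 s) (h2 s)
    have e3 := hl.bound s _ (dmn_mono (by norm_num) (hm s).2.2.2)
    have e4 : ‖dir (0, 1) (dir (0, 1) G) s (φ s, ι s) - dir (0, 1) (dir (0, 1)
        (lead a c₀ c₂ ω₀ T)) s (Ψ (z + (Ω * s : ℝ)), J * (deriv Ψ (z + (Ω * s : ℝ)))⁻¹)‖ ≤
        M / T + B' * q := e1.trans (by gcongr)
    have hDn : 1 ≤ ‖D s‖ := (hDre s).trans (re_le_norm _)
    have e5 := norm_inv_sq_sub_le ((h.angle.re_deriv _ (hw s)).trans (re_le_norm _))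
      (h.angle.norm_deriv _ (hw s)) hDn (h3 s) (by linarith)
    have hDi : ‖(D s)⁻¹ ^ 2‖ ≤ 1 := by
      rw [norm_pow, norm_inv]
      exact pow_le_one₀ (by positivity) (inv_le_one_of_one_le₀ hDn)
    have hXs := lift_pertVel_apply (c := 1 / T) (T := T) (Ω := Ω) hf0 h.osc₃ hz s
    rw [← hX] at hXs
    have hsq := h.angle.inv_sq_mul (hw s)
    have hC := (h.bound₃ (T * s) _ (hw s)).2
    rw [dir_snd_dir_snd_lead] at e3 e4
    rw [e0, hXs, deriv_const]
    generalize z + ((Ω * s : ℝ) : ℂ) = w at *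
    generalize dir (0, 1) (dir (0, 1) G) s (φ s, ι s) = g at *
    have hTc : (T : ℂ) ≠ 0 := ofReal_ne_zero.2 hT.ne'
    have hbc : (b : ℂ) ≠ 0 := ofReal_ne_zero.2 h.hb.ne'
    have e6 : g * (D s)⁻¹ ^ 2 - (((-2 * a : ℝ) : ℂ) * (Ω * 0 + ((1 / T : ℝ) : ℂ) *
        (Ω * deriv (C₃ (T * s)) w + T * ((deriv Ψ w)⁻¹ * ((deriv Ψ w)⁻¹ *
          oscTerm ω₀ c₀ c₂ β Ψ (T * s) w)))) - ((2 * a * (3 * c₀ / 8) / b : ℝ) : ℂ)) =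
        (g - -2 * a * ((c₀ + c₂ * cos (2 * ((T * s : ℝ) : ℂ))) *
          cos (Ψ w + ω₀ * ((T * s : ℝ) : ℂ)) ^ 4)) * (D s)⁻¹ ^ 2 +
        -2 * a * ((c₀ + c₂ * cos (2 * ((T * s : ℝ) : ℂ))) *
          cos (Ψ w + ω₀ * ((T * s : ℝ) : ℂ)) ^ 4) * ((D s)⁻¹ ^ 2 - (deriv Ψ w)⁻¹ ^ 2) +
        (Ω : ℂ) * ((2 * a / T : ℝ) * deriv (C₃ (T * s)) w) := by
      have e7 : ((1 / T : ℝ) : ℂ) * T = 1 := by push_cast; field_simp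
      have e8 : ((2 * a * (3 * c₀ / 8) / b : ℝ) : ℂ) * b = 2 * a * (3 * c₀ / 8) := by
        push_cast; field_simp
      have e9 : ((2 * a / T : ℝ) : ℂ) = 2 * a * ((1 / T : ℝ) : ℂ) := by push_cast; ring
      have e10 : ((-2 * a : ℝ) : ℂ) = -2 * a := by push_cast; ring
      rw [e9, e10]
      simp only [oscTerm]
      generalize (deriv Ψ w)⁻¹ = v at *
      generalize ((2 * a * (3 * c₀ / 8) / b : ℝ) : ℂ) = m at *
      linear_combination 2 * a * v ^ 2 * ((c₀ + c₂ * cos (2 * ((T * s : ℝ) : ℂ))) *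
          cos (Ψ w + ω₀ * ((T * s : ℝ) : ℂ)) ^ 4 - 3 * c₀ / 8 * (1 + β * cos (2 * Ψ w))) * e7 -
          m * hsq + v ^ 2 * (1 + β * cos (2 * Ψ w)) * e8
    rw [e6]
    have n1 := mul_le_mul e4 hDi (norm_nonneg _) ((norm_nonneg _).trans e4)
    have n2 := mul_le_mul e3 e5 (norm_nonneg _) hB'0
    have n3 : ‖((2 * a / T : ℝ) : ℂ) * deriv (C₃ (T * s)) w‖ ≤ 2 * (a * (P / T)) := by
      have ha := h.ha
      rw [norm_mul, norm_real, Real.norm_of_nonneg (by positivity)]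
      calc _ ≤ 2 * a / T * P := by gcongr
        _ = _ := by ring
    have n4 := mul_le_mul_of_nonneg_left n3 (abs_nonneg Ω)
    refine (norm_add₃_le).trans ?_
    rw [norm_mul, norm_mul, norm_mul (Ω : ℂ), norm_real, Real.norm_eq_abs]
    linarith
  have hfin : mean (op 2 (dir (0, 1) (dir (0, 1) G)) φ ι * Ring.inverse D ^ 2) +
      (2 * a * (3 * c₀ / 8) / b : ℝ) = mean E + ((-2 * a : ℝ) : ℂ) * mean X := by
    rw [hE, map_sub, map_sub, map_smul, mean_const, smul_eq_mul]
    ring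
  rw [hfin]
  have ha := h.ha
  have f1 : ‖((-2 * a : ℝ) : ℂ) * mean X‖ ≤ q := by
    rw [norm_mul, norm_real, Real.norm_eq_abs, abs_mul, abs_neg, abs_two, abs_of_pos ha]
    calc _ ≤ 2 * a * (2 * (P / T)) := by gcongr
      _ = 4 * (a * (P / T)) := by ring
      _ ≤ q := hq4
  have f2 : |Ω| * (2 * (a * (P / T))) ≤ |Ω| * q := by
    refine mul_le_mul_of_nonneg_left ?_ (abs_nonneg _)
    have : 0 ≤ a * (P / T) := by have := h.hP; positivity
    linarith
  have f3 := (norm_mean_le E).trans hEn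
  refine (norm_add_le _ _).trans ?_
  linarith

end

end Seed

end Sitnikov

namespace Sitnikov

open Set Complex

open TimeCurve

lemma continuous_twist {R A : ℝ} (h : Ham R A) {φ ι : ℂ → TimeCurve} {σ m : ℝ} (hσ : 0 < σ)
    (hm : 0 < m) (hφ : DifferentiableOn ℂ φ (strip σ)) (hι : DifferentiableOn ℂ ι (strip σ))
    (hd : ∀ z ∈ strip σ, Dom R (φ z) (ι z)) (hre : ∀ z ∈ strip σ, ∀ s, m ≤ (deriv φ z s).re) :
    Continuous fun x : ℝ => mean (h.H22 (φ x) (ι x) * Ring.inverse (deriv φ x) ^ 2) := by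
  have : ContinuousOn (fun z => mean (h.H22 (φ z) (ι z) * Ring.inverse (deriv φ z) ^ 2))
      (strip σ) := by
    refine mean.continuous.comp_continuousOn (ContinuousOn.mul (fun z hz => ?_)
      (ContinuousOn.pow (fun z hz => ?_) 2))
    · have hz4 := strip_mem_nhds hz
      refine (h.taylor_H22.hasDerivAt ?_ (hφ.differentiableAt hz4).hasDerivAt
        (hι.differentiableAt hz4).hasDerivAt).continuousAt.continuousWithinAt
      filter_upwards [hz4] with w hw using hd w hw
    · obtain ⟨U, hU, -⟩ := exists_inverse hm (hre z hz)
      exact (DifferentiableAt.inverse ((hφ.deriv (isOpen_strip σ)).differentiableAt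
        (strip_mem_nhds hz)) (IsUnit.of_mul_eq_one_right _ hU)).continuousAt.continuousWithinAt
  exact this.comp_continuous continuous_ofReal fun x => ofReal_mem_strip hσ x

namespace Seed

variable {a ω₀ c₀ c₂ b β σ P J T Ω : ℝ} {Ψ : ℂ → ℂ} {C₁ C₂ C₃ : ℝ → ℂ → ℂ}
variable {B B' M : ℝ} {G : unitInterval → ℂ × ℂ → ℂ}

lemma err_close (h : Seed a ω₀ c₀ c₂ b β σ P Ψ C₁ C₂ C₃) (hJ : J ∈ Icc (1 : ℝ) 2) (hT : 0 < T)
    (hΩ : Ω = -2 * a * J * (3 * c₀ / 8) / b)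
    (hG : HolBdd 2 G 4 B) (hL : HolBdd 2 (lead a c₀ c₂ ω₀ T) 4 B')
    (hGL : ∀ s, ∀ z ∈ dmn 2 4, ‖G s z - lead a c₀ c₂ ω₀ T s z‖ ≤ M / T) {q : ℝ}
    (hq : q ≤ 1 / 100) (hqP : 4 * a * P / T ≤ q) {z : ℂ} (hz : z ∈ strip σ) :
    ‖lift T Ω (pertVel Ψ (-2 * a * J / T) T Ω C₁
        fun τ z => (deriv Ψ z)⁻¹ * oscTerm ω₀ c₀ c₂ β Ψ τ z) z -
      op 2 (dir (0, 1) G) (lift T Ω (pert Ψ (-2 * a * J / T) C₁) z)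
        (lift T Ω (pert (fun z => (J : ℂ) * (deriv Ψ z)⁻¹) (a * J ^ 2 / T) C₂) z)‖ ≤
        M / T + B' * q + |Ω| * q ∧
    ‖lift T Ω (pertVel (fun z => (J : ℂ) * (deriv Ψ z)⁻¹) (a * J ^ 2 / T) T Ω C₂
        fun τ z => (deriv Ψ z)⁻¹ * ((deriv Ψ z)⁻¹ * oscTermDeriv ω₀ c₀ c₂ β Ψ τ z)) z +
      op 2 (dir (1, 0) G) (lift T Ω (pert Ψ (-2 * a * J / T) C₁) z)
        (lift T Ω (pert (fun z => (J : ℂ) * (deriv Ψ z)⁻¹) (a * J ^ 2 / T) C₂) z)‖ ≤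
        M / T + B' * q + |Ω| * q := by
  have hB'0 : 0 ≤ B' := by
    have := hL.bound 0 ((0, 0) : ℂ × ℂ) ⟨by norm_num, by norm_num⟩
    exact (norm_nonneg _).trans this
  have hw : ∀ s : unitInterval, z + ((Ω * s : ℝ) : ℂ) ∈ strip σ := fun s =>
    add_real_mem_strip hz _
  have hc := fun s => h.close (Ω := Ω) hJ hT hz s
  have hv := fun s => h.vel_close hJ hT hΩ hz s
  have hm := fun s => h.mem_dmn hJ (hw s) ((hc s).1.trans hqP) ((hc s).2.1.trans hqP) hq
  have hg1 : HolBdd 2 (dir (1, 0) G) 3 B :=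
    (hG.mono (by norm_num : (3 : ℝ) + 1 ≤ 4)).dir (by simp) (by simp) (by simp)
  have hg2 : HolBdd 2 (dir (0, 1) G) 3 B :=
    (hG.mono (by norm_num : (3 : ℝ) + 1 ≤ 4)).dir (by simp) (by simp) (by simp)
  set φ := lift T Ω (pert Ψ (-2 * a * J / T) C₁) z
  set ι := lift T Ω (pert (fun z => (J : ℂ) * (deriv Ψ z)⁻¹) (a * J ^ 2 / T) C₂) z
  have hdom : Dom 2 φ ι := ⟨fun s => (hm s).1.trans (by norm_num),
    norm_le_of fun s => (hm s).2.1.trans (by norm_num)⟩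
  have key : ∀ v : ℂ × ℂ, ‖v‖ ≤ 1 → v.1.im = 0 → v.2.im = 0 → ∀ s : unitInterval,
      ‖dir v G s (φ s, ι s) - dir v (lead a c₀ c₂ ω₀ T) s
        (Ψ (z + (Ω * s : ℝ)), J * (deriv Ψ (z + (Ω * s : ℝ)))⁻¹)‖ ≤ M / T + B' * q := by
    intro v h1 h2 h3 s
    have e1 := (hG.mono (by norm_num : (1 : ℝ) + 2 ≤ 4)).norm_dir_sub_dir_le (v := v)
      (hL.mono (by norm_num)) (fun s z hz => hGL s z (dmn_mono (by norm_num) hz)) s h1 h2 h3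
      (hm s).2.2.1 (hm s).2.2.2
    have e2 : ‖(φ s, ι s) - (Ψ (z + (Ω * s : ℝ)), J * (deriv Ψ (z + (Ω * s : ℝ)))⁻¹)‖ ≤ q :=
      max_le ((hc s).1.trans hqP) ((hc s).2.1.trans hqP)
    exact e1.trans (by gcongr)
  have hΩq : |Ω| * (4 * a * P / T) ≤ |Ω| * q := by gcongr
  refine ⟨norm_le_of fun s => ?_, norm_le_of fun s => ?_⟩
  · have k := key (0, 1) (by simp) (by simp) (by simp) s
    have e := (hv s).1.trans hΩq
    rw [ContinuousMap.sub_apply, hg2.op_apply (by norm_num) hdom]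
    rw [norm_sub_rev] at k
    have := norm_sub_le_norm_sub_add_norm_sub (lift T Ω (pertVel Ψ (-2 * a * J / T) T Ω C₁
        fun τ z => (deriv Ψ z)⁻¹ * oscTerm ω₀ c₀ c₂ β Ψ τ z) z s) (dir (0, 1) (lead a c₀ c₂ ω₀ T) s
        (Ψ (z + (Ω * s : ℝ)), J * (deriv Ψ (z + (Ω * s : ℝ)))⁻¹)) (dir (0, 1) G s (φ s, ι s))
    linarith
  · have k := key (1, 0) (by simp) (by simp) (by simp) s
    have e := (hv s).2.trans hΩq
    rw [ContinuousMap.add_apply, hg1.op_apply (by norm_num) hdom]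
    have := (norm_add_le _ _).trans (add_le_add e k)
    rw [add_add_sub_cancel] at this
    linarith

theorem exists_approxTorus (h : Seed a ω₀ c₀ c₂ b β σ P Ψ C₁ C₂ C₃)
    (hΩ : Ω = -2 * a * J * (3 * c₀ / 8) / b) (hJ : J ∈ Icc (1 : ℝ) 2) (hT : 0 < T) {n : ℕ}
    (hTn : T = 2 * Real.pi * n)
    {A κ δ q m : ℝ} (hG : HolBdd 2 G 4 B) (hC : 4 * B ≤ A)
    (hL : HolBdd 2 (lead a c₀ c₂ ω₀ T) 4 B')
    (hGL : ∀ s, ∀ z ∈ dmn 2 4, ‖G s z - lead a c₀ c₂ ω₀ T s z‖ ≤ M / T)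
    (hq : q ≤ 1 / 100) (hqP : 4 * a * P / T ≤ q) (hδ : 0 < δ) (hδσ : 4 * δ ≤ σ)
    (hδ1 : δ ≤ 1 / 52) (hA1 : 14 ≤ A) (hA2 : 2 * P + 1 ≤ A) (hm : m = 2 * a * (3 * c₀ / 8) / b)
    (hA3 : 1 / A ≤ m / 4) (hδm : δ ≤ m / 4)
    (h1 : M / T + B' * q + |Ω| * q ≤ κ * δ ^ 8)
    (h2 : M / T + 8 * B' * q + (|Ω| + 1) * q ≤ m / 2) :
    ∃ φ ι Y Z : ℂ → TimeCurve, ApproxTorus (hG.ham hC) (ω₀ * T) (Ω + n * ω₀) κ δ φ ι Y Z ∧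
      ∀ x : ℝ, ∀ s, 1 / 26 + δ ≤ (ι x s).re := by
  have hss : strip (4 * δ) ⊆ strip σ := strip_mono hδσ
  have hinv : ∀ z ∈ strip σ, (fun z => (J : ℂ) * (deriv Ψ z)⁻¹) (z + 1) =
      (fun z => (J : ℂ) * (deriv Ψ z)⁻¹) z + 0 := fun z hz => by
    have := (Angle.liftData_inv_deriv h.hσ h.angle).per 0 z hz
    simp only at this ⊢
    rw [this, add_zero]
  have hinvn : ∀ z ∈ strip σ, (fun z => (J : ℂ) * (deriv Ψ z)⁻¹) (z + (n * ω₀ : ℝ)) =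
      (fun z => (J : ℂ) * (deriv Ψ z)⁻¹) z + 0 := fun z hz => by
    have := h.angle.inv_deriv_add h.rot n hz
    simp only at this ⊢
    rw [this, add_zero]
  have hrot : ∀ z ∈ strip σ, Ψ (z + (n * ω₀ : ℝ)) = Ψ z + ((ω₀ * T : ℝ) : ℂ) := fun z hz => by
    rw [h.angle.add_rotation h.rot n hz, hTn]; push_cast; ring
  have hinvr : ∀ x : ℝ, ((J : ℂ) * (deriv Ψ x)⁻¹).im = 0 := fun x => by
    have := (Angle.liftData_inv_deriv h.hσ h.angle).real 0 x
    rw [im_ofReal_mul, this, mul_zero]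
  have hdi := h.diff_inv J
  have hc := fun (z : ℂ) (hz : z ∈ strip σ) s => h.close (Ω := Ω) hJ hT hz s
  have herr := fun (z : ℂ) (hz : z ∈ strip σ) => h.err_close hJ hT hΩ hG hL hGL hq hqP hz
  have hmd := fun (z : ℂ) (hz : z ∈ strip σ) (s : unitInterval) =>
    h.mem_dmn hJ (add_real_mem_strip hz (Ω * s)) ((hc z hz s).1.trans hqP)
      ((hc z hz s).2.1.trans hqP) hq
  have htw := fun (z : ℂ) (hz : z ∈ strip σ) => h.twist_close (Ω := Ω) hJ hT hG hL hGL hz hq hqP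
    (fun s => (hc z hz s).1.trans hqP) (fun s => (hc z hz s).2.1.trans hqP)
    (fun s => (hc z hz s).2.2.1.trans hqP)
  have dφ := differentiableOn_lift_pert (c := -2 * a * J / T) (T := T) (Ω := Ω)
    h.angle.diff h.osc₁
  have dι := differentiableOn_lift_pert (c := a * J ^ 2 / T) (T := T) (Ω := Ω) hdi h.osc₂
  have hre : ∀ z ∈ strip σ, ∀ s, 1 ≤
      (deriv (lift T Ω (pert Ψ (-2 * a * J / T) C₁)) z s).re := fun z hz s => by
    have e1 := h.angle.re_deriv _ (add_real_mem_strip hz (Ω * s))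
    have e2 := (abs_re_le_norm _).trans ((hc z hz s).2.2.1.trans hqP)
    rw [sub_re, abs_le] at e2
    linarith
  have hdom : ∀ z ∈ strip σ, Dom 2 (lift T Ω (pert Ψ (-2 * a * J / T) C₁) z)
      (lift T Ω (pert (fun z => (J : ℂ) * (deriv Ψ z)⁻¹) (a * J ^ 2 / T) C₂) z) := fun z hz =>
    ⟨fun s => (hmd z hz s).1.trans (by norm_num),
      norm_le_of fun s => (hmd z hz s).2.1.trans (by norm_num)⟩
  have hA4 : 1 / A ≤ 1 / 14 := one_div_le_one_div_of_le (by norm_num) hA1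
  refine ⟨lift T Ω (pert Ψ (-2 * a * J / T) C₁),
    lift T Ω (pert (fun z => (J : ℂ) * (deriv Ψ z)⁻¹) (a * J ^ 2 / T) C₂),
    lift T Ω (pertVel Ψ (-2 * a * J / T) T Ω C₁
      fun τ z => (deriv Ψ z)⁻¹ * oscTerm ω₀ c₀ c₂ β Ψ τ z),
    lift T Ω (pertVel (fun z => (J : ℂ) * (deriv Ψ z)⁻¹) (a * J ^ 2 / T) T Ω C₂
      fun τ z => (deriv Ψ z)⁻¹ * ((deriv Ψ z)⁻¹ * oscTermDeriv ω₀ c₀ c₂ β Ψ τ z)), ?_, ?_⟩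
  · exact {
      dφ := dφ.mono hss
      dι := dι.mono hss
      dY := (differentiableOn_lift_pertVel h.angle.diff h.osc₁).mono hss
      dZ := (differentiableOn_lift_pertVel hdi h.osc₂).mono hss
      perφ := fun z hz => lift_pert_add_one h.angle.diff h.osc₁ h.angle.per (hss hz)
      perι := fun z hz => by
        have := lift_pert_add_one (c := a * J ^ 2 / T) (T := T) (Ω := Ω) hdi h.osc₂ hinv (hss hz)
        rwa [map_zero, add_zero] at this
      perY := fun z hz => lift_pertVel_add_one h.angle.diff h.osc₁ h.angle.per (hss hz)
      perZ := fun z hz => lift_pertVel_add_one hdi h.osc₂ hinv (hss hz)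
      primφ := fun z hz => isPrim_pert h.angle.diff h.osc₁ (hss hz)
      primι := fun z hz => isPrim_pert hdi h.osc₂ (hss hz)
      matchφ := fun z hz => lift_pert_match h.angle.diff h.osc₁ hrot (hss hz) hTn
      matchι := fun z hz => by
        have := lift_pert_match (c := a * J ^ 2 / T) (Ω := Ω) hdi h.osc₂ hinvn (hss hz) hTn
        rwa [add_zero] at this
      err1 := fun z hz => (herr z (hss hz)).1.trans h1
      err2 := fun z hz => (herr z (hss hz)).2.trans h1
      imφ := fun z hz s => (hmd z (hss hz) s).1.trans (by linarith)
      normι := fun z hz => norm_le_of fun s => (hmd z (hss hz) s).2.1.trans (by linarith)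
      derivφ := fun z hz => norm_le_of fun s => by
        have e1 := h.angle.norm_deriv _ (add_real_mem_strip (hss hz) (Ω * s))
        have e2 := norm_sub_norm_le (deriv (lift T Ω (pert Ψ (-2 * a * J / T) C₁)) z s)
          (deriv Ψ (z + (Ω * s : ℝ)))
        linarith [(hc z (hss hz) s).2.2.1]
      derivι := fun z hz => norm_le_of fun s => by
        linarith [(hc z (hss hz) s).2.2.2]
      re_deriv := fun z hz s => by linarith [hre z (hss hz) s]
      twist := by
        have hcont := continuous_twist (hG.ham hC) h.hσ one_pos dφ dι hdom hre
        have hle := intervalIntegral.norm_integral_le_of_norm_le_const (a := (0 : ℝ)) (b := 1)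
          (C := m / 2) (f := fun x : ℝ => mean ((hG.ham hC).H22
            (lift T Ω (pert Ψ (-2 * a * J / T) C₁) x)
            (lift T Ω (pert (fun z => (J : ℂ) * (deriv Ψ z)⁻¹) (a * J ^ 2 / T) C₂) x) *
            Ring.inverse (deriv (lift T Ω (pert Ψ (-2 * a * J / T) C₁)) x) ^ 2) +
              (m : ℂ)) fun x _ => by
            have := htw x (ofReal_mem_strip h.hσ x)
            rw [← hm] at this
            exact this.trans h2
        rw [intervalIntegral.integral_add (hcont.intervalIntegrable _ _)
          (continuous_const.intervalIntegrable _ _), intervalIntegral.integral_const, sub_zero,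
          one_smul, abs_one, mul_one] at hle
        generalize (∫ x in (0 : ℝ)..1, mean ((hG.ham hC).H22
            (lift T Ω (pert Ψ (-2 * a * J / T) C₁) x)
            (lift T Ω (pert (fun z => (J : ℂ) * (deriv Ψ z)⁻¹) (a * J ^ 2 / T) C₂) x) *
            Ring.inverse (deriv (lift T Ω (pert Ψ (-2 * a * J / T) C₁)) x) ^ 2)) = X at *
        have e1 := norm_sub_norm_le (m : ℂ) (-X)
        have e2 : (m : ℂ) - -X = X + m := by ring
        rw [e2, norm_neg, norm_real, Real.norm_eq_abs] at e1
        linarith [le_abs_self m]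
      realφ := isSelfAdjoint_lift_pert h.hσ h.angle.diff h.osc₁ h.angle.real
      realι := isSelfAdjoint_lift_pert h.hσ hdi h.osc₂ hinvr
      realY := isSelfAdjoint_lift_pertVel h.hσ h.angle.diff h.osc₁ h.angle.real
      realZ := isSelfAdjoint_lift_pertVel h.hσ hdi h.osc₂ hinvr }
  · intro x s
    have e2 := (abs_re_le_norm _).trans ((hc x (ofReal_mem_strip h.hσ x) s).2.1.trans hqP)
    have hw := ofReal_mem_strip h.hσ (x + Ω * s)
    have hx : (x : ℂ) + ((Ω * s : ℝ) : ℂ) = ((x + Ω * s : ℝ) : ℂ) := by push_cast; ring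
    rw [hx] at e2
    have e3 : (deriv Ψ ((x + Ω * s : ℝ) : ℂ)).im = 0 := deriv_im_eq_zero h.angle.real
      (h.angle.diff.differentiableAt (strip_mem_nhds hw))
    have e4 := h.angle.norm_deriv _ hw
    have e5 := h.angle.re_deriv _ hw
    have e6 : deriv Ψ ((x + Ω * s : ℝ) : ℂ) = ((deriv Ψ ((x + Ω * s : ℝ) : ℂ)).re : ℂ) :=
      Complex.ext rfl (by rw [e3, ofReal_im])
    generalize (deriv Ψ ((x + Ω * s : ℝ) : ℂ)).re = u at *
    rw [e6, norm_real, Real.norm_eq_abs, abs_of_pos (by linarith)] at e4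
    rw [e6, sub_re, ← ofReal_inv, ← ofReal_mul, ofReal_re, abs_le] at e2
    have e7 : 1 / 13 ≤ J * u⁻¹ := by
      rw [← div_eq_mul_inv, le_div_iff₀ (by linarith)]
      linarith [hJ.1]
    linarith [e2.1]

end Seed

end Sitnikov

namespace Sitnikov

open Set Complex

open TimeCurve

lemma one_le_abs_mul_sqrt_two_sub (k l : ℤ) (hk : k ≠ 0) :
    1 / (4 * |(k : ℝ)|) ≤ |k * √2 - l| := by
  have hk1 : (1 : ℝ) ≤ |(k : ℝ)| := by exact_mod_cast Int.one_le_abs hk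
  by_contra! hlt
  have h4 : 1 / (4 * |(k : ℝ)|) ≤ 1 / 4 := one_div_le_one_div_of_le (by norm_num) (by linarith)
  have hne : 2 * k ^ 2 - l ^ 2 ≠ 0 := fun h0 => by
    have h1 : (k : ℝ) * √2 - l = 0 ∨ (k : ℝ) * √2 + l = 0 := by
      rw [← mul_eq_zero]
      have : (2 * k ^ 2 - l ^ 2 : ℝ) = 0 := by exact_mod_cast h0
      have h2 := Real.sq_sqrt (zero_le_two (α := ℝ))
      linear_combination this + k ^ 2 * h2
    rcases h1 with h1 | h1
    · exact (irrational_sqrt_two.intCast_mul hk).ne_int l (by linarith)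
    · exact (irrational_sqrt_two.intCast_mul hk).ne_int (-l) (by push_cast; linarith)
  have h1 : (1 : ℝ) ≤ |2 * (k : ℝ) ^ 2 - l ^ 2| := by exact_mod_cast Int.one_le_abs hne
  have h2 : 2 * (k : ℝ) ^ 2 - l ^ 2 = (k * √2 - l) * (k * √2 + l) := by
    have h2 := Real.sq_sqrt (zero_le_two (α := ℝ))
    linear_combination -k ^ 2 * h2
  rw [h2, abs_mul] at h1
  have hs : √2 ≤ 3 / 2 := Real.sqrt_le_iff.2 ⟨by norm_num, by norm_num⟩
  have h3 : |k * √2 + l| ≤ 4 * |(k : ℝ)| := by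
    have e : k * √2 + l = 2 * (k * √2) - (k * √2 - l) := by ring
    rw [e]
    refine (abs_sub _ _).trans ?_
    rw [abs_mul, abs_mul, abs_two, abs_of_nonneg (Real.sqrt_nonneg 2)]
    nlinarith
  have h5 : |k * √2 - l| * |k * √2 + l| < 1 / (4 * |(k : ℝ)|) * (4 * |(k : ℝ)|) :=
    lt_of_le_of_lt (mul_le_mul_of_nonneg_left h3 (abs_nonneg _))
      (mul_lt_mul_of_pos_right hlt (by linarith))
  rw [one_div_mul_cancel (by positivity)] at h5
  linarith

/-- Diophantine numbers with a uniform constant exist in all intervals of a given length. -/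
lemma exists_diophantine {ℓ : ℝ} (hℓ : 0 < ℓ) :
    ∃ γ, 0 < γ ∧ ∀ x : ℝ, ∃ ω ∈ Icc x (x + ℓ), Diophantine γ ω := by
  obtain ⟨m, hm⟩ := exists_nat_one_div_lt hℓ
  set μ : ℝ := m + 1 with hμ
  have hμ0 : 0 < μ := by positivity
  refine ⟨1 / (4 * μ), by positivity, fun x => ⟨(√2 + ⌈μ * x - √2⌉) / μ, ⟨?_, ?_⟩, ?_⟩⟩
  · rw [le_div_iff₀ hμ0]
    linarith [Int.le_ceil (μ * x - √2)]
  · have := Int.ceil_lt_add_one (μ * x - √2)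
    rw [div_le_iff₀ hμ0]
    rw [div_lt_iff₀ hμ0] at hm
    linarith
  · intro k l hk
    have := one_le_abs_mul_sqrt_two_sub k (l * (m + 1) - k * ⌈μ * x - √2⌉) hk
    have e : k * ((√2 + ⌈μ * x - √2⌉) / μ) - l =
        (k * √2 - ((l * (m + 1) - k * ⌈μ * x - √2⌉ : ℤ) : ℝ)) / μ := by
      push_cast
      rw [← hμ]
      field_simp
      ring
    rw [e, abs_div, abs_of_pos hμ0, le_div_iff₀ hμ0]
    refine le_trans (le_of_eq ?_) this
    have : |(k : ℝ)| ≠ 0 := by simpa using hk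
    field_simp

/-- Invariant tori of small perturbations of the leading Hamiltonian. -/
theorem exists_invTorus {a ω₀ c₀ c₂ β M B : ℝ} (ha : 0 < a) (hc₀ : 0 < c₀) (hω : 1 / 2 < ω₀)
    (hβ : |β| ≤ 27 / 100) (hcomp : Compatible ω₀ c₀ c₂ β) (hM : 0 ≤ M) :
    ∃ A, 1 ≤ A ∧ ∃ hC : 4 * B ≤ A, ∃ N : ℕ, ∀ n ≥ N, ∀ G, ∀ hG : HolBdd 2 G 4 B,
      (∀ s, ∀ z ∈ dmn 2 4,
        ‖G s z - lead a c₀ c₂ ω₀ (2 * Real.pi * n) s z‖ ≤ M / (2 * Real.pi * n)) →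
      ∃ (ω : ℝ) (Φ J : ℝ → TimeCurve), InvTorus (hG.ham hC) (ω₀ * (2 * Real.pi * n)) ω Φ J ∧
        ∀ x, Dom 2 (Φ x) (J x) ∧ ∀ s, 1 / 26 ≤ (J x s).re := by
  obtain ⟨b, σ, P, Ψ, C₁, C₂, C₃, h⟩ := exists_seed ha hc₀ hω hβ hcomp
  obtain ⟨B', hB'0, hL⟩ := holBdd_lead a c₀ c₂ ω₀
  have hb := h.hb
  have hP := h.hP
  have hσ := h.hσ
  obtain ⟨m, hm⟩ : ∃ m, m = 2 * a * (3 * c₀ / 8) / b := ⟨_, rfl⟩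
  have hm0 : 0 < m := by rw [hm]; positivity
  obtain ⟨γ, hγ, hdio⟩ := exists_diophantine hm0
  obtain ⟨A, hA⟩ : ∃ A, A = |4 * B| + 2 / γ + 4 / m + 14 + (2 * P + 1) := ⟨_, rfl⟩
  have p1 : 0 < 2 / γ := by positivity
  have p2 : 0 < 4 / m := by positivity
  have p3 := abs_nonneg (4 * B)
  have hA14 : 14 ≤ A := by linarith
  have hA0 : 0 < A := by linarith
  have hAm : 1 / A ≤ m / 4 := by
    rw [div_le_div_iff₀ hA0 four_pos]
    have : 4 / m ≤ A := by linarith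
    rw [div_le_iff₀ hm0] at this
    linarith
  obtain ⟨δ, hδ⟩ : ∃ δ, δ = min (1 / 52) (min (σ / 4) (m / 4)) := ⟨_, rfl⟩
  have hδ0 : 0 < δ := by rw [hδ]; positivity
  have hδ1 : δ ≤ 1 / 52 := hδ ▸ min_le_left _ _
  have hδ2 : δ ≤ σ / 4 := hδ ▸ (min_le_right _ _).trans (min_le_left _ _)
  have hδ3 : δ ≤ m / 4 := hδ ▸ (min_le_right _ _).trans (min_le_right _ _)
  obtain ⟨κ, hκ⟩ : ∃ κ, κ = 1 / (10 ^ 9 * A ^ 23) := ⟨_, rfl⟩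
  have hκ0 : 0 < κ := by rw [hκ]; positivity
  have hκA : 10 ^ 9 * (A ^ 23 * κ) ≤ 1 := by
    rw [hκ]
    exact le_of_eq (by field_simp)
  obtain ⟨E, hE⟩ : ∃ E, E = M + 8 * B' * (4 * a * P) + (2 * m + 1) * (4 * a * P) := ⟨_, rfl⟩
  have hE0 : 0 < E := by rw [hE]; positivity
  obtain ⟨N, hN⟩ := exists_nat_ge (E / (κ * δ ^ 8) + E / (m / 2) + 4 * a * P / (1 / 100))
  refine ⟨A, by linarith, by linarith [le_abs_self (4 * B)], N, fun n hn G hG hGL => ?_⟩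
  have q1 : 0 < E / (κ * δ ^ 8) := by positivity
  have q2 : 0 < E / (m / 2) := by positivity
  have q3 : 0 < 4 * a * P / (1 / 100) := by positivity
  have hnN : (N : ℝ) ≤ n := by exact_mod_cast hn
  have hTn : (n : ℝ) ≤ 2 * Real.pi * n :=
    le_mul_of_one_le_left n.cast_nonneg (by linarith [Real.pi_gt_three])
  obtain ⟨T, hT⟩ : ∃ T, T = 2 * Real.pi * n := ⟨_, rfl⟩
  rw [← hT] at hGL hTn ⊢
  have hT0 : 0 < T := by linarith
  have r1 : E / T ≤ κ * δ ^ 8 := by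
    rw [div_le_comm₀ hT0 (by positivity)]; linarith
  have r2 : E / T ≤ m / 2 := by
    rw [div_le_comm₀ hT0 (by positivity)]; linarith
  have r3 : 4 * a * P / T ≤ 1 / 100 := by
    rw [div_le_comm₀ hT0 (by positivity)]; linarith
  obtain ⟨ω, hω1, hω2⟩ := hdio (n * ω₀ - 2 * m)
  obtain ⟨J, hJ⟩ : ∃ J, J = (n * ω₀ - ω) / m := ⟨_, rfl⟩
  have hJm : J * m = n * ω₀ - ω := by rw [hJ]; field_simp
  have hJ1 : J ∈ Icc (1 : ℝ) 2 := by
    rw [hJ]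
    exact ⟨by rw [le_div_iff₀ hm0]; linarith [hω1.2], by rw [div_le_iff₀ hm0]; linarith [hω1.1]⟩
  obtain ⟨Ω, hΩ⟩ : ∃ Ω, Ω = -2 * a * J * (3 * c₀ / 8) / b := ⟨_, rfl⟩
  have hΩm : Ω = -(J * m) := by rw [hΩ, hm]; ring
  have hΩ2 : |Ω| ≤ 2 * m := by
    rw [hΩm, abs_neg, abs_of_pos (mul_pos (by linarith [hJ1.1]) hm0)]
    exact mul_le_mul_of_nonneg_right hJ1.2 hm0.le
  have hq0 : 0 < 4 * a * P / T := by positivity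
  have hs : M / T + 8 * B' * (4 * a * P / T) + (|Ω| + 1) * (4 * a * P / T) ≤ E / T := by
    have e : E / T = M / T + 8 * B' * (4 * a * P / T) + (2 * m + 1) * (4 * a * P / T) := by
      rw [hE]; ring
    rw [e]
    gcongr
  have hs' : M / T + B' * (4 * a * P / T) + |Ω| * (4 * a * P / T) ≤ E / T := by
    have := mul_pos hB'0 hq0
    linarith
  obtain ⟨φ, ι, Y, Z, hap, hre⟩ := h.exists_approxTorus hΩ hJ1 hT0 hT hG
    (by linarith [le_abs_self (4 * B)]) (hL T) hGL r3 le_rfl hδ0 (by linarith) hδ1 hA14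
    (by linarith) hm hAm hδ3 (hs'.trans r1) (hs.trans r2)
  have hωe : Ω + n * ω₀ = ω := by rw [hΩm]; linarith
  rw [hωe] at hap
  obtain ⟨Φ, J', hinv, hJ'⟩ := hap.exists_invTorus (by linarith) hω2 hγ (by linarith) hδ0
    (by linarith) hκ0.le hκA
  refine ⟨ω, Φ, J', hinv, fun x => ⟨(hJ' x).1, fun s => ?_⟩⟩
  have e := (abs_re_le_norm (J' x s - ι x s)).trans
    (((J' x - ι x).norm_coe_le_norm s).trans (hJ' x).2)
  rw [sub_re, abs_le] at e
  linarith [hre x s, e.1]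

end Sitnikov

namespace Sitnikov

open Set Complex

/-- The entire function `Q ↦ cos √Q`. -/
noncomputable def cosSqrt (Q : ℂ) : ℂ := ∑' n : ℕ, (-1) ^ n * Q ^ n / ((2 * n).factorial : ℂ)

lemma cosSqrt_sq (q : ℂ) : cosSqrt (q ^ 2) = cos q := by
  rw [← (Complex.hasSum_cos q).tsum_eq, cosSqrt]
  simp only [pow_mul]

lemma differentiable_cosSqrt : Differentiable ℂ cosSqrt := by
  intro Q
  have hd : DifferentiableOn ℂ cosSqrt (Metric.ball 0 (‖Q‖ + 1)) := by
    refine Complex.differentiableOn_tsum_of_summable_norm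
      (Real.summable_pow_div_factorial (‖Q‖ + 1)) (fun n => by fun_prop) Metric.isOpen_ball
      fun n w hw => ?_
    rw [mem_ball_zero_iff] at hw
    rw [norm_div, norm_mul, norm_pow, norm_neg, norm_one, one_pow, one_mul, norm_pow, norm_natCast]
    have : (n.factorial : ℝ) ≤ (2 * n).factorial := by
      exact_mod_cast Nat.factorial_le (by lia)
    gcongr
  exact hd.differentiableAt (Metric.isOpen_ball.mem_nhds (by simp))

lemma cosSqrt_ofReal_im (x : ℝ) : (cosSqrt x).im = 0 := by
  have : cosSqrt x = ((∑' n : ℕ, (-1) ^ n * x ^ n / ((2 * n).factorial : ℝ) : ℝ) : ℂ) := by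
    rw [cosSqrt, ofReal_tsum]
    push_cast
    rfl
  rw [this, ofReal_im]

lemma norm_cosSqrt_sub_le {Q : ℂ} (hQ : ‖Q‖ ≤ 1) :
    ‖1 - cosSqrt Q - Q / 2 + Q ^ 2 / 24‖ ≤ ‖Q‖ ^ 3 := by
  obtain ⟨q, rfl⟩ : ∃ q : ℂ, q ^ 2 = Q := by
    obtain ⟨q, hq⟩ := IsAlgClosed.exists_pow_nat_eq Q two_pos
    exact ⟨q, hq⟩
  have hq : ‖q‖ ≤ 1 := by
    rw [norm_pow] at hQ
    nlinarith [norm_nonneg q]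
  rw [cosSqrt_sq]
  have h1 := Complex.exp_bound (x := q * I) (by simpa using hq) (n := 6) (by norm_num)
  have h2 := Complex.exp_bound (x := -q * I) (by simpa using hq) (n := 6) (by norm_num)
  have e : 1 - cos q - q ^ 2 / 2 + (q ^ 2) ^ 2 / 24 =
      -(1 / 2) * ((exp (q * I) - ∑ m ∈ Finset.range 6, (q * I) ^ m / m.factorial) +
        (exp (-q * I) - ∑ m ∈ Finset.range 6, (-q * I) ^ m / m.factorial)) := by
    rw [Complex.cos]
    simp only [Finset.sum_range_succ, Finset.sum_range_zero, Nat.factorial]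
    push_cast
    have : I ^ 4 = 1 := I_pow_four
    linear_combination (-q ^ 4 / 24) * this - (q ^ 2 / 2) * I_sq
  have h3 : (Nat.succ 6 : ℝ) * ((Nat.factorial 6 : ℝ) * (6 : ℕ))⁻¹ ≤ 1 := by
    norm_num [Nat.factorial]
  have h4 : ‖(q ^ 2)‖ ^ 3 = ‖q‖ ^ 6 := by rw [norm_pow, ← pow_mul]
  have h5 : ‖q * I‖ = ‖q‖ := by simp
  have h6 : ‖-q * I‖ = ‖q‖ := by simp
  rw [h5] at h1
  rw [h6] at h2
  have h7 := mul_le_mul_of_nonneg_left h3 (by positivity : (0 : ℝ) ≤ ‖q‖ ^ 6)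
  rw [e, h4, norm_mul, norm_neg, norm_div, norm_one, Complex.norm_ofNat]
  have h8 := (norm_add_le _ _).trans (add_le_add h1 h2)
  linarith

lemma norm_inv_sqrt_sub_le {x : ℂ} (hx : ‖x‖ ≤ 1 / 4) :
    ‖(1 + x) ^ (-(1 / 2) : ℂ) - (1 - x / 2 + 3 * x ^ 2 / 8)‖ ≤ 4 * ‖x‖ ^ 3 := by
  have hre := (abs_re_le_norm x).trans hx
  rw [abs_le] at hre
  have h1re : 0 < (1 + x).re := by rw [add_re, one_re]; linarith
  have hne : 1 + x ≠ 0 := fun h => by rw [h] at h1re; simp at h1re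
  set u := (1 + x) ^ (-(1 / 2) : ℂ) with hu
  set p := 1 - x / 2 + 3 * x ^ 2 / 8 with hp
  have hu2 : u ^ 2 * (1 + x) = 1 := by
    rw [hu, sq, ← cpow_add _ _ hne, show (-(1 / 2) + -(1 / 2) : ℂ) = -1 by norm_num, cpow_neg_one,
      inv_mul_cancel₀ hne]
  have hure : 0 ≤ u.re := by
    rw [hu, cpow_def_of_ne_zero hne, exp_re]
    refine mul_nonneg (Real.exp_pos _).le (Real.cos_nonneg_of_mem_Icc ?_)
    have e : (log (1 + x) * -(1 / 2)).im = -(arg (1 + x) / 2) := by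
      have : (log (1 + x) * -(1 / 2) : ℂ) = ((-(1 / 2) : ℝ) : ℂ) * log (1 + x) := by
        push_cast; ring
      rw [this, im_ofReal_mul, log_im]; ring
    have := abs_le.1 (abs_arg_le_pi (1 + x))
    rw [e]
    constructor <;> linarith [Real.pi_pos]
  have hx2 : ‖x ^ 2‖ ≤ 1 / 16 := by
    rw [norm_pow]; nlinarith [norm_nonneg x]
  have hpre : 1 / 2 ≤ p.re := by
    have e1 := (abs_re_le_norm (x ^ 2)).trans hx2
    rw [abs_le] at e1
    have e2 : p.re = 1 - x.re / 2 + 3 * (x ^ 2).re / 8 := by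
      have : p = 1 - ((1 / 2 : ℝ) : ℂ) * x + ((3 / 8 : ℝ) : ℂ) * x ^ 2 := by
        rw [hp]; push_cast; ring
      rw [this, add_re, sub_re, one_re, re_ofReal_mul, re_ofReal_mul]; ring
    rw [e2]; linarith
  have hsum : 1 / 2 ≤ ‖u + p‖ := by
    refine le_trans ?_ (re_le_norm _)
    rw [add_re]; linarith
  have h34 : 3 / 4 ≤ ‖1 + x‖ := by
    refine le_trans ?_ (re_le_norm _)
    rw [add_re, one_re]; linarith
  have e : (u - p) * ((u + p) * (1 + x)) = -(x ^ 3 * (5 / 8 - 15 / 64 * x + 9 / 64 * x ^ 2)) := by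
    rw [hp]
    linear_combination hu2
  have e2 : ‖(u - p)‖ * (‖u + p‖ * ‖1 + x‖) ≤ ‖x‖ ^ 3 * 1 := by
    rw [← norm_mul, ← norm_mul, e, norm_neg, norm_mul, norm_pow]
    refine mul_le_mul_of_nonneg_left ?_ (by positivity)
    refine (norm_add_le _ _).trans ((add_le_add (norm_sub_le _ _) le_rfl).trans ?_)
    rw [norm_mul, norm_mul]
    norm_num
    rw [← norm_pow]
    linarith
  have e3 : 3 / 8 ≤ ‖u + p‖ * ‖1 + x‖ := by nlinarith
  nlinarith [norm_nonneg (u - p)]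

end Sitnikov

namespace Sitnikov

open Set Complex

lemma norm_two_mul_cosSqrt_le {k κ : ℝ} {Q : ℂ} (hk : |k| ≤ κ) (hQ : ‖Q‖ ≤ 1 / 10) :
    ‖(2 * k : ℝ) * (1 - cosSqrt Q)‖ ≤ 2 * (κ * ‖Q‖) := by
  have h1 := norm_cosSqrt_sub_le (hQ.trans (by norm_num))
  have hQ0 := norm_nonneg Q
  have hQ2 : ‖Q‖ ^ 2 ≤ ‖Q‖ * (1 / 10) := by rw [sq]; gcongr
  have hQ3 : ‖Q‖ ^ 3 ≤ ‖Q‖ * (1 / 100) := by rw [pow_succ' ‖Q‖ 2]; gcongr; linarith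
  have h2 : ‖1 - cosSqrt Q‖ ≤ ‖Q‖ := by
    have e : 1 - cosSqrt Q = (1 - cosSqrt Q - Q / 2 + Q ^ 2 / 24) + (Q / 2 - Q ^ 2 / 24) := by ring
    rw [e]
    have e2 : ‖Q / 2 - Q ^ 2 / 24‖ ≤ ‖Q‖ / 2 + ‖Q‖ ^ 2 / 24 := by
      refine (norm_sub_le _ _).trans (le_of_eq ?_)
      rw [norm_div, norm_div, norm_pow, Complex.norm_ofNat, Complex.norm_ofNat]
    linarith [norm_add_le (1 - cosSqrt Q - Q / 2 + Q ^ 2 / 24) (Q / 2 - Q ^ 2 / 24)]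
  rw [norm_mul, norm_real, Real.norm_eq_abs, abs_mul, abs_two]
  have := mul_le_mul hk h2 (norm_nonneg _) ((abs_nonneg k).trans hk)
  linarith

lemma norm_inv_sqrt_cosSqrt_sub_le {k κ : ℝ} {Q : ℂ} (hk : |k| ≤ κ) (hQ : ‖Q‖ ≤ 1 / 10)
    (hκQ : κ * ‖Q‖ ≤ 1 / 8) :
    ‖(1 + (2 * k : ℝ) * (1 - cosSqrt Q)) ^ (-(1 / 2) : ℂ) -
      (1 - k / 2 * (Q - Q ^ 2 / 12) + 3 * k ^ 2 / 8 * Q ^ 2)‖ ≤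
      (κ + κ ^ 2 + 32 * κ ^ 3) * ‖Q‖ ^ 3 := by
  have hκ : 0 ≤ κ := (abs_nonneg k).trans hk
  have hx := norm_two_mul_cosSqrt_le hk hQ
  have h1 := norm_inv_sqrt_sub_le (hx.trans (by linarith))
  have h2 := norm_cosSqrt_sub_le (hQ.trans (by norm_num))
  have hQ0 := norm_nonneg Q
  obtain ⟨e, he⟩ : ∃ e, e = 1 - cosSqrt Q - Q / 2 + Q ^ 2 / 24 := ⟨_, rfl⟩
  rw [← he] at h2
  have he' : 1 - cosSqrt Q = Q / 2 - Q ^ 2 / 24 + e := by rw [he]; ring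
  have hk2 : k ^ 2 ≤ κ ^ 2 := sq_le_sq' (neg_le_of_abs_le hk) (le_of_abs_le hk)
  have b1 : ‖(k : ℂ) * e‖ ≤ κ * ‖Q‖ ^ 3 := by
    rw [norm_mul, norm_real, Real.norm_eq_abs]; gcongr
  have hQ2 : ‖Q‖ ^ 2 ≤ ‖Q‖ * (1 / 10) := by rw [sq]; gcongr
  have hQ3 : ‖Q‖ ^ 3 ≤ ‖Q‖ * (1 / 100) := by rw [pow_succ' ‖Q‖ 2]; gcongr; linarith
  have hQ32 : ‖Q‖ ^ 3 ≤ ‖Q‖ ^ 2 * (1 / 10) := by rw [pow_succ ‖Q‖ 2]; gcongr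
  have n1 : ‖-Q ^ 2 / 12 + 2 * e‖ ≤ ‖Q‖ ^ 2 * (1 / 2) := by
    refine (norm_add_le _ _).trans ?_
    rw [norm_div, norm_neg, norm_pow, norm_mul, Complex.norm_ofNat, Complex.norm_ofNat]
    linarith [sq_nonneg ‖Q‖]
  have n2 : ‖2 * Q + (-Q ^ 2 / 12 + 2 * e)‖ ≤ ‖Q‖ * 3 := by
    refine (norm_add_le _ _).trans ?_
    rw [norm_mul, Complex.norm_ofNat]
    linarith
  have b2 : ‖((3 * k ^ 2 / 8 : ℝ) : ℂ) * ((-Q ^ 2 / 12 + 2 * e) *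
      (2 * Q + (-Q ^ 2 / 12 + 2 * e)))‖ ≤ κ ^ 2 * ‖Q‖ ^ 3 := by
    rw [norm_mul, norm_real, Real.norm_of_nonneg (by positivity), norm_mul]
    have := mul_le_mul n1 n2 (norm_nonneg _) (by positivity)
    have h3 : 3 * k ^ 2 / 8 ≤ 3 * κ ^ 2 / 8 := by linarith
    have h4 := mul_le_mul h3 this (by positivity) (by positivity)
    refine h4.trans ?_
    have : 0 ≤ κ ^ 2 * ‖Q‖ ^ 3 := by positivity
    linarith
  have b3 : 4 * ‖((2 * k : ℝ) : ℂ) * (1 - cosSqrt Q)‖ ^ 3 ≤ 32 * κ ^ 3 * ‖Q‖ ^ 3 := by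
    have := pow_le_pow_left₀ (norm_nonneg _) hx 3
    linarith
  have key : (1 + (2 * k : ℝ) * (1 - cosSqrt Q)) ^ (-(1 / 2) : ℂ) -
      (1 - k / 2 * (Q - Q ^ 2 / 12) + 3 * k ^ 2 / 8 * Q ^ 2) =
      ((1 + (2 * k : ℝ) * (1 - cosSqrt Q)) ^ (-(1 / 2) : ℂ) -
        (1 - ((2 * k : ℝ) : ℂ) * (1 - cosSqrt Q) / 2 +
          3 * (((2 * k : ℝ) : ℂ) * (1 - cosSqrt Q)) ^ 2 / 8)) + (-(k * e) +
      ((3 * k ^ 2 / 8 : ℝ) : ℂ) * ((-Q ^ 2 / 12 + 2 * e) * (2 * Q + (-Q ^ 2 / 12 + 2 * e)))) := by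
    generalize (1 + (2 * k : ℝ) * (1 - cosSqrt Q)) ^ (-(1 / 2) : ℂ) = u
    rw [he']
    push_cast
    ring
  rw [key]
  refine (norm_add_le _ _).trans ((add_le_add h1 (norm_add_le _ _)).trans ?_)
  rw [norm_neg]
  linarith

/-- The reciprocal distance to one primary, in units of `r`, as a function of the squared angle. -/
noncomputable def invDist (r t : ℝ) (Q : ℂ) : ℂ :=
  (1 + (2 * ((1 + r * Real.cos t) / r ^ 2) : ℝ) * (1 - cosSqrt Q)) ^ (-(1 / 2) : ℂ)

/-- The anharmonic part of the potential energy, as a function of the squared angle. -/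
noncomputable def anharm (r t : ℝ) (Q : ℂ) : ℂ :=
  -(1 / r) * (invDist r t Q + invDist (-r) t Q) + 2 / r - Q / r ^ 3

section

variable {r t : ℝ} {Q : ℂ}

lemma abs_amp_le (hr : r ≠ 0) (hr2 : |r| ≤ 2) : |(1 + r * Real.cos t) / r ^ 2| ≤ 3 / r ^ 2 := by
  rw [abs_div, abs_of_nonneg (sq_nonneg r)]
  have h1 : |r * Real.cos t| ≤ 2 * 1 := by
    rw [abs_mul]
    exact mul_le_mul hr2 (Real.abs_cos_le_one t) (abs_nonneg _) zero_le_two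
  have h2 := abs_add_le 1 (r * Real.cos t)
  rw [abs_one] at h2
  gcongr
  linarith

lemma norm_anharm_sub_le (hr : 0 < r) (hr2 : r ≤ 2) (hQ : ‖Q‖ ≤ r ^ 2 / 40) :
    ‖anharm r t Q + ((9 + r ^ 2 + 9 * r ^ 2 * Real.cos t ^ 2) / (3 * r ^ 5) : ℝ) * Q ^ 2 / 4‖ ≤
      2 / r * (3 / r ^ 2 + (3 / r ^ 2) ^ 2 + 32 * (3 / r ^ 2) ^ 3) * ‖Q‖ ^ 3 := by
  have hQ1 : ‖Q‖ ≤ 1 / 10 := by nlinarith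
  have hQ2 : 3 / r ^ 2 * ‖Q‖ ≤ 1 / 8 := by
    rw [div_mul_eq_mul_div, div_le_iff₀ (by positivity)]; linarith [sq_nonneg r]
  have h1 := norm_inv_sqrt_cosSqrt_sub_le (abs_amp_le (t := t) hr.ne'
    (by rwa [abs_of_pos hr])) hQ1 hQ2
  have h2 := norm_inv_sqrt_cosSqrt_sub_le (k := (1 + -r * Real.cos t) / (-r) ^ 2)
    (abs_amp_le (t := t) (neg_ne_zero.2 hr.ne')
    (by rwa [abs_neg, abs_of_pos hr])) hQ1 (by rwa [neg_sq])
  rw [neg_sq r] at h2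
  have hrc : (r : ℂ) ≠ 0 := ofReal_ne_zero.2 hr.ne'
  have e : anharm r t Q + ((9 + r ^ 2 + 9 * r ^ 2 * Real.cos t ^ 2) / (3 * r ^ 5) : ℝ) *
      Q ^ 2 / 4 = ((-(1 / r) : ℝ) : ℂ) *
      (((1 + (2 * ((1 + r * Real.cos t) / r ^ 2) : ℝ) * (1 - cosSqrt Q)) ^ (-(1 / 2) : ℂ) -
      (1 - ((1 + r * Real.cos t) / r ^ 2 : ℝ) / 2 * (Q - Q ^ 2 / 12) +
        3 * ((1 + r * Real.cos t) / r ^ 2 : ℝ) ^ 2 / 8 * Q ^ 2)) +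
      ((1 + (2 * ((1 + -r * Real.cos t) / r ^ 2) : ℝ) * (1 - cosSqrt Q)) ^ (-(1 / 2) : ℂ) -
      (1 - ((1 + -r * Real.cos t) / r ^ 2 : ℝ) / 2 * (Q - Q ^ 2 / 12) +
        3 * ((1 + -r * Real.cos t) / r ^ 2 : ℝ) ^ 2 / 8 * Q ^ 2))) := by
    rw [anharm, invDist, invDist, neg_sq]
    generalize (1 + (2 * ((1 + r * Real.cos t) / r ^ 2) : ℝ) * (1 - cosSqrt Q)) ^
      (-(1 / 2) : ℂ) = u
    generalize (1 + (2 * ((1 + -r * Real.cos t) / r ^ 2) : ℝ) * (1 - cosSqrt Q)) ^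
      (-(1 / 2) : ℂ) = v
    push_cast
    field_simp
    ring
  rw [e, norm_mul, norm_real, norm_neg, Real.norm_of_nonneg (by positivity)]
  have h3 := (norm_add_le _ _).trans (add_le_add h1 h2)
  refine (mul_le_mul_of_nonneg_left h3 (by positivity)).trans (le_of_eq ?_)
  ring

end

end Sitnikov

namespace Sitnikov

open Set Complex

section

variable {r t : ℝ} {Q : ℂ}

lemma re_invDist_base_pos (hr : r ≠ 0) (hr2 : |r| ≤ 2) (hQ : ‖Q‖ ≤ r ^ 2 / 40) :
    0 < (1 + (2 * ((1 + r * Real.cos t) / r ^ 2) : ℝ) * (1 - cosSqrt Q)).re := by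
  have hr0 : 0 < r ^ 2 := by positivity
  have hr4 : r ^ 2 ≤ 4 := by rw [← sq_abs]; nlinarith [abs_nonneg r]
  have hQ2 : 3 / r ^ 2 * ‖Q‖ ≤ 1 / 8 := by
    rw [div_mul_eq_mul_div, div_le_iff₀ (by positivity)]; linarith
  have h := norm_two_mul_cosSqrt_le (abs_amp_le (t := t) hr hr2)
    (by linarith : ‖Q‖ ≤ 1 / 10)
  have h2 := (abs_re_le_norm _).trans h
  rw [abs_le] at h2
  rw [add_re, one_re]
  linarith [h2.1]

lemma analyticAt_invDist (hr : r ≠ 0) (hr2 : |r| ≤ 2) (hQ : ‖Q‖ ≤ r ^ 2 / 40) :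
    AnalyticAt ℂ (invDist r t) Q :=
  AnalyticAt.cpow (analyticAt_const.add (analyticAt_const.mul
    (analyticAt_const.sub (differentiable_cosSqrt.analyticAt Q)))) analyticAt_const
    (Or.inl (re_invDist_base_pos hr hr2 hQ))

lemma continuousAt_invDist (hr : r ≠ 0) (hr2 : |r| ≤ 2) (hQ : ‖Q‖ ≤ r ^ 2 / 40) :
    ContinuousAt (fun p : ℝ × ℂ => invDist r p.1 p.2) (t, Q) := by
  have h := differentiable_cosSqrt.continuous
  refine ContinuousAt.cpow ?_ continuousAt_const (Or.inl (re_invDist_base_pos hr hr2 hQ))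
  fun_prop

lemma invDist_ofReal {x : ℝ} (h : 0 < 1 + 2 * ((1 + r * Real.cos t) / r ^ 2) * (1 - Real.cos x)) :
    invDist r t ((x : ℂ) ^ 2) =
      ((1 + 2 * ((1 + r * Real.cos t) / r ^ 2) * (1 - Real.cos x)) ^ (-(1 / 2) : ℝ) : ℝ) := by
  rw [invDist, cosSqrt_sq, ofReal_cpow h.le]
  push_cast
  rfl

lemma invDist_im_eq_zero (hr : r ≠ 0) (hr2 : |r| ≤ 2) {x : ℝ} (hx : ‖(x : ℂ)‖ ≤ r ^ 2 / 40) :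
    (invDist r t x).im = 0 := by
  have h := re_invDist_base_pos (t := t) hr hr2 hx
  have h2 : cosSqrt x = ((cosSqrt x).re : ℂ) :=
    Complex.ext rfl (by rw [cosSqrt_ofReal_im, ofReal_im])
  rw [invDist]
  rw [h2] at h ⊢
  generalize (cosSqrt x).re = c at *
  have e : 1 + ((2 * ((1 + r * Real.cos t) / r ^ 2) : ℝ) : ℂ) * (1 - (c : ℂ)) =
      ((1 + (2 * ((1 + r * Real.cos t) / r ^ 2)) * (1 - c) : ℝ) : ℂ) := by push_cast; rfl
  rw [e] at h ⊢
  rw [ofReal_re] at h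
  rw [show (-(1 / 2) : ℂ) = ((-(1 / 2) : ℝ) : ℂ) by push_cast; rfl, ← ofReal_cpow h.le, ofReal_im]

lemma analyticAt_anharm (hr : 0 < r) (hr2 : r ≤ 2) (hQ : ‖Q‖ ≤ r ^ 2 / 40) :
    AnalyticAt ℂ (anharm r t) Q := by
  have h1 := analyticAt_invDist (t := t) hr.ne' (by rwa [abs_of_pos hr]) hQ
  have h2 := analyticAt_invDist (r := -r) (t := t) (neg_ne_zero.2 hr.ne')
    (by rwa [abs_neg, abs_of_pos hr]) (by rwa [neg_sq])
  exact ((analyticAt_const.mul (h1.add h2)).add analyticAt_const).sub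
    (analyticAt_id.div analyticAt_const (by exact_mod_cast (pow_pos hr 3).ne'))

lemma continuousAt_anharm (hr : 0 < r) (hr2 : r ≤ 2) (hQ : ‖Q‖ ≤ r ^ 2 / 40) :
    ContinuousAt (fun p : ℝ × ℂ => anharm r p.1 p.2) (t, Q) := by
  have h1 := continuousAt_invDist (t := t) hr.ne' (by rwa [abs_of_pos hr]) hQ
  have h2 := continuousAt_invDist (r := -r) (t := t) (neg_ne_zero.2 hr.ne')
    (by rwa [abs_neg, abs_of_pos hr]) (by rwa [neg_sq])
  exact ((continuousAt_const.mul (h1.add h2)).add continuousAt_const).sub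
    (continuousAt_snd.div_const _)

lemma anharm_im_eq_zero (hr : 0 < r) (hr2 : r ≤ 2) {x : ℝ} (hx : ‖(x : ℂ)‖ ≤ r ^ 2 / 40) :
    (anharm r t x).im = 0 := by
  have h1 := invDist_im_eq_zero (t := t) hr.ne' (by rwa [abs_of_pos hr]) hx
  have h2 := invDist_im_eq_zero (r := -r) (t := t) (neg_ne_zero.2 hr.ne')
    (by rwa [abs_neg, abs_of_pos hr]) (by rwa [neg_sq])
  have e : anharm r t x = ((-(1 / r) : ℝ) : ℂ) * (invDist r t x + invDist (-r) t x) +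
      ((2 / r - x / r ^ 3 : ℝ) : ℂ) := by
    rw [anharm]; push_cast; ring
  rw [e, add_im, im_ofReal_mul, add_im, h1, h2, ofReal_im]
  ring

lemma dist_sq_pos (hr : 0 < r) (hr2 : r < 2) (t x : ℝ) :
    0 < r ^ 2 + 2 * (1 + r * Real.cos t) * (1 - Real.cos x) := by
  have h1 := Real.neg_one_le_cos t
  have h2 := Real.cos_le_one x
  have h3 := Real.neg_one_le_cos x
  have h4 : 0 ≤ r * (1 + Real.cos t) * (1 - Real.cos x) := by
    have : 0 ≤ 1 + Real.cos t := by linarith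
    have : 0 ≤ 1 - Real.cos x := by linarith
    positivity
  have h5 : 0 < r ^ 2 * (1 + Real.cos x) + (2 - r) ^ 2 * (1 - Real.cos x) := by
    rcases h3.eq_or_lt with h | h
    · rw [← h]
      have : 0 < (2 - r) ^ 2 := by nlinarith
      linarith
    · have := mul_pos (pow_pos hr 2) (by linarith : 0 < 1 + Real.cos x)
      have := mul_nonneg (sq_nonneg (2 - r)) (by linarith : 0 ≤ 1 - Real.cos x)
      linarith
  linarith

lemma invDist_base_pos (hr : 0 < r) (hr2 : r < 2) (t x : ℝ) :
    0 < 1 + 2 * ((1 + r * Real.cos t) / r ^ 2) * (1 - Real.cos x) := by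
  have h := div_pos (dist_sq_pos hr hr2 t x) (pow_pos hr 2)
  refine h.trans_le (le_of_eq ?_)
  field_simp

lemma hasDerivAt_invDist_base (hr : 0 < r) (hr2 : r < 2) (t x : ℝ) : HasDerivAt (fun x : ℝ =>
    (1 + 2 * ((1 + r * Real.cos t) / r ^ 2) * (1 - Real.cos x)) ^ (-(1 / 2) : ℝ))
    (-(r * ((1 + r * Real.cos t) * Real.sin x /
      (r ^ 2 + 2 * (1 + r * Real.cos t) * (1 - Real.cos x)) ^ ((3 : ℝ) / 2)))) x := by
  have hb := invDist_base_pos hr hr2 t x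
  have h1 := ((((Real.hasDerivAt_cos x).const_sub 1).const_mul
    (2 * ((1 + r * Real.cos t) / r ^ 2))).const_add 1).rpow_const (p := -(1 / 2)) (Or.inl hb.ne')
  refine h1.congr_deriv ?_
  have e1 : r ^ 2 + 2 * (1 + r * Real.cos t) * (1 - Real.cos x) =
      r ^ 2 * (1 + 2 * ((1 + r * Real.cos t) / r ^ 2) * (1 - Real.cos x)) := by
    field_simp
  have e2 : (r ^ 2) ^ ((3 : ℝ) / 2) = r ^ 3 := by
    rw [← Real.rpow_natCast, ← Real.rpow_mul hr.le, ← Real.rpow_natCast]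
    norm_num
  rw [e1, Real.mul_rpow (sq_nonneg r) hb.le, e2,
    show (-(1 / 2) - 1 : ℝ) = -(3 / 2) by norm_num, Real.rpow_neg hb.le]
  have := (Real.rpow_pos_of_pos hb (3 / 2)).ne'
  generalize (1 + 2 * ((1 + r * Real.cos t) / r ^ 2) * (1 - Real.cos x)) ^ ((3 : ℝ) / 2) = u at *
  field_simp

end

lemma f0_eq (q t r : ℝ) : f0 q t r =
    -((1 + r * Real.cos t) * Real.sin q /
      (r ^ 2 + 2 * (1 + r * Real.cos t) * (1 - Real.cos q)) ^ ((3 : ℝ) / 2)) -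
    (1 + r * Real.cos (t + Real.pi)) * Real.sin q /
      (r ^ 2 + 2 * (1 + r * Real.cos (t + Real.pi)) * (1 - Real.cos q)) ^ ((3 : ℝ) / 2) := by
  rw [f0, Real.cos_add_pi]
  congr 3 <;> ring_nf

lemma invDist_neg (r t : ℝ) (Q : ℂ) : invDist (-r) t Q = invDist r (t + Real.pi) Q := by
  rw [invDist, invDist, Real.cos_add_pi]
  simp

lemma f0_eq_deriv_anharm {r : ℝ} (hr : 0 < r) (hr2 : r < 2) (t : ℝ) {q : ℝ}
    (hq : q ^ 2 ≤ r ^ 2 / 40) : (f0 q t r : ℂ) =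
      -(2 / r ^ 3) * q - 2 * q * deriv (anharm r t) ((q : ℂ) ^ 2) := by
  have hq' : ‖(q : ℂ) ^ 2‖ ≤ r ^ 2 / 40 := by
    rw [norm_pow, norm_real, Real.norm_eq_abs, sq_abs]; exact hq
  have h1 : HasDerivAt (fun x : ℂ => anharm r t (x ^ 2))
      (deriv (anharm r t) ((q : ℂ) ^ 2) * (2 * q)) q := by
    have e := ((analyticAt_anharm (t := t) hr hr2.le hq').differentiableAt.hasDerivAt).comp
      (q : ℂ) (hasDerivAt_pow 2 (q : ℂ))
    refine e.congr_deriv ?_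
    push_cast
    ring
  have h2 := h1.comp_ofReal
  have h3 : HasDerivAt (fun x : ℝ => -(1 / r) * ((1 + 2 * ((1 + r * Real.cos t) / r ^ 2) *
      (1 - Real.cos x)) ^ (-(1 / 2) : ℝ) + (1 + 2 * ((1 + r * Real.cos (t + Real.pi)) / r ^ 2) *
      (1 - Real.cos x)) ^ (-(1 / 2) : ℝ)) + 2 / r - x ^ 2 / r ^ 3) (-(f0 q t r) -
        2 * q / r ^ 3) q := by
    refine ((((hasDerivAt_invDist_base hr hr2 t q).add (hasDerivAt_invDist_base hr hr2
      (t + Real.pi) q)).const_mul (-(1 / r))).add_const (2 / r)).sub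
      ((hasDerivAt_pow 2 q).div_const (r ^ 3)) |>.congr_deriv ?_
    rw [f0_eq]
    push_cast
    field_simp
    ring
  have h4 := h3.ofReal_comp
  have e : (fun x : ℝ => anharm r t ((x : ℂ) ^ 2)) = fun x : ℝ => ((-(1 / r) *
      ((1 + 2 * ((1 + r * Real.cos t) / r ^ 2) *
      (1 - Real.cos x)) ^ (-(1 / 2) : ℝ) + (1 + 2 * ((1 + r * Real.cos (t + Real.pi)) / r ^ 2) *
      (1 - Real.cos x)) ^ (-(1 / 2) : ℝ)) + 2 / r - x ^ 2 / r ^ 3 : ℝ) : ℂ) := by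
    funext x
    rw [anharm, invDist_neg, invDist_ofReal (invDist_base_pos hr hr2 t x),
      invDist_ofReal (invDist_base_pos hr hr2 (t + Real.pi) x)]
    push_cast
    ring
  rw [e] at h2
  have h5 := h2.unique h4
  push_cast at h5
  linear_combination h5

end Sitnikov

namespace Sitnikov

open Set Complex

/-- The square of the position in scaled rotating symplectic polar coordinates. -/
noncomputable def rotArg (ω₀ T : ℝ) (s : unitInterval) (z : ℂ × ℂ) : ℂ :=
  (2 / (ω₀ * T) : ℝ) * (z.2 * cos (z.1 + ω₀ * ((T * s : ℝ) : ℂ)) ^ 2)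

/-- The Hamiltonian in scaled rotating symplectic polar coordinates. -/
noncomputable def rotHam (r ω₀ T : ℝ) (s : unitInterval) (z : ℂ × ℂ) : ℂ :=
  T ^ 2 * anharm r (T * s) (rotArg ω₀ T s z)

lemma norm_rotArg_le {ω₀ T : ℝ} (hω : 0 < ω₀) (hT : 0 < T) (s : unitInterval) {z : ℂ × ℂ}
    (hz : z ∈ dmn 2 4) : ‖rotArg ω₀ T s z‖ ≤ 12 * Real.exp 5 ^ 2 / ω₀ / T := by
  obtain ⟨h1, h2⟩ := hz
  have e2 : ‖cos (z.1 + ω₀ * ((T * s : ℝ) : ℂ))‖ ≤ Real.exp 5 := by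
    refine (norm_cos_le_exp_abs _).trans (Real.exp_le_exp.2 ?_)
    have : (z.1 + ω₀ * ((T * s : ℝ) : ℂ)).im = z.1.im := by
      rw [← ofReal_mul, add_im, ofReal_im, add_zero]
    rw [this]; linarith
  have e3 : ‖z.2‖ ≤ 6 := by linarith
  rw [rotArg, norm_mul, norm_mul, norm_pow, norm_real, Real.norm_of_nonneg (by positivity)]
  calc _ ≤ 2 / (ω₀ * T) * (6 * Real.exp 5 ^ 2) := by gcongr
    _ = _ := by field_simp; ring

lemma rotArg_ofReal (ω₀ T : ℝ) (s : unitInterval) (x y : ℝ) :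
    rotArg ω₀ T s ((x : ℂ), (y : ℂ)) =
      ((2 / (ω₀ * T) * (y * Real.cos (x + ω₀ * (T * s)) ^ 2) : ℝ) : ℂ) := by
  rw [rotArg]
  push_cast
  ring

lemma continuous_rotArg (ω₀ T : ℝ) :
    Continuous fun p : unitInterval × (ℂ × ℂ) => rotArg ω₀ T p.1 p.2 := by
  unfold rotArg
  fun_prop

lemma analyticAt_rotArg (ω₀ T : ℝ) (s : unitInterval) (z : ℂ × ℂ) :
    AnalyticAt ℂ (rotArg ω₀ T s) z := by
  unfold rotArg
  have h : AnalyticAt ℂ (fun z : ℂ × ℂ => z.1 + ω₀ * ((T * s : ℝ) : ℂ)) z :=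
    analyticAt_fst.add analyticAt_const
  exact analyticAt_const.mul (analyticAt_snd.mul
    ((AnalyticAt.fun_comp (g := cos) analyticAt_cos h).pow 2))

lemma exists_holBdd_rotHam {r ω₀ c₀ c₂ : ℝ} (hr : 0 < r) (hr2 : r ≤ 2) (hω : 0 < ω₀)
    (hc : ∀ t : ℝ, c₀ + c₂ * Real.cos (2 * t) =
      (9 + r ^ 2 + 9 * r ^ 2 * Real.cos t ^ 2) / (3 * r ^ 5)) :
    ∃ M B T₀ : ℝ, 0 ≤ M ∧ ∀ T : ℝ, T₀ ≤ T →
      HolBdd 2 (rotHam r ω₀ T) 4 B ∧ (∀ s, ∀ z ∈ dmn 2 4, ‖rotArg ω₀ T s z‖ ≤ r ^ 2 / 40) ∧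
      ∀ s, ∀ z ∈ dmn 2 4, ‖rotHam r ω₀ T s z - lead (1 / ω₀ ^ 2) c₀ c₂ ω₀ T s z‖ ≤ M / T := by
  obtain ⟨B, hB, hlead⟩ := holBdd_lead (1 / ω₀ ^ 2) c₀ c₂ ω₀
  obtain ⟨L, hL⟩ : ∃ L, L = 12 * Real.exp 5 ^ 2 / ω₀ := ⟨_, rfl⟩
  have hL0 : 0 < L := by rw [hL]; positivity
  obtain ⟨K, hK⟩ : ∃ K, K = 2 / r * (3 / r ^ 2 + (3 / r ^ 2) ^ 2 + 32 * (3 / r ^ 2) ^ 3) :=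
    ⟨_, rfl⟩
  have hK0 : 0 < K := by rw [hK]; positivity
  refine ⟨K * L ^ 3, B + K * L ^ 3, max 1 (40 * L / r ^ 2), by positivity, fun T hT => ?_⟩
  have hT1 : 1 ≤ T := (le_max_left _ _).trans hT
  have hT0 : 0 < T := by linarith
  have hT2 : 40 * L / r ^ 2 ≤ T := (le_max_right _ _).trans hT
  have hQ : ∀ s, ∀ z ∈ dmn 2 4, ‖rotArg ω₀ T s z‖ ≤ L / T := fun s z hz => by
    rw [hL]; exact norm_rotArg_le hω hT0 s hz
  have hQr : L / T ≤ r ^ 2 / 40 := by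
    rw [div_le_iff₀ (by positivity)] at hT2
    rw [div_le_iff₀ hT0]; linarith
  have hclose : ∀ s, ∀ z ∈ dmn 2 4,
      ‖rotHam r ω₀ T s z - lead (1 / ω₀ ^ 2) c₀ c₂ ω₀ T s z‖ ≤ K * L ^ 3 / T := fun s z hz => by
    have h1 := norm_anharm_sub_le (t := T * s) hr hr2 ((hQ s z hz).trans hQr)
    rw [← hc, ← hK] at h1
    have h2 : rotHam r ω₀ T s z - lead (1 / ω₀ ^ 2) c₀ c₂ ω₀ T s z =
        (T ^ 2 : ℝ) * (anharm r (T * s) (rotArg ω₀ T s z) +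
          ((c₀ + c₂ * Real.cos (2 * (T * s)) : ℝ) : ℂ) * rotArg ω₀ T s z ^ 2 / 4) := by
      rw [rotHam, lead]
      have hTc : (T : ℂ) ≠ 0 := by exact_mod_cast hT0.ne'
      have hωc : (ω₀ : ℂ) ≠ 0 := by exact_mod_cast hω.ne'
      generalize anharm r (T * s) (rotArg ω₀ T s z) = u
      rw [rotArg]
      push_cast
      generalize cos (z.1 + ω₀ * (T * (s : ℝ) : ℂ)) = v
      generalize cos (2 * (T * (s : ℝ) : ℂ)) = v'
      field_simp
      ring
    rw [h2, norm_mul, norm_real, Real.norm_of_nonneg (by positivity)]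
    have h3 := pow_le_pow_left₀ (norm_nonneg _) (hQ s z hz) 3
    calc _ ≤ T ^ 2 * (K * (L / T) ^ 3) := by gcongr; exact h1.trans (by gcongr)
      _ = _ := by field_simp
  refine ⟨⟨fun s z hz => ?_, fun s z hz => ?_, ?_, ?_, ?_⟩,
    fun s z hz => (hQ s z hz).trans hQr, hclose⟩
  · unfold rotHam
    exact analyticAt_const.mul (AnalyticAt.fun_comp (g := anharm r (T * s))
      (analyticAt_anharm hr hr2 ((hQ s z hz).trans hQr)) (analyticAt_rotArg ω₀ T s z))
  · have h1 := hclose s z hz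
    have h2 := (hlead T).bound s z hz
    have h3 : K * L ^ 3 / T ≤ K * L ^ 3 := div_le_self (by positivity) hT1
    have := norm_add_le (rotHam r ω₀ T s z - lead (1 / ω₀ ^ 2) c₀ c₂ ω₀ T s z)
      (lead (1 / ω₀ ^ 2) c₀ c₂ ω₀ T s z)
    rw [sub_add_cancel] at this
    linarith
  · rintro ⟨s, z⟩ hz
    unfold rotHam
    refine ContinuousAt.continuousWithinAt (continuousAt_const.mul ?_)
    have h1 := continuousAt_anharm (t := T * s) hr hr2 ((hQ s z hz).trans hQr)
    exact ContinuousAt.comp (f := fun p : unitInterval × (ℂ × ℂ) =>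
      ((T * p.1 : ℝ), rotArg ω₀ T p.1 p.2)) (x := (s, z))
      (g := fun p : ℝ × ℂ => anharm r p.1 p.2) h1
        ((by fun_prop : Continuous fun p : unitInterval × (ℂ × ℂ) => T * (p.1 : ℝ)).prodMk
          (continuous_rotArg ω₀ T)).continuousAt
  · intro s z hz h1 h2
    have hz' := hQ s z hz
    have e : z = ((z.1.re : ℂ), (z.2.re : ℂ)) := by
      refine Prod.ext ?_ ?_ <;> apply Complex.ext <;> simp [h1, h2]
    rw [e, rotArg_ofReal] at hz'
    rw [rotHam, e, rotArg_ofReal, ← ofReal_pow, im_ofReal_mul,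
      anharm_im_eq_zero hr hr2 (hz'.trans hQr), mul_zero]
  · intro s z
    rw [rotHam, rotHam, rotArg, rotArg]
    simp only [Prod.fst_add, Prod.snd_add, add_zero]
    rw [add_right_comm, cos_add_two_pi]

end Sitnikov

namespace Sitnikov

open Set Complex

lemma hasDerivWithinAt_polar {ω₀ T u : ℝ} {θ j : ℝ → ℝ} {S : Set ℝ} {s : ℝ} (hω : 0 < ω₀)
    (hT : 0 < T) (hj : 0 < j s)
    (hθ' : HasDerivWithinAt θ (ω₀ * T + 2 * T / ω₀ * u * Real.cos (θ s) ^ 2) S s)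
    (hj' : HasDerivWithinAt j (4 * T / ω₀ * u * j s * (Real.cos (θ s) * Real.sin (θ s))) S s) :
    HasDerivWithinAt (fun s => √(2 * j s / (ω₀ * T)) * Real.cos (θ s))
      (T * (-(ω₀ * (√(2 * j s / (ω₀ * T)) * Real.sin (θ s))))) S s ∧
    HasDerivWithinAt (fun s => -(ω₀ * (√(2 * j s / (ω₀ * T)) * Real.sin (θ s))))
      (T * (-ω₀ ^ 2 * (√(2 * j s / (ω₀ * T)) * Real.cos (θ s)) -
        2 * (√(2 * j s / (ω₀ * T)) * Real.cos (θ s)) * u)) S s := by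
  have h0 : 0 < 2 * j s / (ω₀ * T) := by positivity
  have h1 := ((hj'.const_mul 2).div_const (ω₀ * T)).sqrt h0.ne'
  have h2 : HasDerivWithinAt (fun s => √(2 * j s / (ω₀ * T)))
      (√(2 * j s / (ω₀ * T)) * (2 * T / ω₀ * u * (Real.cos (θ s) * Real.sin (θ s)))) S s := by
    refine h1.congr_deriv ?_
    rw [div_eq_iff (by positivity)]
    have e := Real.mul_self_sqrt h0.le
    generalize √(2 * j s / (ω₀ * T)) = v at e
    rw [show v * (2 * T / ω₀ * u * (Real.cos (θ s) * Real.sin (θ s))) * (2 * v) =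
      (v * v) * (2 * (2 * T / ω₀ * u * (Real.cos (θ s) * Real.sin (θ s)))) by ring, e]
    field_simp
    ring
  have e := Real.sin_sq_add_cos_sq (θ s)
  refine ⟨(h2.mul hθ'.cos).congr_deriv ?_, ((h2.mul hθ'.sin).const_mul ω₀).neg.congr_deriv ?_⟩
  · field_simp
    ring
  · generalize √(2 * j s / (ω₀ * T)) = v
    have e2 : 2 * T / ω₀ * u * ω₀ = 2 * T * u := by field_simp
    generalize 2 * T / ω₀ * u = w at e2
    linear_combination (-v * Real.cos (θ s) * w * ω₀) * e - (v * Real.cos (θ s)) * e2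

lemma hasDerivAt_rotHam {r ω₀ T : ℝ} (hr : 0 < r) (hr2 : r ≤ 2) {s : unitInterval} {z v : ℂ × ℂ}
    (hQ : ‖rotArg ω₀ T s z‖ ≤ r ^ 2 / 40) {d : ℂ}
    (hd : HasDerivAt (fun τ : ℂ => rotArg ω₀ T s (z + τ • v)) d 0) :
    dir v (rotHam r ω₀ T) s z = T ^ 2 * (deriv (anharm r (T * s)) (rotArg ω₀ T s z) * d) := by
  have hA := analyticAt_anharm (t := T * s) hr hr2 hQ
  have hD : DifferentiableAt ℂ (rotHam r ω₀ T s) z := by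
    unfold rotHam
    exact (AnalyticAt.fun_comp (g := anharm r (T * s)) hA
      (analyticAt_rotArg ω₀ T s z)).differentiableAt.const_mul _
  refine (hasDerivAt_comp_add_smul hD v).unique ?_
  unfold rotHam
  have e0 : rotArg ω₀ T s (z + (0 : ℂ) • v) = rotArg ω₀ T s z := by simp
  refine HasDerivAt.const_mul _ (HasDerivAt.comp (h₂ := anharm r (T * s)) (0 : ℂ) ?_ hd)
  rw [e0]
  exact hA.differentiableAt.hasDerivAt

lemma dir_fst_rotHam {r ω₀ T : ℝ} (hr : 0 < r) (hr2 : r ≤ 2) {s : unitInterval} {z : ℂ × ℂ}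
    (hQ : ‖rotArg ω₀ T s z‖ ≤ r ^ 2 / 40) : dir (1, 0) (rotHam r ω₀ T) s z =
      T ^ 2 * (deriv (anharm r (T * s)) (rotArg ω₀ T s z) * ((2 / (ω₀ * T) : ℝ) * (z.2 *
        (2 * cos (z.1 + ω₀ * ((T * s : ℝ) : ℂ)) * -sin (z.1 + ω₀ * ((T * s : ℝ) : ℂ)))))) := by
  refine hasDerivAt_rotHam hr hr2 hQ ?_
  have h2 : HasDerivAt (fun τ : ℂ => z.1 + τ + ω₀ * ((T * s : ℝ) : ℂ)) 1 0 :=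
    ((hasDerivAt_id (0 : ℂ)).const_add z.1).add_const _
  have h3 := ((h2.ccos.pow 2).const_mul z.2).const_mul ((2 / (ω₀ * T) : ℝ) : ℂ)
  unfold rotArg
  refine (h3.congr_deriv ?_).congr_of_eventuallyEq (Filter.Eventually.of_forall fun τ => ?_)
  · simp only [add_zero]; push_cast; ring
  · simp

lemma dir_snd_rotHam {r ω₀ T : ℝ} (hr : 0 < r) (hr2 : r ≤ 2) {s : unitInterval} {z : ℂ × ℂ}
    (hQ : ‖rotArg ω₀ T s z‖ ≤ r ^ 2 / 40) : dir (0, 1) (rotHam r ω₀ T) s z =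
      T ^ 2 * (deriv (anharm r (T * s)) (rotArg ω₀ T s z) * ((2 / (ω₀ * T) : ℝ) *
        cos (z.1 + ω₀ * ((T * s : ℝ) : ℂ)) ^ 2)) := by
  refine hasDerivAt_rotHam hr hr2 hQ ?_
  have h2 : HasDerivAt (fun τ : ℂ => z.2 + τ) 1 0 := (hasDerivAt_id (0 : ℂ)).const_add z.2
  have h3 := (h2.mul_const (cos (z.1 + ω₀ * ((T * s : ℝ) : ℂ)) ^ 2)).const_mul
    ((2 / (ω₀ * T) : ℝ) : ℂ)
  unfold rotArg
  refine (h3.congr_deriv ?_).congr_of_eventuallyEq (Filter.Eventually.of_forall fun τ => ?_)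
  · ring
  · simp

lemma hasDerivWithinAt_re {f : ℝ → ℂ} {f' : ℂ} {S : Set ℝ} {s : ℝ}
    (h : HasDerivWithinAt f f' S s) : HasDerivWithinAt (fun s => (f s).re) f'.re S s :=
  (reCLM.hasFDerivAt.comp_hasDerivWithinAt s h)

/-- Position on an invariant torus. -/
noncomputable def torusPos (ω₀ T : ℝ) (Φ J : ℝ → TimeCurve) (x s : ℝ) : ℝ :=
  √(2 * ((J x).ext s).re / (ω₀ * T)) * Real.cos (((Φ x).ext s).re + ω₀ * (T * s))

/-- Velocity on an invariant torus. -/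
noncomputable def torusVel (ω₀ T : ℝ) (Φ J : ℝ → TimeCurve) (x s : ℝ) : ℝ :=
  -(ω₀ * (√(2 * ((J x).ext s).re / (ω₀ * T)) * Real.sin (((Φ x).ext s).re + ω₀ * (T * s))))

open TimeCurve

lemma hasDerivWithinAt_torus {r ω₀ T B A α ω : ℝ} {Φ J : ℝ → TimeCurve} (hr : 0 < r)
    (hr2 : r < 2) (hω : 0 < ω₀) (hωr : ω₀ ^ 2 = 2 / r ^ 3) (hT : 0 < T)
    (hQ : ∀ s, ∀ z ∈ dmn 2 4, ‖rotArg ω₀ T s z‖ ≤ r ^ 2 / 40)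
    {hG : HolBdd 2 (rotHam r ω₀ T) 4 B} {hC : 4 * B ≤ A} (h : InvTorus (hG.ham hC) α ω Φ J)
    {x : ℝ} (hD : Dom 2 (Φ x) (J x)) (hJ : ∀ s, 0 < (J x s).re) {s : ℝ} (hs : s ∈ Icc (0 : ℝ) 1) :
    HasDerivWithinAt (torusPos ω₀ T Φ J x) (T * torusVel ω₀ T Φ J x s) (Icc 0 1) s ∧
    HasDerivWithinAt (torusVel ω₀ T Φ J x) (T * f0 (torusPos ω₀ T Φ J x s) (T * s) r)
      (Icc 0 1) s := by
  lift s to unitInterval using hs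
  have hz := hD.mem_dmn (by norm_num : (0 : ℝ) < 4) s
  have hQs := hQ s _ hz
  obtain ⟨y, hy⟩ : ∃ y, y = (Φ x s).re := ⟨_, rfl⟩
  obtain ⟨w, hw⟩ : ∃ w, w = (J x s).re := ⟨_, rfl⟩
  have ey : Φ x s = (y : ℂ) := by
    apply Complex.ext <;> simp [hy, isSelfAdjoint_iff.1 (h.real_fst x) s]
  have ew : J x s = (w : ℂ) := by
    apply Complex.ext <;> simp [hw, isSelfAdjoint_iff.1 (h.real_snd x) s]
  have hw0 : 0 < w := hw ▸ hJ s
  have hω' := hω.ne'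
  have hT' := hT.ne'
  have d1 := hasDerivWithinAt_re (h.prim_fst x s s.2)
  have d2 := hasDerivWithinAt_re (h.prim_snd x s s.2)
  have e1 : ext ((hG.ham hC).H2 (Φ x) (J x)) s = dir (0, 1) (rotHam r ω₀ T) s (Φ x s, J x s) := by
    rw [ext_coe]
    exact ((hG.mono (by norm_num : (3 : ℝ) + 1 ≤ 4)).dir (v := (0, 1)) (by simp) (by simp)
      (by simp)).op_apply (by norm_num) hD s
  have e2 : ext (-(hG.ham hC).H1 (Φ x) (J x)) s =
      -dir (1, 0) (rotHam r ω₀ T) s (Φ x s, J x s) := by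
    rw [ext_coe, ContinuousMap.neg_apply]
    exact congrArg _ (((hG.mono (by norm_num : (3 : ℝ) + 1 ≤ 4)).dir (v := (1, 0)) (by simp)
      (by simp) (by simp)).op_apply (by norm_num) hD s)
  rw [e1, dir_snd_rotHam hr hr2.le hQs] at d1
  rw [e2, dir_fst_rotHam hr hr2.le hQs] at d2
  rw [ey, ew, rotArg_ofReal] at hQs d1 d2
  obtain ⟨q, hq⟩ : ∃ q, q = √(2 * w / (ω₀ * T)) * Real.cos (y + ω₀ * (T * s)) := ⟨_, rfl⟩
  have hq2 : 2 / (ω₀ * T) * (w * Real.cos (y + ω₀ * (T * s)) ^ 2) = q ^ 2 := by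
    rw [hq, mul_pow, Real.sq_sqrt (by positivity)]; ring
  rw [hq2] at hQs d1 d2
  have hf := f0_eq_deriv_anharm hr hr2 (T * s) (q := q) (by
    rwa [norm_real, Real.norm_of_nonneg (sq_nonneg q)] at hQs)
  rw [← ofReal_pow q 2] at hf
  obtain ⟨U, hU⟩ : ∃ U, U = deriv (anharm r (T * s)) ((q ^ 2 : ℝ) : ℂ) := ⟨_, rfl⟩
  rw [← hU] at d1 d2 hf
  have hf' : f0 q (T * s) r = -ω₀ ^ 2 * q - 2 * q * U.re := by
    have := congrArg Complex.re hf
    rw [ofReal_re, show -(2 / (r : ℂ) ^ 3) * q - 2 * q * U = ((-(2 / r ^ 3) * q : ℝ) : ℂ) -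
      ((2 * q : ℝ) : ℂ) * U by push_cast; ring, sub_re, ofReal_re, re_ofReal_mul] at this
    rw [this, hωr]
  have d1' : HasDerivWithinAt (fun s => ((Φ x).ext s).re + ω₀ * (T * s))
      (ω₀ * T + 2 * T / ω₀ * U.re * Real.cos (((Φ x).ext s).re + ω₀ * (T * s)) ^ 2)
      (Icc 0 1) s := by
    refine (d1.add (((hasDerivAt_id (s : ℝ)).hasDerivWithinAt.const_mul T).const_mul ω₀)
      ).congr_deriv ?_
    rw [ext_coe, ey, ofReal_re]
    rw [show (T : ℂ) ^ 2 * (U * (((2 / (ω₀ * T) : ℝ) : ℂ) *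
      cos ((y : ℂ) + ω₀ * ((T * s : ℝ) : ℂ)) ^ 2)) = ((T ^ 2 * (2 / (ω₀ * T) *
        Real.cos (y + ω₀ * (T * s)) ^ 2) : ℝ) : ℂ) * U by push_cast; ring, re_ofReal_mul]
    field_simp
    ring
  have d2' : HasDerivWithinAt (fun s => ((J x).ext s).re)
      (4 * T / ω₀ * U.re * ((J x).ext s).re * (Real.cos (((Φ x).ext s).re + ω₀ * (T * s)) *
        Real.sin (((Φ x).ext s).re + ω₀ * (T * s)))) (Icc 0 1) s := by
    refine d2.congr_deriv ?_
    rw [ext_coe, ext_coe, ey, ew, ofReal_re, ofReal_re]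
    rw [show -((T : ℂ) ^ 2 * (U * (((2 / (ω₀ * T) : ℝ) : ℂ) * ((w : ℂ) *
      (2 * cos ((y : ℂ) + ω₀ * ((T * s : ℝ) : ℂ)) * -sin ((y : ℂ) + ω₀ * ((T * s : ℝ) : ℂ))))))) =
        ((T ^ 2 * (2 / (ω₀ * T) * (w * (2 * Real.cos (y + ω₀ * (T * s)) *
        Real.sin (y + ω₀ * (T * s))))) : ℝ) : ℂ) * U by push_cast; ring, re_ofReal_mul]
    field_simp
    ring
  have hj : 0 < ((J x).ext s).re := by rw [ext_coe]; exact hJ s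
  have key := hasDerivWithinAt_polar hω hT hj d1' d2'
  refine ⟨key.1, key.2.congr_deriv ?_⟩
  have eq : torusPos ω₀ T Φ J x s = q := by
    rw [torusPos, ext_coe, ext_coe, ey, ew, ofReal_re, ofReal_re, hq]
  have eq' : √(2 * ((J x).ext s).re / (ω₀ * T)) * Real.cos (((Φ x).ext s).re + ω₀ * (T * s)) =
    q := eq
  rw [eq, eq', hf']

end Sitnikov

namespace Sitnikov

open Set Complex

/-- A closed curve depending on time, in polar coordinates around the origin. -/
noncomputable def polarCurve (θ j : ℝ → ℝ → ℝ) (x s : ℝ) : ℂ := √(j x s) * exp (θ x s * I)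

/-- Families of closed curves winding once around the origin. -/
structure WindingCurve (θ j : ℝ → ℝ → ℝ) : Prop where
  continuous_angle : Continuous (Function.uncurry θ)
  continuous_radius : Continuous (Function.uncurry j)
  strictMono : ∀ s, StrictMono fun x => θ x s
  angle_add_one : ∀ x s, θ (x + 1) s = θ x s + 2 * Real.pi
  radius_add_one : ∀ x s, j (x + 1) s = j x s
  radius_pos : ∀ x s, 0 < j x s

/-- The closed region enclosed by the curve. -/
def Inside (θ j : ℝ → ℝ → ℝ) (s : ℝ) (ζ : ℂ) : Prop :=
  ∃ x : ℝ, ∃ c ∈ Icc (0 : ℝ) 1, ζ = c * polarCurve θ j x s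

/-- The closed region outside of the curve. -/
def Outside (θ j : ℝ → ℝ → ℝ) (s : ℝ) (ζ : ℂ) : Prop :=
  ∃ x : ℝ, ∃ c ∈ Icc (0 : ℝ) 1, c * ζ = polarCurve θ j x s

namespace WindingCurve

variable {θ j : ℝ → ℝ → ℝ}

lemma norm_polarCurve (x s : ℝ) : ‖polarCurve θ j x s‖ = √(j x s) := by
  rw [polarCurve, norm_mul, norm_exp_ofReal_mul_I, mul_one, norm_real,
    Real.norm_of_nonneg (Real.sqrt_nonneg _)]

lemma angle_add_int (h : WindingCurve θ j) (x s : ℝ) (n : ℤ) :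
    θ (x + n) s = θ x s + n * (2 * Real.pi) := by
  have hp : Function.Periodic (fun x => θ x s - x * (2 * Real.pi)) 1 := fun x => by
    simp only [h.angle_add_one]; ring
  have := hp.int_mul n x
  simp only [mul_one] at this
  linarith

lemma radius_add_int (h : WindingCurve θ j) (x s : ℝ) (n : ℤ) : j (x + n) s = j x s := by
  have hp : Function.Periodic (fun x => j x s) 1 := fun x => h.radius_add_one x s
  simpa using hp.int_mul n x

lemma polarCurve_add_int (h : WindingCurve θ j) (x s : ℝ) (n : ℤ) :
    polarCurve θ j (x + n) s = polarCurve θ j x s := by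
  rw [polarCurve, polarCurve, h.angle_add_int, h.radius_add_int]
  congr 1
  rw [Complex.exp_eq_exp_iff_exists_int]
  exact ⟨n, by push_cast; ring⟩

lemma continuous_polarCurve (h : WindingCurve θ j) :
    Continuous fun p : ℝ × ℝ => polarCurve θ j p.1 p.2 := by
  have h1 : Continuous fun p : ℝ × ℝ => θ p.1 p.2 := h.continuous_angle
  have h2 : Continuous fun p : ℝ × ℝ => j p.1 p.2 := h.continuous_radius
  unfold polarCurve
  fun_prop

lemma inside_or_outside (h : WindingCurve θ j) (s : ℝ) (ζ : ℂ) :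
    Inside θ j s ζ ∨ Outside θ j s ζ := by
  by_cases hζ : ζ = 0
  · exact Or.inl ⟨0, 0, by simp, by simp [hζ]⟩
  have hsur : Function.Surjective fun x => θ x s := by
    have hc : Continuous fun x => θ x s :=
      h.continuous_angle.comp (by fun_prop : Continuous fun x : ℝ => (x, s))
    intro a
    obtain ⟨n, hn⟩ := exists_int_gt ((a - θ 0 s) / (2 * Real.pi))
    obtain ⟨m, hm⟩ := exists_int_lt ((a - θ 0 s) / (2 * Real.pi))
    rw [div_lt_iff₀ (by positivity)] at hn
    rw [lt_div_iff₀ (by positivity)] at hm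
    have en := h.angle_add_int 0 s n
    have em := h.angle_add_int 0 s m
    exact mem_range_of_exists_le_of_exists_ge hc ⟨0 + m, by linarith⟩ ⟨0 + n, by linarith⟩
  obtain ⟨x, hx⟩ := hsur ζ.arg
  have hj := h.radius_pos x s
  have hs := Real.sqrt_pos.2 hj
  have hn := norm_pos_iff.2 hζ
  have e : (√(j x s) : ℂ) * ζ = ‖ζ‖ * polarCurve θ j x s := by
    simp only at hx
    rw [polarCurve, hx]
    linear_combination -(√(j x s) : ℂ) * norm_mul_exp_arg_mul_I ζ
  have hs' : (√(j x s) : ℂ) ≠ 0 := by exact_mod_cast hs.ne'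
  have hn' : (‖ζ‖ : ℂ) ≠ 0 := by exact_mod_cast hn.ne'
  rcases le_total ‖ζ‖ √(j x s) with hle | hle
  · refine Or.inl ⟨x, ‖ζ‖ / √(j x s), ⟨by positivity, div_le_one_of_le₀ hle hs.le⟩, ?_⟩
    push_cast
    field_simp
    linear_combination e
  · refine Or.inr ⟨x, √(j x s) / ‖ζ‖, ⟨by positivity, div_le_one_of_le₀ hle hn.le⟩, ?_⟩
    push_cast
    field_simp
    linear_combination e

lemma exists_eq_of_inside_of_outside (h : WindingCurve θ j) {s : ℝ} {ζ : ℂ} (h1 : Inside θ j s ζ)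
    (h2 : Outside θ j s ζ) : ∃ x, ζ = polarCurve θ j x s := by
  obtain ⟨x, c, hc, rfl⟩ := h1
  obtain ⟨y, d, hd, hxy⟩ := h2
  have hj := h.radius_pos x s
  have hj' := h.radius_pos y s
  have hn := congrArg (‖·‖) hxy
  simp only [norm_mul, norm_polarCurve, norm_real, Real.norm_of_nonneg hc.1,
    Real.norm_of_nonneg hd.1] at hn
  have he : exp (θ x s * I) = exp (θ y s * I) := by
    have h3 : ((√(j y s) : ℝ) : ℂ) * exp (θ x s * I) = √(j y s) * exp (θ y s * I) := by
      calc _ = d * (c * polarCurve θ j x s) := by rw [← hn, polarCurve]; push_cast; ring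
        _ = _ := hxy
    have : (√(j y s) : ℂ) ≠ 0 := by exact_mod_cast (Real.sqrt_pos.2 hj').ne'
    exact mul_left_cancel₀ this h3
  obtain ⟨n, hn2⟩ := Complex.exp_eq_exp_iff_exists_int.1 he
  have h4 : θ x s = θ (y + n) s := by
    rw [h.angle_add_int]
    have : ((θ x s : ℝ) : ℂ) * I = ((θ y s + n * (2 * Real.pi) : ℝ) : ℂ) * I := by
      rw [hn2]; push_cast; ring
    exact_mod_cast mul_right_cancel₀ I_ne_zero this
  have h5 : x = y + n := (h.strictMono s).injective h4
  rw [h5, h.radius_add_int] at hn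
  have h6 : d * c = 1 := by
    have := (Real.sqrt_pos.2 hj').ne'
    refine mul_right_cancel₀ this ?_
    rw [one_mul, mul_assoc]; exact hn
  have h7 : c = 1 := le_antisymm hc.2 (by nlinarith [hd.2, hc.1])
  exact ⟨x, by simp [h7]⟩

lemma exists_mem_Icc (h : WindingCurve θ j) (x s : ℝ) :
    ∃ y ∈ Icc (0 : ℝ) 1, polarCurve θ j y s = polarCurve θ j x s := by
  refine ⟨Int.fract x, ⟨Int.fract_nonneg x, (Int.fract_lt_one x).le⟩, ?_⟩
  have := h.polarCurve_add_int (Int.fract x) s ⌊x⌋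
  rw [Int.fract_add_floor] at this
  exact this.symm

lemma isClosed_aux {b : ℝ} {f : ℝ × ℝ × ℝ → ℂ} (hf : ContinuousOn f (Icc 0 b ×ˢ univ)) :
    IsClosed {s | s ∈ Icc (0 : ℝ) b ∧ ∃ x ∈ Icc (0 : ℝ) 1, ∃ c ∈ Icc (0 : ℝ) 1,
      f (s, x, c) = 0} := by
  obtain ⟨S, hS⟩ : ∃ S : Set (ℝ × ℝ × ℝ), S = Icc 0 b ×ˢ Icc 0 1 ×ˢ Icc 0 1 := ⟨_, rfl⟩
  have hSc : IsCompact S := hS ▸ isCompact_Icc.prod (isCompact_Icc.prod isCompact_Icc)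
  have h1 : IsCompact (S ∩ f ⁻¹' {0}) := by
    refine hSc.of_isClosed_subset ?_ inter_subset_left
    refine (hf.mono ?_).preimage_isClosed_of_isClosed hSc.isClosed isClosed_singleton
    rw [hS]; exact prod_mono_right (subset_univ _)
  have h2 := (h1.image continuous_fst).isClosed
  convert h2 using 1
  ext s
  simp only [hS, mem_ofPred_eq, mem_image, mem_inter_iff, mem_prod, mem_preimage,
    mem_singleton_iff, Prod.exists, exists_and_right, exists_eq_right]
  constructor
  · rintro ⟨hs, x, hx, c, hc, h⟩
    exact ⟨x, c, ⟨hs, hx, hc⟩, h⟩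
  · rintro ⟨x, c, ⟨hs, hx, hc⟩, h⟩
    exact ⟨hs, x, hx, c, hc, h⟩

lemma not_outside (h : WindingCurve θ j) {b : ℝ} {ζ : ℝ → ℂ} (hζ : ContinuousOn ζ (Icc 0 b))
    (h0 : ¬ Outside θ j 0 (ζ 0)) (hne : ∀ s ∈ Icc 0 b, ∀ x, ζ s ≠ polarCurve θ j x s) :
    ∀ s ∈ Icc 0 b, ¬ Outside θ j s (ζ s) := by
  intro s₁ hs₁ ho
  have hζ' : ContinuousOn (fun p : ℝ × ℝ × ℝ => ζ p.1) (Icc 0 b ×ˢ univ) :=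
    hζ.comp continuous_fst.continuousOn fun p hp => hp.1
  have hκ : Continuous fun p : ℝ × ℝ × ℝ => polarCurve θ j p.2.1 p.1 :=
    h.continuous_polarCurve.comp (by fun_prop : Continuous fun p : ℝ × ℝ × ℝ => (p.2.1, p.1))
  have hcc : Continuous fun p : ℝ × ℝ × ℝ => (p.2.2 : ℂ) := by fun_prop
  have c1 := isClosed_aux (f := fun p => ζ p.1 - p.2.2 * polarCurve θ j p.2.1 p.1)
    (hζ'.sub (hcc.mul hκ).continuousOn)
  have c2 := isClosed_aux (f := fun p => p.2.2 * ζ p.1 - polarCurve θ j p.2.1 p.1)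
    ((hcc.continuousOn.mul hζ').sub hκ.continuousOn)
  have e1 : {s | s ∈ Icc (0 : ℝ) b ∧ ∃ x ∈ Icc (0 : ℝ) 1, ∃ c ∈ Icc (0 : ℝ) 1,
      ζ s - c * polarCurve θ j x s = 0} = {s | s ∈ Icc 0 b ∧ Inside θ j s (ζ s)} := by
    ext s
    refine and_congr_right fun _ => ⟨?_, ?_⟩
    · rintro ⟨x, _, c, hc, hx⟩
      exact ⟨x, c, hc, sub_eq_zero.1 hx⟩
    · rintro ⟨x, c, hc, hx⟩
      obtain ⟨y, hy, hxy⟩ := h.exists_mem_Icc x s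
      exact ⟨y, hy, c, hc, by rw [hxy, ← hx, sub_self]⟩
  have e2 : {s | s ∈ Icc (0 : ℝ) b ∧ ∃ x ∈ Icc (0 : ℝ) 1, ∃ c ∈ Icc (0 : ℝ) 1,
      c * ζ s - polarCurve θ j x s = 0} = {s | s ∈ Icc 0 b ∧ Outside θ j s (ζ s)} := by
    ext s
    refine and_congr_right fun _ => ⟨?_, ?_⟩
    · rintro ⟨x, _, c, hc, hx⟩
      exact ⟨x, c, hc, sub_eq_zero.1 hx⟩
    · rintro ⟨x, c, hc, hx⟩
      obtain ⟨y, hy, hxy⟩ := h.exists_mem_Icc x s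
      exact ⟨y, hy, c, hc, by rw [hxy, ← hx, sub_self]⟩
  simp only at c1 c2
  rw [e1] at c1
  rw [e2] at c2
  have hb0 : (0 : ℝ) ∈ Icc 0 b := ⟨le_rfl, hs₁.1.trans hs₁.2⟩
  have hpre := isPreconnected_closed_iff.1 (isPreconnected_Icc (a := (0 : ℝ)) (b := b)) _ _ c1 c2
    (fun s hs => (h.inside_or_outside s (ζ s)).imp (fun hi => ⟨hs, hi⟩) fun hi => ⟨hs, hi⟩)
    ⟨0, hb0, hb0, (h.inside_or_outside 0 (ζ 0)).resolve_right h0⟩ ⟨s₁, hs₁, hs₁, ho⟩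
  obtain ⟨s, hs, ⟨_, hi⟩, ⟨_, ho⟩⟩ := hpre
  obtain ⟨x, hx⟩ := h.exists_eq_of_inside_of_outside hi ho
  exact hne s hs x hx

lemma outside_of_eq {x s : ℝ} {ζ : ℂ} (hx : ζ = polarCurve θ j x s) :
    Outside θ j s ζ := ⟨x, 1, by simp, by simp [hx]⟩

end WindingCurve

end Sitnikov

namespace Sitnikov

open Set Complex

open TimeCurve

lemma f0_add_two_pi_mul (q t r : ℝ) (n : ℕ) : f0 q (t + n * (2 * Real.pi)) r = f0 q t r := by
  rw [f0, f0, Real.cos_add_nat_mul_two_pi]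

lemma contDiff_f0 {r : ℝ} (hr : 0 < r) (hr2 : r < 2) :
    ContDiff ℝ 1 fun p : ℝ × ℝ => f0 p.1 p.2 r := by
  have h : ∀ c : ℝ, ContDiff ℝ 1 fun p : ℝ × ℝ => (1 + r * Real.cos (p.2 + c)) * Real.sin p.1 /
      (r ^ 2 + 2 * (1 + r * Real.cos (p.2 + c)) * (1 - Real.cos p.1)) ^ ((3 : ℝ) / 2) := fun c => by
    have h1 : ContDiff ℝ 1 fun p : ℝ × ℝ =>
        r ^ 2 + 2 * (1 + r * Real.cos (p.2 + c)) * (1 - Real.cos p.1) := by fun_prop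
    have h2 := h1.rpow_const_of_ne (p := 3 / 2) fun p => (dist_sq_pos hr hr2 (p.2 + c) p.1).ne'
    refine ContDiff.div (by fun_prop) h2 fun p => ?_
    exact (Real.rpow_pos_of_pos (dist_sq_pos hr hr2 (p.2 + c) p.1) _).ne'
  simp only [f0_eq]
  have h0 := h 0
  simp only [add_zero] at h0
  exact h0.neg.sub (h Real.pi)

/-- Solutions over a time interval in the rescaled time. -/
def IsSol (r T b : ℝ) (q p : ℝ → ℝ) : Prop :=
  ∀ s ∈ Icc 0 b, HasDerivWithinAt q (T * p s) (Icc 0 b) s ∧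
    HasDerivWithinAt p (T * f0 (q s) (T * s) r) (Icc 0 b) s

lemma IsSol.mono {r T b c : ℝ} {q p : ℝ → ℝ} (h : IsSol r T b q p) (hc : c ≤ b) :
    IsSol r T c q p := fun s hs =>
  have hm : Icc (0 : ℝ) c ⊆ Icc 0 b := Icc_subset_Icc_right hc
  ⟨(h s (hm hs)).1.mono hm, (h s (hm hs)).2.mono hm⟩

lemma IsSol.eq_zero_time {r T b : ℝ} {q p q' p' : ℝ → ℝ} (hr : 0 < r) (hr2 : r < 2) (hb : 0 ≤ b)
    (h : IsSol r T b q p) (h' : IsSol r T b q' p') (hq : q b = q' b) (hp : p b = p' b) :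
    q 0 = q' 0 ∧ p 0 = p' 0 := by
  obtain ⟨V, hV⟩ : ∃ V : ℝ × (ℝ × ℝ) → ℝ × ℝ, V = fun z => (T * z.2.2, T * f0 z.2.1 (T * z.1) r) :=
    ⟨_, rfl⟩
  have hVd : ContDiff ℝ 1 V := by
    rw [hV]
    have hF := contDiff_f0 hr hr2
    generalize f0 = F at hF ⊢
    have h1 : ContDiff ℝ 1 fun z : ℝ × (ℝ × ℝ) => F z.2.1 (T * z.1) r :=
      hF.comp (f := fun z : ℝ × (ℝ × ℝ) => (z.2.1, T * z.1)) (by fun_prop)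
    have h2 : ContDiff ℝ 1 fun z : ℝ × (ℝ × ℝ) => T * z.2.2 := by fun_prop
    exact h2.prodMk (contDiff_const.mul h1)
  have hs : ∀ {q p : ℝ → ℝ}, IsSol r T b q p → ∀ s ∈ Icc 0 b,
      HasDerivWithinAt (fun s => (q s, p s)) (V (s, (q s, p s))) (Icc 0 b) s := fun h s hs => by
    rw [hV]
    exact (h s hs).1.prodMk (h s hs).2
  have hc : ∀ {q p : ℝ → ℝ}, IsSol r T b q p → ContinuousOn (fun s => (q s, p s)) (Icc 0 b) :=
    fun h s hs' => (hs h s hs').continuousWithinAt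
  obtain ⟨S, hS⟩ : ∃ S : Set (ℝ × ℝ), S = (fun s => (q s, p s)) '' Icc 0 b ∪
    (fun s => (q' s, p' s)) '' Icc 0 b := ⟨_, rfl⟩
  have hSc : IsCompact S :=
    hS ▸ (isCompact_Icc.image_of_continuousOn (hc h)).union
      (isCompact_Icc.image_of_continuousOn (hc h'))
  obtain ⟨K, hK⟩ := (hVd.locallyLipschitz.locallyLipschitzOn
    (s := Icc 0 b ×ˢ S)).exists_lipschitzOnWith_of_compact (isCompact_Icc.prod hSc)
  have hleft : ∀ {q p : ℝ → ℝ}, IsSol r T b q p → ∀ s ∈ Ioc 0 b,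
      HasDerivWithinAt (fun s => (q s, p s)) (V (s, (q s, p s))) (Iic s) s := fun h s hs' =>
    ((hs h s (Ioc_subset_Icc_self hs')).mono (Icc_subset_Icc_right hs'.2)).mono_of_mem_nhdsWithin
      (Icc_mem_nhdsLE hs'.1)
  have key := ODE_solution_unique_of_mem_Icc_left (v := fun s y => V (s, y)) (s := fun _ => S)
    (K := K) (a := 0) (b := b) (f := fun s => (q s, p s)) (g := fun s => (q' s, p' s))
    (fun s hs' y hy z hz => by
      refine (hK ⟨Ioc_subset_Icc_self hs', hy⟩ ⟨Ioc_subset_Icc_self hs', hz⟩).trans (le_of_eq ?_)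
      congr 1
      simp [Prod.edist_eq])
    (hc h) (hleft h) (fun s hs' => hS ▸ Or.inl ⟨s, Ioc_subset_Icc_self hs', rfl⟩)
    (hc h') (hleft h') (fun s hs' => hS ▸ Or.inr ⟨s, Ioc_subset_Icc_self hs', rfl⟩)
    (by simp [hq, hp])
  have := key ⟨le_rfl, hb⟩
  exact ⟨congrArg Prod.fst this, congrArg Prod.snd this⟩

/-- Scaled phase space coordinates. -/
noncomputable def phase (ω₀ T q p : ℝ) : ℂ := ⟨√(ω₀ * T / 2) * q, -(√(ω₀ * T / 2) / ω₀ * p)⟩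

lemma phase_inj {ω₀ T q p q' p' : ℝ} (hω : 0 < ω₀) (hT : 0 < T)
    (h : phase ω₀ T q p = phase ω₀ T q' p') : q = q' ∧ p = p' := by
  have h0 : 0 < √(ω₀ * T / 2) := Real.sqrt_pos.2 (by positivity)
  obtain ⟨h1, h2⟩ := Complex.ext_iff.1 h
  exact ⟨mul_left_cancel₀ h0.ne' h1, mul_left_cancel₀ (div_pos h0 hω).ne' (neg_injective h2)⟩

lemma norm_phase_sq {ω₀ T q p : ℝ} (hω : 0 < ω₀) (hT : 0 < T) :
    ‖phase ω₀ T q p‖ ^ 2 = ω₀ * T / 2 * (q ^ 2 + p ^ 2 / ω₀ ^ 2) := by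
  have e := Real.sq_sqrt (by positivity : 0 ≤ ω₀ * T / 2)
  rw [Complex.sq_norm, normSq_apply, phase]
  linear_combination (q ^ 2 + p ^ 2 / ω₀ ^ 2) * e

lemma continuousOn_phase {r T b ω₀ : ℝ} {q p : ℝ → ℝ} (h : IsSol r T b q p) :
    ContinuousOn (fun s => phase ω₀ T (q s) (p s)) (Icc 0 b) := by
  have h1 : ContinuousOn q (Icc 0 b) := fun s hs => (h s hs).1.continuousWithinAt
  have h2 : ContinuousOn p (Icc 0 b) := fun s hs => (h s hs).2.continuousWithinAt
  have e : ∀ s, phase ω₀ T (q s) (p s) = ((√(ω₀ * T / 2) * q s : ℝ) : ℂ) +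
      ((-(√(ω₀ * T / 2) / ω₀ * p s) : ℝ) : ℂ) * I := fun s => by
    rw [phase, mk_eq_add_mul_I]
  simp only [e]
  fun_prop

section

variable {r ω₀ T ω : ℝ} {Φ J : ℝ → TimeCurve}

lemma phase_torus (hω : 0 < ω₀) (hT : 0 < T) (x s : ℝ) :
    phase ω₀ T (torusPos ω₀ T Φ J x s) (torusVel ω₀ T Φ J x s) =
      polarCurve (fun x s => ((Φ x).ext s).re + ω₀ * (T * s)) (fun x s => ((J x).ext s).re)
        x s := by
  have e : √(ω₀ * T / 2) * √(2 * ((J x).ext s).re / (ω₀ * T)) = √((J x).ext s).re := by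
    rw [← Real.sqrt_mul (by positivity)]
    congr 1
    field_simp
  have hω' := hω.ne'
  apply Complex.ext
  · rw [polarCurve, re_ofReal_mul, exp_ofReal_mul_I_re, ← e, phase, torusPos]
    ring
  · rw [polarCurve, im_ofReal_mul, exp_ofReal_mul_I_im, ← e, phase, torusVel]
    field_simp

lemma windingCurve_torus {A B : ℝ} {hG : HolBdd 2 (rotHam r ω₀ T) 4 B} {hC : 4 * B ≤ A} {α : ℝ}
    (h : InvTorus (hG.ham hC) α ω Φ J) (hA : 0 < A) (hJ : ∀ x s, 0 < (J x s).re) :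
    WindingCurve (fun x s => ((Φ x).ext s).re + ω₀ * (T * s)) (fun x s => ((J x).ext s).re) where
  continuous_angle := by
    have h1 : Continuous fun p : ℝ × ℝ => Φ p.1 (projIcc 0 1 zero_le_one p.2) :=
      (h.continuous_fst.comp continuous_fst).eval (continuous_projIcc.comp continuous_snd)
    exact (continuous_re.comp h1).add (by fun_prop)
  continuous_radius := by
    have h1 : Continuous fun p : ℝ × ℝ => J p.1 (projIcc 0 1 zero_le_one p.2) :=
      (h.continuous_snd.comp continuous_fst).eval (continuous_projIcc.comp continuous_snd)
    exact continuous_re.comp h1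
  strictMono s x y hxy := by
    have h1 := h.mono (projIcc 0 1 zero_le_one s) x y hxy.le
    have h2 : 0 < 1 / A * (y - x) := by
      have := sub_pos.2 hxy
      positivity
    have h3 : ((Φ x).ext s).re < ((Φ y).ext s).re := sub_pos.1 (h2.trans_le h1)
    simpa using h3
  angle_add_one x s := by
    have : (Φ (x + 1)).ext s = (Φ x).ext s + ((2 * Real.pi : ℝ) : ℂ) := by
      rw [h.per_fst]; push_cast; rfl
    simp only [this, add_re, ofReal_re]
    ring
  radius_add_one x s := by simp only [h.per_snd]
  radius_pos x s := hJ x _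

end

end Sitnikov

namespace Sitnikov

open Set Complex

open TimeCurve

section

variable {r ω₀ T ω A B : ℝ} {Φ J : ℝ → TimeCurve}

lemma not_outside_step (hr : 0 < r) (hr2 : r < 2) (hω : 0 < ω₀) (hT : 0 < T)
    (hW : WindingCurve (fun x s => ((Φ x).ext s).re + ω₀ * (T * s)) (fun x s => ((J x).ext s).re))
    (hsol : ∀ x, IsSol r T 1 (torusPos ω₀ T Φ J x) (torusVel ω₀ T Φ J x)) {b : ℝ} (hb : b ≤ 1)
    {q p : ℝ → ℝ} (h : IsSol r T b q p)
    (h0 : ¬ Outside (fun x s => ((Φ x).ext s).re + ω₀ * (T * s)) (fun x s => ((J x).ext s).re) 0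
      (phase ω₀ T (q 0) (p 0))) :
    ∀ s ∈ Icc 0 b, ¬ Outside (fun x s => ((Φ x).ext s).re + ω₀ * (T * s))
      (fun x s => ((J x).ext s).re) s (phase ω₀ T (q s) (p s)) := by
  refine hW.not_outside (ζ := fun s => phase ω₀ T (q s) (p s)) (continuousOn_phase h) h0
    fun s hs x hx => ?_
  rw [← phase_torus hω hT] at hx
  obtain ⟨h1, h2⟩ := phase_inj hω hT hx
  obtain ⟨e1, e2⟩ := (h.mono hs.2).eq_zero_time hr hr2 hs.1 ((hsol x).mono (hs.2.trans hb)) h1 h2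
  refine h0 (WindingCurve.outside_of_eq (x := x) ?_)
  rw [← phase_torus hω hT, e1, e2]

lemma outside_one {hG : HolBdd 2 (rotHam r ω₀ T) 4 B} {hC : 4 * B ≤ A}
    (h : InvTorus (hG.ham hC) (ω₀ * T) ω Φ J) {ζ : ℂ}
    (h0 : Outside (fun x s => ((Φ x).ext s).re + ω₀ * (T * s)) (fun x s => ((J x).ext s).re) 0 ζ) :
    Outside (fun x s => ((Φ x).ext s).re + ω₀ * (T * s)) (fun x s => ((J x).ext s).re) 1 ζ := by
  obtain ⟨y, c, hc, hy⟩ := h0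
  refine ⟨y - ω, c, hc, hy.trans ?_⟩
  have e1 : ∀ f : TimeCurve, f.ext 1 = f 1 := fun f => ext_coe f 1
  have e0 : ∀ f : TimeCurve, f.ext 0 = f 0 := fun f => ext_coe f 0
  have m1 := h.match_fst (y - ω)
  have m2 := h.match_snd (y - ω)
  rw [sub_add_cancel] at m1 m2
  have m1' := congrArg Complex.re m1
  rw [add_re, ofReal_re] at m1'
  rw [polarCurve, polarCurve]
  simp only [e1, e0, m2, mul_zero, add_zero, mul_one, m1']

end

/-- Solutions starting inside an invariant torus stay inside. -/
lemma norm_phase_sq_lt {r ω₀ A B ω : ℝ} {n : ℕ} {Φ J : ℝ → TimeCurve} (hr : 0 < r) (hr2 : r < 2)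
    (hω : 0 < ω₀) (hωr : ω₀ ^ 2 = 2 / r ^ 3) (hn : 0 < n) (hA : 0 < A)
    (hQ : ∀ s, ∀ z ∈ dmn 2 4, ‖rotArg ω₀ (2 * Real.pi * n) s z‖ ≤ r ^ 2 / 40)
    {hG : HolBdd 2 (rotHam r ω₀ (2 * Real.pi * n)) 4 B} {hC : 4 * B ≤ A}
    (h : InvTorus (hG.ham hC) (ω₀ * (2 * Real.pi * n)) ω Φ J)
    (hD : ∀ x, Dom 2 (Φ x) (J x) ∧ ∀ s, 1 / 26 ≤ (J x s).re) {b : ℝ} {q p : ℝ → ℝ}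
    (hq : ∀ t ∈ Icc 0 b, HasDerivAt q (p t) t) (hp : ∀ t ∈ Icc 0 b, HasDerivAt p (f0 (q t) t r) t)
    (h0 : ‖phase ω₀ (2 * Real.pi * n) (q 0) (p 0)‖ ^ 2 < 1 / 26) {t : ℝ} (ht : t ∈ Icc 0 b) :
    ‖phase ω₀ (2 * Real.pi * n) (q t) (p t)‖ ^ 2 ≤ 2 := by
  obtain ⟨T, hT⟩ : ∃ T, T = 2 * Real.pi * n := ⟨_, rfl⟩
  have hT0 : 0 < T := by rw [hT]; positivity
  rw [← hT] at h0 ⊢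
  obtain ⟨θ, hθ⟩ : ∃ θ : ℝ → ℝ → ℝ, θ = fun x s => ((Φ x).ext s).re + ω₀ * (T * s) := ⟨_, rfl⟩
  obtain ⟨j, hj⟩ : ∃ j : ℝ → ℝ → ℝ, j = fun x s => ((J x).ext s).re := ⟨_, rfl⟩
  have hJ : ∀ x s, 0 < (J x s).re := fun x s => by linarith [(hD x).2 s]
  have hsol : ∀ x, IsSol r T 1 (torusPos ω₀ T Φ J x) (torusVel ω₀ T Φ J x) := fun x s hs => by
    subst hT
    exact hasDerivWithinAt_torus hr hr2 hω hωr hT0 hQ h (hD x).1 (hJ x) hs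
  have hW : WindingCurve θ j := by
    subst hT hθ hj
    exact windingCurve_torus h hA hJ
  have hstep := fun {b : ℝ} (hb : b ≤ 1) {q p : ℝ → ℝ} (h : IsSol r T b q p) =>
    not_outside_step hr hr2 hω hT0 (hθ ▸ hj ▸ hW) hsol hb h
  rw [← hθ, ← hj] at hstep
  have hout : ∀ {ζ : ℂ}, Outside θ j 0 ζ → Outside θ j 1 ζ := fun {ζ} h0 => by
    subst hT hθ hj
    exact outside_one h h0
  have base : ∀ k : ℕ, k * T ≤ b →
      ¬ Outside θ j 0 (phase ω₀ T (q (k * T)) (p (k * T))) →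
      ∀ t ∈ Icc 0 b, k * T ≤ t → t ≤ (k + 1) * T →
      ¬ Outside θ j ((t - k * T) / T) (phase ω₀ T (q t) (p t)) := by
    intro k hk hk0 t ht h1 h2
    have hs1 : (t - k * T) / T ≤ 1 := by
      rw [div_le_one hT0]; linarith
    have hs0 : 0 ≤ (t - k * T) / T := div_nonneg (by linarith) hT0.le
    have hsol' : IsSol r T ((t - k * T) / T) (fun s => q (k * T + T * s))
        (fun s => p (k * T + T * s)) := by
      intro s hs
      have hmem : k * T + T * s ∈ Icc 0 b := by
        have h3 : 0 ≤ T * s := mul_nonneg hT0.le hs.1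
        have h4 := hs.2
        rw [le_div_iff₀ hT0] at h4
        have h5 : 0 ≤ k * T := by positivity
        exact ⟨by linarith, by linarith [ht.2]⟩
      have hl : HasDerivAt (fun s : ℝ => k * T + T * s) T s := by
        simpa using ((hasDerivAt_id s).const_mul T).const_add (k * T)
      refine ⟨(((hq _ hmem).comp s hl).congr_deriv ?_).hasDerivWithinAt,
        (((hp _ hmem).comp s hl).congr_deriv ?_).hasDerivWithinAt⟩
      · ring
      · have := f0_add_two_pi_mul (q (k * T + T * s)) (T * s) r (k * n)
        rw [show T * s + (k * n : ℕ) * (2 * Real.pi) = k * T + T * s by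
          rw [hT]; push_cast; ring] at this
        rw [this, mul_comm]
    have := hstep hs1 hsol' (by simpa using hk0) _ ⟨hs0, le_rfl⟩
    have e : k * T + T * ((t - k * T) / T) = t := by field_simp; ring
    simpa only [e] using this
  have main : ∀ k : ℕ, ∀ t ∈ Icc 0 b, k * T ≤ t → t ≤ (k + 1) * T →
      ¬ Outside θ j ((t - k * T) / T) (phase ω₀ T (q t) (p t)) := by
    intro k
    induction k with
    | zero =>
      refine base 0 (by simpa using ht.1.trans ht.2) ?_
      rintro ⟨x, c, hc, hx⟩
      have h1 := congrArg (fun z => ‖z‖ ^ 2) hx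
      simp only [norm_mul, norm_real, Real.norm_of_nonneg hc.1, WindingCurve.norm_polarCurve,
        Real.sq_sqrt (hW.radius_pos x 0).le] at h1
      simp only [Nat.cast_zero, zero_mul] at h1
      have h2 : 1 / 26 ≤ j x 0 := hj ▸ (hD x).2 _
      have h3 : (c * ‖phase ω₀ T (q 0) (p 0)‖) ^ 2 ≤ ‖phase ω₀ T (q 0) (p 0)‖ ^ 2 :=
        pow_le_pow_left₀ (mul_nonneg hc.1 (norm_nonneg _))
          (mul_le_of_le_one_left (norm_nonneg _) hc.2) 2
      linarith
    | succ k ih =>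
      intro t ht h1 h2
      have hk : ((k + 1 : ℕ) : ℝ) * T ≤ b := h1.trans ht.2
      refine base _ hk (fun ho => ?_) t ht h1 h2
      have h5 : ((k + 1 : ℕ) : ℝ) * T ∈ Icc 0 b := ⟨by positivity, hk⟩
      have := ih _ h5 (by push_cast; linarith) (by push_cast; exact le_rfl)
      refine this ?_
      rw [show (((k + 1 : ℕ) : ℝ) * T - k * T) / T = 1 by push_cast; field_simp; ring]
      exact hout ho
  have h1 : ⌊t / T⌋₊ * T ≤ t := by
    rw [← le_div_iff₀ hT0]; exact Nat.floor_le (div_nonneg ht.1 hT0.le)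
  have h2 : t ≤ (⌊t / T⌋₊ + 1) * T := by
    rw [← div_le_iff₀ hT0]; exact (Nat.lt_floor_add_one _).le
  obtain ⟨x, c, hc, hx⟩ := (hW.inside_or_outside _ _).resolve_right (main _ t ht h1 h2)
  rw [hx, norm_mul, WindingCurve.norm_polarCurve, norm_real, Real.norm_of_nonneg hc.1, mul_pow,
    Real.sq_sqrt (hW.radius_pos _ _).le]
  have h3 : j x ((t - ⌊t / T⌋₊ * T) / T) ≤ 2 := by
    rw [hj]
    exact (re_le_norm _).trans ((norm_ext_le _ _).trans (hD x).1.2)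
  have h4 := hW.radius_pos x ((t - ⌊t / T⌋₊ * T) / T)
  have h5 : c ^ 2 ≤ 1 := pow_le_one₀ hc.1 hc.2
  exact (mul_le_of_le_one_left h4.le h5).trans h3

lemma exists_compatible {r ω₀ : ℝ} (hr : 0 < r) (hωr : ω₀ ^ 2 = 2 / r ^ 3) :
    ∃ β, |β| ≤ 27 / 100 ∧ Compatible ω₀ ((9 + 11 / 2 * r ^ 2) / (3 * r ^ 5))
      ((9 / 2 * r ^ 2) / (3 * r ^ 5)) β := by
  by_cases h1 : ω₀ = 1
  · have hr3 : r ^ 3 = 2 := by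
      rw [h1, one_pow, eq_div_iff (by positivity), one_mul] at hωr; exact hωr
    have hr13 : r ≤ 63 / 50 := by
      by_contra! h
      have := pow_lt_pow_left₀ h (by norm_num) (n := 3) (by norm_num)
      norm_num at this; linarith
    have hr2 : r ^ 2 ≤ (63 / 50) ^ 2 := pow_le_pow_left₀ hr.le hr13 2
    refine ⟨(3 * r ^ 2) / (9 + 11 / 2 * r ^ 2), ?_, Or.inl ⟨h1, ?_⟩⟩
    · rw [abs_of_pos (by positivity), div_le_iff₀ (by positivity)]
      norm_num at hr2
      linarith
    · field_simp
      ring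
  · exact ⟨0, by norm_num, Or.inr ⟨h1, rfl⟩⟩

theorem stable {r : ℝ} (hr : 0 < r) (hr2 : r < 2) {η : ℝ} (hη : 0 < η) :
    ∃ δ > 0, ∀ T : ℝ, 0 ≤ T → ∀ q p : ℝ → ℝ,
      (∀ t ∈ Icc 0 T, HasDerivAt q (p t) t) →
      (∀ t ∈ Icc 0 T, HasDerivAt p (f0 (q t) t r) t) →
      q 0 ^ 2 + p 0 ^ 2 < δ ^ 2 →
      ∀ t ∈ Icc 0 T, q t ^ 2 + p t ^ 2 < η ^ 2 := by
  obtain ⟨ω₀, hω₀⟩ : ∃ ω₀, ω₀ = √(2 / r ^ 3) := ⟨_, rfl⟩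
  have hω : 0 < ω₀ := hω₀ ▸ Real.sqrt_pos.2 (by positivity)
  have hωr : ω₀ ^ 2 = 2 / r ^ 3 := by rw [hω₀, Real.sq_sqrt (by positivity)]
  have hωh : 1 / 2 < ω₀ := by
    refine lt_of_pow_lt_pow_left₀ 2 hω.le ?_
    rw [hωr, lt_div_iff₀ (by positivity)]
    have := pow_lt_pow_left₀ hr2 hr.le (n := 3) (by norm_num)
    norm_num at this ⊢
    linarith
  obtain ⟨β, hβ, hcomp⟩ := exists_compatible hr hωr
  have hc : ∀ t : ℝ, (9 + 11 / 2 * r ^ 2) / (3 * r ^ 5) + (9 / 2 * r ^ 2) / (3 * r ^ 5) *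
      Real.cos (2 * t) = (9 + r ^ 2 + 9 * r ^ 2 * Real.cos t ^ 2) / (3 * r ^ 5) := fun t => by
    rw [Real.cos_two_mul]
    field_simp
    ring
  obtain ⟨M, B, T₀, hM, hT₀⟩ := exists_holBdd_rotHam hr hr2.le hω hc
  obtain ⟨A, hA, hC, N, hN⟩ := exists_invTorus (a := 1 / ω₀ ^ 2) (B := B) (by positivity)
    (by positivity) hωh hβ hcomp hM
  obtain ⟨m, hm⟩ := exists_nat_gt (max T₀ (4 * (1 + ω₀ ^ 2) / (ω₀ * η ^ 2)))
  obtain ⟨n, hn⟩ : ∃ n, n = max (m + 1) N := ⟨_, rfl⟩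
  have hn0 : 0 < n := by omega
  have hmn : (m : ℝ) ≤ n := by
    have : m ≤ n := by omega
    exact_mod_cast this
  have hnT : (n : ℝ) ≤ 2 * Real.pi * n := by
    have : (1 : ℝ) ≤ 2 * Real.pi := by linarith [Real.pi_gt_three]
    exact le_mul_of_one_le_left n.cast_nonneg this
  obtain ⟨hG, hQ, hclose⟩ := hT₀ (2 * Real.pi * n)
    (by linarith [le_max_left T₀ (4 * (1 + ω₀ ^ 2) / (ω₀ * η ^ 2))])
  obtain ⟨ω, Φ, J, h, hD⟩ := hN n (by omega) _ hG hclose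
  obtain ⟨P, hP⟩ : ∃ P, P = 2 * Real.pi * n := ⟨_, rfl⟩
  have hP0 : 0 < P := by rw [hP]; positivity
  have hPη : 4 * (1 + ω₀ ^ 2) / (ω₀ * η ^ 2) < P := by
    linarith [le_max_right T₀ (4 * (1 + ω₀ ^ 2) / (ω₀ * η ^ 2))]
  rw [div_lt_iff₀ (by positivity)] at hPη
  have hδ : 0 < 1 / (13 * (ω₀ * P) * (1 + 1 / ω₀ ^ 2)) := by positivity
  refine ⟨√(1 / (13 * (ω₀ * P) * (1 + 1 / ω₀ ^ 2))), Real.sqrt_pos.2 hδ, ?_⟩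
  intro T hT q p hq hp h0 t ht
  rw [Real.sq_sqrt hδ.le, lt_div_iff₀ (by positivity)] at h0
  have key := norm_phase_sq_lt hr hr2 hω hωr hn0 (by linarith) hQ h hD hq hp (by
    rw [← hP, norm_phase_sq hω hP0]
    have h1 : q 0 ^ 2 + p 0 ^ 2 / ω₀ ^ 2 ≤ (q 0 ^ 2 + p 0 ^ 2) * (1 + 1 / ω₀ ^ 2) := by
      have h2 : 0 ≤ q 0 ^ 2 * (1 / ω₀ ^ 2) := by positivity
      have h3 := sq_nonneg (p 0)
      rw [div_eq_mul_one_div]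
      linarith
    have := mul_le_mul_of_nonneg_left h1 (by positivity : 0 ≤ ω₀ * P / 2)
    linarith) ht
  rw [← hP, norm_phase_sq hω hP0] at key
  have h1 : q t ^ 2 + p t ^ 2 ≤ (q t ^ 2 + p t ^ 2 / ω₀ ^ 2) * (1 + ω₀ ^ 2) := by
    have e : p t ^ 2 / ω₀ ^ 2 * ω₀ ^ 2 = p t ^ 2 := by field_simp
    have h2 : 0 ≤ p t ^ 2 / ω₀ ^ 2 := by positivity
    have h3 : 0 ≤ q t ^ 2 * ω₀ ^ 2 := by positivity
    linarith
  have h2 := mul_le_mul_of_nonneg_left h1 (by positivity : 0 ≤ ω₀ * P / 2)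
  have h3 := mul_le_mul_of_nonneg_right key (by positivity : 0 ≤ 1 + ω₀ ^ 2)
  refine lt_of_mul_lt_mul_left (a := ω₀ * P / 2) ?_ (by positivity)
  linarith

end Sitnikov

/-- Proposition 4.4: for every `r ∈ (0,2)` the equilibrium `(0,0)` of the
system `q̇ = p, ṗ = f₀(q,t;r)` is Lyapunov stable: for every `η > 0` there is `δ > 0`
such that every solution starting with `q(0)² + p(0)² < δ²` stays defined and satisfies
`q(t)² + p(t)² < η²` for all `t ≥ 0` (here quantified over solutions on any interval
`[0,T]`). -/
theorem equilibrium_zero_stable (r : ℝ) (hr : r ∈ Set.Ioo (0 : ℝ) 2) :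
    ∀ η > 0, ∃ δ > 0, ∀ T : ℝ, 0 ≤ T → ∀ q p : ℝ → ℝ,
      (∀ t ∈ Set.Icc 0 T, HasDerivAt q (p t) t) →
      (∀ t ∈ Set.Icc 0 T, HasDerivAt p (f0 (q t) t r) t) →
      q 0 ^ 2 + p 0 ^ 2 < δ ^ 2 →
      ∀ t ∈ Set.Icc 0 T, q t ^ 2 + p t ^ 2 < η ^ 2 := by
  exact fun η hη => Sitnikov.stable hr.1 hr.2 hη
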